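/- Let d > 4, let α denote the number of 1's in the binary expansion of d − 1, let ε_α = 2 if d is odd and α ≡ 3 (mod 4), ε_α = 1 if d is odd and α ≡ 2 (mod 4), and ε_α = 0 otherwise, and let δ = 0 if d is odd and δ = 1 if d is even. Then: (a) every tuple (A_1, …, A_N) of complex Hermitian d×d matrices having the phase retrieval property on ℂ^d satisfies N ≥ 4d − 2 − 2α + ε_α; and (b) there exists a tuple of N = 4d − 3 − α − δ complex Hermitian d×d matrices with the phase retrieval property on ℂ^d. That is, 4d − 2 − 2α + ε_α ≤ 𝔪_ℂ(d) ≤ 4d − 3 − α − δ. -/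

import Mathlib

open Matrix

/-- A tuple of complex Hermitian `d×d` matrices has the phase retrieval property on `ℂ^d`
if equality of all quadratic measurements implies equality up to a unimodular constant. -/
def PhaseRetrievableC {d N : ℕ} (A : Fin N → Matrix (Fin d) (Fin d) ℂ) : Prop :=
  ∀ x y : Fin d → ℂ,
    (∀ j, star x ⬝ᵥ (A j) *ᵥ x = star y ⬝ᵥ (A j) *ᵥ y) →
      ∃ b : ℂ, ‖b‖ = 1 ∧ x = b • y

/-! ### Skew forms without isotropic planes -/

section UpperBound

/-- Real bilinear alternating forms with values in a real vector space that are invariant under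
multiplication by `i`. -/
structure IsSkewForm {V E : Type} [AddCommGroup V] [Module ℂ V] [AddCommGroup E] [Module ℝ E]
    (β : V → V → E) : Prop where
  add_left : ∀ u v w, β (u + v) w = β u w + β v w
  smul_left : ∀ (t : ℝ) u v, β ((t : ℂ) • u) v = t • β u v
  swap : ∀ u v, β u v = -β v u
  I_smul : ∀ u v, β (Complex.I • u) (Complex.I • v) = β u v

namespace IsSkewForm

variable {V E : Type} [AddCommGroup V] [Module ℂ V] [AddCommGroup E] [Module ℝ E]
  {β : V → V → E} (h : IsSkewForm β)

include h

theorem add_right (u v w) : β u (v + w) = β u v + β u w := by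
  rw [h.swap, h.add_left, h.swap v, h.swap w]; abel

theorem smul_right (t : ℝ) (u v) : β u ((t : ℂ) • v) = t • β u v := by
  rw [h.swap, h.smul_left, h.swap v, smul_neg, neg_neg]

theorem neg_left (u v) : β (-u) v = -β u v := by
  simpa using h.smul_left (-1) u v

theorem neg_right (u v) : β u (-v) = -β u v := by
  simpa using h.smul_right (-1) u v

theorem zero_left (v) : β 0 v = 0 := by
  simpa using h.smul_left 0 0 v

theorem zero_right (v) : β v 0 = 0 := by
  simpa using h.smul_right 0 v 0

theorem sub_left (u v w) : β (u - v) w = β u w - β v w := by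
  rw [sub_eq_add_neg, h.add_left, h.neg_left, sub_eq_add_neg]

theorem sub_right (u v w) : β u (v - w) = β u v - β u w := by
  rw [sub_eq_add_neg, h.add_right, h.neg_right, sub_eq_add_neg]

theorem self (u) : β u u = 0 := by
  have := h.swap u u
  have h2 : (2 : ℝ) • β u u = 0 := by
    rw [two_smul]; nth_rewrite 1 [this]; abel
  simpa using h2

end IsSkewForm

/-- Real linear dependence of two vectors of a complex vector space. -/
def RealDependent {V : Type} [AddCommGroup V] [Module ℂ V] (x y : V) : Prop :=
  x = 0 ∨ ∃ t : ℝ, y = (t : ℂ) • x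

theorem RealDependent.symm {V : Type} [AddCommGroup V] [Module ℂ V] {x y : V}
    (h : RealDependent x y) : RealDependent y x := by
  rcases h with rfl | ⟨t, rfl⟩
  · exact Or.inr ⟨0, by simp⟩
  · by_cases ht : t = 0
    · left; simp [ht]
    · right
      refine ⟨t⁻¹, ?_⟩
      rw [smul_smul, ← Complex.ofReal_mul, inv_mul_cancel₀ ht]; simp

/-- The inductive data used to build skew forms without isotropic planes. -/
structure SkewSystem (V E F : Type) [AddCommGroup V] [Module ℂ V] [AddCommGroup E] [Module ℝ E]
    [AddCommGroup F] [Module ℝ F] where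
  L : V → V → E
  T : V → V → F
  ι : F →ₗ[ℝ] E
  R : V → V → ℝ
  hL : IsSkewForm L
  hT : IsSkewForm T
  ι_inj : Function.Injective ι
  R_add : ∀ u v w, R (u + v) w = R u w + R v w
  R_smul : ∀ (t : ℝ) u v, R ((t : ℂ) • u) v = t * R u v
  R_comm : ∀ u v, R u v = R v u
  R_I : ∀ u v, R (Complex.I • u) (Complex.I • v) = R u v
  R_nonneg : ∀ u, 0 ≤ R u u
  R_pos : ∀ u, R u u = 0 → u = 0
  dep : ∀ x y w w', L x y = 0 → L x w + L y w' + ι (T x y) = 0 → RealDependent x y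

/-- A skew form attached to a subspace of the space of a `SkewSystem`. -/
structure SkewExtension {V E F : Type} [AddCommGroup V] [Module ℂ V] [AddCommGroup E] [Module ℝ E]
    [AddCommGroup F] [Module ℝ F] (S : SkewSystem V E F) (W Z : Type)
    [AddCommGroup W] [Module ℂ W] [AddCommGroup Z] [Module ℝ Z] where
  j : W →ₗ[ℂ] V
  j_inj : Function.Injective j
  β : W → W → Z
  hβ : IsSkewForm β
  κ : F →ₗ[ℝ] Z
  dep : ∀ x w y, S.L x (j y) = 0 → κ (S.T x (j y)) + β w y = 0 → RealDependent x (j y)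
  nondeg : ∀ u v, β u v = 0 → RealDependent u v

variable {V E F : Type} [AddCommGroup V] [Module ℂ V] [AddCommGroup E] [Module ℝ E]
    [AddCommGroup F] [Module ℝ F]

namespace SkewSystem

variable (S : SkewSystem V E F)

theorem R_smul_right (t : ℝ) (u v) : S.R u ((t : ℂ) • v) = t * S.R u v := by
  rw [S.R_comm, S.R_smul, S.R_comm v]

theorem R_zero_right (u) : S.R u 0 = 0 := by
  simpa using S.R_smul_right 0 u 0

theorem R_zero_left (u) : S.R 0 u = 0 := by
  simpa using S.R_smul 0 0 u

/-- The doubled form. -/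
def doubleL (u v : V × V) : E × E × ℝ :=
  (S.L u.1 v.1, S.L u.1 v.2 + S.L u.2 v.1 + S.ι (S.T u.1 v.1), S.R u.1 v.2 - S.R u.2 v.1)

/-- The doubled auxiliary form. -/
def doubleT (u v : V × V) : E × F :=
  (S.L u.2 v.2 + S.ι (S.T u.1 v.2 + S.T u.2 v.1), S.T u.2 v.2)

/-- The embedding for the doubled system. -/
def doubleι : E × F →ₗ[ℝ] E × E × ℝ where
  toFun p := (p.1, S.ι p.2, 0)
  map_add' p q := by simp
  map_smul' t p := by simp

theorem isSkewForm_doubleL : IsSkewForm S.doubleL where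
  add_left u v w := by
    simp only [doubleL, Prod.fst_add, Prod.snd_add, S.hL.add_left, S.hT.add_left, map_add, S.R_add,
      Prod.mk_add_mk]
    refine Prod.ext rfl (Prod.ext ?_ ?_) <;> simp only <;> abel
  smul_left t u v := by
    simp only [doubleL, Prod.smul_fst, Prod.smul_snd, S.hL.smul_left, S.hT.smul_left, map_smul,
      S.R_smul, Prod.smul_mk, smul_add, smul_eq_mul, mul_sub]
  swap u v := by
    simp only [doubleL, Prod.neg_mk]
    refine Prod.ext (S.hL.swap _ _) (Prod.ext ?_ ?_) <;> simp only
    · rw [S.hL.swap u.1, S.hL.swap u.2, S.hT.swap u.1, map_neg]; abel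
    · rw [S.R_comm u.1, S.R_comm u.2]; ring
  I_smul u v := by
    simp only [doubleL, Prod.smul_fst, Prod.smul_snd, S.hL.I_smul, S.hT.I_smul, S.R_I]

theorem isSkewForm_doubleT : IsSkewForm S.doubleT where
  add_left u v w := by
    simp only [doubleT, Prod.fst_add, Prod.snd_add, S.hL.add_left, S.hT.add_left, map_add,
      Prod.mk_add_mk]
    refine Prod.ext ?_ rfl
    simp only; abel
  smul_left t u v := by
    simp only [doubleT, Prod.smul_fst, Prod.smul_snd, S.hL.smul_left, S.hT.smul_left, map_smul,
      Prod.smul_mk, smul_add, map_add]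
  swap u v := by
    simp only [doubleT, Prod.neg_mk]
    refine Prod.ext ?_ (S.hT.swap _ _)
    simp only
    rw [S.hL.swap u.2, S.hT.swap u.1, S.hT.swap u.2]
    simp only [map_add, map_neg]; abel
  I_smul u v := by
    simp only [doubleT, Prod.smul_fst, Prod.smul_snd, S.hL.I_smul, S.hT.I_smul]

theorem double_dep_aux (x y w w' : V × V) (hy : y.1 = 0) (h1 : S.doubleL x y = 0)
    (h2 : S.doubleL x w + S.doubleL y w' + S.doubleι (S.doubleT x y) = 0) :
    RealDependent x y := by
  obtain ⟨x0, x1⟩ := x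
  obtain ⟨y0, y1⟩ := y
  obtain ⟨w0, w1⟩ := w
  obtain ⟨z0, z1⟩ := w'
  simp only at hy
  subst hy
  simp only [doubleL, doubleι, doubleT, S.hL.zero_left, S.hL.zero_right, S.hT.zero_right,
    S.hT.zero_left, S.R_zero_left, S.R_zero_right, map_zero, Prod.mk_eq_zero, LinearMap.coe_mk,
    AddHom.coe_mk, Prod.mk_add_mk, add_zero, zero_add, sub_zero, zero_sub] at h1 h2
  obtain ⟨-, h12, h13⟩ := h1
  obtain ⟨h21, h22, -⟩ := h2
  by_cases hx : x0 = 0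
  · subst hx
    simp only [S.hL.zero_left, S.hT.zero_left, map_zero, zero_add, add_zero, add_assoc] at h21 h22
    rw [← add_assoc] at h22
    have := S.dep x1 y1 w0 z0 h21 h22
    rcases this with rfl | ⟨t, rfl⟩
    · left; rfl
    · right; exact ⟨t, by simp⟩
  · have := S.dep x0 y1 w0 (-x1) h12 (by
      rw [S.hL.neg_right, ← S.hL.swap, add_assoc, ]
      simpa [add_assoc] using h21)
    rcases this with h | ⟨t, rfl⟩
    · exact absurd h hx
    · rw [S.R_smul_right] at h13
      have ht : t = 0 := by
        rcases mul_eq_zero.1 h13 with h | h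
        · exact h
        · exact absurd (S.R_pos _ h) hx
      right; exact ⟨0, by simp [ht]⟩

theorem double_dep (x y w w' : V × V) (h1 : S.doubleL x y = 0)
    (h2 : S.doubleL x w + S.doubleL y w' + S.doubleι (S.doubleT x y) = 0) :
    RealDependent x y := by
  have hL := S.isSkewForm_doubleL
  have hT := S.isSkewForm_doubleT
  have key : RealDependent x.1 y.1 := by
    have h11 := h1
    simp only [doubleL, Prod.mk_eq_zero] at h11
    refine S.dep x.1 y.1 y.2 (-x.2) h11.1 ?_
    rw [S.hL.neg_right, ← S.hL.swap]
    exact h11.2.1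
  by_cases hx : x.1 = 0
  · refine (S.double_dep_aux y x (-w') (-w) hx ?_ ?_).symm
    · rw [hL.swap, h1, neg_zero]
    · rw [hL.neg_right, hL.neg_right, hT.swap, map_neg, ← neg_eq_zero, ← h2]; abel
  · rcases key with h | ⟨t, ht⟩
    · exact absurd h hx
    · have := S.double_dep_aux x (y - (t : ℂ) • x) (w + (t : ℂ) • w') w' (by simp [ht]) (by
        rw [hL.sub_right, h1, hL.smul_right, hL.self]; simp) (by
        rw [hL.add_right, hL.smul_right, hL.sub_left, hL.smul_left, hT.sub_right, hT.smul_right,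
          hT.self, ← h2]
        simp only [smul_zero, sub_zero]; abel)
      rcases this with h | ⟨s, hs⟩
      · left; exact h
      · right; refine ⟨s + t, ?_⟩
        rw [sub_eq_iff_eq_add] at hs
        rw [hs, Complex.ofReal_add, add_smul]

/-- The doubled system. -/
def double : SkewSystem (V × V) (E × E × ℝ) (E × F) where
  L := S.doubleL
  T := S.doubleT
  ι := S.doubleι
  R u v := S.R u.1 v.1 + S.R u.2 v.2
  hL := S.isSkewForm_doubleL
  hT := S.isSkewForm_doubleT
  ι_inj := by
    rintro ⟨p, q⟩ ⟨p', q'⟩ h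
    simp only [doubleι, LinearMap.coe_mk, AddHom.coe_mk, Prod.mk.injEq] at h
    exact Prod.ext h.1 (S.ι_inj h.2.1)
  R_add u v w := by simp only [Prod.fst_add, Prod.snd_add, S.R_add]; ring
  R_smul t u v := by simp only [Prod.smul_fst, Prod.smul_snd, S.R_smul]; ring
  R_comm u v := by rw [S.R_comm u.1, S.R_comm u.2]
  R_I u v := by simp only [Prod.smul_fst, Prod.smul_snd, S.R_I]
  R_nonneg u := add_nonneg (S.R_nonneg _) (S.R_nonneg _)
  R_pos u h := by
    have h1 := S.R_nonneg u.1
    have h2 := S.R_nonneg u.2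
    exact Prod.ext (S.R_pos _ (by linarith)) (S.R_pos _ (by linarith))
  dep := S.double_dep

end SkewSystem

namespace SkewExtension

variable {W Z : Type} [AddCommGroup W] [Module ℂ W] [AddCommGroup Z] [Module ℝ Z]
  {S : SkewSystem V E F} (X : SkewExtension S W Z)

/-- Push an extension to the second half of the doubled system. -/
noncomputable def lift : SkewExtension S.double W Z where
  j := (LinearMap.inl ℂ V V).comp X.j
  j_inj := fun a b h => X.j_inj (by simpa using h)
  β := X.β
  hβ := X.hβ
  κ := X.κ.comp ((S.ι.leftInverse).comp (LinearMap.fst ℝ E F))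
  nondeg := X.nondeg
  dep := by
    rintro ⟨x0, x1⟩ w y h1 h2
    have hli : ∀ f, S.ι.leftInverse (S.ι f) = f := fun f =>
      LinearMap.leftInverse_apply_of_inj (LinearMap.ker_eq_bot.2 S.ι_inj) f
    simp only [SkewSystem.double, SkewSystem.doubleL, SkewSystem.doubleT, LinearMap.comp_apply,
      LinearMap.inl_apply, LinearMap.fst_apply, S.hL.zero_right, S.hT.zero_right,
      S.R_zero_right, zero_add, zero_sub, Prod.mk_eq_zero, neg_eq_zero, hli] at h1 h2
    obtain ⟨h11, h12, h13⟩ := h1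
    have main : ∀ z, S.L x1 z = 0 → S.R x1 z = 0 → RealDependent x1 z → z = 0 ∨ x1 = 0 := by
      intro z _ h3 h4
      rcases h4 with h4 | ⟨t, rfl⟩
      · right; exact h4
      · rw [S.R_smul_right] at h3
        rcases mul_eq_zero.1 h3 with h | h
        · left; simp [h]
        · right; exact S.R_pos _ h
    have d0 : RealDependent x0 (X.j y) := by
      refine S.dep x0 (X.j y) 0 (-x1) h11 ?_
      rw [S.hL.neg_right, ← S.hL.swap, S.hL.zero_right, zero_add]
      exact h12
    by_cases hy : X.j y = 0
    · right; exact ⟨0, by simp [hy]⟩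
    · rcases d0.symm with h | ⟨t, ht⟩
      · exact absurd h hy
      · subst ht
        rw [S.hL.smul_left, S.hT.smul_left, S.hL.self, S.hT.self] at *
        have h12' : S.L x1 (X.j y) = 0 := by simpa using h12
        have := X.dep x1 w y h12' h2
        rcases main _ h12' h13 this with h | h
        · exact absurd h hy
        · refine RealDependent.symm (Or.inr ⟨t, ?_⟩)
          simp [h]

/-- Add the first half of the doubled system to an extension. -/
def extend : SkewExtension S.double (V × W) ((E × E × ℝ) × Z) where
  j := LinearMap.prodMap LinearMap.id X.j
  j_inj := by
    rintro ⟨a, b⟩ ⟨a', b'⟩ h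
    simp only [LinearMap.prodMap_apply, LinearMap.id_apply, Prod.mk.injEq] at h
    exact Prod.ext h.1 (X.j_inj h.2)
  β u v := (S.doubleL (u.1, X.j u.2) (v.1, X.j v.2),
    X.β u.2 v.2 + X.κ (S.T u.1 (X.j v.2) + S.T (X.j u.2) v.1))
  hβ :=
    { add_left := fun u v w => by
        have := S.isSkewForm_doubleL.add_left (u.1, X.j u.2) (v.1, X.j v.2) (w.1, X.j w.2)
        simp only [Prod.mk_add_mk] at this
        refine Prod.ext ?_ ?_
        · simp only [Prod.fst_add, Prod.snd_add, map_add, this]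
        · simp only [Prod.fst_add, Prod.snd_add, map_add, X.hβ.add_left, S.hT.add_left]; abel
      smul_left := fun t u v => by
        have := S.isSkewForm_doubleL.smul_left t (u.1, X.j u.2) (v.1, X.j v.2)
        simp only [Prod.smul_mk] at this
        refine Prod.ext ?_ ?_
        · simp only [Prod.smul_fst, Prod.smul_snd, map_smul, this]
        · simp only [Prod.smul_fst, Prod.smul_snd, map_smul, map_add, X.hβ.smul_left,
            S.hT.smul_left, smul_add]
      swap := fun u v => by
        refine Prod.ext (S.isSkewForm_doubleL.swap _ _) ?_
        simp only [Prod.snd_neg]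
        rw [X.hβ.swap, S.hT.swap u.1, S.hT.swap _ v.1]
        simp only [map_add, map_neg]; abel
      I_smul := fun u v => by
        have := S.isSkewForm_doubleL.I_smul (u.1, X.j u.2) (v.1, X.j v.2)
        simp only [Prod.smul_mk] at this
        refine Prod.ext ?_ ?_
        · simp only [Prod.smul_fst, Prod.smul_snd, map_smul, this]
        · simp only [Prod.smul_fst, Prod.smul_snd, map_smul, map_add, X.hβ.I_smul,
            S.hT.I_smul] }
  κ := (LinearMap.inl ℝ _ _).comp S.doubleι
  dep := by
    rintro x w y h1 h2
    refine S.double_dep x _ 0 (-(w.1, X.j w.2)) h1 ?_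
    have h2' := congrArg Prod.fst h2
    simp only [Prod.fst_add, LinearMap.comp_apply, LinearMap.inl_apply, Prod.fst_zero] at h2'
    have hL := S.isSkewForm_doubleL
    rw [hL.zero_right, zero_add, hL.neg_right, ← hL.swap, add_comm]
    exact h2'
  nondeg := by
    rintro ⟨u0, u1⟩ ⟨v0, v1⟩ h
    simp only [Prod.mk_eq_zero] at h
    obtain ⟨h1, h2⟩ := h
    -- the case `v0 = 0`
    have aux : ∀ u0 u1 v1, S.doubleL (u0, X.j u1) (0, X.j v1) = 0 →
        X.β u1 v1 + X.κ (S.T u0 (X.j v1) + S.T (X.j u1) 0) = 0 →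
        RealDependent (u0, u1) ((0 : V), v1) := by
      intro u0 u1 v1 h1 h2
      simp only [SkewSystem.doubleL, S.hL.zero_right, S.hT.zero_right, map_zero, add_zero,
        S.R_zero_right, sub_zero, Prod.mk_eq_zero, true_and] at h1 h2
      by_cases hu : u0 = 0
      · subst hu
        rw [S.hT.zero_left, map_zero, add_zero] at h2
        rcases X.nondeg _ _ h2 with rfl | ⟨t, rfl⟩
        · left; rfl
        · right; exact ⟨t, by simp⟩
      · rcases X.dep u0 u1 v1 h1.1 (by rw [add_comm]; exact h2) with h | ⟨t, ht⟩
        · exact absurd h hu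
        · rw [ht, S.R_smul_right] at h1
          rcases mul_eq_zero.1 h1.2 with h | h
          · subst h
            have : v1 = 0 := X.j_inj (by simpa using ht)
            right; exact ⟨0, by simp [this]⟩
          · exact absurd (S.R_pos _ h) hu
    have d0 : RealDependent u0 v0 := by
      simp only [SkewSystem.doubleL, Prod.mk_eq_zero] at h1
      refine S.dep u0 v0 (X.j v1) (-X.j u1) h1.1 ?_
      rw [S.hL.neg_right, ← S.hL.swap]
      exact h1.2.1
    have hL := S.isSkewForm_doubleL
    by_cases hu : u0 = 0
    · subst hu
      refine (aux v0 v1 u1 ?_ ?_).symm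
      · rw [hL.swap, h1, neg_zero]
      · rw [X.hβ.swap, S.hT.swap v0, S.hT.swap _ 0, ← neg_eq_zero, ← h2]
        simp only [map_add, map_neg]; abel
    · rcases d0 with h | ⟨t, rfl⟩
      · exact absurd h hu
      · have e : (((0 : V), X.j (v1 - (t : ℂ) • u1)) : V × V)
            = ((t : ℂ) • u0, X.j v1) - (t : ℂ) • (u0, X.j u1) := by
          simp
        rcases aux u0 u1 (v1 - (t : ℂ) • u1) (by
          rw [e, hL.sub_right, hL.smul_right, h1, hL.self]; simp) (by
          simp only [X.hβ.sub_right, X.hβ.smul_right, X.hβ.self, map_sub, map_smul,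
            S.hT.sub_right, S.hT.smul_right, S.hT.zero_right] at h2 ⊢
          have : S.T (X.j u1) u0 = - S.T u0 (X.j u1) := S.hT.swap _ _
          refine Eq.trans ?_ h2
          simp only [map_add, map_sub, map_smul, this, map_neg, smul_zero, sub_zero,
            add_zero, smul_neg]
          abel) with h | ⟨s, hs⟩
        · left; exact h
        · right
          refine ⟨s + t, ?_⟩
          simp only [Prod.smul_mk, Prod.mk.injEq] at hs ⊢
          have hs0 : s = 0 := by
            rcases smul_eq_zero.1 hs.1.symm with h | h
            · exact_mod_cast h
            · exact absurd h hu
          subst hs0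
          refine ⟨by simp, ?_⟩
          rw [sub_eq_iff_eq_add] at hs
          rw [hs.2, Complex.ofReal_add, add_smul]

end SkewExtension

/-- The form on `ℂ²` given by the three Pauli matrices. -/
def pauliForm (u v : ℂ × ℂ) : ℝ × ℝ × ℝ :=
  ((starRingEnd ℂ u.1 * v.1 - starRingEnd ℂ u.2 * v.2).im,
    (starRingEnd ℂ u.1 * v.2 + starRingEnd ℂ u.2 * v.1).im,
    (starRingEnd ℂ u.1 * v.2 - starRingEnd ℂ u.2 * v.1).re)

theorem isSkewForm_pauliForm : IsSkewForm pauliForm where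
  add_left u v w := by
    simp only [pauliForm, Prod.fst_add, Prod.snd_add, map_add, Prod.mk_add_mk]
    refine Prod.ext ?_ (Prod.ext ?_ ?_) <;> simp <;> ring
  smul_left t u v := by
    simp only [pauliForm, Prod.smul_fst, Prod.smul_snd, Prod.smul_mk]
    refine Prod.ext ?_ (Prod.ext ?_ ?_) <;> simp <;> ring
  swap u v := by
    simp only [pauliForm, Prod.neg_mk]
    refine Prod.ext ?_ (Prod.ext ?_ ?_) <;> simp <;> ring
  I_smul u v := by
    simp only [pauliForm, Prod.smul_fst, Prod.smul_snd]
    refine Prod.ext ?_ (Prod.ext ?_ ?_) <;> simp <;> ring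

theorem realDependent_of_im_eq_zero {u v : ℂ} (h : (starRingEnd ℂ u * v).im = 0) (hu : u ≠ 0) :
    ∃ t : ℝ, v = t * u := by
  refine ⟨(starRingEnd ℂ u * v).re / Complex.normSq u, ?_⟩
  have h1 : starRingEnd ℂ u * v = ((starRingEnd ℂ u * v).re : ℂ) :=
    Complex.ext (by simp) (by simpa using h)
  have h2 : ((Complex.normSq u : ℝ) : ℂ) = starRingEnd ℂ u * u := Complex.normSq_eq_conj_mul_self
  have h3 : starRingEnd ℂ u ≠ 0 := by simpa using hu
  rw [Complex.ofReal_div, ← h1, h2]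
  field_simp

theorem pauliForm_dep (u v : ℂ × ℂ) (h : pauliForm u v = 0) : RealDependent u v := by
  obtain ⟨u0, u1⟩ := u
  obtain ⟨v0, v1⟩ := v
  simp only [pauliForm, Prod.mk_eq_zero] at h
  obtain ⟨h1, h2, h3⟩ := h
  have h4 : starRingEnd ℂ u1 * v0 = u0 * starRingEnd ℂ v1 := by
    apply Complex.ext
    · simp at h3 ⊢; linarith
    · simp at h2 ⊢; linarith
  by_cases hu : u0 = 0
  · subst hu
    by_cases hu1 : u1 = 0
    · left; simp [hu1]
    · have hv0 : v0 = 0 := by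
        simpa [hu1] using h4
      subst hv0
      obtain ⟨t, ht⟩ := realDependent_of_im_eq_zero (u := u1) (v := v1)
        (by simp at h1 ⊢; linarith) hu1
      right; exact ⟨t, by simp [ht]⟩
  · set z := v0 / u0 with hz
    have hv0 : v0 = z * u0 := by rw [hz]; field_simp
    have hv1 : v1 = starRingEnd ℂ z * u1 := by
      have : starRingEnd ℂ v1 = z * starRingEnd ℂ u1 := by
        have : u0 * starRingEnd ℂ v1 = u0 * (z * starRingEnd ℂ u1) := by
          rw [← h4, hv0]; ring
        exact mul_left_cancel₀ hu this
      have := congrArg (starRingEnd ℂ) this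
      simpa using this
    have hzi : z.im = 0 := by
      rw [hv0, hv1] at h1
      have e : starRingEnd ℂ u0 * (z * u0) - starRingEnd ℂ u1 * (starRingEnd ℂ z * u1)
          = z * (Complex.normSq u0 : ℝ) - starRingEnd ℂ z * (Complex.normSq u1 : ℝ) := by
        rw [Complex.normSq_eq_conj_mul_self, Complex.normSq_eq_conj_mul_self]; ring
      rw [e] at h1
      simp only [Complex.sub_im, Complex.mul_im, Complex.ofReal_im, Complex.ofReal_re,
        Complex.conj_im, mul_zero, zero_add] at h1
      have hp : 0 < Complex.normSq u0 := Complex.normSq_pos.2 hu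
      have hq := Complex.normSq_nonneg u1
      have : z.im * (Complex.normSq u0 + Complex.normSq u1) = 0 := by linarith
      rcases mul_eq_zero.1 this with h | h
      · exact h
      · linarith
    right
    refine ⟨z.re, ?_⟩
    have hzr : z = (z.re : ℂ) := Complex.ext (by simp) (by simpa using hzi)
    have hzc : starRingEnd ℂ z = z := Complex.conj_eq_iff_im.2 hzi
    rw [← hzr, hv1, hzc]; simp [hv0]

/-- The initial system. -/
def pauliSystem : SkewSystem (ℂ × ℂ) (ℝ × ℝ × ℝ) (Fin 0 → ℝ) where
  L := pauliForm
  T _ _ := 0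
  ι := 0
  R u v := (starRingEnd ℂ u.1 * v.1 + starRingEnd ℂ u.2 * v.2).re
  hL := isSkewForm_pauliForm
  hT := ⟨by simp, by simp, by simp, by simp⟩
  ι_inj := Function.injective_of_subsingleton _
  R_add u v w := by simp; ring
  R_smul t u v := by simp; ring
  R_comm u v := by simp; ring
  R_I u v := by simp
  R_nonneg u := by
    rw [← Complex.normSq_eq_conj_mul_self, ← Complex.normSq_eq_conj_mul_self,
      ← Complex.ofReal_add, Complex.ofReal_re]
    exact add_nonneg (Complex.normSq_nonneg _) (Complex.normSq_nonneg _)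
  R_pos u h := by
    rw [← Complex.normSq_eq_conj_mul_self, ← Complex.normSq_eq_conj_mul_self,
      ← Complex.ofReal_add, Complex.ofReal_re] at h
    have h1 := Complex.normSq_nonneg u.1
    have h2 := Complex.normSq_nonneg u.2
    exact Prod.ext (Complex.normSq_eq_zero.1 (by linarith))
      (Complex.normSq_eq_zero.1 (by linarith))
  dep x y _ _ h _ := pauliForm_dep x y h

/-- There is an extension of the given dimensions. -/
def HasExtension (S : SkewSystem V E F) (w z : ℕ) : Prop :=
  ∃ (W Z : Type) (_ : AddCommGroup W) (_ : Module ℂ W) (_ : AddCommGroup Z) (_ : Module ℝ Z),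
    FiniteDimensional ℂ W ∧ FiniteDimensional ℝ Z ∧ Module.finrank ℂ W = w ∧
      Module.finrank ℝ Z = z ∧ Nonempty (SkewExtension S W Z)

theorem hasExtension_pauliSystem_two : HasExtension pauliSystem 2 3 := by
  refine ⟨ℂ × ℂ, ℝ × ℝ × ℝ, _, _, _, _, inferInstance, inferInstance, by simp, by simp, ⟨?_⟩⟩
  exact
    { j := LinearMap.id
      j_inj := fun _ _ h => h
      β := pauliForm
      hβ := isSkewForm_pauliForm
      κ := 0
      dep := fun x _ y h _ => pauliForm_dep x y h
      nondeg := pauliForm_dep }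

theorem hasExtension_pauliSystem_one : HasExtension pauliSystem 1 1 := by
  refine ⟨ℂ, ℝ, _, _, _, _, inferInstance, inferInstance, by simp, by simp, ⟨?_⟩⟩
  exact
    { j := LinearMap.inl ℂ ℂ ℂ
      j_inj := fun a b h => by simpa using h
      β := fun u v => (starRingEnd ℂ u * v).im
      hβ := ⟨fun u v w => by simp; ring, fun t u v => by simp; ring, fun u v => by simp; ring,
        fun u v => by simp⟩
      κ := 0
      dep := fun x _ y h _ => pauliForm_dep x _ h
      nondeg := fun u v h => by
        by_cases hu : u = 0
        · left; exact hu
        · right; simpa using realDependent_of_im_eq_zero h hu }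

theorem HasExtension.lift {S : SkewSystem V E F} {w z : ℕ} (h : HasExtension S w z) :
    HasExtension S.double w z := by
  obtain ⟨W, Z, _, _, _, _, h1, h2, h3, h4, ⟨X⟩⟩ := h
  exact ⟨W, Z, _, _, _, _, h1, h2, h3, h4, ⟨X.lift⟩⟩

theorem HasExtension.extend [FiniteDimensional ℂ V] [FiniteDimensional ℝ E]
    {S : SkewSystem V E F} {w z : ℕ} (h : HasExtension S w z) :
    HasExtension S.double (Module.finrank ℂ V + w)
      (2 * Module.finrank ℝ E + 1 + z) := by
  obtain ⟨W, Z, _, _, _, _, h1, h2, h3, h4, ⟨X⟩⟩ := h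
  refine ⟨V × W, (E × E × ℝ) × Z, _, _, _, _, inferInstance, inferInstance, ?_, ?_, ⟨X.extend⟩⟩
  · rw [Module.finrank_prod, h3]
  · simp only [Module.finrank_prod, h4, Module.finrank_self]; ring

theorem sum_digits_two_pow_add (a m : ℕ) (hm : m < 2 ^ a) :
    (Nat.digits 2 (2 ^ a + m)).sum = (Nat.digits 2 m).sum + 1 := by
  induction a generalizing m with
  | zero => obtain rfl : m = 0 := by omega
            simp
  | succ a ih =>
    have h1 := ih (m / 2) (by rw [pow_succ] at hm; omega)
    have e : (2 ^ (a + 1) + m) / 2 = 2 ^ a + m / 2 := by rw [pow_succ]; omega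
    have e' : (2 ^ (a + 1) + m) % 2 = m % 2 := by rw [pow_succ]; omega
    rw [Nat.digits_eq_cons_digits_div (by norm_num) (by positivity), e, e', List.sum_cons, h1]
    by_cases hm0 : m = 0
    · subst hm0; simp
    · rw [Nat.digits_eq_cons_digits_div (n := m) (by norm_num) hm0, List.sum_cons]
      ring

theorem exists_skewSystem (c e : ℕ) (h0 : HasExtension pauliSystem c e) (a : ℕ) :
    ∃ (V E F : Type) (_ : AddCommGroup V) (_ : Module ℂ V) (_ : AddCommGroup E) (_ : Module ℝ E)
      (_ : AddCommGroup F) (_ : Module ℝ F) (S : SkewSystem V E F),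
      FiniteDimensional ℂ V ∧ FiniteDimensional ℝ E ∧ Module.finrank ℂ V = 2 * 2 ^ a ∧
      Module.finrank ℝ E + 1 = 4 * 2 ^ a ∧
      ∀ m < 2 ^ a, ∃ z, z + (Nat.digits 2 m).sum = 8 * m + e ∧ HasExtension S (2 * m + c) z := by
  induction a with
  | zero =>
    refine ⟨_, _, _, _, _, _, _, _, _, pauliSystem, inferInstance, inferInstance, by simp, by simp,
      ?_⟩
    intro m hm
    obtain rfl : m = 0 := by simpa using hm
    exact ⟨e, by simp, by simpa using h0⟩
  | succ a ih =>
    obtain ⟨V, E, F, _, _, _, _, _, _, S, _, _, hV, hE, hS⟩ := ih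
    refine ⟨_, _, _, _, _, _, _, _, _, S.double, inferInstance, inferInstance, ?_, ?_, ?_⟩
    · rw [Module.finrank_prod, hV]; ring
    · simp only [Module.finrank_prod, Module.finrank_self]; rw [pow_succ]; omega
    · intro m hm
      rcases lt_or_ge m (2 ^ a) with h | h
      · obtain ⟨z, hz, hz'⟩ := hS m h
        exact ⟨z, hz, hz'.lift⟩
      · obtain ⟨m, rfl⟩ := Nat.exists_eq_add_of_le h
        have hm' : m < 2 ^ a := by rw [pow_succ] at hm; omega
        obtain ⟨z, hz, hz'⟩ := hS m hm'
        refine ⟨2 * Module.finrank ℝ E + 1 + z, ?_, ?_⟩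
        · rw [sum_digits_two_pow_add a m hm']; omega
        · have := hz'.extend
          rw [hV] at this
          convert this using 1
          ring

theorem exists_nondegenerate_skewForm (c e m z : ℕ) (h0 : HasExtension pauliSystem c e)
    (hz : z + (Nat.digits 2 m).sum = 8 * m + e) :
    ∃ β : (Fin (2 * m + c) → ℂ) → (Fin (2 * m + c) → ℂ) → (Fin z → ℝ),
      IsSkewForm β ∧ ∀ u v, β u v = 0 → RealDependent u v := by
  obtain ⟨V, E, F, _, _, _, _, _, _, S, _, _, hV, hE, hS⟩ := exists_skewSystem c e h0 m
  obtain ⟨z', hz', W, Z, _, _, _, _, _, _, hW, hZ, ⟨X⟩⟩ := hS m Nat.lt_two_pow_self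
  obtain rfl : z = z' := by omega
  let f : (Fin (2 * m + c) → ℂ) ≃ₗ[ℂ] W := LinearEquiv.ofFinrankEq _ _ (by simp [hW])
  let g : Z ≃ₗ[ℝ] (Fin z → ℝ) := LinearEquiv.ofFinrankEq _ _ (by simp [hZ])
  refine ⟨fun u v => g (X.β (f u) (f v)), ⟨?_, ?_, ?_, ?_⟩, ?_⟩
  · intro u v w; rw [map_add, X.hβ.add_left, map_add]
  · intro t u v; rw [map_smul, X.hβ.smul_left, map_smul]
  · intro u v; rw [X.hβ.swap, map_neg]
  · intro u v; rw [map_smul, map_smul, X.hβ.I_smul]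
  · intro u v h
    have h1 : X.β (f u) (f v) = 0 := by simpa using h
    rcases X.nondeg _ _ h1 with h2 | ⟨t, ht⟩
    · left; simpa using h2
    · right; refine ⟨t, f.injective ?_⟩
      rw [ht, map_smul]

theorem phaseRetrievableC_of_skewForm {d N : ℕ} (β : (Fin d → ℂ) → (Fin d → ℂ) → (Fin N → ℝ))
    (hβ : IsSkewForm β) (hnd : ∀ u v, β u v = 0 → RealDependent u v) :
    ∃ A : Fin N → Matrix (Fin d) (Fin d) ℂ, (∀ j, (A j).IsHermitian) ∧ PhaseRetrievableC A := by
  have hII : ∀ v : Fin d → ℂ, Complex.I • Complex.I • v = -v := fun v => by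
    rw [smul_smul, Complex.I_mul_I, neg_one_smul]
  have hsym : ∀ u v, β v (Complex.I • u) = β u (Complex.I • v) := fun u v => by
    rw [hβ.swap, ← hβ.I_smul, hII, hβ.neg_left, neg_neg]
  let H (j : Fin N) (u : Fin d → ℂ) : (Fin d → ℂ) →ₗ[ℂ] ℂ :=
    { toFun := fun v => (β u (Complex.I • v) j : ℂ) + Complex.I * (β u v j : ℂ)
      map_add' := fun v w => by
        simp only [smul_add, hβ.add_right, Pi.add_apply]; push_cast; ring
      map_smul' := fun c v => by
        have e : c • v = (c.re : ℂ) • v + (c.im : ℂ) • Complex.I • v := by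
          rw [smul_smul, ← add_smul, Complex.re_add_im]
        have e' : Complex.I • c • v = (c.re : ℂ) • Complex.I • v - (c.im : ℂ) • v := by
          rw [e, smul_add, smul_comm _ (c.im : ℂ), hII, smul_comm]; simp [sub_eq_add_neg]
        rw [e', e]
        simp only [hβ.add_right, hβ.sub_right, hβ.smul_right, Pi.add_apply, Pi.sub_apply,
          Pi.smul_apply, smul_eq_mul, RingHom.id_apply]
        nth_rewrite 5 [← Complex.re_add_im c]
        push_cast
        linear_combination (-(c.im : ℂ) * (β u v j : ℂ)) * Complex.I_mul_I }
  have hHsym : ∀ j u v, H j v u = starRingEnd ℂ (H j u v) := fun j u v => by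
    have h1 := congrFun (hβ.swap v u) j
    simp only [H, LinearMap.coe_mk, AddHom.coe_mk, hsym u v, h1, map_add, map_mul,
      Complex.conj_ofReal, Complex.conj_I, Pi.neg_apply]
    push_cast; ring
  let e (k : Fin d) : Fin d → ℂ := fun l => if k = l then 1 else 0
  have hH1 : ∀ j u v, H j u v = ∑ l, v l * H j u (e l) := fun j u v => by
    rw [LinearMap.pi_apply_eq_sum_univ (H j u) v]; simp [e]
  have hH2 : ∀ j u v, H j u v = ∑ k, starRingEnd ℂ (u k) * H j (e k) v := fun j u v => by
    rw [hHsym, hH1, map_sum]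
    refine Finset.sum_congr rfl fun k _ => ?_
    rw [map_mul, ← hHsym]
  let A (j : Fin N) : Matrix (Fin d) (Fin d) ℂ := Matrix.of fun k l => H j (e k) (e l)
  have hA : ∀ j x, star x ⬝ᵥ (A j) *ᵥ x = (β x (Complex.I • x) j : ℂ) := fun j x => by
    have h1 : H j x x = (β x (Complex.I • x) j : ℂ) := by
      simp [H, hβ.self]
    rw [← h1, hH2]
    simp only [dotProduct, mulVec, A, Matrix.of_apply, Pi.star_apply, RCLike.star_def]
    refine Finset.sum_congr rfl fun k _ => ?_
    rw [hH1 j (e k) x]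
    congr 1
    exact Finset.sum_congr rfl fun l _ => mul_comm _ _
  refine ⟨A, fun j => ?_, fun x y hxy => ?_⟩
  · ext k l
    simp only [A, Matrix.conjTranspose_apply, Matrix.of_apply]
    exact (hHsym j _ _).symm
  · have hxy' : β x (Complex.I • x) = β y (Complex.I • y) := by
      funext j
      have := hxy j
      rw [hA, hA] at this
      exact_mod_cast this
    have h0 : β (x + y) (Complex.I • (x - y)) = 0 := by
      rw [smul_sub, hβ.sub_right, hβ.add_left, hβ.add_left, hsym x y, hxy']; abel
    rcases hnd _ _ h0 with h | ⟨t, ht⟩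
    · refine ⟨-1, by simp, ?_⟩
      rw [neg_one_smul]; exact eq_neg_of_add_eq_zero_left h
    · have hne : Complex.I - (t : ℂ) ≠ 0 := fun h => by
        have := congrArg Complex.im h
        simp at this
      refine ⟨(Complex.I + t) / (Complex.I - t), ?_, ?_⟩
      · rw [norm_div, div_eq_one_iff_eq (by simpa using hne)]
        have : Complex.I - (t : ℂ) = -starRingEnd ℂ (Complex.I + t) := by simp; ring
        rw [this, norm_neg, RCLike.norm_conj]
      · have : (Complex.I - (t : ℂ)) • x = (Complex.I + t) • y := by
          rw [smul_sub, smul_add] at ht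
          rw [sub_smul, add_smul]
          linear_combination (exp := 1) ht
        rw [div_eq_inv_mul, mul_smul, ← this, smul_smul, inv_mul_cancel₀ hne, one_smul]

theorem exists_phaseRetrievableC (d : ℕ) (hd : 1 ≤ d) :
    ∃ A : Fin (4 * d - 3 - (Nat.digits 2 (d - 1)).sum - if Odd d then 0 else 1) →
      Matrix (Fin d) (Fin d) ℂ, (∀ j, (A j).IsHermitian) ∧ PhaseRetrievableC A := by
  have key : ∀ m : ℕ, (Nat.digits 2 m).sum ≤ m := fun m => Nat.digit_sum_le 2 m
  rcases Nat.even_or_odd d with h | h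
  · rw [if_neg (by simpa using h)]
    obtain ⟨m, rfl⟩ : ∃ m, d = 2 * m + 2 := by
      obtain ⟨m, hm⟩ := h
      exact ⟨m - 1, by omega⟩
    have e : (Nat.digits 2 (2 * m + 2 - 1)).sum = (Nat.digits 2 m).sum + 1 := by
      have : 2 * m + 2 - 1 = 1 + 2 * m := by omega
      rw [this, Nat.digits_add 2 (by norm_num) 1 m (by norm_num) (by simp), List.sum_cons,
        add_comm]
    have := key m
    obtain ⟨β, h1, h2⟩ := exists_nondegenerate_skewForm 2 3 m
      (4 * (2 * m + 2) - 3 - (Nat.digits 2 (2 * m + 2 - 1)).sum - 1)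
      hasExtension_pauliSystem_two (by omega)
    exact phaseRetrievableC_of_skewForm β h1 h2
  · rw [if_pos h]
    obtain ⟨m, rfl⟩ := h
    have e : (Nat.digits 2 (2 * m + 1 - 1)).sum = (Nat.digits 2 m).sum := by
      rw [Nat.add_sub_cancel]
      rcases Nat.eq_zero_or_pos m with rfl | hm
      · simp
      · have := Nat.digits_add 2 (by norm_num) 0 m (by norm_num) (Or.inr hm.ne')
        rw [zero_add] at this
        rw [this, List.sum_cons, zero_add]
    have := key m
    obtain ⟨β, h1, h2⟩ := exists_nondegenerate_skewForm 1 1 m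
      (4 * (2 * m + 1) - 3 - (Nat.digits 2 (2 * m + 1 - 1)).sum - 0)
      hasExtension_pauliSystem_one (by omega)
    exact phaseRetrievableC_of_skewForm β h1 h2

end UpperBound

section Signature

variable {n m : Type*} [Fintype n] [DecidableEq n] [Fintype m] [DecidableEq m]

/-- The signature of a (Hermitian) complex matrix, read off from the characteristic polynomial. -/
noncomputable def matSig (A : Matrix n n ℂ) : ℤ :=
  (A.charpoly.roots.map fun z => (SignType.sign z.re : ℤ)).sum

theorem matSig_eq_of_charpoly_eq {A : Matrix n n ℂ} {B : Matrix m m ℂ}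
    (h : A.charpoly = B.charpoly) : matSig A = matSig B := by
  unfold matSig; rw [h]

theorem matSig_submatrix_equiv (A : Matrix n n ℂ) (e : m ≃ n) :
    matSig (A.submatrix e e) = matSig A :=
  matSig_eq_of_charpoly_eq (by simpa using charpoly_reindex e.symm A)

theorem matSig_conj (A U V : Matrix n n ℂ) (h : U * V = 1) : matSig (V * A * U) = matSig A := by
  refine matSig_eq_of_charpoly_eq ?_
  rw [charpoly_mul_comm, ← mul_assoc, h, one_mul]

theorem matSig_diagonal (d : n → ℂ) :
    matSig (diagonal d) = ∑ i, (SignType.sign (d i).re : ℤ) := by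
  unfold matSig
  rw [charpoly_diagonal, Polynomial.roots_prod _ _
    (by simp [Finset.prod_ne_zero_iff, Polynomial.X_sub_C_ne_zero])]
  simp

theorem matSig_hermitian {A : Matrix n n ℂ} (hA : A.IsHermitian) :
    matSig A = ∑ i, (SignType.sign (hA.eigenvalues i) : ℤ) := by
  unfold matSig
  rw [hA.roots_charpoly_eq_eigenvalues]
  simp

theorem matSig_block {κ : Type*} [Fintype κ] [DecidableEq κ] (A : Matrix n n ℂ) (b : n → κ)
    (h : ∀ i j, b i ≠ b j → A i j = 0) :
    matSig A = ∑ a, matSig (A.toSquareBlock b a) := by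
  classical
  let _ : LinearOrder κ := LinearOrder.lift' (Fintype.equivFin κ) (Fintype.equivFin κ).injective
  have hc : A.charpoly = ∏ a, (A.toSquareBlock b a).charpoly := by
    have h1 : A.BlockTriangular b := fun i j hij => h i j hij.ne'
    rw [h1.charpoly]
    have h2 : ∏ a ∈ Finset.univ.image b, (A.toSquareBlock b a).charpoly =
        ∏ a, (A.toSquareBlock b a).charpoly := by
      refine Finset.prod_subset (Finset.subset_univ _) fun a _ ha => ?_
      have : IsEmpty {i // b i = a} :=
        ⟨fun i => ha (Finset.mem_image.2 ⟨i, Finset.mem_univ _, i.2⟩)⟩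
      exact charpoly_isEmpty
    convert h2
  unfold matSig
  rw [hc, Polynomial.roots_prod _ _ (by
    rw [Finset.prod_ne_zero_iff]; exact fun a _ => (charpoly_monic _).ne_zero)]
  simp only [Multiset.map_bind, Multiset.sum_bind]
  rfl

theorem charpoly_neg_eq {A : Matrix n n ℂ} (hA : A.IsHermitian) :
    (-A).charpoly = (diagonal fun i => (-(hA.eigenvalues i : ℂ))).charpoly := by
  conv_lhs => rw [hA.spectral_theorem, Unitary.conjStarAlgAut_apply, ← neg_mul, ← mul_neg,
    charpoly_mul_comm, ← mul_assoc]
  simp [charpoly_diagonal]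

theorem matSig_neg {A : Matrix n n ℂ} (hA : A.IsHermitian) : matSig (-A) = - matSig A := by
  rw [matSig_eq_of_charpoly_eq (charpoly_neg_eq hA), matSig_diagonal, matSig_hermitian hA, ← Finset.sum_neg_distrib]
  refine Finset.sum_congr rfl fun i _ => ?_
  simp [Left.sign_neg]

theorem matSig_eq_zero_of_conj_neg {A U V : Matrix n n ℂ} (hA : A.IsHermitian) (h : U * V = 1)
    (hneg : V * A * U = -A) : matSig A = 0 := by
  have h1 := matSig_conj A U V h
  rw [hneg, matSig_neg hA] at h1
  omega

/-- The number of positive eigenvalues. -/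
noncomputable def posIdx {A : Matrix n n ℂ} (hA : A.IsHermitian) : ℕ :=
  Fintype.card {i // 0 < hA.eigenvalues i}

/-- The number of negative eigenvalues. -/
noncomputable def negIdx {A : Matrix n n ℂ} (hA : A.IsHermitian) : ℕ :=
  Fintype.card {i // hA.eigenvalues i < 0}

theorem matSig_eq_posIdx_sub_negIdx {A : Matrix n n ℂ} (hA : A.IsHermitian) :
    matSig A = posIdx hA - negIdx hA := by
  rw [matSig_hermitian hA, posIdx, negIdx, Fintype.card_subtype, Fintype.card_subtype,
    Finset.card_filter, Finset.card_filter]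
  push_cast
  rw [← Finset.sum_sub_distrib]
  refine Finset.sum_congr rfl fun i _ => ?_
  rcases lt_trichotomy (hA.eigenvalues i) 0 with h | h | h
  · simp [h, h.not_gt]
  · simp [h]
  · simp [h, h.not_gt]

theorem posIdx_add_negIdx_le {A : Matrix n n ℂ} (hA : A.IsHermitian) :
    posIdx hA + negIdx hA ≤ Fintype.card n := by
  rw [posIdx, negIdx, Fintype.card_subtype, Fintype.card_subtype, ← Finset.card_union_of_disjoint]
  · exact Finset.card_le_univ _
  · rw [Finset.disjoint_filter]
    intro i _ h1 h2
    exact absurd h1 h2.not_gt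

theorem posIdx_add_negIdx {A : Matrix n n ℂ} (hA : A.IsHermitian)
    (h : ∀ i, hA.eigenvalues i ≠ 0) : posIdx hA + negIdx hA = Fintype.card n := by
  rw [posIdx, negIdx, Fintype.card_subtype, Fintype.card_subtype, ← Finset.card_union_of_disjoint]
  · rw [← Finset.card_univ]; congr 1; ext i
    simpa using (h i).symm.lt_or_gt
  · rw [Finset.disjoint_filter]
    intro i _ h1 h2
    exact absurd h1 h2.not_gt

/-- The squared Euclidean norm. -/
noncomputable def nsq {ι : Type*} [Fintype ι] (v : ι → ℂ) : ℝ := ∑ i, ‖v i‖ ^ 2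

theorem nsq_nonneg {ι : Type*} [Fintype ι] (v : ι → ℂ) : 0 ≤ nsq v :=
  Finset.sum_nonneg fun _ _ => by positivity

theorem star_dotProduct_self {ι : Type*} [Fintype ι] (v : ι → ℂ) : star v ⬝ᵥ v = (nsq v : ℂ) := by
  simp [dotProduct, nsq, Complex.conj_mul']

theorem nsq_pos {ι : Type*} [Fintype ι] {v : ι → ℂ} (hv : v ≠ 0) : 0 < nsq v := by
  obtain ⟨i, hi⟩ := Function.ne_iff.1 hv
  exact Finset.sum_pos' (fun _ _ => by positivity) ⟨i, Finset.mem_univ _, by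
    have : 0 < ‖v i‖ := norm_pos_iff.2 hi
    positivity⟩

theorem hermitian_diag {A : Matrix n n ℂ} (hA : A.IsHermitian) :
    A * (hA.eigenvectorUnitary : Matrix n n ℂ) =
      (hA.eigenvectorUnitary : Matrix n n ℂ) * diagonal (fun i => (hA.eigenvalues i : ℂ)) := by
  have h := hA.spectral_theorem
  rw [Unitary.conjStarAlgAut_apply] at h
  nth_rewrite 1 [h]
  rw [mul_assoc, Unitary.coe_star_mul_self, mul_one]
  rfl

theorem quadForm_eigen {A : Matrix n n ℂ} (hA : A.IsHermitian) (c : n → ℂ) :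
    star ((hA.eigenvectorUnitary : Matrix n n ℂ) *ᵥ c) ⬝ᵥ
      A *ᵥ ((hA.eigenvectorUnitary : Matrix n n ℂ) *ᵥ c) =
      ((∑ i, hA.eigenvalues i * ‖c i‖ ^ 2 : ℝ) : ℂ) := by
  rw [mulVec_mulVec, hermitian_diag, star_mulVec, ← mulVec_mulVec, ← dotProduct_mulVec,
    mulVec_mulVec, ← star_eq_conjTranspose, Unitary.coe_star_mul_self, one_mulVec]
  simp only [dotProduct, mulVec_diagonal]
  push_cast
  refine Finset.sum_congr rfl fun i _ => ?_
  rw [Pi.star_apply, mul_left_comm]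
  simp [Complex.conj_mul']

theorem nsq_eigen {A : Matrix n n ℂ} (hA : A.IsHermitian) (c : n → ℂ) :
    nsq ((hA.eigenvectorUnitary : Matrix n n ℂ) *ᵥ c) = nsq c := by
  have : ((nsq ((hA.eigenvectorUnitary : Matrix n n ℂ) *ᵥ c) : ℝ) : ℂ) = (nsq c : ℝ) := by
    rw [← star_dotProduct_self, ← star_dotProduct_self, star_mulVec, ← dotProduct_mulVec,
      mulVec_mulVec, ← star_eq_conjTranspose, Unitary.coe_star_mul_self, one_mulVec]
  exact_mod_cast this

theorem posIdx_le {A B : Matrix n n ℂ} (hA : A.IsHermitian) (hB : B.IsHermitian)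
    (h : ∀ c : n → ℂ, c ≠ 0 → (∀ i, c i ≠ 0 → 0 < hA.eigenvalues i) →
      0 < (star ((hA.eigenvectorUnitary : Matrix n n ℂ) *ᵥ c) ⬝ᵥ
      B *ᵥ ((hA.eigenvectorUnitary : Matrix n n ℂ) *ᵥ c)).re) : posIdx hA ≤ posIdx hB := by
  by_contra! hlt
  let UA := (hA.eigenvectorUnitary : Matrix n n ℂ)
  let UB := (hB.eigenvectorUnitary : Matrix n n ℂ)
  let E : ({i // 0 < hA.eigenvalues i} → ℂ) →ₗ[ℂ] (n → ℂ) :=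
    Function.ExtendByZero.linearMap ℂ Subtype.val
  let R : (n → ℂ) →ₗ[ℂ] ({i // 0 < hB.eigenvalues i} → ℂ) :=
    LinearMap.funLeft ℂ ℂ Subtype.val
  let f := R ∘ₗ (star UB * UA).mulVecLin ∘ₗ E
  have hker : LinearMap.ker f ≠ ⊥ := by
    apply LinearMap.ker_ne_bot_of_finrank_lt
    rw [Module.finrank_fintype_fun_eq_card, Module.finrank_fintype_fun_eq_card]
    exact hlt
  obtain ⟨c, hc, hc0⟩ := Submodule.exists_mem_ne_zero_of_ne_bot hker
  have hEi : ∀ i : {i // 0 < hA.eigenvalues i}, E c i = c i := fun i =>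
    Subtype.val_injective.extend_apply _ _ _
  have hpos := h (E c) (by
    intro h0
    apply hc0
    ext i
    rw [← hEi, h0]; rfl) (by
    intro i hi
    by_contra hni
    apply hi
    change Function.extend Subtype.val c 0 i = 0
    rw [Function.extend_apply' _ _ _ (by rintro ⟨a, rfl⟩; exact hni a.2)]
    rfl)
  set w := (star UB * UA) *ᵥ E c with hw
  have hUw : UA *ᵥ E c = UB *ᵥ w := by
    rw [hw, mulVec_mulVec, ← mul_assoc, show UB * star UB = 1 from Unitary.coe_mul_star_self _,
      one_mul]
  change 0 < (star (UA *ᵥ E c) ⬝ᵥ B *ᵥ (UA *ᵥ E c)).re at hpos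
  rw [hUw, quadForm_eigen hB, Complex.ofReal_re] at hpos
  refine absurd hpos (not_lt.2 (Finset.sum_nonpos fun i _ => ?_))
  by_cases hi : 0 < hB.eigenvalues i
  · have : w i = 0 := congrFun (LinearMap.mem_ker.1 hc) ⟨i, hi⟩
    simp [this]
  · exact mul_nonpos_of_nonpos_of_nonneg (not_lt.1 hi) (by positivity)

theorem negIdx_eq_posIdx_neg {A : Matrix n n ℂ} (hA : A.IsHermitian) :
    (negIdx hA : ℤ) = posIdx hA.neg := by
  have h2 := hA.neg.roots_charpoly_eq_eigenvalues
  rw [charpoly_neg_eq hA, charpoly_diagonal, Polynomial.roots_prod _ _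
    (by rw [Finset.prod_ne_zero_iff]; exact fun _ _ => Polynomial.X_sub_C_ne_zero _)] at h2
  have h3 := congrArg (fun s : Multiset ℂ => (s.map fun z => if 0 < z.re then (1 : ℤ) else 0).sum) h2
  simp only [Polynomial.roots_X_sub_C, Multiset.bind_singleton, Multiset.map_map,
    Function.comp_def] at h3
  rw [negIdx, posIdx, Fintype.card_subtype, Fintype.card_subtype, Finset.card_filter,
    Finset.card_filter]
  push_cast
  simpa using h3

theorem le_abs_eigenvalues {A : Matrix n n ℂ} (hA : A.IsHermitian) {g : ℝ} (hg : 0 ≤ g)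
    (h : ∀ v, g ^ 2 * nsq v ≤ nsq (A *ᵥ v)) (i : n) : g ≤ |hA.eigenvalues i| := by
  have h1 := h ((hA.eigenvectorUnitary : Matrix n n ℂ) *ᵥ Pi.single i 1)
  rw [nsq_eigen, mulVec_mulVec, hermitian_diag, ← mulVec_mulVec, nsq_eigen] at h1
  have h2 : nsq (Pi.single i 1 : n → ℂ) = 1 := by
    rw [nsq, Finset.sum_eq_single i] <;> simp +contextual
  have h3 : nsq (diagonal (fun i => (hA.eigenvalues i : ℂ)) *ᵥ Pi.single i 1) =
      hA.eigenvalues i ^ 2 := by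
    rw [nsq, Finset.sum_eq_single i]
    · simp
    · intro j _ hj
      simp [hj]
    · simp
  rw [h2, h3, mul_one] at h1
  exact abs_le_abs_of_sq_le_sq' hg h1
where
  abs_le_abs_of_sq_le_sq' {a b : ℝ} (ha : 0 ≤ a) (h : a ^ 2 ≤ b ^ 2) : a ≤ |b| := by
    rw [← abs_of_nonneg ha]; exact sq_le_sq.1 h

private theorem posIdx_le_of_gap {A B : Matrix n n ℂ} (hA : A.IsHermitian) (hB : B.IsHermitian)
    {g η : ℝ} (hη : η < g) (hgA : ∀ i, g ≤ |hA.eigenvalues i|)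
    (hAB : ∀ v, |(star v ⬝ᵥ (A - B) *ᵥ v).re| ≤ η * nsq v) : posIdx hA ≤ posIdx hB := by
  refine posIdx_le hA hB fun c hc0 hc => ?_
  set v := (hA.eigenvectorUnitary : Matrix n n ℂ) *ᵥ c with hv
  have h1 := hAB v
  rw [sub_mulVec, dotProduct_sub, Complex.sub_re, hv, quadForm_eigen hA, ← hv, hv, nsq_eigen, ← hv,
    Complex.ofReal_re] at h1
  have h2 : g * nsq c ≤ ∑ i, hA.eigenvalues i * ‖c i‖ ^ 2 := by
    rw [nsq, Finset.mul_sum]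
    refine Finset.sum_le_sum fun i _ => ?_
    by_cases hi : c i = 0
    · simp [hi]
    · have := hgA i
      rw [abs_of_pos (hc i hi)] at this
      gcongr
  have h3 := (abs_le.1 h1).2
  have h4 := nsq_pos hc0
  nlinarith

theorem matSig_eq_of_gap {A B : Matrix n n ℂ} (hA : A.IsHermitian) (hB : B.IsHermitian)
    {g η : ℝ} (hη0 : 0 ≤ η) (hη : η < g) (hgap : ∀ v, g ^ 2 * nsq v ≤ nsq (A *ᵥ v))
    (hAB : ∀ v, |(star v ⬝ᵥ (A - B) *ᵥ v).re| ≤ η * nsq v) : matSig A = matSig B := by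
  have hg0 : 0 ≤ g := by linarith
  have h1 := posIdx_le_of_gap hA hB hη (le_abs_eigenvalues hA hg0 hgap) hAB
  have h2 := posIdx_le_of_gap hA.neg hB.neg hη (le_abs_eigenvalues hA.neg hg0 (fun v => by
    rw [neg_mulVec, show nsq (-(A *ᵥ v)) = nsq (A *ᵥ v) by simp [nsq]]; exact hgap v)) (fun v => by
    rw [show -A - -B = -(A - B) by abel, neg_mulVec, dotProduct_neg, Complex.neg_re, abs_neg]
    exact hAB v)
  have h3 := posIdx_add_negIdx hA (fun i hi => by
    have := le_abs_eigenvalues hA hg0 hgap i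
    rw [hi, abs_zero] at this
    linarith)
  have h4 := posIdx_add_negIdx_le hB
  have h5 := negIdx_eq_posIdx_neg hA
  have h6 := negIdx_eq_posIdx_neg hB
  rw [matSig_eq_posIdx_sub_negIdx hA, matSig_eq_posIdx_sub_negIdx hB]
  omega

theorem eigenvalues_ne_zero {A : Matrix n n ℂ} (hA : A.IsHermitian)
    (h : ∀ v, A *ᵥ v = 0 → v = 0) (i : n) : hA.eigenvalues i ≠ 0 := by
  intro h0
  have h1 := h ((hA.eigenvectorUnitary : Matrix n n ℂ) *ᵥ Pi.single i 1) (by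
    rw [mulVec_mulVec, hermitian_diag, ← mulVec_mulVec]
    have : diagonal (fun i => (hA.eigenvalues i : ℂ)) *ᵥ (Pi.single i 1 : n → ℂ) = 0 := by
      ext j
      rcases eq_or_ne j i with rfl | hj
      · simp [h0]
      · simp [hj]
    rw [this, mulVec_zero])
  have h2 := nsq_eigen hA (Pi.single i 1)
  rw [h1] at h2
  have h3 : (0:ℝ) < nsq (Pi.single i 1 : n → ℂ) := nsq_pos (by simp)
  have h4 : nsq (0 : n → ℂ) = 0 := by simp [nsq]
  linarith

theorem matSig_eq_two_mul_posIdx {A : Matrix n n ℂ} (hA : A.IsHermitian)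
    (h : ∀ v, A *ᵥ v = 0 → v = 0) : matSig A = 2 * posIdx hA - Fintype.card n := by
  have h3 := posIdx_add_negIdx hA (eigenvalues_ne_zero hA h)
  rw [matSig_eq_posIdx_sub_negIdx hA]
  omega

theorem even_posIdx {A G : Matrix n n ℂ} (hA : A.IsHermitian)
    (hG : G * A.map star = A * G) (hGG : G * G.map star = -1) : Even (posIdx hA) := by
  set U := (hA.eigenvectorUnitary : Matrix n n ℂ) with hU
  have hUU : U * star U = 1 := Unitary.coe_mul_star_self _
  have hUU' : star U * U = 1 := Unitary.coe_star_mul_self _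
  set Λ : Matrix n n ℂ := diagonal (fun i => (hA.eigenvalues i : ℂ)) with hΛ
  have hAU : A * U = U * Λ := hermitian_diag hA
  have cm : ∀ X Y : Matrix n n ℂ, (X * Y).map star = X.map star * Y.map star := fun X Y =>
    Matrix.map_mul (f := starRingEnd ℂ)
  have cΛ : Λ.map star = Λ := by
    rw [hΛ, diagonal_map (by simp)]
    congr 1; ext i; simp
  have c1 : (1 : Matrix n n ℂ).map star = 1 := Matrix.map_one star (by simp) (by simp)
  have cc : ∀ X : Matrix n n ℂ, (X.map star).map star = X := fun X => by ext; simp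
  set K := star U * G * U.map star with hK
  have hKΛ : K * Λ = Λ * K := by
    have h1 : A.map star * U.map star = U.map star * Λ := by rw [← cm, hAU, cm, cΛ]
    have h2 : star U * A = Λ * star U := by
      calc star U * A = star U * A * (U * star U) := by rw [hUU, mul_one]
        _ = star U * (A * U) * star U := by simp only [mul_assoc]
        _ = Λ * star U := by rw [hAU, ← mul_assoc, hUU', one_mul]
    calc K * Λ = star U * G * (U.map star * Λ) := by rw [hK]; simp only [mul_assoc]
      _ = star U * (G * A.map star) * U.map star := by rw [← h1]; simp only [mul_assoc]
      _ = Λ * K := by rw [hG, ← mul_assoc, h2, hK]; simp only [mul_assoc]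
  have hKK : K * K.map star = -1 := by
    have h3 : U.map star * (star U).map star = 1 := by rw [← cm, hUU, c1]
    calc K * K.map star
        = star U * G * (U.map star * (star U).map star) * G.map star * U := by
          rw [hK, cm, cm, cc]; simp only [mul_assoc]
      _ = star U * (G * G.map star) * U := by rw [h3]; simp only [mul_assoc, one_mul]
      _ = -1 := by rw [hGG]; simp [hUU']
  have hK0 : ∀ i j, hA.eigenvalues i ≠ hA.eigenvalues j → K i j = 0 := by
    intro i j hij
    have := congrFun (congrFun hKΛ i) j
    rw [hΛ, mul_diagonal, diagonal_mul, mul_comm] at this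
    have h4 : ((hA.eigenvalues j : ℂ) - hA.eigenvalues i) * K i j = 0 := by linear_combination this
    rcases mul_eq_zero.1 h4 with h5 | h5
    · exact absurd (by exact_mod_cast (sub_eq_zero.1 h5).symm) hij
    · exact h5
  let P := {i // 0 < hA.eigenvalues i}
  let K' : Matrix P P ℂ := K.submatrix Subtype.val Subtype.val
  have hK' : K' * K'.map star = -1 := by
    ext i j
    have h6 := congrFun (congrFun hKK i) j
    rw [mul_apply] at h6 ⊢
    have h8 : ∑ l ∈ Finset.univ.filter (fun l => 0 < hA.eigenvalues l), K i l * (K.map star) l j =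
        ∑ l, K i l * (K.map star) l j := by
      refine Finset.sum_subset (Finset.subset_univ _) fun l _ hl => ?_
      rw [hK0 _ _ (fun h => hl (by simpa using h ▸ i.2)), zero_mul]
    rw [← h8, Finset.sum_subtype _ (p := fun l => 0 < hA.eigenvalues l) (by simp)] at h6
    rw [show (∑ l, K' i l * (K'.map star) l j) =
        ∑ l : P, K i l * (K.map star) l j from rfl, h6]
    rcases eq_or_ne i j with rfl | hij
    · simp
    · simp [one_apply_ne hij, one_apply_ne (Subtype.coe_ne_coe.2 hij)]
  have hdet := congrArg det hK'
  rw [det_mul, det_neg, det_one, mul_one,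
    show (K'.map star).det = star K'.det from ((starRingEnd ℂ).map_det K').symm] at hdet
  by_contra hodd
  rw [Nat.not_even_iff_odd] at hodd
  rw [show Fintype.card P = posIdx hA from rfl, hodd.neg_one_pow] at hdet
  have h7 := congrArg Complex.re hdet
  rw [show star K'.det = (starRingEnd ℂ) K'.det from rfl, Complex.mul_conj] at h7
  have := Complex.normSq_nonneg K'.det
  rw [Complex.ofReal_re] at h7
  simp at h7
  linarith

end Signature

section MeasureOpens

open MeasureTheory Matrix Filter
open scoped Pointwise

section SphereMeasure

/-- The unit sphere of `ℂ^d`. -/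
abbrev Sph (d : ℕ) := Metric.sphere (0 : EuclideanSpace ℂ (Fin d)) 1

/-- Lebesgue measure on `ℂ^d`, as a product measure. -/
noncomputable def lebC (d : ℕ) : Measure (EuclideanSpace ℂ (Fin d)) :=
  (volume : Measure (Fin d → ℂ)).map (EuclideanSpace.equiv (Fin d) ℂ).symm

instance (d : ℕ) : (lebC d).IsAddHaarMeasure :=
  (PiLp.continuousLinearEquiv 2 ℝ (fun _ : Fin d => ℂ)).symm.isAddHaarMeasure_map volume

/-- The (unnormalised) rotation invariant measure on the unit sphere of `ℂ^d`. -/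
noncomputable def sphMeas (d : ℕ) : Measure (Sph d) := (lebC d).toSphere

instance (d : ℕ) : IsFiniteMeasure (sphMeas d) :=
  inferInstanceAs (IsFiniteMeasure (lebC d).toSphere)

theorem integral_lebC {d : ℕ} (f : EuclideanSpace ℂ (Fin d) → ℂ) :
    ∫ x, f x ∂(lebC d) = ∫ x : Fin d → ℂ, f ((EuclideanSpace.equiv (Fin d) ℂ).symm x) := by
  unfold lebC
  exact (EuclideanSpace.equiv (Fin d) ℂ).symm.toHomeomorph.measurableEmbedding.integral_map f

theorem integral_polar {d : ℕ} (f : Sph d → ℂ) (g : ℝ → ℂ) (F : EuclideanSpace ℂ (Fin d) → ℂ)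
    (hF : ∀ (x : Sph d) (r : ℝ), 0 < r → F (r • (x : EuclideanSpace ℂ (Fin d))) = f x * g r)
    (hd : 0 < d) :
    ∫ x, F x ∂(lebC d) =
      (∫ x, f x ∂(sphMeas d)) * ∫ r in Set.Ioi (0 : ℝ), (r : ℂ) ^ (2 * d - 1) * g r := by
  have hdim : Module.finrank ℝ (EuclideanSpace ℂ (Fin d)) = 2 * d := by
    rw [← Module.finrank_mul_finrank ℝ ℂ, finrank_euclideanSpace]
    simp
  have : Nontrivial (EuclideanSpace ℂ (Fin d)) := by
    apply Module.nontrivial_of_finrank_pos (R := ℝ)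
    omega
  calc
    ∫ x, F x ∂(lebC d) = ∫ x : ({(0)}ᶜ : Set (EuclideanSpace ℂ (Fin d))), F x
        ∂((lebC d).comap (↑)) := by
      rw [integral_subtype_comap (measurableSet_singleton _).compl fun x ↦ F x,
        restrict_compl_singleton]
    _ = ∫ p : Sph d × Set.Ioi (0 : ℝ), f p.1 * g p.2
        ∂(lebC d).toSphere.prod (.volumeIoiPow (2 * d - 1)) := by
      rw [← hdim, ← (lebC d).measurePreserving_homeomorphUnitSphereProd.integral_comp
        (Homeomorph.measurableEmbedding _)]
      refine integral_congr_ae (Filter.Eventually.of_forall fun x => ?_)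
      have h1 := hF (homeomorphUnitSphereProd _ x).1 (homeomorphUnitSphereProd _ x).2
        (homeomorphUnitSphereProd _ x).2.2
      refine Eq.trans ?_ h1
      have h2 := (homeomorphUnitSphereProd (EuclideanSpace ℂ (Fin d))).symm_apply_apply x
      conv_lhs => rw [← h2]
      rfl
    _ = (∫ x, f x ∂(sphMeas d)) * ∫ r : Set.Ioi (0 : ℝ), g r ∂(.volumeIoiPow (2 * d - 1)) :=
      integral_prod_mul f (fun r : Set.Ioi (0:ℝ) => g r)
    _ = _ := by
      congr 1
      simp only [Measure.volumeIoiPow, ENNReal.ofReal]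
      rw [integral_withDensity_eq_integral_smul,
        integral_subtype_comap measurableSet_Ioi
          fun a ↦ Real.toNNReal (a ^ (2 * d - 1)) • g a,
        setIntegral_congr_fun measurableSet_Ioi fun x hx ↦ ?_]
      · rw [NNReal.smul_def, Real.coe_toNNReal _ (pow_nonneg hx.out.le _), Complex.real_smul]
        push_cast; rfl
      · exact (measurable_subtype_coe.pow_const _).real_toNNReal

/-- The monomial `x^α` as a function on `ℂ^d`. -/
def cmono {d : ℕ} (α : Fin d → ℕ) (x : Fin d → ℂ) : ℂ := ∏ j, x j ^ α j

/-- The squared norm of a monomial in `L²` of the sphere. -/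
noncomputable def monoNorm {d : ℕ} (α : Fin d → ℕ) : ℝ :=
  ∫ x : Sph d, ‖cmono α (x : EuclideanSpace ℂ (Fin d))‖ ^ 2 ∂(sphMeas d)

theorem monoNorm_mul_Gamma {d : ℕ} (hd : 0 < d) (α : Fin d → ℕ) :
    monoNorm α * (Real.Gamma ((∑ j, α j : ℕ) + d) / 2) =
      ∏ j, (Real.pi * (Nat.factorial (α j) : ℝ)) := by
  have h1 := integral_polar (d := d) (fun x => ((‖cmono α (x : EuclideanSpace ℂ (Fin d))‖ ^ 2 : ℝ) : ℂ))
    (fun r => ((r ^ (2 * ∑ j, α j) * Real.exp (-r ^ 2) : ℝ) : ℂ))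
    (fun x => ((∏ j, (‖x j‖ ^ (2 * α j) * Real.exp (-‖x j‖ ^ 2)) : ℝ) : ℂ)) (by
      intro x r hr
      norm_cast
      have hx : ∑ j, ‖(x : EuclideanSpace ℂ (Fin d)) j‖ ^ 2 = 1 := by
        have := x.2
        rw [mem_sphere_zero_iff_norm, EuclideanSpace.norm_eq] at this
        simpa using this
      rw [Finset.prod_mul_distrib, ← Real.exp_sum]
      have e1 : ∑ j, -‖(r • (x : EuclideanSpace ℂ (Fin d))) j‖ ^ 2 = - r ^ 2 := by
        simp only [PiLp.smul_apply, norm_smul, mul_pow, Finset.sum_neg_distrib, ← Finset.mul_sum, hx]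
        simp
      have e2 : ∏ j, ‖(r • (x : EuclideanSpace ℂ (Fin d))) j‖ ^ (2 * α j) =
          r ^ (2 * ∑ j, α j) * ‖cmono α (x : EuclideanSpace ℂ (Fin d))‖ ^ 2 := by
        simp only [PiLp.smul_apply, norm_smul, mul_pow, Finset.prod_mul_distrib, cmono, norm_prod,
          norm_pow, ← Finset.prod_pow, Finset.prod_pow_eq_pow_sum, ← Finset.mul_sum]
        rw [Real.norm_of_nonneg hr.le]
        congr 1
        refine Finset.prod_congr rfl fun j _ => ?_
        ring
      rw [e1, e2]; ring) hd
  rw [integral_lebC] at h1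
  have h2 : ∫ x : Fin d → ℂ, ((∏ j, (‖((EuclideanSpace.equiv (Fin d) ℂ).symm x) j‖ ^ (2 * α j) *
      Real.exp (-‖((EuclideanSpace.equiv (Fin d) ℂ).symm x) j‖ ^ 2)) : ℝ) : ℂ) =
      ((∏ j, (Real.pi * (Nat.factorial (α j) : ℝ)) : ℝ) : ℂ) := by
    rw [integral_complex_ofReal]
    congr 1
    refine (integral_fintype_prod_volume_eq_prod (fun (j : Fin d) (z : ℂ) =>
      ‖z‖ ^ (2 * α j) * Real.exp (-‖z‖ ^ 2))).trans ?_
    refine Finset.prod_congr rfl fun j _ => ?_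
    have := Complex.integral_rpow_mul_exp_neg_rpow (p := 2) (q := (2 * α j : ℕ)) (by norm_num)
      (by have : (0:ℝ) ≤ (2 * α j : ℕ) := by positivity
          linarith)
    have e3 : (((2 * α j : ℕ) : ℝ) + 2) / 2 = (α j : ℝ) + 1 := by push_cast; ring
    rw [e3, Real.Gamma_nat_eq_factorial] at this
    simp only [Real.rpow_natCast, Real.rpow_two] at this
    rw [this]; ring
  have h3 : ∫ r in Set.Ioi (0 : ℝ), (r : ℂ) ^ (2 * d - 1) *
      ((r ^ (2 * ∑ j, α j) * Real.exp (-r ^ 2) : ℝ) : ℂ) =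
      ((Real.Gamma ((∑ j, α j : ℕ) + d) / 2 : ℝ) : ℂ) := by
    have := integral_rpow_mul_exp_neg_rpow (p := 2) (q := ((2 * d - 1 + 2 * ∑ j, α j : ℕ) : ℝ))
      (by norm_num) (by
        have : (0:ℝ) ≤ ((2 * d - 1 + 2 * ∑ j, α j : ℕ) : ℝ) := by positivity
        linarith)
    have e3 : (((2 * d - 1 + 2 * ∑ j, α j : ℕ) : ℝ) + 1) / 2 = ((∑ j, α j : ℕ) : ℝ) + d := by
      rw [div_eq_iff (by norm_num)]
      norm_cast
      omega
    rw [e3] at this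
    simp only [Real.rpow_natCast, Real.rpow_two] at this
    rw [show Real.Gamma ((∑ j, α j : ℕ) + d) / 2 = 1 / 2 * Real.Gamma ((∑ j, α j : ℕ) + d) by ring,
      ← this, ← integral_complex_ofReal]
    congr 1
    ext r
    push_cast
    rw [pow_add]; ring
  rw [h2, h3, integral_complex_ofReal] at h1
  exact_mod_cast h1.symm

theorem monoNorm_pos {d : ℕ} (hd : 0 < d) (α : Fin d → ℕ) : 0 < monoNorm α := by
  have h := monoNorm_mul_Gamma hd α
  have h1 : (0:ℝ) < ∏ j, (Real.pi * (Nat.factorial (α j) : ℝ)) :=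
    Finset.prod_pos fun j _ => by have := Real.pi_pos; positivity
  have hd' : (0:ℝ) < d := by exact_mod_cast hd
  have h2 : 0 < Real.Gamma ((∑ j, α j : ℕ) + d) / 2 := by
    have := Real.Gamma_pos_of_pos (s := (∑ j, α j : ℕ) + d) (by positivity)
    positivity
  rw [← h] at h1
  exact pos_of_mul_pos_left h1 h2.le

theorem monoNorm_succ {d : ℕ} (hd : 0 < d) (α : Fin d → ℕ) (j : Fin d) :
    monoNorm (α + Pi.single j 1) * ((∑ j, α j : ℕ) + d) = (α j + 1) * monoNorm α := by
  have h := monoNorm_mul_Gamma hd α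
  have h' := monoNorm_mul_Gamma hd (α + Pi.single j 1)
  have hd' : (0:ℝ) < d := by exact_mod_cast hd
  have e1 : ∑ i, (α + Pi.single j 1 : Fin d → ℕ) i = ∑ i, α i + 1 := by
    simp [Finset.sum_add_distrib]
  have e2 : ∏ i, (Real.pi * (Nat.factorial ((α + Pi.single j 1 : Fin d → ℕ) i) : ℝ)) =
      (α j + 1) * ∏ i, (Real.pi * (Nat.factorial (α i) : ℝ)) := by
    rw [← Finset.mul_prod_erase _ _ (Finset.mem_univ j),
      ← Finset.mul_prod_erase (s := Finset.univ) (f := fun i => Real.pi * (Nat.factorial (α i) : ℝ))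
        (h := Finset.mem_univ j)]
    rw [Finset.prod_congr rfl (g := fun i => Real.pi * (Nat.factorial (α i) : ℝ))]
    · simp [Nat.factorial_succ]; ring
    · intro i hi
      simp [Pi.single_eq_of_ne (Finset.ne_of_mem_erase hi)]
  rw [e1, e2, ← h] at h'
  have e3 : (((∑ i, α i + 1 : ℕ) : ℝ) + d) = (((∑ i, α i : ℕ) : ℝ) + d) + 1 := by push_cast; ring
  have hs : (0:ℝ) < ((∑ i, α i : ℕ) : ℝ) + d := by positivity
  rw [e3, Real.Gamma_add_one hs.ne'] at h'
  have h2 := Real.Gamma_pos_of_pos hs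
  have h3 : (monoNorm (α + Pi.single j 1) * ((∑ j, α j : ℕ) + d) - (α j + 1) * monoNorm α) *
    Real.Gamma ((∑ i, α i : ℕ) + d) = 0 := by linear_combination 2 * h'
  rcases mul_eq_zero.1 h3 with h4 | h4
  · linarith
  · exact absurd h4 h2.ne'

/-- The action of the torus on the sphere. -/
noncomputable def torusAct {d : ℕ} (t : Fin d → Circle) : Sph d ≃ₜ Sph d where
  toFun x := ⟨WithLp.toLp 2 fun j => (t j : ℂ) * (x : EuclideanSpace ℂ (Fin d)) j, by
    have := x.2
    rw [mem_sphere_zero_iff_norm, EuclideanSpace.norm_eq] at this ⊢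
    simpa [norm_mul, Circle.norm_coe] using this⟩
  invFun x := ⟨WithLp.toLp 2 fun j => ((t j)⁻¹ : ℂ) * (x : EuclideanSpace ℂ (Fin d)) j, by
    have := x.2
    rw [mem_sphere_zero_iff_norm, EuclideanSpace.norm_eq] at this ⊢
    simpa [norm_mul, Circle.norm_coe] using this⟩
  left_inv x := by ext j; simp
  right_inv x := by ext j; simp
  continuous_toFun := by fun_prop
  continuous_invFun := by fun_prop

theorem torusAct_apply {d : ℕ} (t : Fin d → Circle) (x : Sph d) (j : Fin d) :
    (torusAct t x : EuclideanSpace ℂ (Fin d)) j = t j * (x : EuclideanSpace ℂ (Fin d)) j := rfl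

theorem measurePreserving_equiv_lebC {d : ℕ} {T : (Fin d → ℂ) → Fin d → ℂ}
    (h1 : MeasurePreserving T volume volume) :
    MeasurePreserving (fun x : EuclideanSpace ℂ (Fin d) => WithLp.toLp 2 (T x.ofLp))
      (lebC d) (lebC d) := by
  have h2 : MeasurePreserving (EuclideanSpace.equiv (Fin d) ℂ).symm volume (lebC d) :=
    ⟨(EuclideanSpace.equiv (Fin d) ℂ).symm.continuous.measurable, rfl⟩
  have h3 : MeasurePreserving (EuclideanSpace.equiv (Fin d) ℂ) (lebC d) volume := by
    refine ⟨(EuclideanSpace.equiv (Fin d) ℂ).continuous.measurable, ?_⟩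
    unfold lebC
    rw [Measure.map_map (EuclideanSpace.equiv (Fin d) ℂ).continuous.measurable
      (EuclideanSpace.equiv (Fin d) ℂ).symm.continuous.measurable]
    have : (EuclideanSpace.equiv (Fin d) ℂ) ∘ (EuclideanSpace.equiv (Fin d) ℂ).symm = id := by
      ext x; simp
    rw [this]
    exact Measure.map_id
  exact h2.comp (h1.comp h3)

/-- A homeomorphism of the sphere is measure preserving if its radial extension is. -/
theorem measurePreserving_of_radial {d : ℕ} (φ : Sph d ≃ₜ Sph d)
    {T : EuclideanSpace ℂ (Fin d) → EuclideanSpace ℂ (Fin d)}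
    (hT : MeasurePreserving T (lebC d) (lebC d)) (hinj : Function.Injective T)
    (hrad : ∀ (r : ℝ) (x : Sph d), T (r • (x : EuclideanSpace ℂ (Fin d))) = r • (φ x : _)) :
    MeasurePreserving φ (sphMeas d) (sphMeas d) := by
  refine ⟨φ.continuous.measurable, ?_⟩
  ext s hs
  rw [Measure.map_apply φ.continuous.measurable hs, sphMeas, Measure.toSphere_apply' _ hs,
    Measure.toSphere_apply' _ (φ.continuous.measurable hs)]
  congr 1
  have hm : MeasurableSet (Set.Ioo (0:ℝ) 1 • ((↑) '' s : Set (EuclideanSpace ℂ (Fin d)))) := by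
    have h1 : (Set.Ioo (0:ℝ) 1 • ((↑) '' s : Set (EuclideanSpace ℂ (Fin d)))) =
      ((↑) '' (homeomorphUnitSphereProd (EuclideanSpace ℂ (Fin d)) ⁻¹'
        s ×ˢ Set.Iio (⟨1, Set.mem_Ioi.2 one_pos⟩ : Set.Ioi (0:ℝ)))) := by
      rw [← Set.image2_smul, Set.image2_image_right, ← Homeomorph.image_symm, Set.image_image]
      ext x
      simp only [Set.mem_image2, Set.mem_image, Set.mem_prod, Prod.exists]
      constructor
      · rintro ⟨r, hr, y, hy, rfl⟩
        exact ⟨y, ⟨r, hr.1⟩, ⟨hy, hr.2⟩, rfl⟩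
      · rintro ⟨y, r, ⟨hy, hr⟩, rfl⟩
        exact ⟨r, ⟨r.2, hr⟩, y, hy, rfl⟩
    rw [h1]
    refine (MeasurableEmbedding.subtype_coe (measurableSet_singleton _).compl).measurableSet_image.2 ?_
    exact (Homeomorph.measurable _) (hs.prod measurableSet_Iio)
  rw [← hT.measure_preimage hm.nullMeasurableSet]
  congr 1
  ext x
  simp only [Set.mem_preimage, Set.mem_smul, Set.mem_image]
  constructor
  · rintro ⟨r, hr, _, ⟨y, hy, rfl⟩, rfl⟩
    exact ⟨r, hr, _, ⟨_, hy, rfl⟩, (hrad r y).symm⟩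
  · rintro ⟨r, hr, _, ⟨y, hy, rfl⟩, h⟩
    refine ⟨r, hr, _, ⟨φ.symm y, by simpa using hy, rfl⟩, hinj ?_⟩
    change T (r • _) = _
    rw [hrad, Homeomorph.apply_symm_apply]
    exact h

theorem measurePreserving_torusAct {d : ℕ} (t : Fin d → Circle) :
    MeasurePreserving (torusAct t) (sphMeas d) (sphMeas d) := by
  refine measurePreserving_of_radial _ (measurePreserving_equiv_lebC
    (T := fun x j => (t j : ℂ) * x j) (volume_preserving_pi (f := fun j z => (t j : ℂ) * z)
        fun j => (rotation (t j)).measurePreserving)) (fun x y h => ?_) fun r x => ?_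
  · ext j
    have := congrArg (fun v : EuclideanSpace ℂ (Fin d) => v j) h
    exact mul_left_cancel₀ (Circle.coe_ne_zero (t j)) this
  · ext j
    simp [torusAct_apply]
    ring

/-- Complex conjugation of the coordinates on the sphere. -/
noncomputable def conjS {d : ℕ} : Sph d ≃ₜ Sph d where
  toFun x := ⟨WithLp.toLp 2 fun j => star ((x : EuclideanSpace ℂ (Fin d)) j), by
    have := x.2
    rw [mem_sphere_zero_iff_norm, EuclideanSpace.norm_eq] at this ⊢
    simpa using this⟩
  invFun x := ⟨WithLp.toLp 2 fun j => star ((x : EuclideanSpace ℂ (Fin d)) j), by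
    have := x.2
    rw [mem_sphere_zero_iff_norm, EuclideanSpace.norm_eq] at this ⊢
    simpa using this⟩
  left_inv x := by ext j; simp
  right_inv x := by ext j; simp
  continuous_toFun := by fun_prop
  continuous_invFun := by fun_prop

theorem conjS_apply {d : ℕ} (x : Sph d) (j : Fin d) :
    (conjS x : EuclideanSpace ℂ (Fin d)) j = star ((x : EuclideanSpace ℂ (Fin d)) j) := rfl

theorem conjS_conjS {d : ℕ} (x : Sph d) : conjS (conjS x) = x := conjS.left_inv x

theorem measurePreserving_conjS {d : ℕ} :
    MeasurePreserving (conjS (d := d)) (sphMeas d) (sphMeas d) := by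
  refine measurePreserving_of_radial _ (measurePreserving_equiv_lebC
    (T := fun x j => star (x j)) (volume_preserving_pi (f := fun j z => star z)
        fun j => Complex.conjLIE.measurePreserving)) (fun x y h => ?_) fun r x => ?_
  · ext j
    have := congrArg (fun v : EuclideanSpace ℂ (Fin d) => v j) h
    exact star_injective this
  · ext j
    simp [conjS_apply]

end SphereMeasure

section ProductSphere

variable {σ : Type*} [Fintype σ] [DecidableEq σ] {d : ℕ}

/-- The product measure on a product of spheres. -/
noncomputable def prodMeas (σ : Type*) [Fintype σ] (d : ℕ) : Measure (σ → Sph d) :=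
  Measure.pi fun _ : σ => sphMeas d

instance : IsFiniteMeasure (prodMeas σ d) := by
  unfold prodMeas; infer_instance

/-- The action of a product of tori on a product of spheres. -/
noncomputable def torusActPi (t : σ → Fin d → Circle) : (σ → Sph d) ≃ₜ (σ → Sph d) :=
  Homeomorph.piCongrRight fun s => torusAct (t s)

theorem torusActPi_apply (t : σ → Fin d → Circle) (x : σ → Sph d) (s : σ) :
    torusActPi t x s = torusAct (t s) (x s) := rfl

theorem measurePreserving_torusActPi (t : σ → Fin d → Circle) :
    MeasurePreserving (torusActPi t) (prodMeas σ d) (prodMeas σ d) :=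
  measurePreserving_pi _ _ fun s => measurePreserving_torusAct (t s)

theorem integral_eq_zero_of_torus {φ : (σ → Sph d) → ℂ} (t : σ → Fin d → Circle) {χ : ℂ}
    (hχ : χ ≠ 1) (h : ∀ x, φ (torusActPi t x) = χ * φ x) : ∫ x, φ x ∂(prodMeas σ d) = 0 := by
  have h1 := (measurePreserving_torusActPi t).integral_comp
    (torusActPi t).measurableEmbedding φ
  simp only [h, integral_const_mul] at h1
  have h2 : (χ - 1) * ∫ x, φ x ∂(prodMeas σ d) = 0 := by rw [sub_mul, h1]; ring
  exact (mul_eq_zero.mp h2).resolve_left (sub_ne_zero.mpr hχ)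

/-- The coordinate functions on a product of spheres. -/
noncomputable def coordP (s : σ) (j : Fin d) : C(σ → Sph d, ℂ) :=
  ⟨fun x => (x s : EuclideanSpace ℂ (Fin d)) j, by fun_prop⟩

theorem coordP_apply (s : σ) (j : Fin d) (x : σ → Sph d) :
    coordP s j x = (x s : EuclideanSpace ℂ (Fin d)) j := rfl

/-- The monomials on a product of spheres. -/
noncomputable def monoP (γ : σ → Fin d → ℕ) : C(σ → Sph d, ℂ) :=
  ∏ s, ∏ j, coordP s j ^ γ s j

theorem monoP_apply (γ : σ → Fin d → ℕ) (x : σ → Sph d) :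
    monoP γ x = ∏ s, ∏ j, (x s : EuclideanSpace ℂ (Fin d)) j ^ γ s j := by
  simp [monoP, coordP_apply, ContinuousMap.prod_apply]

theorem monoP_add (γ γ' : σ → Fin d → ℕ) : monoP (γ + γ') = monoP γ * monoP γ' := by
  simp [monoP, pow_add, Finset.prod_mul_distrib]

theorem monoP_single (s : σ) (j : Fin d) :
    monoP (Pi.single s (Pi.single j 1)) = coordP s j := by
  unfold monoP
  rw [Finset.prod_eq_single s, Finset.prod_eq_single j]
  · simp
  · intro i _ hi; simp [hi]
  · simp
  · intro i _ hi; simp [hi]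
  · simp

theorem monoP_torus (γ : σ → Fin d → ℕ) (t : σ → Fin d → Circle) (x : σ → Sph d) :
    monoP γ (torusActPi t x) = (∏ s, ∏ j, (t s j : ℂ) ^ γ s j) * monoP γ x := by
  simp only [monoP_apply, torusActPi_apply, torusAct_apply, mul_pow, Finset.prod_mul_distrib]

/-- The squared norm of a monomial. -/
noncomputable def monoPNorm (γ : σ → Fin d → ℕ) : ℝ := ∏ s, monoNorm (γ s)

theorem monoPNorm_pos (hd : 0 < d) (γ : σ → Fin d → ℕ) : 0 < monoPNorm γ :=
  Finset.prod_pos fun s _ => monoNorm_pos hd (γ s)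

theorem monoPNorm_succ (hd : 0 < d) (γ : σ → Fin d → ℕ) (s : σ) (j : Fin d) :
    monoPNorm (γ + Pi.single s (Pi.single j 1)) * ((∑ i, γ s i : ℕ) + d) =
      (γ s j + 1) * monoPNorm γ := by
  unfold monoPNorm
  rw [← Finset.mul_prod_erase _ _ (Finset.mem_univ s), ← Finset.mul_prod_erase _ _
    (Finset.mem_univ s), mul_right_comm, ← mul_assoc (_ + 1 : ℝ), ← monoNorm_succ hd]
  congr 1
  · simp
  · apply Finset.prod_congr rfl
    intro i hi
    rw [Finset.mem_erase] at hi
    simp [hi.1]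

/-- A circle element distinguishing two exponents. -/
theorem exists_circle_pow_ne {p q : ℕ} (h : p ≠ q) : ∃ z : Circle, (z : ℂ) ^ p ≠ (z : ℂ) ^ q := by
  wlog hpq : p < q generalizing p q
  · obtain ⟨z, hz⟩ := this h.symm (by omega)
    exact ⟨z, hz.symm⟩
  obtain ⟨k, rfl⟩ := Nat.exists_eq_add_of_lt hpq
  refine ⟨Circle.exp (Real.pi / (k + 1)), fun hz => ?_⟩
  rw [add_assoc, pow_add] at hz
  have h0 : ((Circle.exp (Real.pi / (k + 1)) : Circle) : ℂ) ^ p ≠ 0 := by simp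
  have h1 : ((Circle.exp (Real.pi / (k + 1)) : Circle) : ℂ) ^ (k + 1) = -1 := by
    rw [← Circle.coe_pow, ← Circle.exp_natCast_mul, Circle.coe_exp]
    push_cast
    rw [mul_div_cancel₀ _ (by exact_mod_cast Nat.succ_ne_zero k)]
    exact Complex.exp_pi_mul_I
  rw [h1] at hz
  apply h0
  linear_combination hz / 2

theorem integral_star_monoP_mul (γ γ' : σ → Fin d → ℕ) :
    ∫ x, star (monoP γ x) * monoP γ' x ∂(prodMeas σ d) =
      if γ = γ' then (monoPNorm γ : ℂ) else 0 := by
  split_ifs with h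
  · subst h
    have : ∀ x : σ → Sph d, star (monoP γ x) * monoP γ x =
        ((∏ s, ‖cmono (γ s) (x s : EuclideanSpace ℂ (Fin d))‖ ^ 2 : ℝ) : ℂ) := by
      intro x
      rw [monoP_apply, Finset.prod_pow, ← norm_prod]
      rw [show star (∏ s, ∏ j, (x s : EuclideanSpace ℂ (Fin d)) j ^ γ s j) =
        starRingEnd ℂ (∏ s, ∏ j, (x s : EuclideanSpace ℂ (Fin d)) j ^ γ s j) from rfl,
        Complex.conj_mul']
      push_cast
      rfl
    simp only [this]
    rw [integral_complex_ofReal, prodMeas, integral_fintype_prod_eq_prod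
      (fun s (y : Sph d) => ‖cmono (γ s) (y : EuclideanSpace ℂ (Fin d))‖ ^ 2)]
    rfl
  · obtain ⟨s, hs⟩ := Function.ne_iff.mp h
    obtain ⟨j, hj⟩ := Function.ne_iff.mp hs
    obtain ⟨z, hz⟩ := exists_circle_pow_ne hj
    let t : σ → Fin d → Circle := Pi.mulSingle s (Pi.mulSingle j z)
    have ht : ∀ η : σ → Fin d → ℕ, (∏ s, ∏ j, (t s j : ℂ) ^ η s j) = (z : ℂ) ^ η s j := by
      intro η
      rw [Finset.prod_eq_single s, Finset.prod_eq_single j]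
      · simp [t]
      · intro i _ hi; simp [hi, t]
      · simp
      · intro i _ hi; simp [hi, t]
      · simp
    refine integral_eq_zero_of_torus t (χ := star ((z : ℂ) ^ γ s j) * (z : ℂ) ^ γ' s j) ?_ ?_
    · intro h1
      apply hz
      have h2 : star ((z : ℂ) ^ γ s j) * (z : ℂ) ^ γ s j = 1 := by
        rw [show star ((z : ℂ) ^ γ s j) = starRingEnd ℂ ((z : ℂ) ^ γ s j) from rfl,
          Complex.conj_mul']
        simp [Circle.norm_coe]
      have h3 : star ((z : ℂ) ^ γ s j) ≠ 0 := left_ne_zero_of_mul_eq_one h2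
      exact mul_left_cancel₀ h3 (h2.trans h1.symm)
    · intro x
      rw [monoP_torus, monoP_torus, ht, ht, star_mul']
      ring

/-- Multiplication of each point by a scalar of modulus one. -/
noncomputable def scalP (l : σ → Circle) : (σ → Sph d) ≃ₜ (σ → Sph d) :=
  torusActPi fun s _ => l s

theorem monoP_scal (γ : σ → Fin d → ℕ) (l : σ → Circle) (x : σ → Sph d) :
    monoP γ (scalP l x) = (∏ s, (l s : ℂ) ^ ∑ j, γ s j) * monoP γ x := by
  rw [scalP, monoP_torus]
  simp only [Finset.prod_pow_eq_pow_sum]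

/-- Mismatched weights give vanishing matrix coefficients. -/
theorem integral_star_monoP_mul_eq_zero (γ γ' : σ → Fin d → ℕ) (p q : σ → ℕ)
    (φ : (σ → Sph d) → ℂ)
    (hφ : ∀ (l : σ → Circle) x,
      (∏ s, (l s : ℂ) ^ q s) * φ (scalP l x) = (∏ s, (l s : ℂ) ^ p s) * φ x)
    (h : ∃ s, ∑ j, γ s j + q s ≠ ∑ j, γ' s j + p s) :
    ∫ x, star (monoP γ x) * (φ x * monoP γ' x) ∂(prodMeas σ d) = 0 := by
  obtain ⟨s, hs⟩ := h
  obtain ⟨z, hz⟩ := exists_circle_pow_ne hs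
  let l : σ → Circle := Pi.mulSingle s z
  have hl : ∀ η : σ → ℕ, (∏ s, (l s : ℂ) ^ η s) = (z : ℂ) ^ η s := by
    intro η
    rw [Finset.prod_eq_single s]
    · simp [l]
    · intro i _ hi; simp [hi, l]
    · simp
  have hz0 : (z : ℂ) ≠ 0 := by simp
  have hzz : star (z : ℂ) * z = 1 := by
    rw [show star (z : ℂ) = starRingEnd ℂ (z : ℂ) from rfl, Complex.conj_mul']
    simp [Circle.norm_coe]
  have hstar : star (z : ℂ) = (z : ℂ)⁻¹ := eq_inv_of_mul_eq_one_left hzz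
  refine integral_eq_zero_of_torus (fun s _ => l s)
    (χ := ((z : ℂ) ^ (∑ j, γ s j + q s))⁻¹ * (z : ℂ) ^ (∑ j, γ' s j + p s)) ?_ ?_
  · intro h1
    apply hz
    have := mul_left_cancel₀ (inv_ne_zero (pow_ne_zero _ hz0))
      (h1.trans (inv_mul_cancel₀ (pow_ne_zero (∑ j, γ s j + q s) hz0)).symm)
    exact this.symm
  · intro x
    have h1 := hφ l x
    rw [hl, hl] at h1
    have h2 : φ (scalP l x) = ((z : ℂ) ^ q s)⁻¹ * ((z : ℂ) ^ p s * φ x) := by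
      rw [← h1, inv_mul_cancel_left₀ (pow_ne_zero _ hz0)]
    change star (monoP γ (scalP l x)) * (φ (scalP l x) * monoP γ' (scalP l x)) = _
    rw [monoP_scal, monoP_scal, hl (fun s => ∑ j, γ s j), hl (fun s => ∑ j, γ' s j), h2, star_mul',
      star_pow, hstar, pow_add, pow_add, mul_inv, inv_pow]
    ring

end ProductSphere

section Approximation

theorem norm_sq_sum_of_orthogonal {H ι : Type*} [NormedAddCommGroup H] [InnerProductSpace ℂ H]
    [DecidableEq ι] (s : Finset ι) (v : ι → H) (h : ∀ i j, i ≠ j → inner ℂ (v i) (v j) = 0) :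
    ‖∑ i ∈ s, v i‖ ^ 2 = ∑ i ∈ s, ‖v i‖ ^ 2 := by
  have h1 : inner ℂ (∑ i ∈ s, v i) (∑ i ∈ s, v i) = ∑ i ∈ s, inner ℂ (v i) (v i) := by
    rw [sum_inner]
    refine Finset.sum_congr rfl fun i hi => ?_
    rw [inner_sum, Finset.sum_eq_single_of_mem i hi]
    intro j _ hj
    exact h i j hj.symm
  simp only [inner_self_eq_norm_sq_to_K] at h1
  exact_mod_cast h1

variable {σ : Type*} [Fintype σ] [DecidableEq σ] {d : ℕ}

/-- A continuous function on a product of spheres as an element of `L²`. -/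
noncomputable def toL2 (f : C(σ → Sph d, ℂ)) : Lp ℂ 2 (prodMeas σ d) :=
  ContinuousMap.toLp 2 (prodMeas σ d) ℂ f

theorem toL2_add (f g : C(σ → Sph d, ℂ)) : toL2 (f + g) = toL2 f + toL2 g := map_add _ _ _

theorem toL2_sub (f g : C(σ → Sph d, ℂ)) : toL2 (f - g) = toL2 f - toL2 g := map_sub _ _ _

theorem toL2_smul (c : ℂ) (f : C(σ → Sph d, ℂ)) : toL2 (c • f) = c • toL2 f := map_smul _ _ _

theorem toL2_zero : toL2 (0 : C(σ → Sph d, ℂ)) = 0 := map_zero _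

theorem toL2_sum {ι : Type*} (s : Finset ι) (f : ι → C(σ → Sph d, ℂ)) :
    toL2 (∑ i ∈ s, f i) = ∑ i ∈ s, toL2 (f i) := map_sum _ _ _

theorem inner_toL2 (f g : C(σ → Sph d, ℂ)) :
    inner ℂ (toL2 f) (toL2 g) = ∫ x, star (f x) * g x ∂(prodMeas σ d) := by
  unfold toL2
  rw [ContinuousMap.inner_toLp]
  simp only [mul_comm, starRingEnd_apply]

theorem inner_self_toL2 (f : C(σ → Sph d, ℂ)) :
    inner ℂ (toL2 f) (toL2 f) = ((‖toL2 f‖ ^ 2 : ℝ) : ℂ) := by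
  rw [inner_self_eq_norm_sq_to_K]; push_cast; rfl

theorem norm_toL2_sq (f : C(σ → Sph d, ℂ)) :
    ‖toL2 f‖ ^ 2 = ∫ x, ‖f x‖ ^ 2 ∂(prodMeas σ d) := by
  have h := inner_self_toL2 f
  rw [inner_toL2] at h
  have h1 : ∀ x, star (f x) * f x = ((‖f x‖ ^ 2 : ℝ) : ℂ) := by
    intro x
    rw [show star (f x) = starRingEnd ℂ (f x) from rfl, Complex.conj_mul']
    push_cast; rfl
  simp only [h1] at h
  rw [integral_complex_ofReal] at h
  symm
  exact Complex.ofReal_injective h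

theorem integrable_of_continuous {E : Type*} [NormedAddCommGroup E] {f : (σ → Sph d) → E}
    [SecondCountableTopologyEither (σ → Sph d) E] (hf : Continuous f) :
    Integrable f (prodMeas σ d) :=
  hf.integrable_of_hasCompactSupport (HasCompactSupport.of_compactSpace f)

theorem norm_toL2_le {f g : C(σ → Sph d, ℂ)} {C : ℝ} (hC : 0 ≤ C)
    (h : ∀ x, ‖f x‖ ≤ C * ‖g x‖) : ‖toL2 f‖ ≤ C * ‖toL2 g‖ := by
  refine abs_le_of_sq_le_sq' ?_ (by positivity) |>.2
  rw [mul_pow, norm_toL2_sq, norm_toL2_sq, ← integral_const_mul]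
  refine integral_mono (integrable_of_continuous (by fun_prop))
    (integrable_of_continuous (by fun_prop)) fun x => ?_
  simp only
  rw [← mul_pow]
  gcongr
  exact h x

theorem norm_toL2_mul_le (φ f : C(σ → Sph d, ℂ)) : ‖toL2 (φ * f)‖ ≤ ‖φ‖ * ‖toL2 f‖ :=
  norm_toL2_le (norm_nonneg _) fun x => by
    rw [ContinuousMap.mul_apply, norm_mul]
    gcongr
    exact φ.norm_coe_le_norm x

theorem inner_toL2_monoP (γ γ' : σ → Fin d → ℕ) :
    inner ℂ (toL2 (monoP γ)) (toL2 (monoP γ')) = if γ = γ' then (monoPNorm γ : ℂ) else 0 := by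
  rw [inner_toL2, integral_star_monoP_mul]

/-- The span of the monomials all of whose degrees are at least `M`. -/
noncomputable def highDeg (σ : Type*) [Fintype σ] (d M : ℕ) : Submodule ℂ C(σ → Sph d, ℂ) :=
  Submodule.span ℂ (monoP '' {γ | ∀ s, M ≤ ∑ j, γ s j})

theorem highDeg_mono {M M' : ℕ} (h : M ≤ M') : highDeg σ d M' ≤ highDeg σ d M :=
  Submodule.span_mono (Set.image_mono fun _ hγ s => h.trans (hγ s))

/-- Functions whose multiplication operator asymptotically preserves holomorphic polynomials. -/
def IsAppr (φ : C(σ → Sph d, ℂ)) : Prop :=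
  ∀ ε > 0, ∀ M, ∃ M0, ∀ v ∈ highDeg σ d M0, ∃ w ∈ highDeg σ d M,
    ‖toL2 (φ * v - w)‖ ≤ ε * ‖toL2 v‖

theorem isAppr_algebraMap (c : ℂ) : IsAppr (algebraMap ℂ C(σ → Sph d, ℂ) c) := by
  intro ε hε M
  refine ⟨M, fun v hv => ⟨c • v, Submodule.smul_mem _ _ hv, ?_⟩⟩
  rw [← Algebra.smul_def, sub_self]
  simp only [toL2, map_zero, norm_zero]
  positivity

theorem IsAppr.add {φ ψ : C(σ → Sph d, ℂ)} (hφ : IsAppr φ) (hψ : IsAppr ψ) : IsAppr (φ + ψ) := by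
  intro ε hε M
  obtain ⟨M1, h1⟩ := hφ (ε / 2) (by positivity) M
  obtain ⟨M2, h2⟩ := hψ (ε / 2) (by positivity) M
  refine ⟨max M1 M2, fun v hv => ?_⟩
  obtain ⟨w1, hw1, e1⟩ := h1 v (highDeg_mono (le_max_left _ _) hv)
  obtain ⟨w2, hw2, e2⟩ := h2 v (highDeg_mono (le_max_right _ _) hv)
  refine ⟨w1 + w2, Submodule.add_mem _ hw1 hw2, ?_⟩
  rw [show (φ + ψ) * v - (w1 + w2) = (φ * v - w1) + (ψ * v - w2) by ring, toL2_add]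
  refine (norm_add_le _ _).trans ?_
  linarith

theorem IsAppr.mul {φ ψ : C(σ → Sph d, ℂ)} (hφ : IsAppr φ) (hψ : IsAppr ψ) : IsAppr (φ * ψ) := by
  intro ε hε M
  obtain ⟨M1, h1⟩ := hφ (ε / (2 * (‖ψ‖ + 1))) (by positivity) M
  obtain ⟨M2, h2⟩ := hψ (min 1 (ε / (2 * (‖φ‖ + 1)))) (by positivity) M1
  refine ⟨M2, fun v hv => ?_⟩
  obtain ⟨w1, hw1, e1⟩ := h2 v hv
  obtain ⟨w, hw, e2⟩ := h1 w1 hw1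
  refine ⟨w, hw, ?_⟩
  rw [show φ * ψ * v - w = φ * (ψ * v - w1) + (φ * w1 - w) by ring, toL2_add]
  refine (norm_add_le _ _).trans ?_
  have e3 : ‖toL2 w1‖ ≤ (‖ψ‖ + 1) * ‖toL2 v‖ := by
    rw [show w1 = ψ * v - (ψ * v - w1) by ring, toL2_sub]
    refine (norm_sub_le _ _).trans ?_
    have h3 := norm_toL2_mul_le ψ v
    have h4 : min 1 (ε / (2 * (‖φ‖ + 1))) * ‖toL2 v‖ ≤ 1 * ‖toL2 v‖ := by
      gcongr; exact min_le_left _ _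
    linarith
  have e4 : ‖toL2 (φ * (ψ * v - w1))‖ ≤ ε / 2 * ‖toL2 v‖ := by
    refine (norm_toL2_mul_le _ _).trans ?_
    have h4 : min 1 (ε / (2 * (‖φ‖ + 1))) * ‖toL2 v‖ ≤ ε / (2 * (‖φ‖ + 1)) * ‖toL2 v‖ := by
      gcongr; exact min_le_right _ _
    calc ‖φ‖ * ‖toL2 (ψ * v - w1)‖ ≤ (‖φ‖ + 1) * (ε / (2 * (‖φ‖ + 1)) * ‖toL2 v‖) := by
          gcongr
          · linarith
          · exact e1.trans h4
      _ = _ := by field_simp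
  have e5 : ‖toL2 (φ * w1 - w)‖ ≤ ε / 2 * ‖toL2 v‖ := by
    refine e2.trans ?_
    calc _ ≤ ε / (2 * (‖ψ‖ + 1)) * ((‖ψ‖ + 1) * ‖toL2 v‖) := by gcongr
      _ = _ := by field_simp
  linarith

theorem isAppr_of_mem_closure {S : Set C(σ → Sph d, ℂ)} (hS : ∀ φ ∈ S, IsAppr φ)
    {φ : C(σ → Sph d, ℂ)} (hφ : φ ∈ closure S) : IsAppr φ := by
  intro ε hε M
  obtain ⟨ψ, hψ, hd⟩ := Metric.mem_closure_iff.mp hφ (ε / 2) (by positivity)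
  obtain ⟨M0, h0⟩ := hS ψ hψ (ε / 2) (by positivity) M
  refine ⟨M0, fun v hv => ?_⟩
  obtain ⟨w, hw, e⟩ := h0 v hv
  refine ⟨w, hw, ?_⟩
  rw [show φ * v - w = (φ - ψ) * v + (ψ * v - w) by ring, toL2_add]
  refine (norm_add_le _ _).trans ?_
  have h1 := norm_toL2_mul_le (φ - ψ) v
  rw [dist_eq_norm] at hd
  have h2 : ‖φ - ψ‖ * ‖toL2 v‖ ≤ ε / 2 * ‖toL2 v‖ := by gcongr
  linarith

theorem isAppr_coordP (s : σ) (j : Fin d) : IsAppr (coordP s j) := by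
  intro ε hε M
  refine ⟨M, fun v hv => ⟨coordP s j * v, ?_, ?_⟩⟩
  · unfold highDeg at hv ⊢
    induction hv using Submodule.span_induction with
    | mem x hx =>
      obtain ⟨γ, hγ, rfl⟩ := hx
      rw [← monoP_single, ← monoP_add]
      refine Submodule.subset_span ⟨_, fun i => (hγ i).trans ?_, rfl⟩
      refine Finset.sum_le_sum fun k _ => ?_
      simp
    | zero => rw [mul_zero]; exact Submodule.zero_mem _
    | add x y _ _ hx hy => rw [mul_add]; exact Submodule.add_mem _ hx hy
    | smul c x _ hx => rw [mul_smul_comm]; exact Submodule.smul_mem _ _ hx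
  · simp only [sub_self, toL2, map_zero, norm_zero]
    positivity

/-- The approximate annihilation of a monomial. -/
noncomputable def lowerP (s : σ) (j : Fin d) (γ : σ → Fin d → ℕ) : C(σ → Sph d, ℂ) :=
  if 1 ≤ γ s j then
    ((monoPNorm γ / monoPNorm (γ - Pi.single s (Pi.single j 1)) : ℝ) : ℂ) •
      monoP (γ - Pi.single s (Pi.single j 1))
  else 0

theorem sub_add_single {s : σ} {j : Fin d} {γ : σ → Fin d → ℕ} (h : 1 ≤ γ s j) :
    γ - Pi.single s (Pi.single j 1) + Pi.single s (Pi.single j 1) = γ := by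
  refine tsub_add_cancel_of_le fun i k => ?_
  by_cases hi : i = s
  · subst hi
    by_cases hk : k = j
    · subst hk; simpa using h
    · simp [hk]
  · simp [hi]

theorem coordP_mul_monoP (s : σ) (j : Fin d) (γ : σ → Fin d → ℕ) :
    coordP s j * monoP γ = monoP (γ + Pi.single s (Pi.single j 1)) := by
  rw [monoP_add, monoP_single, mul_comm]

theorem coordP_mul_monoP_sub {s : σ} {j : Fin d} {γ : σ → Fin d → ℕ} (h : 1 ≤ γ s j) :
    coordP s j * monoP (γ - Pi.single s (Pi.single j 1)) = monoP γ := by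
  rw [coordP_mul_monoP, sub_add_single h]

theorem inner_star_coordP_mul (s : σ) (j : Fin d) (f g : C(σ → Sph d, ℂ)) :
    inner ℂ (toL2 f) (toL2 (star (coordP s j) * g)) =
      inner ℂ (toL2 (coordP s j * f)) (toL2 g) := by
  rw [inner_toL2, inner_toL2]
  congr 1
  ext x
  simp only [ContinuousMap.mul_apply, ContinuousMap.star_apply, star_mul']
  ring

theorem inner_star_coordP_mul' (s : σ) (j : Fin d) (f g : C(σ → Sph d, ℂ)) :
    inner ℂ (toL2 (star (coordP s j) * f)) (toL2 (star (coordP s j) * g)) =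
      inner ℂ (toL2 (coordP s j * f)) (toL2 (coordP s j * g)) := by
  rw [inner_toL2, inner_toL2]
  congr 1
  ext x
  simp only [ContinuousMap.mul_apply, ContinuousMap.star_apply, star_mul', star_star]
  ring

theorem inner_lowerP (hd : 0 < d) (s : σ) (j : Fin d) (γ γ' : σ → Fin d → ℕ) :
    inner ℂ (toL2 (lowerP s j γ)) (toL2 (star (coordP s j) * monoP γ' - lowerP s j γ')) = 0 := by
  unfold lowerP
  split_ifs with h1 h2 h2
  · rw [toL2_sub, inner_sub_right, toL2_smul, toL2_smul, inner_smul_left, inner_smul_left,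
      inner_smul_right, inner_star_coordP_mul, coordP_mul_monoP_sub h1, inner_toL2_monoP, inner_toL2_monoP]
    by_cases h : γ = γ'
    · subst h
      have := (monoPNorm_pos hd (γ - Pi.single s (Pi.single j 1))).ne'
      have h' : ((monoPNorm (γ - Pi.single s (Pi.single j 1)) : ℝ) : ℂ) ≠ 0 := by exact_mod_cast this
      simp only [if_true]
      push_cast
      field_simp
      ring
    · rw [if_neg h, if_neg]
      · simp
      · intro h3
        apply h
        rw [← sub_add_single h1, h3, sub_add_single h2]
  · rw [sub_zero, toL2_smul, inner_smul_left, inner_star_coordP_mul, coordP_mul_monoP_sub h1, inner_toL2_monoP, if_neg, mul_zero]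
    rintro rfl
    exact h2 h1
  · simp [toL2]
  · simp [toL2]

theorem inner_residual (hd : 0 < d) (s : σ) (j : Fin d) (γ γ' : σ → Fin d → ℕ) :
    inner ℂ (toL2 (star (coordP s j) * monoP γ - lowerP s j γ))
      (toL2 (star (coordP s j) * monoP γ' - lowerP s j γ')) =
    inner ℂ (toL2 (star (coordP s j) * monoP γ - lowerP s j γ))
      (toL2 (star (coordP s j) * monoP γ')) := by
  conv_lhs => rw [toL2_sub (_ * monoP γ') (lowerP s j γ'), inner_sub_right]
  rw [← inner_conj_symm _ (toL2 (lowerP s j γ')), inner_lowerP hd, map_zero, sub_zero]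

theorem inner_residual_ne (hd : 0 < d) (s : σ) (j : Fin d) {γ γ' : σ → Fin d → ℕ} (h : γ ≠ γ') :
    inner ℂ (toL2 (star (coordP s j) * monoP γ - lowerP s j γ))
      (toL2 (star (coordP s j) * monoP γ' - lowerP s j γ')) = 0 := by
  rw [inner_residual hd, toL2_sub, inner_sub_left, inner_star_coordP_mul', coordP_mul_monoP,
    coordP_mul_monoP, inner_toL2_monoP, if_neg (by simpa using h)]
  unfold lowerP
  split_ifs with h1
  · rw [toL2_smul, inner_smul_left, inner_star_coordP_mul, coordP_mul_monoP_sub h1, inner_toL2_monoP,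
      if_neg h]
    simp
  · simp [toL2]

theorem norm_residual_sq_le (hd : 0 < d) (s : σ) (j : Fin d) (γ : σ → Fin d → ℕ) :
    ‖toL2 (star (coordP s j) * monoP γ - lowerP s j γ)‖ ^ 2 * ((∑ i, γ s i : ℕ) + d) ≤
      ‖toL2 (monoP γ)‖ ^ 2 := by
  have hN : ‖toL2 (monoP γ)‖ ^ 2 = monoPNorm γ := by
    have := inner_self_toL2 (monoP γ)
    rw [inner_toL2_monoP, if_pos rfl] at this
    symm; exact Complex.ofReal_injective this
  have hk : ∃ κ : ℝ, κ * ((∑ i, γ s i : ℕ) + d - 1) = γ s j ∧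
      ‖toL2 (star (coordP s j) * monoP γ - lowerP s j γ)‖ ^ 2 =
        monoPNorm (γ + Pi.single s (Pi.single j 1)) - κ * monoPNorm γ ∧ (γ s j = 0 → κ = 0) := by
    have h0 := inner_self_toL2 (star (coordP s j) * monoP γ - lowerP s j γ)
    rw [inner_residual hd, toL2_sub, inner_sub_left, inner_star_coordP_mul', coordP_mul_monoP, inner_toL2_monoP, if_pos rfl] at h0
    unfold lowerP at h0 ⊢
    split_ifs at h0 ⊢ with h1
    · refine ⟨monoPNorm γ / monoPNorm (γ - Pi.single s (Pi.single j 1)), ?_, ?_, by omega⟩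
      · have h2 := monoPNorm_succ hd (γ - Pi.single s (Pi.single j 1) : σ → Fin d → ℕ) s j
        rw [sub_add_single h1] at h2
        have h3 := (monoPNorm_pos hd (γ - Pi.single s (Pi.single j 1))).ne'
        have h4 : ∑ i, γ s i = ∑ i, (γ - Pi.single s (Pi.single j 1) : σ → Fin d → ℕ) s i + 1 := by
          conv_lhs => rw [← sub_add_single h1]
          simp [Finset.sum_add_distrib]
        have h5 : γ s j = (γ - Pi.single s (Pi.single j 1) : σ → Fin d → ℕ) s j + 1 := by
          conv_lhs => rw [← sub_add_single h1]
          simp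
        rw [h4, h5]
        field_simp
        push_cast at h2 ⊢
        linear_combination h2
      · rw [toL2_smul, inner_smul_left, inner_star_coordP_mul, coordP_mul_monoP_sub h1,
          inner_toL2_monoP, if_pos rfl] at h0
        symm
        simp only [Complex.conj_ofReal] at h0
        refine Complex.ofReal_injective (Eq.trans ?_ h0)
        push_cast
        ring
    · refine ⟨0, ?_, ?_, fun _ => rfl⟩
      · have h2 : γ s j = 0 := by omega
        simp [h2]
      · simp only [toL2_zero, inner_zero_left, sub_zero] at h0 ⊢
        symm
        refine Complex.ofReal_injective (Eq.trans ?_ h0)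
        push_cast
        ring
  obtain ⟨κ, hκ, hr, hκ0⟩ := hk
  rw [hN, hr]
  have h2 := monoPNorm_succ hd γ s j
  have hp := monoPNorm_pos hd γ
  have hle : γ s j ≤ ∑ i, γ s i := Finset.single_le_sum (fun _ _ => Nat.zero_le _) (Finset.mem_univ j)
  have hle' : (γ s j : ℝ) ≤ (∑ i, γ s i : ℕ) := by exact_mod_cast hle
  have hd' : (1:ℝ) ≤ d := by exact_mod_cast hd
  have hκn : 0 ≤ κ := by
    by_contra hneg
    push Not at hneg
    have h6 : γ s j ≠ 0 := fun h => by rw [hκ0 h] at hneg; exact lt_irrefl _ hneg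
    have h7 : (1:ℝ) ≤ γ s j := by exact_mod_cast Nat.one_le_iff_ne_zero.mpr h6
    nlinarith
  have : (monoPNorm (γ + Pi.single s (Pi.single j 1)) - κ * monoPNorm γ) * ((∑ i, γ s i : ℕ) + d) =
      (1 - κ) * monoPNorm γ := by
    linear_combination h2 - monoPNorm γ * hκ
  rw [this]
  nlinarith

theorem lowerP_mem {M : ℕ} {s : σ} {j : Fin d} {γ : σ → Fin d → ℕ}
    (h : ∀ i, M + 1 ≤ ∑ k, γ i k) : lowerP s j γ ∈ highDeg σ d M := by
  unfold lowerP
  split_ifs with h1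
  · refine Submodule.smul_mem _ _ (Submodule.subset_span ⟨_, fun i => ?_, rfl⟩)
    have h2 := h i
    by_cases hi : i = s
    · subst hi
      have h4 : ∑ k, γ i k = ∑ k, (γ - Pi.single i (Pi.single j 1) : σ → Fin d → ℕ) i k + 1 := by
        conv_lhs => rw [← sub_add_single h1]
        simp [Finset.sum_add_distrib]
      omega
    · have : (γ - Pi.single s (Pi.single j 1) : σ → Fin d → ℕ) i = γ i := by simp [hi]
      rw [this]; omega
  · exact Submodule.zero_mem _

theorem isAppr_star_coordP (hd : 0 < d) (s : σ) (j : Fin d) : IsAppr (star (coordP s j)) := by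
  classical
  intro ε hε M
  obtain ⟨K, hK⟩ := exists_nat_gt (1 / ε ^ 2)
  refine ⟨max (M + 1) K, fun v hv => ?_⟩
  unfold highDeg at hv
  rw [Submodule.mem_span_image_iff_exists_fun] at hv
  obtain ⟨t, ht, c, rfl⟩ := hv
  refine ⟨∑ i, c i • lowerP s j i, Submodule.sum_mem _ fun i _ => Submodule.smul_mem _ _
    (lowerP_mem fun k => (le_max_left _ _).trans (ht i.2 k)), ?_⟩
  rw [Finset.mul_sum, ← Finset.sum_sub_distrib]
  simp only [mul_smul_comm, ← smul_sub]
  refine abs_le_of_sq_le_sq' ?_ (by positivity) |>.2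
  rw [mul_pow, toL2_sum, toL2_sum, norm_sq_sum_of_orthogonal, norm_sq_sum_of_orthogonal,
    Finset.mul_sum]
  · refine Finset.sum_le_sum fun i _ => ?_
    rw [toL2_smul, toL2_smul, norm_smul, norm_smul, mul_pow, mul_pow]
    have h1 := norm_residual_sq_le hd s j (i : σ → Fin d → ℕ)
    have h2 : (K : ℝ) ≤ (∑ k, (i : σ → Fin d → ℕ) s k : ℕ) := by
      exact_mod_cast (le_max_right _ _).trans (ht i.2 s)
    have h3 : 1 ≤ ε ^ 2 * ((∑ k, (i : σ → Fin d → ℕ) s k : ℕ) + d) := by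
      have h4 : 1 < ε ^ 2 * K := by
        rwa [div_lt_iff₀ (by positivity), mul_comm] at hK
      have h5 : (0:ℝ) ≤ d := by positivity
      nlinarith [sq_nonneg ε]
    set a := ‖toL2 (star (coordP s j) * monoP (i : σ → Fin d → ℕ) - lowerP s j i)‖ ^ 2
    have ha : 0 ≤ a := by positivity
    have h6 : a ≤ ε ^ 2 * ‖toL2 (monoP (i : σ → Fin d → ℕ))‖ ^ 2 := by
      nlinarith [sq_nonneg ε]
    have h7 : 0 ≤ ‖c i‖ ^ 2 := by positivity
    nlinarith
  · intro i k hik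
    rw [toL2_smul, toL2_smul, inner_smul_left, inner_smul_right, inner_toL2_monoP, if_neg]
    · simp
    · exact fun h => hik (Subtype.ext h)
  · intro i k hik
    rw [toL2_smul, toL2_smul, inner_smul_left, inner_smul_right, inner_residual_ne hd]
    · simp
    · exact fun h => hik (Subtype.ext h)

theorem isAppr (hd : 0 < d) (φ : C(σ → Sph d, ℂ)) : IsAppr φ := by
  let S : Set C(σ → Sph d, ℂ) := Set.range fun p : σ × Fin d => coordP p.1 p.2
  have hsep : (StarAlgebra.adjoin ℂ S).SeparatesPoints := by
    intro x y hxy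
    obtain ⟨s, hs⟩ := Function.ne_iff.mp hxy
    have : ∃ j, (x s : EuclideanSpace ℂ (Fin d)) j ≠ (y s : EuclideanSpace ℂ (Fin d)) j := by
      by_contra! h
      exact hs (Subtype.ext (PiLp.ext h))
    obtain ⟨j, hj⟩ := this
    exact ⟨coordP s j, ⟨coordP s j, StarAlgebra.subset_adjoin ℂ S ⟨(s, j), rfl⟩, rfl⟩, hj⟩
  have htop := ContinuousMap.starSubalgebra_topologicalClosure_eq_top_of_separatesPoints _ hsep
  have hmem : φ ∈ (StarAlgebra.adjoin ℂ S).topologicalClosure := by rw [htop]; trivial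
  refine isAppr_of_mem_closure (S := (StarAlgebra.adjoin ℂ S : Set C(σ → Sph d, ℂ))) ?_ hmem
  intro ψ hψ
  have hψ' : ψ ∈ (StarAlgebra.adjoin ℂ S).toSubalgebra := hψ
  rw [StarAlgebra.adjoin_toSubalgebra] at hψ'
  induction hψ' using Algebra.adjoin_induction with
  | mem x hx =>
    rcases hx with ⟨p, rfl⟩ | hx
    · exact isAppr_coordP _ _
    · rw [Set.mem_star] at hx
      obtain ⟨p, hp⟩ := hx
      have : x = star (coordP p.1 p.2) := by
        rw [show coordP p.1 p.2 = star x from hp, star_star]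
      rw [this]
      exact isAppr_star_coordP hd _ _
  | algebraMap r => exact isAppr_algebraMap r
  | add x y hx hy ihx ihy =>
    refine (ihx ?_).add (ihy ?_) <;>
    · change _ ∈ (StarAlgebra.adjoin ℂ S).toSubalgebra
      rwa [StarAlgebra.adjoin_toSubalgebra]
  | mul x y hx hy ihx ihy =>
    refine (ihx ?_).mul (ihy ?_) <;>
    · change _ ∈ (StarAlgebra.adjoin ℂ S).toSubalgebra
      rwa [StarAlgebra.adjoin_toSubalgebra]

end Approximation

section Toeplitz

theorem norm_sq_le_of_orthonormal {H κ : Type*} [NormedAddCommGroup H] [InnerProductSpace ℂ H]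
    [Fintype κ] [DecidableEq κ] {e : κ → H} (he : Orthonormal ℂ e) (w h : H)
    (hh : inner ℂ h (w - ∑ k, inner ℂ (e k) w • e k) = 0) :
    ‖w‖ ^ 2 ≤ ∑ k, ‖inner ℂ (e k) w‖ ^ 2 + ‖w - h‖ ^ 2 := by
  set p := ∑ k, inner ℂ (e k) w • e k with hp
  have hpe : ∀ k, inner ℂ (e k) (w - p) = 0 := by
    intro k
    rw [inner_sub_right, hp, inner_sum]
    simp only [inner_smul_right, orthonormal_iff_ite.mp he]
    simp
  have hpp : inner ℂ p (w - p) = 0 := by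
    have h0 : inner ℂ p (w - p) = ∑ k, inner ℂ (inner ℂ (e k) w • e k) (w - p) := by
      conv_lhs => arg 2; rw [hp]
      rw [sum_inner]
    rw [h0]
    exact Finset.sum_eq_zero fun k _ => by rw [inner_smul_left, hpe, mul_zero]
  have h1 : ‖w‖ ^ 2 = ‖p‖ ^ 2 + ‖w - p‖ ^ 2 := by
    have := norm_add_sq_eq_norm_sq_add_norm_sq_of_inner_eq_zero p (w - p) hpp
    rw [add_sub_cancel] at this
    simpa [sq] using this
  have h2 : ‖w - h‖ ^ 2 = ‖p - h‖ ^ 2 + ‖w - p‖ ^ 2 := by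
    have := norm_add_sq_eq_norm_sq_add_norm_sq_of_inner_eq_zero (𝕜 := ℂ) (p - h) (w - p)
      (by rw [inner_sub_left, hpp, hh, sub_zero])
    rw [show p - h + (w - p) = w - h by abel] at this
    simpa [sq] using this
  have h3 : ‖p‖ ^ 2 = ∑ k, ‖inner ℂ (e k) w‖ ^ 2 := by
    rw [hp, norm_sq_sum_of_orthogonal]
    · refine Finset.sum_congr rfl fun k _ => ?_
      rw [norm_smul, he.1 k, mul_one]
    · intro i j hij
      rw [inner_smul_left, inner_smul_right, he.2 hij]
      simp
  have := sq_nonneg ‖p - h‖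
  linarith

/-- Multi-indices of a given degree. -/
abbrev DegIdx (d n : ℕ) := {α : Fin d → ℕ // ∑ j, α j = n}

instance (d n : ℕ) : Fintype (DegIdx d n) :=
  Fintype.subtype (Finset.piAntidiag Finset.univ n) (by simp)

variable {σ : Type*} [Fintype σ] [DecidableEq σ] {d : ℕ} {ι : Type*} [Fintype ι] [DecidableEq ι]

/-- Index set of the basis of the space of polynomial sections with weights `a`. -/
abbrev ToepIdx (d : ℕ) (a : ι → σ → ℕ) (m : σ → ℕ) := Σ i, ∀ s, DegIdx d (m s + a i s)

/-- The exponent of a basis element. -/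
def ToepIdx.expo {a : ι → σ → ℕ} {m : σ → ℕ} (k : ToepIdx d a m) : σ → Fin d → ℕ :=
  fun s => (k.2 s).1

theorem ToepIdx.expo_sum {a : ι → σ → ℕ} {m : σ → ℕ} (k : ToepIdx d a m) (s : σ) :
    ∑ j, k.expo s j = m s + a k.1 s := (k.2 s).2

theorem ToepIdx.ext_expo {a : ι → σ → ℕ} {m : σ → ℕ} {i : ι} {p q : ∀ s, DegIdx d (m s + a i s)}
    (h : ToepIdx.expo (⟨i, p⟩ : ToepIdx d a m) = ToepIdx.expo (⟨i, q⟩ : ToepIdx d a m)) : p = q := by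
  funext s
  exact Subtype.ext (congrFun h s)

/-- The normalised monomials. -/
noncomputable def monoN (γ : σ → Fin d → ℕ) : C(σ → Sph d, ℂ) :=
  ((Real.sqrt (monoPNorm γ))⁻¹ : ℂ) • monoP γ

theorem inner_toL2_monoN (hd : 0 < d) (γ γ' : σ → Fin d → ℕ) :
    inner ℂ (toL2 (monoN γ)) (toL2 (monoN γ')) = if γ = γ' then 1 else 0 := by
  unfold monoN
  rw [toL2_smul, toL2_smul, inner_smul_left, inner_smul_right, inner_toL2_monoP]
  split_ifs with h
  · subst h
    have h1 := monoPNorm_pos hd γ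
    have h2 : (Real.sqrt (monoPNorm γ) : ℂ) * Real.sqrt (monoPNorm γ) = monoPNorm γ := by
      exact_mod_cast Real.mul_self_sqrt h1.le
    have h3 : (Real.sqrt (monoPNorm γ) : ℂ) ≠ 0 := by
      exact_mod_cast (Real.sqrt_pos.mpr h1).ne'
    rw [map_inv₀, Complex.conj_ofReal, ← h2]
    field_simp
  · simp

/-- The Toeplitz compression of a matrix valued symbol to polynomials of multidegree `m + a`. -/
noncomputable def toep (a : ι → σ → ℕ) (m : σ → ℕ) (F : (σ → Sph d) → Matrix ι ι ℂ) :
    Matrix (ToepIdx d a m) (ToepIdx d a m) ℂ :=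
  Matrix.of fun k l => ∫ x, star (monoN k.expo x) * (F x k.1 l.1 * monoN l.expo x) ∂(prodMeas σ d)

/-- Continuous Hermitian symbols, equivariant of weight `a`. -/
structure IsSymbol (a : ι → σ → ℕ) (F : (σ → Sph d) → Matrix ι ι ℂ) : Prop where
  cont : Continuous F
  herm : ∀ x, (F x).IsHermitian
  equiv : ∀ (l : σ → Circle) x i j,
    (∏ s, (l s : ℂ) ^ a j s) * F (scalP l x) i j = (∏ s, (l s : ℂ) ^ a i s) * F x i j

variable {a : ι → σ → ℕ} {m : σ → ℕ} {F G : (σ → Sph d) → Matrix ι ι ℂ}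

theorem toep_isHermitian (hF : ∀ x, (F x).IsHermitian) : (toep a m F).IsHermitian := by
  ext k l
  rw [conjTranspose_apply]
  unfold toep
  simp only [of_apply]
  rw [show ∀ z : ℂ, star z = starRingEnd ℂ z from fun _ => rfl, ← integral_conj]
  congr 1
  ext x
  have h := (hF x).apply k.1 l.1
  simp only [← starRingEnd_apply] at h ⊢
  rw [map_mul, map_mul, Complex.conj_conj, h]
  ring

/-- A matrix entry of a continuous symbol. -/
def entryC (hF : Continuous F) (i j : ι) : C(σ → Sph d, ℂ) :=
  ⟨fun x => F x i j, hF.matrix_elem i j⟩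

/-- The polynomial section with given coefficients. -/
noncomputable def polySec (c : ToepIdx d a m → ℂ) (i : ι) : C(σ → Sph d, ℂ) :=
  ∑ p, c ⟨i, p⟩ • monoN (ToepIdx.expo (⟨i, p⟩ : ToepIdx d a m))

theorem norm_polySec_sq (hd : 0 < d) (c : ToepIdx d a m → ℂ) (i : ι) :
    ‖toL2 (polySec c i)‖ ^ 2 = ∑ p, ‖c ⟨i, p⟩‖ ^ 2 := by
  unfold polySec
  rw [toL2_sum, norm_sq_sum_of_orthogonal]
  · refine Finset.sum_congr rfl fun p _ => ?_
    rw [toL2_smul, norm_smul, mul_pow]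
    have h1 := inner_self_toL2 (monoN (ToepIdx.expo (⟨i, p⟩ : ToepIdx d a m)))
    rw [inner_toL2_monoN hd, if_pos rfl] at h1
    have h2 : ‖toL2 (monoN (ToepIdx.expo (⟨i, p⟩ : ToepIdx d a m)))‖ ^ 2 = 1 := by
      symm; exact_mod_cast h1
    rw [h2, mul_one]
  · intro p q hpq
    rw [toL2_smul, toL2_smul, inner_smul_left, inner_smul_right, inner_toL2_monoN hd, if_neg]
    · simp
    · exact fun h => hpq (ToepIdx.ext_expo h)

theorem sum_norm_polySec_sq (hd : 0 < d) (c : ToepIdx d a m → ℂ) :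
    ∑ i, ‖toL2 (polySec c i)‖ ^ 2 = nsq c := by
  unfold nsq
  rw [Fintype.sum_sigma]
  exact Finset.sum_congr rfl fun i _ => norm_polySec_sq hd c i

theorem polySec_mem {M : ℕ} (hM : ∀ s, M ≤ m s) (c : ToepIdx d a m → ℂ) (i : ι) :
    polySec c i ∈ highDeg σ d M := by
  refine Submodule.sum_mem _ fun p _ => Submodule.smul_mem _ _ (Submodule.smul_mem _ _
    (Submodule.subset_span ⟨_, fun s => ?_, rfl⟩))
  rw [ToepIdx.expo_sum]
  exact (hM s).trans (Nat.le_add_right _ _)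

/-- The pointwise image of a polynomial section under a symbol. -/
noncomputable def imgSec (hF : Continuous F) (c : ToepIdx d a m → ℂ) (i : ι) : C(σ → Sph d, ℂ) :=
  ∑ j, entryC hF i j * polySec c j

theorem toep_mulVec (hF : Continuous F) (c : ToepIdx d a m → ℂ) (k : ToepIdx d a m) :
    (toep a m F *ᵥ c) k = inner ℂ (toL2 (monoN k.expo)) (toL2 (imgSec hF c k.1)) := by
  unfold imgSec polySec
  rw [toL2_sum, inner_sum, mulVec, dotProduct, Fintype.sum_sigma]
  refine Finset.sum_congr rfl fun j _ => ?_
  rw [Finset.mul_sum, toL2_sum, inner_sum]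
  refine Finset.sum_congr rfl fun p _ => ?_
  rw [mul_smul_comm, toL2_smul, inner_smul_right, inner_toL2, mul_comm]
  rfl

theorem toep_quadForm (hF : Continuous F) (c : ToepIdx d a m → ℂ) :
    star c ⬝ᵥ toep a m F *ᵥ c =
      ∑ i, ∑ j, inner ℂ (toL2 (polySec c i)) (toL2 (entryC hF i j * polySec c j)) := by
  rw [dotProduct, Fintype.sum_sigma]
  refine Finset.sum_congr rfl fun i _ => ?_
  have : ∀ p, star c ⟨i, p⟩ * (toep a m F *ᵥ c) ⟨i, p⟩ =
      inner ℂ (toL2 (c ⟨i, p⟩ • monoN (ToepIdx.expo (⟨i, p⟩ : ToepIdx d a m))))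
        (toL2 (imgSec hF c i)) := by
    intro p
    rw [toep_mulVec hF, toL2_smul, inner_smul_left]
    rfl
  simp only [this]
  rw [← sum_inner, ← toL2_sum]
  change inner ℂ (toL2 (polySec c i)) _ = _
  unfold imgSec
  rw [toL2_sum, inner_sum]

theorem abs_quadForm_sub_le (hd : 0 < d) (hF : Continuous F) (hG : Continuous G) {η : ℝ}
    (h : ∀ x i j, ‖F x i j - G x i j‖ ≤ η) (hη : 0 ≤ η) (c : ToepIdx d a m → ℂ) :
    |(star c ⬝ᵥ (toep a m F - toep a m G) *ᵥ c).re| ≤ η * Fintype.card ι * nsq c := by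
  refine (Complex.abs_re_le_norm _).trans ?_
  rw [sub_mulVec, dotProduct_sub, toep_quadForm hF, toep_quadForm hG, ← Finset.sum_sub_distrib]
  simp only [← Finset.sum_sub_distrib, ← inner_sub_right, ← toL2_sub, ← sub_mul]
  calc _ ≤ ∑ i, ∑ j, ‖toL2 (polySec c i)‖ * (η * ‖toL2 (polySec c j)‖) := by
        refine (norm_sum_le _ _).trans (Finset.sum_le_sum fun i _ => (norm_sum_le _ _).trans
          (Finset.sum_le_sum fun j _ => (norm_inner_le_norm _ _).trans ?_))
        gcongr
        refine norm_toL2_le hη fun x => ?_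
        rw [ContinuousMap.mul_apply, norm_mul]
        gcongr
        exact h x i j
    _ = η * (∑ i, ‖toL2 (polySec c i)‖) ^ 2 := by
        rw [sq, Finset.sum_mul, Finset.mul_sum]
        refine Finset.sum_congr rfl fun i _ => ?_
        rw [Finset.mul_sum, Finset.mul_sum]
        exact Finset.sum_congr rfl fun j _ => by ring
    _ ≤ η * (Fintype.card ι * ∑ i, ‖toL2 (polySec c i)‖ ^ 2) := by
        gcongr
        simpa using sq_sum_le_card_mul_sum_sq (s := Finset.univ)
          (f := fun i => ‖toL2 (polySec c i)‖)
    _ = _ := by rw [sum_norm_polySec_sq hd]; ring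

theorem norm_imgSec_sq_le (hd : 0 < d) (hF : IsSymbol a F) (c : ToepIdx d a m → ℂ) (i : ι)
    {h : C(σ → Sph d, ℂ)} (hh : h ∈ highDeg σ d 0) :
    ‖toL2 (imgSec hF.cont c i)‖ ^ 2 ≤ ∑ p, ‖(toep a m F *ᵥ c) ⟨i, p⟩‖ ^ 2 +
      ‖toL2 (imgSec hF.cont c i - h)‖ ^ 2 := by
  let e : (∀ s, DegIdx d (m s + a i s)) → Lp ℂ 2 (prodMeas σ d) :=
    fun p => toL2 (monoN (ToepIdx.expo (⟨i, p⟩ : ToepIdx d a m)))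
  have he : Orthonormal ℂ e := by
    rw [orthonormal_iff_ite]
    intro p q
    simp only [e, inner_toL2_monoN hd]
    congr 1
    exact propext ⟨ToepIdx.ext_expo, fun h => by rw [h]⟩
  have hw : ∀ p, (toep a m F *ᵥ c) ⟨i, p⟩ = inner ℂ (e p) (toL2 (imgSec hF.cont c i)) :=
    fun p => toep_mulVec hF.cont c ⟨i, p⟩
  simp only [hw]
  rw [toL2_sub]
  refine norm_sq_le_of_orthonormal he _ _ ?_
  set w := toL2 (imgSec hF.cont c i)
  unfold highDeg at hh
  induction hh using Submodule.span_induction with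
  | zero => rw [toL2_zero, inner_zero_left]
  | add x y _ _ hx hy => rw [toL2_add, inner_add_left, hx, hy, add_zero]
  | smul r x _ hx => rw [toL2_smul, inner_smul_left, hx, mul_zero]
  | mem x hx =>
    obtain ⟨γ, -, rfl⟩ := hx
    by_cases hγ : ∀ s, ∑ j, γ s j = m s + a i s
    · let p : ∀ s, DegIdx d (m s + a i s) := fun s => ⟨γ s, hγ s⟩
      have h1 : inner ℂ (e p) (w - ∑ q, inner ℂ (e q) w • e q) = 0 := by
        rw [inner_sub_right, inner_sum]
        simp only [inner_smul_right, orthonormal_iff_ite.mp he]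
        simp
      have h2 : toL2 (monoP γ) = ((Real.sqrt (monoPNorm γ)) : ℂ) • e p := by
        simp only [e, monoN, toL2_smul, smul_smul]
        have h3 : (Real.sqrt (monoPNorm γ) : ℂ) ≠ 0 := by
          exact_mod_cast (Real.sqrt_pos.mpr (monoPNorm_pos hd γ)).ne'
        have h4 : ToepIdx.expo (⟨i, p⟩ : ToepIdx d a m) = γ := rfl
        rw [h4, mul_inv_cancel₀ h3, one_smul]
      rw [h2, inner_smul_left, h1, mul_zero]
    · push Not at hγ
      obtain ⟨s, hs⟩ := hγ
      have h1 : inner ℂ (toL2 (monoP γ)) w = 0 := by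
        simp only [w, imgSec, polySec]
        rw [toL2_sum, inner_sum]
        refine Finset.sum_eq_zero fun j _ => ?_
        rw [Finset.mul_sum, toL2_sum, inner_sum]
        refine Finset.sum_eq_zero fun p _ => ?_
        rw [mul_smul_comm, toL2_smul, inner_smul_right, monoN, mul_smul_comm, toL2_smul,
          inner_smul_right, inner_toL2]
        have := integral_star_monoP_mul_eq_zero γ (ToepIdx.expo (⟨j, p⟩ : ToepIdx d a m))
          (a i) (a j) (fun x => F x i j) (fun l x => hF.equiv l x i j) ⟨s, by
            rw [ToepIdx.expo_sum]; simp only; omega⟩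
        change _ * (_ * ∫ x, star (monoP γ x) * (F x i j * _) ∂_) = 0
        rw [this, mul_zero, mul_zero]
      rw [inner_sub_right, h1, inner_sum, zero_sub, neg_eq_zero]
      refine Finset.sum_eq_zero fun q _ => ?_
      simp only [e, monoN, toL2_smul]
      rw [inner_smul_right, inner_smul_right, inner_toL2_monoP, if_neg, mul_zero, mul_zero]
      rintro rfl
      exact hs (ToepIdx.expo_sum (⟨i, q⟩ : ToepIdx d a m) s)

theorem eventually_toep_gap (hd : 0 < d) (hF : IsSymbol a F) {g : ℝ} (hg : 0 < g)
    (h : ∀ x v, g ^ 2 * nsq v ≤ nsq (F x *ᵥ v)) :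
    ∀ᶠ m in atTop, ∀ c : ToepIdx d a m → ℂ, (g / 2) ^ 2 * nsq c ≤ nsq (toep a m F *ᵥ c) := by
  set ε : ℝ := g / (2 * (Fintype.card ι + 1)) with hε
  have hε0 : 0 < ε := by positivity
  have key : ∀ i j, ∃ M0, ∀ v ∈ highDeg σ d M0, ∃ w ∈ highDeg σ d 0,
      ‖toL2 (entryC hF.cont i j * v - w)‖ ≤ ε * ‖toL2 v‖ :=
    fun i j => isAppr hd (entryC hF.cont i j) ε hε0 0
  choose M0 hM0 using key
  filter_upwards [eventually_ge_atTop (fun _ : σ => ∑ i, ∑ j, M0 i j)] with m hm c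
  have hmem : ∀ i j, polySec c j ∈ highDeg σ d (M0 i j) := fun i j => by
    refine polySec_mem (fun s => le_trans ?_ (hm s)) c j
    exact (Finset.single_le_sum (f := fun j => M0 i j) (fun _ _ => Nat.zero_le _)
      (Finset.mem_univ j)).trans (Finset.single_le_sum (f := fun i => ∑ j, M0 i j)
      (fun _ _ => Nat.zero_le _) (Finset.mem_univ i))
  choose w hw hwn using fun i j => hM0 i j (polySec c j) (hmem i j)
  have h1 : ∀ i, ‖toL2 (imgSec hF.cont c i - ∑ j, w i j)‖ ^ 2 ≤
      Fintype.card ι * ε ^ 2 * nsq c := by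
    intro i
    have h2 : ‖toL2 (imgSec hF.cont c i - ∑ j, w i j)‖ ≤ ∑ j, ε * ‖toL2 (polySec c j)‖ := by
      unfold imgSec
      rw [← Finset.sum_sub_distrib, toL2_sum]
      exact (norm_sum_le _ _).trans (Finset.sum_le_sum fun j _ => hwn i j)
    calc _ ≤ (∑ j, ε * ‖toL2 (polySec c j)‖) ^ 2 := by gcongr
      _ ≤ Fintype.card ι * ∑ j, (ε * ‖toL2 (polySec c j)‖) ^ 2 := by
          simpa using sq_sum_le_card_mul_sum_sq (s := Finset.univ)
            (f := fun j => ε * ‖toL2 (polySec c j)‖)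
      _ = _ := by
          simp only [mul_pow]
          rw [← Finset.mul_sum, sum_norm_polySec_sq hd, mul_assoc]
  have h3 : g ^ 2 * nsq c ≤ ∑ i, ‖toL2 (imgSec hF.cont c i)‖ ^ 2 := by
    rw [← sum_norm_polySec_sq hd]
    simp only [norm_toL2_sq]
    rw [← integral_finsetSum _ fun i _ => integrable_of_continuous (by fun_prop),
      ← integral_finsetSum _ fun i _ => integrable_of_continuous (by fun_prop),
      ← integral_const_mul]
    refine integral_mono (integrable_of_continuous (by fun_prop))
      (integrable_of_continuous (by fun_prop)) fun x => ?_
    have h4 := h x (fun i => polySec c i x)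
    have h5 : ∀ i, (F x *ᵥ fun i => polySec c i x) i = imgSec hF.cont c i x := by
      intro i
      unfold imgSec
      rw [ContinuousMap.sum_apply]
      rfl
    simpa only [nsq, h5] using h4
  have h6 : ∑ i, ‖toL2 (imgSec hF.cont c i)‖ ^ 2 ≤
      nsq (toep a m F *ᵥ c) + Fintype.card ι * (Fintype.card ι * ε ^ 2 * nsq c) := by
    calc _ ≤ ∑ i, (∑ p, ‖(toep a m F *ᵥ c) ⟨i, p⟩‖ ^ 2 + Fintype.card ι * ε ^ 2 * nsq c) :=
          Finset.sum_le_sum fun i _ => (norm_imgSec_sq_le hd hF c i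
            (Submodule.sum_mem _ fun j _ => hw i j)).trans (by gcongr; exact h1 i)
      _ = _ := by
          rw [Finset.sum_add_distrib, show nsq (toep a m F *ᵥ c) =
            ∑ i, ∑ p, ‖(toep a m F *ᵥ c) ⟨i, p⟩‖ ^ 2 from Fintype.sum_sigma _]
          simp
  have h7 : (Fintype.card ι : ℝ) * (Fintype.card ι * ε ^ 2) ≤ g ^ 2 / 4 := by
    have h8 : Fintype.card ι * ε ≤ g / 2 := by
      rw [hε, ← mul_div_assoc, div_le_div_iff₀ (by positivity) (by positivity)]
      nlinarith
    have h9 : 0 ≤ Fintype.card ι * ε := by positivity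
    nlinarith
  have h10 := nsq_nonneg c
  nlinarith [sq_nonneg g, mul_le_mul_of_nonneg_right h7 h10,
    mul_nonneg (sq_nonneg g) h10]

theorem exists_pointwise_gap (hF : Continuous F) (hdet : ∀ x v, F x *ᵥ v = 0 → v = 0) :
    ∃ g > 0, ∀ x v, g ^ 2 * nsq v ≤ nsq (F x *ᵥ v) := by
  let K : Set ((σ → Sph d) × (ι → ℂ)) := Set.univ ×ˢ Metric.sphere 0 1
  have hK : IsCompact K := isCompact_univ.prod (isCompact_sphere _ _)
  have hcont : Continuous fun p : (σ → Sph d) × (ι → ℂ) => nsq (F p.1 *ᵥ p.2) := by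
    unfold nsq
    have h1 : Continuous fun p : (σ → Sph d) × (ι → ℂ) => F p.1 *ᵥ p.2 :=
      (hF.comp continuous_fst).matrix_mulVec continuous_snd
    exact continuous_finsetSum _ fun i _ => (((continuous_apply i).comp h1).norm.pow 2)
  have hbound : ∃ r > 0, ∀ x v, ‖v‖ = 1 → r ≤ nsq (F x *ᵥ v) := by
    by_cases hne : K.Nonempty
    · obtain ⟨p, hp, hmin⟩ := hK.exists_isMinOn hne hcont.continuousOn
      refine ⟨nsq (F p.1 *ᵥ p.2), nsq_pos fun h0 => ?_, fun x v hv => hmin (a := (x, v))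
        ⟨trivial, by simpa using hv⟩⟩
      have hp2 : ‖p.2‖ = 1 := by simpa using hp.2
      rw [hdet _ _ h0, norm_zero] at hp2
      exact zero_ne_one hp2
    · exact ⟨1, one_pos, fun x v hv => (hne ⟨(x, v), trivial, by simpa using hv⟩).elim⟩
  obtain ⟨r, hr, hbound⟩ := hbound
  have hnsq : ∀ v : ι → ℂ, nsq v ≤ Fintype.card ι * ‖v‖ ^ 2 := by
    intro v
    unfold nsq
    calc _ ≤ ∑ _i : ι, ‖v‖ ^ 2 := Finset.sum_le_sum fun i _ => by gcongr; exact norm_le_pi_norm v i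
      _ = _ := by simp
  have hsmul : ∀ (c : ℂ) (v : ι → ℂ), nsq (c • v) = ‖c‖ ^ 2 * nsq v := by
    intro c v
    simp [nsq, mul_pow, Finset.mul_sum]
  refine ⟨Real.sqrt (r / (Fintype.card ι + 1)), by positivity, fun x v => ?_⟩
  rw [Real.sq_sqrt (by positivity)]
  by_cases hv : v = 0
  · subst hv
    simp [nsq]
  have hv' : 0 < ‖v‖ := norm_pos_iff.mpr hv
  have h1 := hbound x (((‖v‖)⁻¹ : ℂ) • v) (by
    rw [norm_smul, norm_inv, Complex.norm_real, norm_norm, inv_mul_cancel₀ hv'.ne'])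
  rw [mulVec_smul, hsmul, norm_inv, Complex.norm_real, norm_norm] at h1
  have h2 : r * ‖v‖ ^ 2 ≤ nsq (F x *ᵥ v) := by
    have := mul_le_mul_of_nonneg_right h1 (sq_nonneg ‖v‖)
    rwa [inv_pow, mul_right_comm, inv_mul_cancel₀ (by positivity), one_mul] at this
  calc _ ≤ r / (Fintype.card ι + 1) * ((Fintype.card ι + 1) * ‖v‖ ^ 2) := by
        gcongr
        refine (hnsq v).trans ?_
        gcongr
        linarith
    _ = r * ‖v‖ ^ 2 := by field_simp
    _ ≤ _ := h2

/-- Homotopy invariance of the signature of Toeplitz operators with gapped symbols. -/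
theorem matSig_toep_homotopy (hd : 0 < d) (F : ℝ → (σ → Sph d) → Matrix ι ι ℂ)
    (hcont : Continuous fun p : ℝ × (σ → Sph d) => F p.1 p.2)
    (hsym : ∀ t, IsSymbol a (F t))
    (hinv : ∀ t ∈ Set.Icc (0:ℝ) 1, ∀ x v, F t x *ᵥ v = 0 → v = 0) :
    ∀ᶠ m in atTop, matSig (toep a m (F 0)) = matSig (toep a m (F 1)) := by
  refine isPreconnected_Icc.induction₂ (s := Set.Icc (0:ℝ) 1)
    (fun s t => ∀ᶠ m in atTop, matSig (toep a m (F s)) = matSig (toep a m (F t))) ?_ ?_ ?_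
    (by simp) (by simp)
  · intro t ht
    obtain ⟨g, hg, hgap⟩ := exists_pointwise_gap (hsym t).cont (hinv t ht)
    have hT := eventually_toep_gap hd (hsym t) hg hgap
    set η : ℝ := g / (4 * (Fintype.card ι + 1)) with hη
    have hη0 : 0 < η := by positivity
    have hnear : ∀ᶠ s in nhds t, ∀ x i j, ‖F t x i j - F s x i j‖ ≤ η := by
      have h1 : ∀ i j, ∀ᶠ s in nhds t, ∀ x ∈ Set.univ, ‖F t x i j - F s x i j‖ ≤ η := by
        intro i j
        refine isCompact_univ.eventually_forall_of_forall_eventually fun x _ => ?_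
        have h2 : Continuous fun p : ℝ × (σ → Sph d) => ‖F t p.2 i j - F p.1 p.2 i j‖ :=
          ((((hsym t).cont.comp continuous_snd).matrix_elem i j).sub
            (hcont.matrix_elem i j)).norm
        have h3 := (h2.tendsto (t, x)).eventually_lt_const (u := η) (by simpa using hη0)
        exact h3.mono fun p hp => hp.le
      have h4 : ∀ᶠ s in nhds t, ∀ i j, ∀ x ∈ Set.univ, ‖F t x i j - F s x i j‖ ≤ η := by
        simpa only [eventually_all] using h1
      exact h4.mono fun s hs x i j => hs i j x trivial
    refine nhdsWithin_le_nhds (hnear.mono fun s hs => hT.mono fun m hm => ?_)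
    refine matSig_eq_of_gap (toep_isHermitian (hsym t).herm) (toep_isHermitian (hsym s).herm)
      (η := η * Fintype.card ι) (by positivity) ?_ hm
      (abs_quadForm_sub_le hd (hsym t).cont (hsym s).cont hs hη0.le)
    rw [hη, div_mul_eq_mul_div, div_lt_div_iff₀ (by positivity) (by positivity)]
    nlinarith
  · intro x y z _ _ _ h1 h2
    filter_upwards [h1, h2] with m e1 e2 using e1.trans e2
  · intro x y _ _ h1
    filter_upwards [h1] with m e1 using e1.symm

end Toeplitz

section TwoVariables

variable {σ : Type*} [Fintype σ] [DecidableEq σ] {d : ℕ} {ι : Type*} [Fintype ι] [DecidableEq ι]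

/-- Index sets of equal degree agree. -/
def degCast {d n n' : ℕ} (h : n = n') : DegIdx d n ≃ DegIdx d n' :=
  Equiv.subtypeEquivRight fun _ => by rw [h]

theorem matSig_sigma {κ : Type*} [Fintype κ] [DecidableEq κ] {τ : κ → Type*}
    [∀ k, Fintype (τ k)] [∀ k, DecidableEq (τ k)] (A : Matrix (Σ k, τ k) (Σ k, τ k) ℂ)
    (h : ∀ p q, p.1 ≠ q.1 → A p q = 0) :
    matSig A = ∑ k, matSig (A.submatrix (Sigma.mk k) (Sigma.mk k)) := by
  rw [matSig_block A Sigma.fst h]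
  refine Finset.sum_congr rfl fun k _ => ?_
  exact (matSig_submatrix_equiv _ (Equiv.sigmaSubtype k).symm).symm

/-- Signatures of Toeplitz compressions of block diagonal symbols. -/
theorem matSig_toep_blocks {κ : Type*} [Fintype κ] [DecidableEq κ] {τ : κ → Type*}
    [∀ k, Fintype (τ k)] [∀ k, DecidableEq (τ k)] (e : (Σ k, τ k) ≃ ι)
    {a : ι → σ → ℕ} {a' : ∀ k, τ k → σ → ℕ} {m : σ → ℕ} {m' : κ → σ → ℕ}
    (hw : ∀ k i s, m' k s + a' k i s = m s + a (e ⟨k, i⟩) s)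
    {F : (σ → Sph d) → Matrix ι ι ℂ} {G : ∀ k, (σ → Sph d) → Matrix (τ k) (τ k) ℂ}
    (hG : ∀ x k i j, F x (e ⟨k, i⟩) (e ⟨k, j⟩) = G k x i j)
    (h0 : ∀ x k l i j, k ≠ l → F x (e ⟨k, i⟩) (e ⟨l, j⟩) = 0) :
    matSig (toep a m F) = ∑ k, matSig (toep (a' k) (m' k) (G k)) := by
  let E : (Σ k, ToepIdx d (a' k) (m' k)) ≃ ToepIdx d a m :=
    (Equiv.sigmaAssoc fun k i => ∀ s, DegIdx d (m' k s + a' k i s)).symm.trans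
      (Equiv.sigmaCongr e fun p => Equiv.piCongrRight fun s => degCast (hw p.1 p.2 s))
  have hE1 : ∀ p, (E p).1 = e ⟨p.1, p.2.1⟩ := fun p => rfl
  have hE2 : ∀ p, (E p).expo = p.2.expo := fun p => rfl
  rw [← matSig_submatrix_equiv _ E, matSig_sigma]
  · refine Finset.sum_congr rfl fun k _ => ?_
    congr 1
    ext p q
    simp only [submatrix_apply, of_apply, toep]
    refine integral_congr_ae (Filter.Eventually.of_forall fun x => ?_)
    simp only [hE1, hE2, hG]
  · intro p q hpq
    simp only [submatrix_apply, toep, of_apply, hE1]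
    simp [h0 _ _ _ _ _ hpq]

theorem matSig_toep_anticomm {a : ι → σ → ℕ} {m : σ → ℕ} {F : (σ → Sph d) → Matrix ι ι ℂ}
    (hF : ∀ x, (F x).IsHermitian) (ε : ι → ℂ) (hε : ∀ i, ε i * ε i = 1)
    (h : ∀ x i j, ε i * F x i j = -(F x i j * ε j)) : matSig (toep a m F) = 0 := by
  have hUU : (diagonal fun k : ToepIdx d a m => ε k.1) * diagonal (fun k => ε k.1) = 1 := by
    rw [diagonal_mul_diagonal]
    simp [hε]
  refine matSig_eq_zero_of_conj_neg (toep_isHermitian hF) hUU ?_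
  ext k l
  rw [mul_diagonal, diagonal_mul, neg_apply]
  simp only [toep, of_apply]
  rw [← integral_const_mul, ← integral_mul_const, ← integral_neg]
  congr 1
  ext x
  have h1 : ε k.1 * F x k.1 l.1 * ε l.1 = - F x k.1 l.1 := by
    rw [h, neg_mul, mul_assoc, hε, mul_one]
  linear_combination star (monoN k.expo x) * monoN l.expo x * h1

theorem toep_neg (a : ι → σ → ℕ) (m : σ → ℕ) (F : (σ → Sph d) → Matrix ι ι ℂ) :
    toep a m (fun x => - F x) = - toep a m F := by
  ext k l
  rw [neg_apply]
  have h1 : toep a m (fun x => - F x) k l =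
    ∫ x, star (monoN k.expo x) * (-F x k.1 l.1 * monoN l.expo x) ∂(prodMeas σ d) := rfl
  rw [h1, toep, of_apply, ← integral_neg]
  congr 1
  ext x
  ring

theorem toep_diagonal (hd : 0 < d) (a : ι → σ → ℕ) (m : σ → ℕ) (ε : ι → ℂ) :
    toep a m (fun _ : σ → Sph d => diagonal ε) = diagonal fun k => ε k.1 := by
  ext k l
  have h1 : ∫ x, star (monoN k.expo x) * monoN l.expo x ∂(prodMeas σ d) =
      if k.expo = l.expo then 1 else 0 := by
    rw [← inner_toL2_monoN hd, inner_toL2]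
  simp only [toep, of_apply]
  by_cases hkl : k.1 = l.1
  · obtain ⟨i, p⟩ := k
    obtain ⟨j, q⟩ := l
    obtain rfl : i = j := hkl
    simp only [diagonal_apply_eq]
    have h2 : ∀ x, star (monoN (ToepIdx.expo (⟨i, p⟩ : ToepIdx d a m)) x) *
        (ε i * monoN (ToepIdx.expo (⟨i, q⟩ : ToepIdx d a m)) x) = ε i *
        (star (monoN (ToepIdx.expo (⟨i, p⟩ : ToepIdx d a m)) x) *
        monoN (ToepIdx.expo (⟨i, q⟩ : ToepIdx d a m)) x) := fun x => by ring
    simp only [h2]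
    rw [integral_const_mul, h1]
    by_cases hpq : p = q
    · subst hpq; simp
    · rw [if_neg fun h => hpq (ToepIdx.ext_expo h), diagonal_apply_ne, mul_zero]
      simpa using hpq
  · rw [diagonal_apply_ne _ fun h => hkl (congrArg _ h)]
    simp [diagonal_apply_ne _ hkl]

/-- The number of monomials of given degree. -/
theorem card_degIdx (d n : ℕ) : Fintype.card (DegIdx (d + 1) n) = (n + d).choose d := by
  rw [Fintype.card_congr (Sym.equivNatSumOfFintype (Fin (d + 1)) n).symm, Sym.card_sym_eq_choose,
    Fintype.card_fin, show d + 1 + n - 1 = n + d by omega, Nat.choose_symm_add]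

end TwoVariables

section TwoVariableSignature

variable {d : ℕ} {ι : Type*} [Fintype ι] [DecidableEq ι]

/-- Multiplication of a point of the sphere by a phase. -/
noncomputable def rotS (l : Circle) : Sph d ≃ₜ Sph d := torusAct fun _ => l

theorem rotS_coe (l : Circle) (x : Sph d) :
    (rotS l x : EuclideanSpace ℂ (Fin d)) = (l : ℂ) • (x : EuclideanSpace ℂ (Fin d)) := rfl

/-- The weights of a two variable symbol. -/
def wt2 (a b : ι → ℕ) (i : ι) : Fin 2 → ℕ := ![a i, b i]

/-- The symbol with the second variable conjugated. -/
noncomputable def conj2 (F : Sph d → Sph d → Matrix ι ι ℂ) (x : Fin 2 → Sph d) : Matrix ι ι ℂ :=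
  F (x 0) (conjS (x 1))

/-- The signature of the compression of a symbol to polynomials of bidegree `(m, u)` in
`x` and the conjugate of `y`. -/
noncomputable def sg (a b : ι → ℕ) (F : Sph d → Sph d → Matrix ι ι ℂ) (m u : ℕ) : ℤ :=
  matSig (toep (wt2 a b) ![m, u] (conj2 F))

/-- Continuous Hermitian equivariant two variable symbols. -/
structure IsSym2 (a b : ι → ℕ) (F : Sph d → Sph d → Matrix ι ι ℂ) : Prop where
  cont : Continuous fun p : Sph d × Sph d => F p.1 p.2
  herm : ∀ x y, (F x y).IsHermitian
  equiv : ∀ (l μ : Circle) x y i j,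
    (l : ℂ) ^ a j * (μ : ℂ) ^ b i * F (rotS l x) (rotS μ y) i j =
      (l : ℂ) ^ a i * (μ : ℂ) ^ b j * F x y i j

/-- A symbol is gapped if it is pointwise injective. -/
def Gapped (F : Sph d → Sph d → Matrix ι ι ℂ) : Prop := ∀ x y v, F x y *ᵥ v = 0 → v = 0

theorem conjS_rotS (l : Circle) (x : Sph d) : conjS (rotS l x) = rotS l⁻¹ (conjS x) := by
  ext j
  simp [conjS_apply, rotS_coe, ← Circle.coe_inv_eq_conj]

variable {a b : ι → ℕ} {F G : Sph d → Sph d → Matrix ι ι ℂ}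

theorem IsSym2.isSymbol (h : IsSym2 a b F) : IsSymbol (wt2 a b) (conj2 F) where
  cont := h.cont.comp (f := fun x : Fin 2 → Sph d => (x 0, conjS (x 1)))
    ((continuous_apply 0).prodMk (conjS.continuous.comp (continuous_apply 1)))
  herm x := h.herm _ _
  equiv l x i j := by
    have h1 := h.equiv (l 0) (l 1)⁻¹ (x 0) (conjS (x 1)) i j
    rw [← conjS_rotS] at h1
    have h2 : conj2 F (scalP l x) = F (rotS (l 0) (x 0)) (conjS (rotS (l 1) (x 1))) := rfl
    have hl : (l 1 : ℂ) ≠ 0 := Circle.coe_ne_zero _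
    rw [h2]
    simp only [Fin.prod_univ_two, wt2, cons_val_zero, cons_val_one, conj2]
    rw [Circle.coe_inv, inv_pow, inv_pow] at h1
    field_simp at h1
    linear_combination h1

theorem eventually_two {P : (Fin 2 → ℕ) → Prop} (h : ∀ᶠ m in atTop, P m) :
    ∀ᶠ M in atTop, ∀ m ≥ M, ∀ u ≥ M, P ![m, u] := by
  obtain ⟨m0, hm0⟩ := eventually_atTop.1 h
  filter_upwards [eventually_ge_atTop (max (m0 0) (m0 1))] with M hM m hm u hu
  refine hm0 _ fun s => ?_
  fin_cases s
  · exact ((le_max_left _ _).trans hM).trans hm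
  · exact ((le_max_right _ _).trans hM).trans hu

theorem sg_homotopy (hd : 0 < d) (F : ℝ → Sph d → Sph d → Matrix ι ι ℂ)
    (hcont : Continuous fun p : ℝ × Sph d × Sph d => F p.1 p.2.1 p.2.2)
    (hsym : ∀ t, IsSym2 a b (F t)) (hinv : ∀ t ∈ Set.Icc (0:ℝ) 1, Gapped (F t)) :
    ∀ᶠ M in atTop, ∀ m ≥ M, ∀ u ≥ M, sg a b (F 0) m u = sg a b (F 1) m u := by
  refine eventually_two (P := fun m => matSig (toep (wt2 a b) m (conj2 (F 0))) =
    matSig (toep (wt2 a b) m (conj2 (F 1)))) (matSig_toep_homotopy hd (fun t => conj2 (F t)) ?_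
    (fun t => (hsym t).isSymbol) fun t ht x v => hinv t ht _ _ v)
  exact hcont.comp (f := fun p : ℝ × (Fin 2 → Sph d) => (p.1, p.2 0, conjS (p.2 1)))
    (continuous_fst.prodMk (((continuous_apply 0).comp continuous_snd).prodMk
      (conjS.continuous.comp ((continuous_apply 1).comp continuous_snd))))

theorem sg_blocks {κ : Type*} [Fintype κ] [DecidableEq κ] {τ : κ → Type*}
    [∀ k, Fintype (τ k)] [∀ k, DecidableEq (τ k)] (e : (Σ k, τ k) ≃ ι)
    {a' b' : ∀ k, τ k → ℕ} {m u : ℕ} {m' u' : κ → ℕ}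
    (hwa : ∀ k i, m' k + a' k i = m + a (e ⟨k, i⟩))
    (hwb : ∀ k i, u' k + b' k i = u + b (e ⟨k, i⟩))
    {G : ∀ k, Sph d → Sph d → Matrix (τ k) (τ k) ℂ}
    (hG : ∀ x y k i j, F x y (e ⟨k, i⟩) (e ⟨k, j⟩) = G k x y i j)
    (h0 : ∀ x y k l i j, k ≠ l → F x y (e ⟨k, i⟩) (e ⟨l, j⟩) = 0) :
    sg a b F m u = ∑ k, sg (a' k) (b' k) (G k) (m' k) (u' k) :=
  matSig_toep_blocks e (a' := fun k => wt2 (a' k) (b' k)) (m' := fun k => ![m' k, u' k])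
    (fun k i s => by fin_cases s; exacts [hwa k i, hwb k i]) (fun _ _ _ _ => hG _ _ _ _ _)
    (fun _ _ _ _ _ h => h0 _ _ _ _ _ _ h)

theorem sg_anticomm (hF : ∀ x y, (F x y).IsHermitian) (ε : ι → ℂ) (hε : ∀ i, ε i * ε i = 1)
    (h : ∀ x y i j, ε i * F x y i j = -(F x y i j * ε j)) (m u : ℕ) : sg a b F m u = 0 :=
  matSig_toep_anticomm (fun _ => hF _ _) ε hε fun _ _ _ => h _ _ _ _

theorem sg_neg (hF : ∀ x y, (F x y).IsHermitian) (m u : ℕ) :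
    sg a b (fun x y => - F x y) m u = - sg a b F m u := by
  unfold sg
  rw [← matSig_neg (toep_isHermitian (F := conj2 F) fun _ => hF _ _), ← toep_neg]
  rfl

theorem card_toepIdx_two (m u : ℕ) : Fintype.card (ToepIdx d (wt2 a b) ![m, u]) =
    ∑ i, Fintype.card (DegIdx d (m + a i)) * Fintype.card (DegIdx d (u + b i)) := by
  rw [Fintype.card_sigma]
  refine Finset.sum_congr rfl fun i _ => ?_
  rw [Fintype.card_pi, Fin.prod_univ_two]
  rfl

theorem sg_smul_one (hd : 0 < d) (ε : ℤ) (hε : ε = 1 ∨ ε = -1) (m u : ℕ) :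
    sg a b (fun _ _ : Sph d => diagonal fun _ => (ε : ℂ)) m u =
    ε * ∑ i, (Fintype.card (DegIdx d (m + a i)) * Fintype.card (DegIdx d (u + b i)) : ℤ) := by
  have h1 : matSig (toep (wt2 a b) ![m, u] (fun _ : Fin 2 → Sph d => diagonal fun _ => (ε : ℂ))) =
    ε * (∑ i, Fintype.card (DegIdx d (m + a i)) * Fintype.card (DegIdx d (u + b i)) : ℕ) := by
    rw [toep_diagonal hd, matSig_diagonal, ← card_toepIdx_two]
    rcases hε with rfl | rfl <;> simp
  push_cast at h1
  exact h1

theorem sg_gapped (hd : 0 < d) (hF : IsSym2 a b F) (hg : Gapped F) :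
    ∀ᶠ M in atTop, ∀ m ≥ M, ∀ u ≥ M, ∀ v, toep (wt2 a b) ![m, u] (conj2 F) *ᵥ v = 0 → v = 0 := by
  obtain ⟨g, hg0, hgap⟩ := exists_pointwise_gap hF.isSymbol.cont (fun x v => hg _ _ v)
  refine eventually_two (P := fun m => ∀ v, toep (wt2 a b) m (conj2 F) *ᵥ v = 0 → v = 0)
    ((eventually_toep_gap hd hF.isSymbol hg0 hgap).mono fun m hm v hv => ?_)
  by_contra hne
  have h1 := hm v
  rw [hv] at h1
  have h2 : nsq (0 : ToepIdx d (wt2 a b) m → ℂ) = 0 := by simp [nsq]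
  have h3 := nsq_pos hne
  rw [h2] at h1
  have : 0 < (g / 2) ^ 2 * nsq v := by positivity
  linarith

theorem sg_even (hd : 0 < d) (hF : IsSym2 a b F) (hg : Gapped F) (hι : 2 ∣ Fintype.card ι)
    (ha : ∀ i, a i = 0) (hb : ∀ i, b i = 0) :
    ∀ᶠ M in atTop, ∀ m ≥ M, ∀ u ≥ M, 2 ∣ sg a b F m u := by
  filter_upwards [sg_gapped hd hF hg] with M hM m hm u hu
  rw [sg, matSig_eq_two_mul_posIdx (toep_isHermitian (F := conj2 F) fun _ => hF.herm _ _) (hM m hm u hu),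
    card_toepIdx_two]
  simp only [ha, hb, add_zero, Finset.sum_const, Finset.card_univ, smul_eq_mul]
  refine dvd_sub (dvd_mul_right _ _) ?_
  exact_mod_cast Dvd.dvd.mul_right hι _

/-- The normalised monomials on a single sphere. -/
noncomputable def monoS (γ : Fin d → ℕ) (x : Sph d) : ℂ :=
  ((Real.sqrt (monoNorm γ))⁻¹ : ℂ) * cmono γ fun j => (x : EuclideanSpace ℂ (Fin d)) j

theorem monoN_eq_prod {σ : Type*} [Fintype σ] [DecidableEq σ] (γ : σ → Fin d → ℕ)
    (x : σ → Sph d) : monoN γ x = ∏ s, monoS (γ s) (x s) := by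
  simp only [monoS, Finset.prod_mul_distrib, monoN, ContinuousMap.smul_apply, smul_eq_mul]
  congr 1
  · rw [monoPNorm, Real.sqrt_prod]
    · push_cast
      rw [Finset.prod_inv_distrib]
    · exact fun s _ => integral_nonneg fun _ => by positivity
  · rw [monoP_apply]
    rfl

theorem integral_monoS (hd : 0 < d) (γ γ' : Fin d → ℕ) :
    ∫ x, star (monoS γ x) * monoS γ' x ∂(sphMeas d) = if γ = γ' then 1 else 0 := by
  have key : ∀ γ γ' : Fin d → ℕ,
      (∫ x, star (monoS γ x) * monoS γ' x ∂(sphMeas d)) = if γ = γ' then 1 else 0 := by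
    intro γ γ'
    have h := inner_toL2_monoN (σ := Unit) hd (fun _ => γ) (fun _ => γ')
    rw [inner_toL2] at h
    have h2 : ∀ x : Unit → Sph d, star (monoN (fun _ => γ) x) * monoN (fun _ => γ') x =
        ∏ s : Unit, star (monoS γ (x s)) * monoS γ' (x s) := fun x => by
      simp [monoN_eq_prod]
    simp only [h2] at h
    rw [prodMeas, integral_fintype_prod_eq_prod (fun _ x => star (monoS γ x) * monoS γ' x)] at h
    simp only [Finset.univ_unique, Finset.prod_const, Finset.card_singleton, pow_one] at h
    rw [h]
    refine if_congr ⟨fun h => congrFun h (), fun h => by rw [h]⟩ rfl rfl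
  exact key γ γ'

/-- Symbols depending on the first variable only. -/
theorem sg_tensor (hd : 0 < d) {b₀ : ℕ} (hb : ∀ i, b i = b₀) (G : Sph d → Matrix ι ι ℂ) (m : ℕ) :
    ∃ ρ : ℤ, ∀ u, sg a b (fun x _ => G x) m u = ρ * Fintype.card (DegIdx d (u + b₀)) := by
  let R : Matrix (Σ i, DegIdx d (m + a i)) (Σ i, DegIdx d (m + a i)) ℂ :=
    Matrix.of fun k l => ∫ x, star (monoS k.2.1 x) * (G x k.1 l.1 * monoS l.2.1 x) ∂(sphMeas d)
  refine ⟨matSig R, fun u => ?_⟩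
  let E : (Σ _ : DegIdx d (u + b₀), Σ i, DegIdx d (m + a i)) ≃ ToepIdx d (wt2 a b) ![m, u] :=
    { toFun := fun p => ⟨p.2.1, (piFinTwoEquiv _).symm
        (p.2.2, degCast (congrArg (u + ·) (hb p.2.1).symm) p.1)⟩
      invFun := fun k => ⟨degCast (congrArg (u + ·) (hb k.1)) (k.2 1), k.1, k.2 0⟩
      left_inv := fun p => rfl
      right_inv := fun k => by
        obtain ⟨i, q⟩ := k
        refine Sigma.ext rfl (heq_of_eq ?_)
        funext s
        fin_cases s <;> rfl }
  have hE1 : ∀ p, (E p).1 = p.2.1 := fun _ => rfl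
  have hE2 : ∀ p, (E p).expo 0 = p.2.2.1 := fun _ => rfl
  have hE3 : ∀ p, (E p).expo 1 = p.1.1 := fun _ => rfl
  have hent : ∀ p q, toep (wt2 a b) ![m, u] (conj2 fun x _ => G x) (E p) (E q) =
      R p.2 q.2 * if p.1.1 = q.1.1 then 1 else 0 := by
    intro p q
    rw [← integral_monoS hd]
    simp only [toep, of_apply, R, hE1, conj2]
    let f : Fin 2 → Sph d → ℂ :=
      ![fun x => star (monoS p.2.2.1 x) * (G x p.2.1 q.2.1 * monoS q.2.2.1 x),
        fun x => star (monoS p.1.1 x) * monoS q.1.1 x]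
    have h3 := integral_fintype_prod_eq_prod (μ := fun _ : Fin 2 => sphMeas d) f
    rw [Fin.prod_univ_two] at h3
    refine Eq.trans ?_ h3
    refine integral_congr_ae (Filter.Eventually.of_forall fun x => ?_)
    simp only [monoN_eq_prod, Fin.prod_univ_two, hE2, hE3, f, cons_val_zero, cons_val_one, star_mul]
    ring
  rw [sg, ← matSig_submatrix_equiv _ E, matSig_sigma]
  · rw [Finset.sum_congr rfl (g := fun _ => matSig R) fun k _ => ?_]
    · simp [mul_comm]
    · congr 1
      ext p q
      rw [submatrix_apply, submatrix_apply, hent]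
      simp
  · intro p q hpq
    rw [submatrix_apply, hent, if_neg, mul_zero]
    exact fun h => hpq (Subtype.ext h)

/-- Exchange and conjugate the two variables. -/
noncomputable def flip2 (x : Fin 2 → Sph d) : Fin 2 → Sph d := ![conjS (x 1), conjS (x 0)]

theorem flip2_flip2 (x : Fin 2 → Sph d) : flip2 (flip2 x) = x := by
  funext s
  fin_cases s <;> exact conjS_conjS _

theorem continuous_flip2 : Continuous (flip2 (d := d)) := by
  refine continuous_pi fun s => ?_
  fin_cases s
  · exact conjS.continuous.comp (continuous_apply 1)
  · exact conjS.continuous.comp (continuous_apply 0)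

theorem integral_flip2 (f : (Fin 2 → Sph d) → ℂ) :
    ∫ x, f (flip2 x) ∂(prodMeas (Fin 2) d) = ∫ x, f x ∂(prodMeas (Fin 2) d) := by
  let φ : (Fin 2 → Sph d) ≃ₜ (Fin 2 → Sph d) :=
    ⟨⟨flip2, flip2, flip2_flip2, flip2_flip2⟩, continuous_flip2, continuous_flip2⟩
  have h1 : MeasurePreserving (fun (x : Fin 2 → Sph d) s => conjS (x s))
      (prodMeas (Fin 2) d) (prodMeas (Fin 2) d) :=
    measurePreserving_pi _ _ fun s => measurePreserving_conjS
  have h2 := measurePreserving_piCongrLeft (fun _ : Fin 2 => sphMeas d) (Equiv.swap 0 1)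
  have h3 : MeasurePreserving φ (prodMeas (Fin 2) d) (prodMeas (Fin 2) d) := by
    have h4 := h1.comp h2
    have h5 : ((fun (x : Fin 2 → Sph d) s => conjS (x s)) ∘
        (MeasurableEquiv.piCongrLeft (fun _ : Fin 2 => Sph d) (Equiv.swap 0 1))) = φ := by
      funext x s
      fin_cases s <;> rfl
    rwa [h5] at h4
  exact h3.integral_comp φ.measurableEmbedding f

theorem star_monoS_conjS (γ : Fin d → ℕ) (x : Sph d) :
    monoS γ (conjS x) = star (monoS γ x) := by
  simp [monoS, cmono, conjS_apply]

/-- A quaternionic structure exchanging the variables makes the signature divisible by four. -/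
theorem four_dvd_sg (hd : 0 < d) (hF : IsSym2 (fun _ => 0) (fun _ => 0) F) (hg : Gapped F)
    (hι : 4 ∣ Fintype.card ι) (V : Matrix ι ι ℂ) (hVV : V * V.map star = -1)
    (hV : ∀ x y, V * (F y x).map star = F x y * V) :
    ∀ᶠ M in atTop, ∀ m ≥ M, 4 ∣ sg (fun _ => 0) (fun _ => 0) F m m := by
  filter_upwards [sg_gapped hd hF hg] with M hM m hm
  rw [sg, matSig_eq_two_mul_posIdx (toep_isHermitian (F := conj2 F) fun _ => hF.herm _ _)
    (hM m hm m hm), card_toepIdx_two]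
  simp only [add_zero, Finset.sum_const, Finset.card_univ, smul_eq_mul]
  refine dvd_sub ?_ ?_
  swap
  · exact_mod_cast Dvd.dvd.mul_right hι _
  let E : ι × DegIdx d m × DegIdx d m ≃
      ToepIdx d (wt2 (fun _ : ι => 0) (fun _ => 0)) ![m, m] :=
    { toFun := fun p => ⟨p.1, (piFinTwoEquiv _).symm p.2⟩
      invFun := fun k => ⟨k.1, k.2 0, k.2 1⟩
      left_inv := fun p => rfl
      right_inv := fun k => by
        obtain ⟨i, q⟩ := k
        refine Sigma.ext rfl (heq_of_eq ?_)
        funext s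
        fin_cases s <;> rfl }
  have hE1 : ∀ p, (E p).1 = p.1 := fun _ => rfl
  have hE2 : ∀ p, (E p).expo 0 = p.2.1.1 := fun _ => rfl
  have hE3 : ∀ p, (E p).expo 1 = p.2.2.1 := fun _ => rfl
  let P : Matrix (DegIdx d m × DegIdx d m) (DegIdx d m × DegIdx d m) ℂ :=
    Matrix.of fun p q => if p.swap = q then 1 else 0
  let W : Matrix (ι × DegIdx d m × DegIdx d m) (ι × DegIdx d m × DegIdx d m) ℂ :=
    Matrix.of fun p q => V p.1 q.1 * P p.2 q.2
  let A := toep (wt2 (fun _ : ι => 0) (fun _ => 0)) ![m, m] (conj2 F)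
  let B := A.submatrix E E
  have hB : ∀ p q, B p q = ∫ x, star (monoS p.2.1.1 (x 0) * monoS p.2.2.1 (x 1)) *
      (F (x 0) (conjS (x 1)) p.1 q.1 * (monoS q.2.1.1 (x 0) * monoS q.2.2.1 (x 1)))
      ∂(prodMeas (Fin 2) d) := by
    intro p q
    simp only [B, A, submatrix_apply, toep, of_apply, hE1, conj2]
    refine integral_congr_ae (Filter.Eventually.of_forall fun x => ?_)
    simp only [monoN_eq_prod, Fin.prod_univ_two, hE2, hE3]
  have hWl : ∀ (X : Matrix (ι × DegIdx d m × DegIdx d m) (ι × DegIdx d m × DegIdx d m) ℂ) p q,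
      (W * X) p q = ∑ r, V p.1 r * X (r, p.2.swap) q := by
    intro X p q
    simp only [W, P, mul_apply, of_apply]
    rw [Fintype.sum_prod_type]
    simp
  have hWr : ∀ (X : Matrix (ι × DegIdx d m × DegIdx d m) (ι × DegIdx d m × DegIdx d m) ℂ) p q,
      (X * W) p q = ∑ r, X p (r, q.2.swap) * V r q.1 := by
    intro X p q
    have h : ∀ a b : DegIdx d m × DegIdx d m, a.swap = b ↔ b.swap = a := fun a b =>
      ⟨fun h => by rw [← h, Prod.swap_swap], fun h => by rw [← h, Prod.swap_swap]⟩
    simp only [W, P, mul_apply, of_apply, h _ q.2]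
    rw [Fintype.sum_prod_type]
    simp
  have hWW : W * W.map star = -1 := by
    ext p q
    rw [hWl]
    have h := congrFun (congrFun hVV p.1) q.1
    rw [mul_apply] at h
    by_cases hpq : p.2 = q.2
    · simp only [W, P, map_apply, of_apply, Prod.swap_swap, hpq, if_true, mul_one] at h ⊢
      rw [show ∑ x, V p.1 x * star (V x q.1) = _ from h]
      simp [one_apply, Prod.ext_iff, hpq]
    · have hpq' : p ≠ q := fun h => hpq (by rw [h])
      simp only [W, P, map_apply, of_apply, Prod.swap_swap, hpq, if_false, mul_zero, star_zero,
        Finset.sum_const_zero]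
      exact (by rw [Matrix.neg_apply, one_apply_ne hpq', neg_zero] : (-1 : Matrix _ _ ℂ) p q = 0).symm
  have hWB : W * B.map star = B * W := by
    ext p q
    have hci : ∀ i j, Continuous fun x : Fin 2 → Sph d => F (x 0) (conjS (x 1)) i j := fun i j =>
      Continuous.matrix_elem (A := fun x : Fin 2 → Sph d => F (x 0) (conjS (x 1)))
        (hF.cont.comp (by fun_prop : Continuous fun x : Fin 2 → Sph d => (x 0, conjS (x 1)))) i j
    have hmc : ∀ (γ : Fin d → ℕ) s, Continuous fun x : Fin 2 → Sph d => monoS γ (x s) :=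
      fun γ s => by unfold monoS cmono; fun_prop
    have hl : ∀ r, V p.1 r * star (B (r, p.2.swap) q) = ∫ x, V p.1 r *
        (star (monoS p.2.1.1 (x 0) * monoS p.2.2.1 (x 1)) *
          (star (F (conjS (x 1)) (x 0) r q.1) * (monoS q.2.2.1 (x 0) * monoS q.2.1.1 (x 1))))
        ∂(prodMeas (Fin 2) d) := by
      intro r
      rw [integral_const_mul, hB, ← integral_flip2, Complex.star_def, ← integral_conj]
      congr 2
      funext x
      simp only [flip2, cons_val_zero, cons_val_one, star_monoS_conjS, conjS_conjS,
        map_mul, Prod.fst_swap, Prod.snd_swap, ← Complex.star_def, star_star]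
      ring
    have hr : ∀ r, B p (r, q.2.swap) * V r q.1 = ∫ x,
        (star (monoS p.2.1.1 (x 0) * monoS p.2.2.1 (x 1)) *
          (F (x 0) (conjS (x 1)) p.1 r * (monoS q.2.2.1 (x 0) * monoS q.2.1.1 (x 1))))
        * V r q.1 ∂(prodMeas (Fin 2) d) := fun r => by
      rw [integral_mul_const, hB]
      rfl
    rw [hWl, hWr]
    simp only [map_apply, hl, hr]
    rw [← integral_finsetSum, ← integral_finsetSum]
    · congr 1
      funext x
      have h := congrFun (congrFun (hV (x 0) (conjS (x 1))) p.1) q.1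
      simp only [mul_apply, map_apply] at h
      rw [show ∑ i, V p.1 i * (star (monoS p.2.1.1 (x 0) * monoS p.2.2.1 (x 1)) *
          (star (F (conjS (x 1)) (x 0) i q.1) * (monoS q.2.2.1 (x 0) * monoS q.2.1.1 (x 1))))
          = star (monoS p.2.1.1 (x 0) * monoS p.2.2.1 (x 1)) *
            (monoS q.2.2.1 (x 0) * monoS q.2.1.1 (x 1)) *
            ∑ i, V p.1 i * star (F (conjS (x 1)) (x 0) i q.1) by
          rw [Finset.mul_sum]; exact Finset.sum_congr rfl fun i _ => by ring, h, Finset.mul_sum]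
      exact Finset.sum_congr rfl fun i _ => by ring
    · exact fun r _ => integrable_of_continuous
        ((((hmc _ 0).mul (hmc _ 1)).star.mul ((hci p.1 r).mul ((hmc _ 0).mul (hmc _ 1)))).mul
          continuous_const)
    · refine fun r _ => integrable_of_continuous ?_
      have h : Continuous fun x : Fin 2 → Sph d => F (conjS (x 1)) (x 0) r q.1 :=
        Continuous.matrix_elem (A := fun x : Fin 2 → Sph d => F (conjS (x 1)) (x 0))
          (hF.cont.comp (by fun_prop : Continuous fun x : Fin 2 → Sph d => (conjS (x 1), x 0))) r q.1
      exact continuous_const.mul (((hmc _ 0).mul (hmc _ 1)).star.mul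
        (h.star.mul ((hmc _ 0).mul (hmc _ 1))))
  have hA : A = B.submatrix E.symm E.symm := by simp [B]
  have h2 := even_posIdx (toep_isHermitian (F := conj2 F) fun _ => hF.herm _ _)
    (A := A) (G := W.submatrix E.symm E.symm)
    (by rw [hA, ← submatrix_map, submatrix_mul_equiv, submatrix_mul_equiv, hWB])
    (by rw [← submatrix_map, submatrix_mul_equiv, hWW]; ext; simp [one_apply])
  obtain ⟨r, hr⟩ := h2
  rw [hr]
  exact ⟨r, by push_cast; ring⟩

end TwoVariableSignature

end MeasureOpens

section FinsetOpens

open Finset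

section Numerics

/-- The shift operator on rational sequences. -/
noncomputable def seqShift : Module.End ℚ (ℕ → ℚ) := LinearMap.funLeft ℚ ℚ (· + 1)

theorem natCast_seqEnd (c : ℕ) : (c : Module.End ℚ (ℕ → ℚ)) = (c : ℚ) • 1 := by
  rw [Nat.cast_smul_eq_nsmul, nsmul_one]

theorem seqShift_pow_apply (k : ℕ) (g : ℕ → ℚ) (t : ℕ) : (seqShift ^ k) g t = g (t + k) := by
  induction k generalizing t with
  | zero => rfl
  | succ k ih => rw [pow_succ', Module.End.mul_apply, seqShift, LinearMap.funLeft_apply, ← seqShift,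
      ih, add_right_comm, add_assoc]

/-- Truncated inverse of `(1 - y) ^ e` for locally nilpotent `y`. -/
theorem one_sub_pow_mul_sum {V : Type*} [AddCommGroup V] [Module ℚ V] (y : Module.End ℚ V) (v : V)
    (n : ℕ) (hv : (y ^ (n + 1)) v = 0) (e : ℕ) :
    ((1 - y) ^ e) ((∑ j ∈ range (n + 1), ((e + j - 1).choose j : ℚ) • y ^ j) v) = v := by
  induction e with
  | zero =>
    rw [sum_range_succ']
    simp
  | succ e ih =>
    have key : ∀ k : ℕ, (1 - y) * ∑ j ∈ range (k + 1), ((e + 1 + j - 1).choose j : ℚ) • y ^ j =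
        ∑ j ∈ range (k + 1), ((e + j - 1).choose j : ℚ) • y ^ j
          - ((e + k).choose k : ℚ) • y ^ (k + 1) := by
      intro k
      induction k with
      | zero => simp
      | succ k ihk =>
        rw [sum_range_succ, mul_add, ihk, sum_range_succ _ (k + 1)]
        have h1 : e + 1 + (k + 1) - 1 = e + k + 1 := by omega
        have h2 : e + (k + 1) - 1 = e + k := by omega
        have h3 : e + (k + 1) = e + k + 1 := by omega
        rw [h1, h2, h3, Nat.choose_succ_succ, mul_smul_comm, sub_mul, one_mul, ← pow_succ']
        push_cast
        module
    rw [pow_succ, Module.End.mul_apply, ← Module.End.mul_apply (1 - y), key, LinearMap.sub_apply,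
      LinearMap.smul_apply, hv, smul_zero, sub_zero, ih]

theorem seqShift_sub_one_pow_choose (n j : ℕ) (hj : j ≤ n) :
    ((seqShift - 1) ^ j) (fun t => (t.choose n : ℚ)) = fun t => (t.choose (n - j) : ℚ) := by
  induction j with
  | zero => rfl
  | succ j ih =>
    rw [pow_succ', Module.End.mul_apply, ih (by omega)]
    funext t
    obtain ⟨i, hi⟩ : ∃ i, n - j = i + 1 := ⟨n - j - 1, by omega⟩
    have hi' : n - (j + 1) = i := by omega
    simp [seqShift, LinearMap.sub_apply, LinearMap.funLeft_apply, hi, hi', Nat.choose_succ_succ]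

/-- Solving `(1 + E) ^ d g = c * choose · n` among sequences killed by `(1 - E) ^ d`. -/
theorem eq_sum_choose_of_shift (n : ℕ) (g : ℕ → ℚ) (c : ℚ)
    (h1 : ∀ t, ∑ k ∈ range (n + 2), ((n + 1).choose k : ℚ) * g (t + k) = c * t.choose n)
    (h2 : ∀ t, ∑ k ∈ range (n + 2), (-1 : ℚ) ^ (n + 1 - k) * (n + 1).choose k * g (t + k) = 0)
    (t : ℕ) :
    g t = c / 2 ^ (n + 1) *
      ∑ j ∈ range (n + 1), ((n + j).choose j : ℚ) * (-1 / 2) ^ j * t.choose (n - j) := by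
  set y : Module.End ℚ (ℕ → ℚ) := (-1 / 2 : ℚ) • (seqShift - 1) with hy
  have hyg : (y ^ (n + 1)) g = 0 := by
    have h : ((seqShift - 1) ^ (n + 1)) g = 0 := by
      funext t
      rw [sub_eq_add_neg, (Commute.neg_one_right seqShift).add_pow, LinearMap.sum_apply,
        Finset.sum_apply, Pi.zero_apply, ← h2 t]
      refine sum_congr rfl fun k _ => ?_
      have hs : ∀ m : ℕ, (-1 : Module.End ℚ (ℕ → ℚ)) ^ m = ((-1 : ℚ) ^ m) • 1 := by
        intro m
        rw [← one_pow (M := Module.End ℚ (ℕ → ℚ)) m, ← smul_pow, one_pow, neg_one_smul]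
      rw [hs, natCast_seqEnd, mul_smul_comm, mul_smul_comm, mul_one, mul_one, LinearMap.smul_apply,
        LinearMap.smul_apply, Pi.smul_apply, Pi.smul_apply, seqShift_pow_apply, smul_eq_mul,
        smul_eq_mul]
      ring
    rw [hy, smul_pow, LinearMap.smul_apply, h, smul_zero]
  have hyc : ((1 - y) ^ (n + 1)) g = (c / 2 ^ (n + 1)) • fun t => (t.choose n : ℚ) := by
    have h : 1 - y = (1 / 2 : ℚ) • (seqShift + 1) := by rw [hy]; module
    rw [h, smul_pow, LinearMap.smul_apply]
    funext t
    rw [(Commute.one_right seqShift).add_pow, Pi.smul_apply, LinearMap.sum_apply, Finset.sum_apply,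
      Pi.smul_apply, smul_eq_mul, smul_eq_mul, div_mul_eq_mul_div, ← h1 t, div_pow, one_pow,
      one_div_mul_eq_div]
    congr 1
    refine sum_congr rfl fun k _ => ?_
    rw [natCast_seqEnd, one_pow, mul_one, mul_smul_comm, mul_one, LinearMap.smul_apply, Pi.smul_apply,
      seqShift_pow_apply, smul_eq_mul]
  have h3 := one_sub_pow_mul_sum y g n hyg (n + 1)
  have hcomm : Commute ((1 - y) ^ (n + 1))
      (∑ j ∈ range (n + 1), ((n + 1 + j - 1).choose j : ℚ) • y ^ j) :=
    Commute.sum_right _ _ _ fun j _ =>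
      (((Commute.one_left y).sub_left (Commute.refl y)).pow_pow _ _).smul_right _
  rw [← Module.End.mul_apply, hcomm.eq, Module.End.mul_apply, hyc, map_smul] at h3
  rw [← h3, Pi.smul_apply, smul_eq_mul, LinearMap.sum_apply, Finset.sum_apply]
  congr 1
  refine sum_congr rfl fun j hj => ?_
  rw [LinearMap.smul_apply, hy, smul_pow, LinearMap.smul_apply,
    seqShift_sub_one_pow_choose n j (by simpa [Nat.lt_succ_iff] using hj)]
  simp only [Pi.smul_apply, smul_eq_mul]
  rw [show n + 1 + j - 1 = n + j by omega]
  ring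

theorem sum_choose_mul_choose_half (q : ℕ) :
    ∑ j ∈ range (2 * q + 1), ((2 * q + j).choose j : ℚ) * (-1 / 2) ^ j * (2 * q).choose (2 * q - j)
      = (-1 / 4) ^ q * (2 * q).choose q := by
  open Polynomial in
  have h : (∑ j ∈ range (2 * q + 1), C (((2 * q).choose j : ℚ) * (-1) ^ j) *
      (X + C (1 / 2)) ^ (2 * q + j) : ℚ[X]) =
      ∑ j ∈ range (2 * q + 1), C ((-1) ^ j * (1 / 4) ^ (2 * q - j) * ((2 * q).choose j : ℚ)) *
        X ^ (2 * j) := by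
    trans (((X + C (1 / 2)) * (1 - (X + C (1 / 2)))) ^ (2 * q) : ℚ[X])
    · generalize (X + C (1 / 2) : ℚ[X]) = Z
      rw [mul_pow, sub_eq_add_neg, add_comm 1, add_pow, mul_sum]
      refine sum_congr rfl fun j _ => ?_
      rw [one_pow, mul_one, neg_pow Z, pow_add, C_mul, C_pow, C_neg, C_1, C_eq_natCast]
      ring
    · rw [show ((X + C (1 / 2)) * (1 - (X + C (1 / 2))) : ℚ[X]) = -X ^ 2 + C (1 / 4) by
        have h1 : (1 : ℚ[X]) = C (1 / 2) + C (1 / 2) := by rw [← C_add]; norm_num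
        have h2 : (C (1 / 4) : ℚ[X]) = C (1 / 2) * C (1 / 2) := by rw [← C_mul]; norm_num
        rw [h2, h1]; ring, add_pow]
      refine sum_congr rfl fun j _ => ?_
      rw [neg_pow (X ^ 2 : ℚ[X]), ← pow_mul, C_mul, C_mul, C_pow, C_pow, C_neg, C_1, C_eq_natCast]
      ring
  have h2 := congrArg (fun p => Polynomial.coeff p (2 * q)) h
  simp only [Polynomial.finsetSum_coeff, Polynomial.coeff_C_mul, Polynomial.coeff_X_add_C_pow,
    Polynomial.coeff_X_pow] at h2
  rw [Finset.sum_eq_single_of_mem (s := range (2 * q + 1))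
    (f := fun x => (-1 : ℚ) ^ x * (1 / 4) ^ (2 * q - x) * ((2 * q).choose x : ℚ) *
      if 2 * q = 2 * x then 1 else 0) q (by simp; omega)] at h2
  · rw [show (-1 / 4 : ℚ) = (-1) * (1 / 4) by norm_num, mul_pow]
    rw [show 2 * q - q = q by omega] at h2
    simp only [if_true, mul_one] at h2
    rw [← h2]
    refine sum_congr rfl fun j hj => ?_
    have hj' : j ≤ 2 * q := by simpa [Nat.lt_succ_iff] using hj
    rw [Nat.choose_symm hj', Nat.choose_symm_add (a := 2 * q) (b := j), add_tsub_cancel_left,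
      show (-1 / 2 : ℚ) = (-1) * (1 / 2) by norm_num, mul_pow]
    ring
  · intro j _ hj
    rw [if_neg (by omega), mul_zero]

theorem eq_zero_of_fwdDiff_iter (d : ℕ) (φ : ℤ → ℤ) (hφ : (fwdDiff (1 : ℤ))^[d] φ = 0) (T : ℤ)
    (h : (∀ t ≥ T, φ t = 0) ∨ ∀ t ≤ T, φ t = 0) (t : ℤ) : φ t = 0 := by
  induction d generalizing φ T t with
  | zero => exact congrFun hφ t
  | succ d ih =>
    have h1 : ∀ t, φ (t + 1) - φ t = 0 := by
      rcases h with h | h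
      · exact ih (fwdDiff 1 φ) hφ T <| Or.inl fun t ht => by
          rw [fwdDiff, h _ (by omega), h _ (by omega), sub_zero]
      · exact ih (fwdDiff 1 φ) hφ (T - 1) <| Or.inr fun t ht => by
          rw [fwdDiff, h _ (by omega), h _ (by omega), sub_zero]
    have h2 : ∀ t, φ t = φ T := by
      intro t
      induction t using Int.inductionOn' (b := T) with
      | zero => rfl
      | succ k _ hk => rw [← hk]; linarith [h1 k]
      | pred k _ hk => rw [← hk]; have := h1 (k - 1); rw [sub_add_cancel] at this; linarith
    rw [h2]
    rcases h with h | h <;> exact h _ le_rfl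

theorem fwdDiff_iter_ringChoose (n : ℕ) (a : ℤ) :
    (fwdDiff (1 : ℤ))^[n + 1] (fun t => Ring.choose (t + a) n) = 0 := by
  induction n with
  | zero => funext t; simp [fwdDiff]
  | succ n ih =>
    rw [Function.iterate_succ_apply, ← ih]
    congr 1
    funext t
    rw [fwdDiff, show t + 1 + a = t + a + 1 by ring, Ring.choose_succ_succ]
    ring

theorem sum_digits_two_mul (n : ℕ) : (Nat.digits 2 (2 * n)).sum = (Nat.digits 2 n).sum := by
  rcases Nat.eq_zero_or_pos n with rfl | hn
  · rfl
  · rw [Nat.digits_def' (by norm_num) (by omega)]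
    simp

theorem padicValNat_centralBinom (n : ℕ) :
    padicValNat 2 ((2 * n).choose n) = (Nat.digits 2 n).sum := by
  have h := sub_one_mul_padicValNat_choose_eq_sub_sum_digits (p := 2) (k := n) (n := 2 * n) (by omega)
  rw [show 2 * n - n = n by omega, sum_digits_two_mul] at h
  omega

/-- An integer with the absolute value of `choose (2 n) n / 2 ^ α` is odd. -/
theorem not_two_dvd_of_abs_eq (n : ℕ) (x : ℤ)
    (hx : 2 ^ (Nat.digits 2 n).sum * |x| = (2 * n).choose n) : ¬ 2 ∣ x := by
  rintro ⟨y, rfl⟩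
  have h : 2 ^ ((Nat.digits 2 n).sum + 1) ∣ (2 * n).choose n := by
    have : ((2 ^ ((Nat.digits 2 n).sum + 1) : ℕ) : ℤ) ∣ ((2 * n).choose n : ℕ) := by
      rw [← hx, abs_mul]
      push_cast
      exact ⟨|y|, by simp; ring⟩
    exact_mod_cast this
  rw [padicValNat_dvd_iff_le (Nat.choose_pos (by omega)).ne', padicValNat_centralBinom] at h
  omega

theorem abs_mul_of_cast_eq {x σ : ℤ} (hσ : |σ| = 1) {n k c : ℕ} {e : ℚ} (he : |e| = 1)
    (h : (x : ℚ) * 4 ^ n = σ * 2 ^ k * e * c) : 2 ^ (2 * n) * |x| = 2 ^ k * c := by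
  have h1 := congrArg abs h
  simp only [abs_mul, abs_pow, he] at h1
  rw [← Int.cast_abs, ← Int.cast_abs, hσ] at h1
  norm_num at h1
  rw [show (2 : ℤ) ^ (2 * n) = 4 ^ n by rw [pow_mul]; norm_num]
  rw [mul_comm]
  exact_mod_cast h1

section Contradiction

variable {n M k : ℕ} {S s r : ℕ → ℕ → ℤ} {σ : ℤ}
  (hs : ∀ m ≥ M, ∀ u ≥ M, s (m + 1) (u + 1) = s m u)
  (hr : ∀ m u, s m u = (m + n).choose n * (u + (n + 1) + n).choose n
    + ∑ k ∈ Ico 1 (n + 1), r k m * (u + (n + 1 - k) + n).choose n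
    - (-1) ^ (n + 1) * (m + n).choose n * (u + n).choose n)

include hs hr

/-- A family of polynomials in `u`, invariant under diagonal shifts for large arguments, with
prescribed extreme coefficients. -/
theorem eq_choose_of_diagonal (m : ℕ) (hm : M ≤ m) (u v : ℕ) (huv : u + n = m + v) :
    s m u = 2 * (-1) ^ n * v.choose n := by
  set H : ℤ → ℤ := fun t => Ring.choose (t + n) n with hH
  have hHn : ∀ t : ℕ, H t = (t + n).choose n := fun t => by
    rw [hH]; simp only; rw [← Nat.cast_add, Ring.choose_natCast]
  let P : ℕ → ℤ → ℤ := fun m t => (m + n).choose n * H (t + (n + 1))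
    + ∑ k ∈ Ico 1 (n + 1), r k m * H (t + (n + 1 - k)) - (-1) ^ (n + 1) * (m + n).choose n * H t
  have hPs : ∀ m u : ℕ, P m u = s m u := by
    intro m u
    rw [hr, ← hHn u, ← hHn (u + (n + 1))]
    have h : ∑ k ∈ Ico 1 (n + 1), r k m * H (u + (n + 1 - k)) =
        ∑ k ∈ Ico 1 (n + 1), r k m * (u + (n + 1 - k) + n).choose n := by
      refine sum_congr rfl fun k hk => ?_
      rw [← hHn, Nat.cast_add, Nat.cast_sub (by have := mem_Ico.1 hk; omega)]
      push_cast
      rfl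
    simp only [P]
    rw [h]
    push_cast
    rfl
  have hPd : ∀ m, ∀ a : ℤ, (fwdDiff (1 : ℤ))^[n + 1] (fun t => P m (t + a)) = 0 := by
    intro m a
    have hHd : ∀ a : ℤ, (fwdDiff (1 : ℤ))^[n + 1] (fun t => H (t + a)) = 0 := fun a => by
      simp only [hH, add_assoc]
      exact fwdDiff_iter_ringChoose n _
    have h : (fun t => P m (t + a)) = ((m + n).choose n : ℤ) • (fun t => H (t + (a + (n + 1))))
        + ∑ k ∈ Ico 1 (n + 1), r k m • (fun t => H (t + (a + (n + 1 - k))))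
        + (-(-1) ^ (n + 1) * (m + n).choose n : ℤ) • fun t => H (t + a) := by
      funext t
      simp only [P, Pi.add_apply, Pi.smul_apply, Finset.sum_apply, smul_eq_mul, add_assoc]
      ring
    rw [h, fwdDiff_iter_add, fwdDiff_iter_add, fwdDiff_iter_const_smul, fwdDiff_iter_const_smul,
      fwdDiff_iter_finsetSum, hHd, hHd]
    simp only [fwdDiff_iter_const_smul, hHd, smul_zero, sum_const_zero, add_zero]
  have hsub : ∀ f g : ℤ → ℤ, (fwdDiff (1 : ℤ))^[n + 1] f = 0 → (fwdDiff (1 : ℤ))^[n + 1] g = 0 →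
      (fwdDiff (1 : ℤ))^[n + 1] (f - g) = 0 := by
    intro f g hf hg
    rw [show f - g = f + (-1 : ℤ) • g by module, fwdDiff_iter_add, fwdDiff_iter_const_smul, hf, hg,
      smul_zero, add_zero]
  have hstep : ∀ m ≥ M, ∀ t, P (m + 1) (t + 1) = P m t := by
    intro m hm t
    refine sub_eq_zero.1 (eq_zero_of_fwdDiff_iter (n + 1)
      ((fun t => P (m + 1) (t + 1)) - fun t => P m t) (hsub _ _ (hPd _ _) ?_) M (Or.inl ?_) t)
    · simpa using hPd m 0
    · intro t ht
      lift t to ℕ using by omega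
      rw [Pi.sub_apply, ← Nat.cast_succ, hPs, hPs, hs m hm t (by omega), sub_self]
  have hsteps : ∀ j : ℕ, ∀ t, P (m + j) (t + j) = P m t := by
    intro j
    induction j with
    | zero => intro t; simp
    | succ j ih => 
      intro t
      rw [← ih, ← hstep (m + j) (by omega), ← add_assoc, Nat.cast_succ, ← add_assoc]
  have hneg : ∀ x : ℤ, Ring.choose (-x) n = (-1) ^ n * Ring.choose (x + n - 1) n := fun x => by
    rw [Ring.choose_neg, Int.negOnePow_def, zpow_natCast, Units.smul_def, smul_eq_mul]
    push_cast
    rfl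
  have hend : ∀ m, P m (-(n + 1)) = 2 * (m + n).choose n := by
    intro m
    have h0 : ∑ k ∈ Ico 1 (n + 1), r k m * H (-(n + 1) + (n + 1 - k)) = 0 := by
      refine sum_eq_zero fun k hk => ?_
      have hk' := mem_Ico.1 hk
      have : H (-(n + 1) + (n + 1 - k)) = 0 := by
        simp only [hH]
        rw [show (-(n + 1) + (n + 1 - k) + n : ℤ) = ((n - k : ℕ) : ℤ) by
          rw [Nat.cast_sub (by omega)]; ring, Ring.choose_natCast, Nat.choose_eq_zero_of_lt (by omega)]
        rfl
      rw [this, mul_zero]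
    have h1 : H (-(n + 1)) = (-1) ^ n := by
      simp only [hH]
      rw [show (-(n + 1) + n : ℤ) = -1 by ring, hneg,
        show (1 + n - 1 : ℤ) = n by ring, Ring.choose_natCast, Nat.choose_self]
      simp
    have h2 : H (-(n + 1) + (n + 1)) = 1 := by
      rw [neg_add_cancel]
      simpa using hHn 0
    simp only [P]
    rw [h0, h1, h2, pow_succ]
    have : ((-1 : ℤ) ^ n) * (-1) ^ n = 1 := by rw [← mul_pow]; simp
    linear_combination ((m + n).choose n : ℤ) * this
  have hfin : ∀ t, P m t = 2 * (-1) ^ n * H (t - m) := by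
    intro t
    refine sub_eq_zero.1 (eq_zero_of_fwdDiff_iter (n + 1)
      ((fun t => P m t) - fun t => 2 * (-1) ^ n * H (t - m)) (hsub _ _ ?_ ?_)
      (-(n + 1)) (Or.inr ?_) t)
    · simpa using hPd m 0
    · rw [show (fun t => 2 * (-1) ^ n * H (t - m)) =
        (2 * (-1) ^ n : ℤ) • fun t : ℤ => Ring.choose (t + (-(m : ℤ) + n)) n by
          funext t; simp only [hH, Pi.smul_apply, smul_eq_mul]; congr 2; ring,
        fwdDiff_iter_const_smul, fwdDiff_iter_ringChoose, smul_zero]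
    · intro t ht
      obtain ⟨j, hj⟩ := Int.eq_ofNat_of_zero_le (show 0 ≤ -(n + 1) - t by omega)
      have h1 : t + j = -(n + 1) := by rw [← hj]; ring
      rw [Pi.sub_apply, sub_eq_zero, ← hsteps j t, h1, hend]
      simp only [hH]
      rw [show t - m + n = -((m + j : ℕ) + 1 : ℤ) by push_cast; linarith, hneg,
        show ((m + j : ℕ) + 1 + n - 1 : ℤ) = ((m + j + n : ℕ) : ℤ) by push_cast; ring,
        Ring.choose_natCast]
      have h3 : ((-1 : ℤ) ^ n) * (-1) ^ n = 1 := by rw [← mul_pow]; simp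
      linear_combination (-2 * ((m + j + n).choose n : ℤ)) * h3
  rw [← hPs, hfin]
  simp only [hH]
  rw [show (u - m + n : ℤ) = (v : ℕ) by linarith [(by exact_mod_cast huv : (u + n : ℤ) = m + v)],
    Ring.choose_natCast]

variable
  (h1 : ∀ m ≥ M, ∀ u ≥ M, ∑ i ∈ range (n + 2), ((n + 1).choose i : ℤ) * S m (u + (n + 1 - i))
    = σ * 2 ^ k * s m u)
  (h2 : ∀ m ≥ M, ∀ u ≥ M,
    ∑ i ∈ range (n + 2), (-1) ^ i * ((n + 1).choose i : ℤ) * S m (u + (n + 1 - i)) = 0)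

include h1 h2

/-- The two recurrences determine the signature in the window `u ≥ m - n`. -/
theorem eq_sum_choose_of_recurrences (m : ℕ) (hm : M + n ≤ m) (t : ℕ) :
    (S m (m - n + t) : ℚ) = σ * 2 ^ k * (-1) ^ n / 2 ^ n *
      ∑ j ∈ range (n + 1), ((n + j).choose j : ℚ) * (-1 / 2) ^ j * t.choose (n - j) := by
  rw [eq_sum_choose_of_shift n (fun t => (S m (m - n + t) : ℚ)) (σ * 2 ^ k * (2 * (-1) ^ n)) ?_ ?_
    t, pow_succ]
  · field_simp
  · intro t
    rw [← sum_flip]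
    have h := h1 m (by omega) (m - n + t) (by omega)
    rw [eq_choose_of_diagonal hs hr m (by omega) (m - n + t) t (by omega)] at h
    have h' := congrArg (Int.cast : ℤ → ℚ) h
    push_cast at h'
    rw [mul_assoc, ← h']
    refine sum_congr rfl fun i hi => ?_
    rw [Nat.choose_symm (by simpa [Nat.lt_succ_iff] using hi), add_assoc]
  · intro t
    rw [← sum_flip]
    have h := h2 m (by omega) (m - n + t) (by omega)
    have h' := congrArg (Int.cast : ℤ → ℚ) h
    push_cast at h'
    rw [← h']
    refine sum_congr rfl fun i hi => ?_
    have hi' : i ≤ n + 1 := by simpa [Nat.lt_succ_iff] using hi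
    rw [Nat.choose_symm hi', add_assoc, Nat.sub_sub_self hi']

variable (hσ : |σ| = 1)

include hσ

theorem false_of_even (hk : k + (Nat.digits 2 n).sum = 2 * n) (hS : ∀ m ≥ M, ∀ u ≥ M, 2 ∣ S m u) :
    False := by
  have h := eq_sum_choose_of_recurrences hs hr h1 h2 (M + n) le_rfl 0
  rw [sum_range_succ, sum_eq_zero, zero_add, Nat.sub_self, Nat.choose_self, Nat.cast_one, mul_one,
    add_zero, Nat.add_sub_cancel] at h
  swap
  · intro j hj
    have := mem_range.1 hj
    rw [Nat.choose_eq_zero_of_lt (by omega : 0 < n - j)]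
    simp
  refine not_two_dvd_of_abs_eq n _ ?_ (hS (M + n) (by omega) M le_rfl)
  have h3 : 2 ^ (2 * n) * |S (M + n) M| = 2 ^ k * ((2 * n).choose n : ℕ) := by
    refine abs_mul_of_cast_eq hσ (e := 1) (by simp) ?_
    rw [h, show (-1 / 2 : ℚ) ^ n = (-1) ^ n / 2 ^ n by rw [div_pow], show (4 : ℚ) ^ n = 2 ^ n * 2 ^ n by
      rw [← mul_pow]; norm_num, two_mul]
    have : ((-1 : ℚ) ^ n) * (-1) ^ n = 1 := by rw [← mul_pow]; simp
    field_simp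
    linear_combination (σ * (n + n).choose n : ℚ) * this
  rw [show (2 : ℤ) ^ (2 * n) = 2 ^ k * 2 ^ (Nat.digits 2 n).sum by rw [← pow_add, hk],
    mul_assoc] at h3
  exact mul_left_cancel₀ (pow_ne_zero k two_ne_zero) h3

theorem false_of_four_dvd (hn : Even n) (hk : k + (Nat.digits 2 n).sum = 2 * n + 1)
    (hS : ∀ m ≥ M, 4 ∣ S m m) : False := by
  obtain ⟨q, rfl⟩ := hn
  rw [← two_mul] at *
  have h := eq_sum_choose_of_recurrences hs hr h1 h2 (M + 2 * q) le_rfl (2 * q)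
  rw [sum_choose_mul_choose_half, Nat.sub_add_cancel (by omega)] at h
  have h3 : 2 ^ (2 * (2 * q)) * |S (M + 2 * q) (M + 2 * q)| = 2 ^ k * ((2 * q).choose q : ℕ) := by
    refine abs_mul_of_cast_eq hσ (e := (-1) ^ q) (by simp) ?_
    rw [h, show (-1 / 4 : ℚ) ^ q = (-1) ^ q / 4 ^ q by rw [div_pow], pow_mul, pow_mul,
      pow_mul, show (4 : ℚ) ^ 2 = 4 * 4 by norm_num, mul_pow, show (2 : ℚ) ^ 2 = 4 by norm_num]
    field_simp
    simp
  obtain ⟨y, hy⟩ := hS (M + 2 * q) (by omega)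
  refine not_two_dvd_of_abs_eq q (2 * y) ?_ ⟨y, rfl⟩
  rw [hy, show (4 * y : ℤ) = 2 * (2 * y) by ring, abs_mul 2, abs_two, ← mul_assoc, ← pow_succ,
    ← hk, pow_add, sum_digits_two_mul, mul_assoc] at h3
  exact mul_left_cancel₀ (pow_ne_zero k two_ne_zero) h3

end Contradiction

end Numerics

end FinsetOpens

section CliffordSystems

open scoped Kronecker

/-- Anticommuting Hermitian involutions. -/
structure IsCliff {ν κ : Type*} [DecidableEq ν] [Fintype κ] [DecidableEq κ]
    (γ : ν → Matrix κ κ ℂ) : Prop where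
  herm : ∀ i, (γ i).IsHermitian
  sq : ∀ i, γ i * γ i = 1
  anti : ∀ i j, i ≠ j → γ i * γ j = -(γ j * γ i)

/-- A Clifford system with an antiunitary symmetry of square `s`. -/
structure IsCliffJ {ν κ : Type*} [DecidableEq ν] [Fintype κ] [DecidableEq κ]
    (γ : ν → Matrix κ κ ℂ) (U : Matrix κ κ ℂ) (s : ℂ) : Prop extends IsCliff γ where
  conj : ∀ i, U * (γ i).map star = γ i * U
  conj_sq : U * U.map star = s • 1

variable {ν μ κ τ : Type*} [DecidableEq ν] [DecidableEq μ] [Fintype κ] [DecidableEq κ] [Fintype τ]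
  [DecidableEq τ]

theorem IsCliff.comp {γ : ν → Matrix κ κ ℂ} (h : IsCliff γ) {f : μ → ν}
    (hf : Function.Injective f) : IsCliff (γ ∘ f) :=
  ⟨fun i => h.herm _, fun i => h.sq _, fun i j hij => h.anti _ _ (hf.ne hij)⟩

theorem IsCliffJ.comp {γ : ν → Matrix κ κ ℂ} {U : Matrix κ κ ℂ} {s : ℂ} (h : IsCliffJ γ U s)
    {f : μ → ν} (hf : Function.Injective f) : IsCliffJ (γ ∘ f) U s :=
  ⟨h.toIsCliff.comp hf, fun i => h.conj _, h.conj_sq⟩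

theorem IsCliff.add {γ : ν → Matrix κ κ ℂ} (h : IsCliff γ) {g : Option μ → Matrix τ τ ℂ}
    (hg : IsCliff g) :
    IsCliff (Sum.elim (fun i => γ i ⊗ₖ g none) (fun a => (1 : Matrix κ κ ℂ) ⊗ₖ g (some a))) where
  herm i := by
    rcases i with i | a
    · simp only [Sum.elim_inl, IsHermitian, conjTranspose_kronecker, (h.herm i).eq, (hg.herm _).eq]
    · simp only [Sum.elim_inr, IsHermitian, conjTranspose_kronecker, conjTranspose_one,
        (hg.herm _).eq]
  sq i := by
    rcases i with i | a <;> simp [← mul_kronecker_mul, h.sq, hg.sq]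
  anti i j hij := by
    rcases i with i | a <;> rcases j with j | b <;>
      simp only [Sum.elim_inl, Sum.elim_inr, ← mul_kronecker_mul, mul_one, one_mul]
    · rw [h.anti i j (fun h => hij (by rw [h])), ← neg_one_smul ℂ, smul_kronecker, neg_one_smul]
    · rw [hg.anti _ _ (by simp), ← neg_one_smul ℂ, kronecker_smul, neg_one_smul]
    · rw [hg.anti _ _ (by simp), ← neg_one_smul ℂ, kronecker_smul, neg_one_smul]
    · rw [hg.anti _ _ (fun h => hij (by rw [Option.some_injective _ h])), ← neg_one_smul ℂ,
        kronecker_smul, neg_one_smul]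

theorem map_star_one : (1 : Matrix κ κ ℂ).map star = 1 :=
  Matrix.map_one _ (star_zero _) (star_one _)

theorem map_star_kronecker (A : Matrix κ κ ℂ) (B : Matrix τ τ ℂ) :
    (A ⊗ₖ B).map star = A.map star ⊗ₖ B.map star := by
  ext i j
  simp [kroneckerMap_apply]

theorem IsCliffJ.add {γ : ν → Matrix κ κ ℂ} {U : Matrix κ κ ℂ} {s : ℂ} (h : IsCliffJ γ U s)
    {g : Option μ → Matrix τ τ ℂ} {V : Matrix τ τ ℂ} {t : ℂ} (hg : IsCliffJ g V t) :
    IsCliffJ (Sum.elim (fun i => γ i ⊗ₖ g none) (fun a => (1 : Matrix κ κ ℂ) ⊗ₖ g (some a)))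
      (U ⊗ₖ V) (s * t) where
  toIsCliff := h.toIsCliff.add hg.toIsCliff
  conj i := by
    rcases i with i | a <;>
      simp only [Sum.elim_inl, Sum.elim_inr, map_star_kronecker, ← mul_kronecker_mul, h.conj,
        hg.conj, map_star_one, one_mul, mul_one]
  conj_sq := by
    rw [map_star_kronecker, ← mul_kronecker_mul, h.conj_sq, hg.conj_sq, smul_kronecker,
      kronecker_smul, smul_smul, one_kronecker_one]

/-- The Pauli matrices. -/
noncomputable def pauli : Option (Fin 2) → Matrix (Fin 2) (Fin 2) ℂ
  | none => !![1, 0; 0, -1]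
  | some 0 => !![0, 1; 1, 0]
  | some 1 => !![0, -Complex.I; Complex.I, 0]

theorem isCliff_pauli : IsCliff pauli where
  herm i := by
    rcases i with _ | i
    · ext a b; fin_cases a <;> fin_cases b <;> simp [pauli]
    · fin_cases i <;> ext a b <;> fin_cases a <;> fin_cases b <;> simp [pauli]
  sq i := by
    rcases i with _ | i
    · ext a b; fin_cases a <;> fin_cases b <;> simp [pauli]
    · fin_cases i <;> ext a b <;> fin_cases a <;> fin_cases b <;> simp [pauli]
  anti i j hij := by
    rcases i with _ | i <;> rcases j with _ | j
    · exact absurd rfl hij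
    · fin_cases j <;> ext a b <;> fin_cases a <;> fin_cases b <;> simp [pauli]
    · fin_cases i <;> ext a b <;> fin_cases a <;> fin_cases b <;> simp [pauli]
    · fin_cases i <;> fin_cases j
      · exact absurd rfl hij
      · ext a b; fin_cases a <;> fin_cases b <;> simp [pauli]
      · ext a b; fin_cases a <;> fin_cases b <;> simp [pauli]
      · exact absurd rfl hij

/-- Five anticommuting matrices on `ℂ⁴` with a quaternionic symmetry. -/
noncomputable def quatCliff : Option (Option (Option (Fin 2))) →
    Matrix (Fin 2 × Fin 2) (Fin 2 × Fin 2) ℂ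
  | none => pauli none ⊗ₖ 1
  | some none => pauli (some 0) ⊗ₖ 1
  | some (some i) => pauli (some 1) ⊗ₖ pauli i

noncomputable def quatJ : Matrix (Fin 2) (Fin 2) ℂ := !![0, 1; -1, 0]

theorem quatJ_pauli (i) : quatJ * (pauli i).map star = -(pauli i * quatJ) := by
  rcases i with _ | i
  · ext a b; fin_cases a <;> fin_cases b <;> simp [pauli, quatJ, mul_apply]
  · fin_cases i <;> ext a b <;> fin_cases a <;> fin_cases b <;> simp [pauli, quatJ, mul_apply]

theorem isCliffJ_quatCliff : IsCliffJ quatCliff ((1 : Matrix (Fin 2) (Fin 2) ℂ) ⊗ₖ quatJ) (-1) where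
  herm i := by
    rcases i with _ | _ | i <;>
      simp [quatCliff, IsHermitian, conjTranspose_kronecker, (isCliff_pauli.herm _).eq]
  sq i := by
    rcases i with _ | _ | i <;> simp [quatCliff, ← mul_kronecker_mul, isCliff_pauli.sq]
  anti i j hij := by
    have h0 := isCliff_pauli.anti none (some 0) (by simp)
    have h1 := isCliff_pauli.anti none (some 1) (by simp)
    have h2 := isCliff_pauli.anti (some 0) (some 1) (by simp)
    have hn : ∀ A B : Matrix (Fin 2) (Fin 2) ℂ, (-A) ⊗ₖ B = -(A ⊗ₖ B) := fun A B => by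
      rw [← neg_one_smul ℂ, smul_kronecker, neg_one_smul]
    have hn' : ∀ A B : Matrix (Fin 2) (Fin 2) ℂ, A ⊗ₖ (-B) = -(A ⊗ₖ B) := fun A B => by
      rw [← neg_one_smul ℂ, kronecker_smul, neg_one_smul]
    rcases i with _ | _ | i <;> rcases j with _ | _ | j <;>
      first
      | exact absurd rfl hij
      | simp only [quatCliff, ← mul_kronecker_mul, mul_one, one_mul]
    · rw [h0, hn]
    · rw [h1, hn]
    · rw [h0, hn, neg_neg]
    · rw [h2, hn]
    · rw [h1, hn, neg_neg]
    · rw [h2, hn, neg_neg]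
    · rw [isCliff_pauli.anti i j (fun h => hij (by rw [h])), hn']
  conj i := by
    have h0 : ∀ i : Option (Fin 2), i ≠ some 1 → (pauli i).map star = pauli i := by
      intro i hi
      rcases i with _ | i
      · ext a b; fin_cases a <;> fin_cases b <;> simp [pauli]
      · fin_cases i
        · ext a b; fin_cases a <;> fin_cases b <;> simp [pauli]
        · exact absurd rfl hi
    have h1 : (pauli (some 1)).map star = -pauli (some 1) := by
      ext a b; fin_cases a <;> fin_cases b <;> simp [pauli]
    rcases i with _ | _ | i
    · simp only [quatCliff, map_star_kronecker, ← mul_kronecker_mul, h0 none (by simp),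
        map_star_one, one_mul, mul_one]
    · simp only [quatCliff, map_star_kronecker, ← mul_kronecker_mul, h0 (some 0) (by simp),
        map_star_one, one_mul, mul_one]
    · simp only [quatCliff, map_star_kronecker, ← mul_kronecker_mul, h1, quatJ_pauli, one_mul,
        mul_one]
      rw [← neg_one_smul ℂ, ← neg_one_smul ℂ (pauli i * quatJ), smul_kronecker, kronecker_smul,
        smul_smul]
      norm_num
  conj_sq := by
    have : quatJ * quatJ.map star = -1 := by
      ext a b; fin_cases a <;> fin_cases b <;> simp [quatJ, mul_apply]
    rw [map_star_kronecker, ← mul_kronecker_mul, this, map_star_one,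
      mul_one, ← neg_one_smul ℂ (1 : Matrix (Fin 2) (Fin 2) ℂ), kronecker_smul, one_kronecker_one]

theorem exists_isCliff (k : ℕ) : ∃ (κ : Type) (_ : Fintype κ) (_ : DecidableEq κ)
    (γ : Fin (2 * k + 1) → Matrix κ κ ℂ), Fintype.card κ = 2 ^ k ∧ IsCliff γ := by
  induction k with
  | zero =>
    refine ⟨Unit, inferInstance, inferInstance, fun _ => 1, rfl, ⟨fun _ => isHermitian_one,
      fun _ => mul_one _, fun i j hij => absurd (Subsingleton.elim (α := Fin 1) i j) hij⟩⟩
  | succ k ih =>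
    obtain ⟨κ, _, _, γ, hκ, h⟩ := ih
    let e : Fin (2 * (k + 1) + 1) ≃ Fin (2 * k + 1) ⊕ Fin 2 :=
      Fintype.equivOfCardEq (by simp; ring)
    exact ⟨κ × Fin 2, inferInstance, inferInstance, _, by simp [hκ, pow_succ],
      (h.add isCliff_pauli).comp e.injective⟩

theorem exists_isCliffJ_add {N k : ℕ} (h : ∃ (κ : Type) (_ : Fintype κ) (_ : DecidableEq κ)
    (γ : Fin N → Matrix κ κ ℂ), Fintype.card κ = 2 ^ k ∧ IsCliffJ γ 1 1) (q : ℕ) :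
    ∃ (κ : Type) (_ : Fintype κ) (_ : DecidableEq κ) (γ : Fin (N + 4 * q) → Matrix κ κ ℂ)
      (U : Matrix κ κ ℂ), Fintype.card κ = 2 ^ (k + 2 * q) ∧ IsCliffJ γ U ((-1) ^ q) := by
  induction q with
  | zero =>
    obtain ⟨κ, _, _, γ, hκ, h⟩ := h
    exact ⟨κ, inferInstance, inferInstance, γ, 1, hκ, by rw [pow_zero]; exact h⟩
  | succ q ih =>
    obtain ⟨κ, _, _, γ, U, hκ, h⟩ := ih
    let e : Fin (N + 4 * (q + 1)) ≃ Fin (N + 4 * q) ⊕ Option (Option (Fin 2)) :=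
      Fintype.equivOfCardEq (by simp; ring)
    refine ⟨κ × (Fin 2 × Fin 2), inferInstance, inferInstance, _, _, ?_,
      pow_succ (-1 : ℂ) q ▸ (h.add isCliffJ_quatCliff).comp e.injective⟩
    simp [hκ]
    ring

theorem exists_isCliffJ_one : ∃ (κ : Type) (_ : Fintype κ) (_ : DecidableEq κ)
    (γ : Fin 1 → Matrix κ κ ℂ), Fintype.card κ = 2 ^ 0 ∧ IsCliffJ γ 1 1 :=
  ⟨Unit, inferInstance, inferInstance, fun _ => 1, rfl, ⟨⟨fun _ => isHermitian_one,
    fun _ => mul_one _, fun i j hij => absurd (Subsingleton.elim i j) hij⟩, fun _ => by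
      rw [map_star_one],
    by rw [map_star_one, one_mul, one_smul]⟩⟩

theorem exists_isCliffJ_two : ∃ (κ : Type) (_ : Fintype κ) (_ : DecidableEq κ)
    (γ : Fin 2 → Matrix κ κ ℂ), Fintype.card κ = 2 ^ 1 ∧ IsCliffJ γ 1 1 := by
  have h : IsCliff (pauli ∘ ![none, some 0]) := isCliff_pauli.comp (by
    intro i j; fin_cases i <;> fin_cases j <;> simp)
  refine ⟨Fin 2, inferInstance, inferInstance, _, rfl, ⟨h, fun i => ?_,
    by rw [map_star_one, one_mul, one_smul]⟩⟩
  fin_cases i <;> ext a b <;> fin_cases a <;> fin_cases b <;> simp [pauli]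

end CliffordSystems

section Fock

open scoped Kronecker

/-- Fermionic annihilation operators on a space with a basis graded by particle number. -/
structure IsFock {d : ℕ} {Λ : Type*} [Fintype Λ] [DecidableEq Λ]
    (a : Fin d → Matrix Λ Λ ℂ) (wt : Λ → ℕ) : Prop where
  car : ∀ i j, a i * a j = -(a j * a i)
  car' : ∀ i j, a i * (a j)ᴴ + (a j)ᴴ * a i = if i = j then 1 else 0
  num : ∑ j, (a j)ᴴ * a j = diagonal fun I => (wt I : ℂ)
  card : ∀ k, Fintype.card {I // wt I = k} = d.choose k

theorem exists_isFock (d : ℕ) : ∃ (Λ : Type) (_ : Fintype Λ) (_ : DecidableEq Λ)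
    (a : Fin d → Matrix Λ Λ ℂ) (wt : Λ → ℕ), IsFock a wt := by
  induction d with
  | zero =>
    refine ⟨Unit, inferInstance, inferInstance, Fin.elim0, fun _ => 0, fun i => i.elim0,
      fun i => i.elim0, by simp, fun k => ?_⟩
    rcases k with _ | k <;> simp
  | succ d ih =>
    obtain ⟨Λ, _, _, a, wt, h⟩ := ih
    let s : Matrix (Fin 2) (Fin 2) ℂ := !![0, 1; 0, 0]
    let z : Matrix (Fin 2) (Fin 2) ℂ := !![1, 0; 0, -1]
    have hzz : z * z = 1 := by
      ext i j; fin_cases i <;> fin_cases j <;> simp [z]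
    have hzs : z * s = -(s * z) := by
      ext i j; fin_cases i <;> fin_cases j <;> simp [z, s]
    have hsH : sᴴ = !![0, 0; 1, 0] := by
      ext i j; fin_cases i <;> fin_cases j <;> simp [s]
    have hzt : z * sᴴ = -(sᴴ * z) := by
      rw [hsH]; ext i j; fin_cases i <;> fin_cases j <;> simp [z]
    have hss : s * s = 0 := by
      ext i j; fin_cases i <;> fin_cases j <;> simp [s]
    have hst : s * sᴴ + sᴴ * s = 1 := by
      rw [hsH]; ext i j; fin_cases i <;> fin_cases j <;> simp [s]
    have hts : sᴴ * s = diagonal fun i : Fin 2 => ((i : ℕ) : ℂ) := by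
      rw [hsH]; ext i j; fin_cases i <;> fin_cases j <;> simp [s]
    have hz : zᴴ = z := by
      ext i j; fin_cases i <;> fin_cases j <;> simp [z]
    have hn : ∀ (A : Matrix Λ Λ ℂ) (B : Matrix (Fin 2) (Fin 2) ℂ), A ⊗ₖ (-B) = -(A ⊗ₖ B) :=
      fun A B => by rw [← neg_one_smul ℂ, kronecker_smul, neg_one_smul]
    have hn' : ∀ (A : Matrix Λ Λ ℂ) (B : Matrix (Fin 2) (Fin 2) ℂ), (-A) ⊗ₖ B = -(A ⊗ₖ B) :=
      fun A B => by rw [← neg_one_smul ℂ, smul_kronecker, neg_one_smul]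
    refine ⟨Λ × Fin 2, inferInstance, inferInstance,
      Fin.cons ((1 : Matrix Λ Λ ℂ) ⊗ₖ s) (fun j => a j ⊗ₖ z), fun p => wt p.1 + p.2, ?_, ?_, ?_, ?_⟩
    · intro i j
      refine Fin.cases ?_ (fun i => ?_) i <;> refine Fin.cases ?_ (fun j => ?_) j <;>
        simp only [Fin.cons_zero, Fin.cons_succ, ← mul_kronecker_mul, one_mul, mul_one]
      · rw [hss, kronecker_zero, neg_zero]
      · rw [hzs, hn, neg_neg]
      · rw [hzs, hn]
      · rw [h.car, hn']
    · intro i j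
      refine Fin.cases ?_ (fun i => ?_) i <;> refine Fin.cases ?_ (fun j => ?_) j <;>
        simp only [Fin.cons_zero, Fin.cons_succ, conjTranspose_kronecker, conjTranspose_one,
          ← mul_kronecker_mul, one_mul, mul_one, hz]
      · rw [← kronecker_add, hst, if_pos trivial, one_kronecker_one]
      · rw [hzs, hn, add_neg_cancel, if_neg (Fin.succ_ne_zero j).symm]
      · rw [hzt, hn, neg_add_cancel, if_neg (Fin.succ_ne_zero i)]
      · rw [hzz, ← add_kronecker, h.car']
        by_cases hij : i = j
        · simp [hij]
        · simp [hij]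
    · rw [Fin.sum_univ_succ]
      simp only [Fin.cons_zero, Fin.cons_succ, conjTranspose_kronecker, conjTranspose_one,
          ← mul_kronecker_mul, one_mul, hz, hzz]
      have : ∑ x, ((a x)ᴴ * a x) ⊗ₖ (1 : Matrix (Fin 2) (Fin 2) ℂ) =
          (∑ x, (a x)ᴴ * a x) ⊗ₖ (1 : Matrix (Fin 2) (Fin 2) ℂ) := by
        ext p q
        simp [kroneckerMap_apply, Matrix.sum_apply, Finset.sum_mul]
      rw [this, h.num, hts, ← diagonal_one, ← diagonal_one, diagonal_kronecker_diagonal,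
        diagonal_kronecker_diagonal, diagonal_add]
      congr 1
      ext p
      push_cast
      ring
    · intro k
      have h' : ∀ k, (∑ I, if wt I = k then 1 else 0) = d.choose k := fun k => by
        rw [← Finset.card_filter, ← Fintype.card_subtype]; exact h.card k
      rw [Fintype.card_subtype, ← Finset.univ_product_univ, Finset.card_filter, Finset.sum_product]
      simp only [Fin.sum_univ_two, Finset.sum_add_distrib, Fin.val_zero, Fin.val_one, add_zero]
      rw [h']
      rcases k with _ | k
      · simp
      · simp only [Nat.add_right_cancel_iff]
        rw [h', Nat.choose_succ_succ', add_comm]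

variable {d : ℕ} {Λ : Type*} [Fintype Λ] [DecidableEq Λ] {a : Fin d → Matrix Λ Λ ℂ} {wt : Λ → ℕ}

/-- The creation operator of a vector. -/
def crea (a : Fin d → Matrix Λ Λ ℂ) (z : EuclideanSpace ℂ (Fin d)) : Matrix Λ Λ ℂ :=
  ∑ j, z j • (a j)ᴴ

/-- The annihilation operator of a vector. -/
def anni (a : Fin d → Matrix Λ Λ ℂ) (z : EuclideanSpace ℂ (Fin d)) : Matrix Λ Λ ℂ :=
  ∑ j, star (z j) • a j

/-- Clifford multiplication on Fock space. -/
def cFock (a : Fin d → Matrix Λ Λ ℂ) (z : EuclideanSpace ℂ (Fin d)) : Matrix Λ Λ ℂ :=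
  crea a z + anni a z

omit [Fintype Λ] [DecidableEq Λ] in
theorem crea_conjTranspose (z) : (crea a z)ᴴ = anni a z := by
  simp [crea, anni, conjTranspose_sum, conjTranspose_smul]

omit [Fintype Λ] [DecidableEq Λ] in
theorem anni_conjTranspose (z) : (anni a z)ᴴ = crea a z := by
  rw [← crea_conjTranspose, conjTranspose_conjTranspose]

omit [Fintype Λ] [DecidableEq Λ] in
theorem crea_add (z w) : crea a (z + w) = crea a z + crea a w := by
  simp [crea, add_smul, Finset.sum_add_distrib]

omit [Fintype Λ] [DecidableEq Λ] in
theorem crea_smul (c : ℂ) (z) : crea a (c • z) = c • crea a z := by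
  simp [crea, mul_smul, Finset.smul_sum]

omit [Fintype Λ] [DecidableEq Λ] in
theorem anni_add (z w) : anni a (z + w) = anni a z + anni a w := by
  simp [anni, add_smul, Finset.sum_add_distrib]

omit [Fintype Λ] [DecidableEq Λ] in
theorem anni_smul (c : ℂ) (z) : anni a (c • z) = star c • anni a z := by
  simp [anni, mul_smul, Finset.smul_sum]

omit [Fintype Λ] [DecidableEq Λ] in
theorem cFock_isHermitian (z) : (cFock a z).IsHermitian := by
  rw [IsHermitian, cFock, conjTranspose_add, crea_conjTranspose, anni_conjTranspose, add_comm]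

omit [Fintype Λ] [DecidableEq Λ] in
theorem eq_zero_of_eq_neg_self {X : Matrix Λ Λ ℂ} (h : X = -X) : X = 0 := by
  ext I J
  have := congrFun (congrFun h I) J
  rw [Matrix.neg_apply] at this
  rw [Matrix.zero_apply]
  linear_combination this / 2

namespace IsFock

variable (h : IsFock a wt)
include h

theorem anni_anni (z w) : anni a z * anni a w = -(anni a w * anni a z) := by
  simp only [anni, Finset.sum_mul_sum]
  rw [Finset.sum_comm, ← Finset.sum_neg_distrib]
  refine Finset.sum_congr rfl fun i _ => ?_
  rw [← Finset.sum_neg_distrib]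
  refine Finset.sum_congr rfl fun j _ => ?_
  rw [smul_mul_smul_comm, smul_mul_smul_comm, h.car, smul_neg, mul_comm]

theorem crea_crea (z w) : crea a z * crea a w = -(crea a w * crea a z) := by
  rw [← anni_conjTranspose z, ← anni_conjTranspose w, ← conjTranspose_mul, h.anni_anni,
    conjTranspose_neg, conjTranspose_mul]

theorem anni_crea (z w) : anni a z * crea a w = inner ℂ z w • 1 - crea a w * anni a z := by
  rw [eq_sub_iff_add_eq]
  simp only [anni, crea, Finset.sum_mul_sum]
  rw [Finset.sum_comm (f := fun i j => (w i • (a i)ᴴ) * (star (z j) • a j)),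
    ← Finset.sum_add_distrib]
  simp only [← Finset.sum_add_distrib]
  have : ∀ i j, (star (z i) • a i) * (w j • (a j)ᴴ) + (w j • (a j)ᴴ) * (star (z i) • a i) =
      (star (z i) * w j) • (if i = j then (1 : Matrix Λ Λ ℂ) else 0) := fun i j => by
    rw [smul_mul_smul_comm, smul_mul_smul_comm, ← h.car' i j, smul_add, mul_comm (w j)]
  simp only [this, smul_ite, smul_zero, Finset.sum_ite_eq, Finset.mem_univ, if_true]
  rw [← Finset.sum_smul, PiLp.inner_apply]
  congr 1
  exact Finset.sum_congr rfl fun j _ => by simp [mul_comm]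

theorem crea_sq (z) : crea a z * crea a z = 0 := eq_zero_of_eq_neg_self (h.crea_crea z z)

theorem anni_sq (z) : anni a z * anni a z = 0 := eq_zero_of_eq_neg_self (h.anni_anni z z)

theorem cFock_mul_add (z w) : cFock a z * cFock a w + cFock a w * cFock a z =
    ((2 * (inner ℂ z w).re : ℝ) : ℂ) • 1 := by
  simp only [cFock, add_mul, mul_add]
  rw [h.anni_crea z w, h.anni_crea w z, h.crea_crea z w, h.anni_anni z w]
  have : ((2 * (inner ℂ z w).re : ℝ) : ℂ) = inner ℂ z w + inner ℂ w z := by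
    rw [← inner_conj_symm w z, Complex.add_conj]
  rw [this, add_smul]
  abel

theorem cFock_cFock_I {x : EuclideanSpace ℂ (Fin d)} (hx : ‖x‖ = 1) :
    cFock a x * cFock a (Complex.I • x) = Complex.I • (1 - 2 • (crea a x * anni a x)) := by
  have h1 : inner ℂ x x = 1 := by rw [inner_self_eq_norm_sq_to_K, hx]; simp
  simp only [cFock, crea_smul, anni_smul, add_mul, mul_add, mul_smul_comm, h.crea_sq, h.anni_sq,
    h.anni_crea, h1, one_smul, Complex.star_def, Complex.conj_I]
  module

theorem crea_grade {z I J} (hne : crea a z I J ≠ 0) : wt I = wt J + 1 := by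
  have key : diagonal (fun I => (wt I : ℂ)) * crea a z = crea a z * diagonal (fun I => (wt I : ℂ)) +
      crea a z := by
    rw [← h.num, Finset.sum_mul, Finset.mul_sum]
    have hb : ∀ j, anni a (EuclideanSpace.single j 1) = a j := fun j => by
      simp [anni, PiLp.single_apply, apply_ite, ite_smul]
    have hb' : ∀ j, crea a (EuclideanSpace.single j 1) = (a j)ᴴ := fun j => by
      rw [← anni_conjTranspose, hb]
    have : ∀ j, (a j)ᴴ * a j * crea a z = crea a z * ((a j)ᴴ * a j) + z j • (a j)ᴴ := fun j => by
      have := h.anni_crea (EuclideanSpace.single j 1) z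
      rw [hb] at this
      have hi : inner ℂ (EuclideanSpace.single j (1 : ℂ)) z = z j := by
        rw [EuclideanSpace.inner_single_left, map_one, one_mul]
      rw [mul_assoc, this, mul_sub, ← mul_assoc, ← hb', h.crea_crea _ z, ← mul_assoc, hi, mul_smul_comm,
        mul_one, neg_mul, sub_neg_eq_add, add_comm]
    rw [Finset.sum_congr rfl fun j _ => this j, Finset.sum_add_distrib]
    rfl
  have := congrFun (congrFun key I) J
  rw [diagonal_mul, Matrix.add_apply, mul_diagonal] at this
  have : ((wt I : ℂ) - (wt J + 1)) * crea a z I J = 0 := by linear_combination this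
  have := (mul_eq_zero.mp this).resolve_right hne
  rw [sub_eq_zero] at this
  exact_mod_cast this

theorem anni_grade {z I J} (hne : anni a z I J ≠ 0) : wt J = wt I + 1 := by
  apply h.crea_grade (z := z)
  rw [← anni_conjTranspose, conjTranspose_apply]
  exact star_ne_zero.mpr hne

theorem a_grade {j I J} (hne : a j I J ≠ 0) : wt J = wt I + 1 := by
  apply h.anni_grade (z := EuclideanSpace.single j 1)
  simpa [anni, PiLp.single_apply, apply_ite, ite_smul] using hne

theorem eq_one_of_commute {X : Matrix Λ Λ ℂ} (hX : ∀ j, X * (a j)ᴴ = (a j)ᴴ * X)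
    (h0 : ∀ J, wt J = 0 → ∀ I, X I J = (1 : Matrix Λ Λ ℂ) I J) : X = 1 := by
  rw [← sub_eq_zero]
  set Y := X - 1
  have hY : ∀ j, Y * (a j)ᴴ = (a j)ᴴ * Y := fun j => by simp [Y, sub_mul, mul_sub, hX]
  have key : Y * diagonal (fun I => (wt I : ℂ)) = ∑ j, (a j)ᴴ * (Y * a j) := by
    rw [← h.num, Finset.mul_sum]
    exact Finset.sum_congr rfl fun j _ => by rw [← mul_assoc, hY, mul_assoc]
  have : ∀ n J, wt J = n → ∀ I, Y I J = 0 := by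
    intro n
    induction n with
    | zero => exact fun J hJ I => sub_eq_zero.mpr (h0 J hJ I)
    | succ n ih =>
      intro J hJ I
      have := congrFun (congrFun key I) J
      rw [mul_diagonal, Matrix.sum_apply, Finset.sum_eq_zero] at this
      · refine (mul_eq_zero.mp this).resolve_right ?_
        rw [hJ]; exact_mod_cast n.succ_ne_zero
      · intro j _
        rw [mul_apply]
        refine Finset.sum_eq_zero fun K _ => mul_eq_zero_of_right _ ?_
        rw [mul_apply]
        refine Finset.sum_eq_zero fun L _ => ?_
        by_cases hL : a j L J = 0
        · rw [hL, mul_zero]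
        · rw [ih L (by have := h.a_grade hL; omega) K, zero_mul]
  ext I J
  exact this _ J rfl I

end IsFock

/-- Fermion parity. -/
def parity (wt : Λ → ℕ) : Matrix Λ Λ ℂ := diagonal fun I => (-1) ^ wt I

theorem parity_sq : parity wt * parity wt = 1 := by
  rw [parity, diagonal_mul_diagonal, ← diagonal_one]
  congr 1; ext I; rw [← mul_pow]; simp

theorem parity_isHermitian : (parity wt).IsHermitian := by
  rw [parity, IsHermitian, diagonal_conjTranspose]
  congr 1; ext I; simp

/-- Reflection in the particle number of `x`. -/
def refl1 (a : Fin d → Matrix Λ Λ ℂ) (x : EuclideanSpace ℂ (Fin d)) : Matrix Λ Λ ℂ :=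
  1 - 2 • (crea a x * anni a x)

namespace IsFock

variable (h : IsFock a wt)
include h

theorem parity_crea (z) : parity wt * crea a z = -(crea a z * parity wt) := by
  ext I J
  rw [parity, diagonal_mul, Matrix.neg_apply, mul_diagonal]
  by_cases hne : crea a z I J = 0
  · simp [hne]
  · rw [h.crea_grade hne, pow_succ]; ring

theorem parity_anni (z) : parity wt * anni a z = -(anni a z * parity wt) := by
  have := congrArg conjTranspose (h.parity_crea z)
  rw [conjTranspose_neg, conjTranspose_mul, conjTranspose_mul, crea_conjTranspose,
    parity_isHermitian.eq] at this
  rw [this, neg_neg]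

theorem parity_cFock (z) : parity wt * cFock a z = -(cFock a z * parity wt) := by
  rw [cFock, mul_add, h.parity_crea, h.parity_anni, add_mul, neg_add]

theorem refl1_crea_self {x : EuclideanSpace ℂ (Fin d)} (hx : ‖x‖ = 1) :
    refl1 a x * crea a x = -(crea a x * refl1 a x) := by
  have h1 : inner ℂ x x = 1 := by rw [inner_self_eq_norm_sq_to_K, hx]; simp
  simp only [refl1, sub_mul, mul_sub, one_mul, mul_one, smul_mul_assoc, mul_smul_comm]
  have hA : crea a x * anni a x * crea a x = crea a x := by
    rw [mul_assoc, h.anni_crea, h1, mul_sub, ← mul_assoc, h.crea_sq]; simp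
  have hB : crea a x * (crea a x * anni a x) = 0 := by rw [← mul_assoc, h.crea_sq, zero_mul]
  rw [hA, hB]
  module

theorem refl1_crea {x z : EuclideanSpace ℂ (Fin d)} (hx : inner ℂ x z = 0) :
    refl1 a x * crea a z = crea a z * refl1 a x := by
  simp only [refl1, sub_mul, mul_sub, one_mul, mul_one, smul_mul_assoc, mul_smul_comm]
  rw [mul_assoc, h.anni_crea, hx, zero_smul, zero_sub, mul_neg, ← mul_assoc, h.crea_crea x z,
    neg_mul, neg_neg, mul_assoc]

theorem refl1_sq {x : EuclideanSpace ℂ (Fin d)} (hx : ‖x‖ = 1) : refl1 a x * refl1 a x = 1 := by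
  have h1 : inner ℂ x x = 1 := by rw [inner_self_eq_norm_sq_to_K, hx]; simp
  have : crea a x * anni a x * (crea a x * anni a x) = crea a x * anni a x := by
    rw [mul_assoc, ← mul_assoc (anni a x), h.anni_crea, h1, sub_mul, mul_assoc (crea a x) (anni a x),
      h.anni_sq]
    simp
  simp only [refl1, sub_mul, mul_sub, one_mul, mul_one, smul_mul_assoc, mul_smul_comm, this]
  module

end IsFock

omit [Fintype Λ] in
theorem refl1_isHermitian [Fintype Λ] (x) : (refl1 a x).IsHermitian := by
  rw [IsHermitian, refl1, conjTranspose_sub, conjTranspose_one, conjTranspose_smul,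
    conjTranspose_mul, crea_conjTranspose, anni_conjTranspose]
  simp

theorem list_prod_mul_eq_smul {R A : Type*} [CommMonoid R] [Monoid A] [MulAction R A]
    [IsScalarTower R A A] [SMulCommClass R A A] (Y : A) :
    ∀ {n : ℕ} (X : Fin n → A) (s : Fin n → R), (∀ j, X j * Y = s j • (Y * X j)) →
      (List.ofFn X).prod * Y = (∏ j, s j) • (Y * (List.ofFn X).prod)
  | 0, X, s, _ => by simp
  | n + 1, X, s, h => by
    rw [List.ofFn_succ, List.prod_cons, mul_assoc,
      list_prod_mul_eq_smul Y (fun i => X i.succ) (fun i => s i.succ) (fun j => h _),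
      mul_smul_comm, ← mul_assoc, h, Fin.prod_univ_succ, smul_mul_assoc, smul_smul, mul_assoc,
      mul_comm (s 0)]

theorem IsFock.prod_refl1 (h : IsFock a wt)
    (b : OrthonormalBasis (Fin d) ℂ (EuclideanSpace ℂ (Fin d))) :
    (List.ofFn fun j => refl1 a (b j)).prod = parity wt := by
  set T := (List.ofFn fun j => refl1 a (b j)).prod with hT
  have hTb : ∀ k, T * crea a (b k) = -(crea a (b k) * T) := fun k => by
    have := list_prod_mul_eq_smul (R := ℂ) (crea a (b k)) (fun j => refl1 a (b j))
      (fun j => if j = k then -1 else 1) (fun j => by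
        by_cases hj : j = k
        · subst hj
          rw [if_pos rfl, neg_one_smul]
          exact h.refl1_crea_self (b.norm_eq_one j)
        · rw [if_neg hj, one_smul]
          exact h.refl1_crea (b.inner_eq_zero hj))
    rw [this, Finset.prod_ite_eq']
    simp [hT]
  have hTz : ∀ z, T * crea a z = -(crea a z * T) := fun z => by
    rw [← b.sum_repr z]
    have hs : crea a (∑ i, b.repr z i • b i) = ∑ i, b.repr z i • crea a (b i) := by
      let f : EuclideanSpace ℂ (Fin d) →ₗ[ℂ] Matrix Λ Λ ℂ :=
        { toFun := crea a, map_add' := crea_add, map_smul' := crea_smul }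
      exact (map_sum f _ _).trans (Finset.sum_congr rfl fun i _ => f.map_smul _ _)
    rw [hs, Finset.mul_sum, Finset.sum_mul, ← Finset.sum_neg_distrib]
    exact Finset.sum_congr rfl fun i _ => by
      rw [mul_smul_comm, hTb, smul_mul_assoc, smul_neg]
  have hcol : ∀ J, wt J = 0 → T *ᵥ Pi.single J 1 = Pi.single J 1 := fun J hJ => by
    have h1 : ∀ x, refl1 a x *ᵥ Pi.single J 1 = Pi.single J 1 := fun x => by
      have : anni a x *ᵥ Pi.single J 1 = 0 := by
        ext I
        rw [mulVec_single_one]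
        by_contra hne
        have := h.anni_grade hne
        omega
      rw [refl1, sub_mulVec, one_mulVec, smul_mulVec, ← mulVec_mulVec, this]
      simp
    have : ∀ l : List (Matrix Λ Λ ℂ), (∀ X ∈ l, X *ᵥ Pi.single J (1 : ℂ) = Pi.single J 1) →
        l.prod *ᵥ Pi.single J (1 : ℂ) = Pi.single J 1 := by
      intro l
      induction l with
      | nil => exact fun _ => one_mulVec _
      | cons X l ih =>
        intro hl
        rw [List.prod_cons, ← mulVec_mulVec, ih fun X hX => hl X (List.mem_cons_of_mem _ hX),
          hl X List.mem_cons_self]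
    refine this _ fun X hX => ?_
    obtain ⟨j, rfl⟩ := (List.mem_ofFn' _ _).mp hX
    exact h1 _
  have : T * parity wt = 1 := by
    refine h.eq_one_of_commute (fun j => ?_) fun J hJ I => ?_
    · have hb : crea a (EuclideanSpace.single j 1) = (a j)ᴴ := by
        simp [crea, PiLp.single_apply, ite_smul]
      rw [← hb, mul_assoc, h.parity_crea, mul_neg, ← mul_assoc, hTz, neg_mul, neg_neg, mul_assoc]
    · rw [parity, mul_diagonal, hJ, pow_zero, mul_one]
      have := congrFun (hcol J hJ) I
      rw [mulVec_single_one] at this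
      rw [one_apply, ← Pi.single_apply]
      simpa [Matrix.col] using this
  calc T = T * (parity wt * parity wt) := by rw [parity_sq, mul_one]
    _ = parity wt := by rw [← mul_assoc, this, one_mul]

end Fock

section Antisymmetrizer

open Equiv

variable {A : Type*} [Ring A] [Algebra ℝ A]

/-- Antisymmetrized product of the entries `G i (σ i)`. -/
def altProd {m : ℕ} (G : Fin m → Fin m → A) : A :=
  ∑ σ : Perm (Fin m), Perm.sign σ • (List.ofFn fun i => G i (σ i)).prod

omit [Algebra ℝ A] in
theorem altProd_succ {m : ℕ} {G : Fin (m + 1) → Fin (m + 1) → A} (h0 : G 0 0 = 1)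
    (h1 : ∀ i : Fin m, G 0 i.succ = 0) : altProd G = altProd fun i j => G i.succ j.succ := by
  rw [altProd, Finset.univ_perm_fin_succ, Finset.sum_map, ← Finset.univ_product_univ,
    Finset.sum_product, Fin.sum_univ_succ, Finset.sum_eq_zero (s := Finset.univ (α := Fin m)),
    add_zero, altProd]
  · refine Finset.sum_congr rfl fun σ _ => ?_
    simp [List.ofFn_succ, h0, Perm.decomposeFin.symm_sign]
  · intro i _
    refine Finset.sum_eq_zero fun σ _ => ?_
    simp [List.ofFn_succ, h1]

/-- The alternating map `X ↦ ∑ σ, sign σ • X (σ 0) * ⋯ * X (σ (m - 1))`. -/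
noncomputable def asym (m : ℕ) : A [⋀^Fin m]→ₗ[ℝ] A :=
  MultilinearMap.alternatization (MultilinearMap.mkPiAlgebraFin ℝ m A)

theorem asym_apply {m : ℕ} (X : Fin m → A) :
    asym m X = ∑ σ : Perm (Fin m), Perm.sign σ • (List.ofFn (X ∘ σ)).prod := by
  rw [asym, MultilinearMap.alternatization_apply]
  rfl

theorem asym_eq_altProd {m : ℕ} (X : Fin m → A) : asym m X = altProd fun _ j => X j := by
  rw [asym_apply, altProd]; rfl

theorem map_asym {B : Type*} [Ring B] [Algebra ℝ B] (φ : A →+* B) {m : ℕ} (X : Fin m → A) :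
    asym m (fun i => φ (X i)) = φ (asym m X) := by
  rw [asym_apply, asym_apply, map_sum]
  refine Finset.sum_congr rfl fun σ _ => ?_
  rw [Units.smul_def, Units.smul_def, map_zsmul, map_list_prod, List.map_ofFn]
  rfl

omit [Algebra ℝ A] in
theorem prod_swap_adjacent : ∀ {m : ℕ} (i : Fin m) (X : Fin (m + 1) → A),
    X i.castSucc * X i.succ = -(X i.succ * X i.castSucc) →
    (List.ofFn (X ∘ swap i.castSucc i.succ)).prod = -(List.ofFn X).prod
  | 0, i, _, _ => i.elim0
  | m + 1, i, X, h => by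
    refine Fin.cases ?_ (fun i => ?_) i (motive := fun i =>
      X i.castSucc * X i.succ = -(X i.succ * X i.castSucc) →
      (List.ofFn (X ∘ swap i.castSucc i.succ)).prod = -(List.ofFn X).prod) h
    · intro h
      have h2 : ∀ j : Fin m, swap (0 : Fin (m + 2)) 1 j.succ.succ = j.succ.succ := fun j =>
        swap_apply_of_ne_of_ne (Fin.succ_ne_zero _) (by
          rw [← Fin.succ_zero_eq_one]; exact fun h => Fin.succ_ne_zero _ (Fin.succ_injective _ h))
      rw [Fin.castSucc_zero, Fin.succ_zero_eq_one] at h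
      simp only [List.ofFn_succ, List.prod_cons, Function.comp_apply, Fin.castSucc_zero,
        Fin.succ_zero_eq_one, swap_apply_left, swap_apply_right, h2]
      rw [← mul_assoc, ← mul_assoc, h, neg_mul, neg_neg]
    · intro h
      have h0 : swap i.succ.castSucc i.succ.succ (0 : Fin (m + 2)) = 0 :=
        swap_apply_of_ne_of_ne (by simp [Fin.ext_iff]) (by simp [Fin.ext_iff])
      have hs : ∀ j : Fin (m + 1), swap i.succ.castSucc i.succ.succ j.succ =
          (swap i.castSucc i.succ j).succ := fun j => by
        rw [Fin.castSucc_succ, ← (Fin.succ_injective _).map_swap]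
      have := prod_swap_adjacent i (fun j => X j.succ) (by
        simpa only [Fin.castSucc_succ] using h)
      rw [List.ofFn_succ, List.ofFn_succ (f := X), List.prod_cons, List.prod_cons, ← mul_neg,
        ← this]
      simp only [Function.comp_apply, h0, hs]
      rfl

omit [Algebra ℝ A] in
theorem prod_perm_of_anticommute {m : ℕ} (σ : Perm (Fin m)) (X : Fin m → A)
    (h : ∀ i j, i ≠ j → X i * X j = -(X j * X i)) :
    (List.ofFn (X ∘ σ)).prod = Perm.sign σ • (List.ofFn X).prod := by
  rcases m with _ | m
  · simp [Subsingleton.elim σ 1]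
  · have hσ : σ ∈ Submonoid.closure (Set.range fun i : Fin m ↦ swap i.castSucc i.succ) := by
      rw [Perm.mclosure_swap_castSucc_succ]; trivial
    induction hσ using Submonoid.closure_induction generalizing X with
    | mem σ hσ =>
      obtain ⟨i, rfl⟩ := hσ
      have hne : i.castSucc ≠ i.succ := Fin.castSucc_lt_succ.ne
      rw [prod_swap_adjacent i X (h _ _ hne), Perm.sign_swap hne, Units.neg_smul, one_smul]
    | one => simp
    | mul σ τ _ _ hσ hτ =>
      rw [Perm.coe_mul, ← Function.comp_assoc, hτ (X ∘ σ) (fun i j hij =>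
        h _ _ (σ.injective.ne hij)), hσ X h, smul_smul, Perm.sign_mul, mul_comm]

theorem asym_of_anticommute {m : ℕ} (X : Fin m → A)
    (h : ∀ i j, i ≠ j → X i * X j = -(X j * X i)) :
    asym m X = (m.factorial : ℝ) • (List.ofFn X).prod := by
  rw [asym_apply, Finset.sum_congr rfl fun σ _ => by
    rw [prod_perm_of_anticommute σ X h, smul_smul, Int.units_mul_self, one_smul],
    Finset.sum_const, Finset.card_univ, Fintype.card_perm, Fintype.card_fin, Nat.cast_smul_eq_nsmul]

theorem AlternatingMap.eq_basis_det_smul {M V ι : Type*} [AddCommGroup M] [Module ℝ M]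
    [AddCommGroup V] [Module ℝ V] [Fintype ι] [DecidableEq ι] (f : M [⋀^ι]→ₗ[ℝ] V)
    (e : Module.Basis ι ℝ M) (v : ι → M) : f v = e.det v • f e := by
  have : f = (LinearMap.toSpanSingleton ℝ V (f e)).compAlternatingMap e.det := by
    refine e.ext_alternating fun w hw => ?_
    let σ : Perm ι := Equiv.ofBijective w (Finite.injective_iff_bijective.mp hw)
    have h1 : (fun i => e (w i)) = e ∘ σ := rfl
    rw [h1, AlternatingMap.map_perm, AlternatingMap.map_perm]
    simp [e.det_self]
  rw [this]
  simp [e.det_self]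

/-- Gram–Schmidt form: a family with scalar symmetrized products is, up to a nonzero factor,
replaced by an anticommuting one in the antisymmetrized product. -/
theorem exists_anticommuting {m : ℕ} (X : Fin m → A) (q : Matrix (Fin m) (Fin m) ℝ)
    (hq : q.IsHermitian) (h : ∀ i j, X i * X j + X j * X i = (2 * q i j) • (1 : A)) :
    ∃ (P : Matrix (Fin m) (Fin m) ℝ) (c : ℝ), c ≠ 0 ∧ P.transpose * P = 1 ∧
      (∀ i j, i ≠ j → (∑ k, P i k • X k) * (∑ k, P j k • X k) =
        -((∑ k, P j k • X k) * (∑ k, P i k • X k))) ∧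
      asym m X = c • (List.ofFn fun i => ∑ k, P i k • X k).prod := by
  set U : Matrix (Fin m) (Fin m) ℝ := hq.eigenvectorUnitary.1
  have hU : U.transpose * U = 1 := by
    have := (Matrix.mem_unitaryGroup_iff').mp hq.eigenvectorUnitary.2
    rwa [star_eq_conjTranspose, conjTranspose_eq_transpose_of_trivial] at this
  have hU' : U * U.transpose = 1 := mul_eq_one_comm.mp hU
  have hspec : U.transpose * q * U = diagonal hq.eigenvalues := by
    have := hq.spectral_theorem
    rw [Unitary.conjStarAlgAut_apply] at this
    have hs : (star hq.eigenvectorUnitary : Matrix (Fin m) (Fin m) ℝ) = U.transpose :=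
      conjTranspose_eq_transpose_of_trivial U
    rw [hs] at this
    conv_lhs => rw [this]
    calc U.transpose * (U * diagonal (RCLike.ofReal ∘ hq.eigenvalues) * U.transpose) * U
        = (U.transpose * U) * diagonal (RCLike.ofReal ∘ hq.eigenvalues) * (U.transpose * U) := by
          simp only [mul_assoc]
      _ = _ := by rw [hU, one_mul, mul_one]; rfl
  set P := U.transpose with hP
  set Y : Fin m → A := fun i => ∑ k, P i k • X k with hY
  have hYY : ∀ i j, Y i * Y j + Y j * Y i = (2 * (P * q * U) i j) • (1 : A) := by
    intro i j
    have h1 : Y i * Y j = ∑ k, ∑ l, (P i k * P j l) • (X k * X l) := by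
      simp only [hY, Finset.sum_mul_sum, smul_mul_smul_comm]
    have h2 : Y j * Y i = ∑ k, ∑ l, (P i k * P j l) • (X l * X k) := by
      simp only [hY, Finset.sum_mul_sum, smul_mul_smul_comm]
      rw [Finset.sum_comm]
      simp only [mul_comm]
    rw [h1, h2, ← Finset.sum_add_distrib]
    simp only [← Finset.sum_add_distrib, ← smul_add, h, smul_smul]
    simp only [← Finset.sum_smul]
    congr 1
    rw [mul_apply, Finset.mul_sum, Finset.sum_comm]
    refine Finset.sum_congr rfl fun l _ => ?_
    rw [mul_apply, Finset.sum_mul, Finset.mul_sum]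
    refine Finset.sum_congr rfl fun k _ => ?_
    rw [hP, transpose_apply, transpose_apply]; ring
  have hanti : ∀ i j, i ≠ j → Y i * Y j = -(Y j * Y i) := fun i j hij => by
    rw [eq_neg_iff_add_eq_zero, hYY, hspec, diagonal_apply_ne _ hij, mul_zero, zero_smul]
  have hdet : P.det ≠ 0 := by
    intro h0
    have := congrArg det hU
    rw [det_mul, h0, zero_mul, det_one] at this
    exact zero_ne_one this
  have hL : asym m Y = P.det • asym m X := by
    let L : (Fin m → ℝ) →ₗ[ℝ] A := Fintype.linearCombination ℝ X
    have := ((asym m).compLinearMap L).eq_basis_det_smul (Pi.basisFun ℝ (Fin m)) fun i => P i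
    rw [show (Pi.basisFun ℝ (Fin m)).det (fun i => P i) = P.det from Pi.basisFun_det_apply P, AlternatingMap.compLinearMap_apply,
      AlternatingMap.compLinearMap_apply] at this
    simpa only [L, Fintype.linearCombination_apply, Pi.basisFun_apply, Pi.single_apply, ite_smul,
      one_smul, zero_smul, Finset.sum_ite_eq', Finset.mem_univ, if_true] using this
  refine ⟨P, P.det⁻¹ * m.factorial, mul_ne_zero (inv_ne_zero hdet) (by positivity), ?_, hanti, ?_⟩
  · rw [hP, transpose_transpose, hU']
  · rw [mul_smul, ← asym_of_anticommute _ hanti, hL, smul_smul, inv_mul_cancel₀ hdet, one_smul]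

omit [Algebra ℝ A] in
theorem prod_mul_of_anticommute {m : ℕ} (Y : Fin m → A)
    (h : ∀ i j, i ≠ j → Y i * Y j = -(Y j * Y i)) (hm : Even m) (k : Fin m) :
    (List.ofFn Y).prod * Y k = -(Y k * (List.ofFn Y).prod) := by
  rw [list_prod_mul_eq_smul (R := ℤ) (Y k) Y (fun j => if j = k then 1 else -1) fun j => by
    by_cases hj : j = k
    · subst hj; simp
    · simp [hj, h j k hj]]
  have : ∏ j, (if j = k then (1 : ℤ) else -1) = (-1) ^ (m - 1) := by
    rw [Finset.prod_ite, Finset.prod_const_one, one_mul, Finset.prod_const,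
      Finset.filter_ne' Finset.univ k, Finset.card_erase_of_mem (Finset.mem_univ k)]
    simp
  rw [this, Odd.neg_one_pow (Nat.Even.sub_odd (by have := k.2; omega) hm odd_one), neg_one_smul]

theorem asym_mul {m : ℕ} (hm : Even m) (X : Fin m → A) (q : Matrix (Fin m) (Fin m) ℝ)
    (hq : q.IsHermitian) (h : ∀ i j, X i * X j + X j * X i = (2 * q i j) • (1 : A)) (k : Fin m) :
    asym m X * X k = -(X k * asym m X) := by
  obtain ⟨P, c, -, hP, hanti, hX⟩ := exists_anticommuting X q hq h
  have hk : X k = ∑ i, P i k • ∑ l, P i l • X l := by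
    have : ∀ l, (∑ i, P i k * P i l) = (1 : Matrix (Fin m) (Fin m) ℝ) k l := fun l => by
      rw [← hP, mul_apply]; rfl
    simp only [Finset.smul_sum, smul_smul]
    rw [Finset.sum_comm]
    simp only [← Finset.sum_smul, this, one_apply, ite_smul, one_smul, zero_smul,
      Finset.sum_ite_eq, Finset.mem_univ, if_true]
  rw [hX]
  have hY := prod_mul_of_anticommute _ hanti hm
  set T := (List.ofFn fun i => ∑ k, P i k • X k).prod
  rw [hk, Finset.mul_sum, Finset.sum_mul, ← Finset.sum_neg_distrib]
  refine Finset.sum_congr rfl fun i _ => ?_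
  rw [smul_mul_smul_comm, smul_mul_smul_comm, hY, smul_neg, mul_comm]

theorem asym_isUnit {m : ℕ} (X : Fin m → A) (q : Matrix (Fin m) (Fin m) ℝ)
    (hq : q.IsHermitian) (h : ∀ i j, X i * X j + X j * X i = (2 * q i j) • (1 : A))
    (hpos : ∀ c : Fin m → ℝ, c ≠ 0 → IsUnit (∑ k, c k • X k)) : IsUnit (asym m X) := by
  obtain ⟨P, c, hc, hP, -, hX⟩ := exists_anticommuting X q hq h
  have hP' : P * P.transpose = 1 := mul_eq_one_comm.mp hP
  have hT : IsUnit (List.ofFn fun i => ∑ k, P i k • X k).prod := by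
    refine List.prod_isUnit fun a ha => ?_
    obtain ⟨i, rfl⟩ := List.mem_ofFn.mp ha
    refine hpos _ fun h0 => one_ne_zero (α := ℝ) ?_
    rw [← one_apply_eq i, ← hP', mul_apply]
    exact Finset.sum_eq_zero fun k _ => by rw [congrFun h0 k, Pi.zero_apply, zero_mul]
  rw [hX]
  exact hT.smul (Units.mk0 c hc)

theorem prod_conjTranspose {ι : Type*} [Fintype ι] [DecidableEq ι] : ∀ {m : ℕ}
    (Y : Fin m → Matrix ι ι ℂ), (∀ i j, i ≠ j → Y i * Y j = -(Y j * Y i)) →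
    (∀ i, (Y i).IsHermitian) →
    (List.ofFn Y).prodᴴ = (-1 : ℂ) ^ (m * (m - 1) / 2) • (List.ofFn Y).prod
  | 0, Y, _, _ => by simp
  | m + 1, Y, h, hY => by
    rw [List.ofFn_succ, List.prod_cons, conjTranspose_mul, (hY 0).eq,
      prod_conjTranspose (fun i => Y i.succ) (fun i j hij => h _ _ (by simpa using hij))
        (fun i => hY _), smul_mul_assoc,
      list_prod_mul_eq_smul (R := ℂ) (Y 0) (fun i => Y i.succ) (fun _ => -1) (fun j => by
        rw [neg_one_smul]; exact h _ _ (Fin.succ_ne_zero j)), smul_smul, Finset.prod_const,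
      ← pow_add, Finset.card_univ, Fintype.card_fin]
    congr 2
    rcases m with _ | m
    · rfl
    · rw [Nat.add_sub_cancel, Nat.add_sub_cancel,
        show (m + 1 + 1) * (m + 1) = (m + 1) * m + (m + 1) * 2 by ring,
        Nat.add_mul_div_right _ _ (by norm_num)]

theorem asym_conjTranspose {ι : Type*} [Fintype ι] [DecidableEq ι] {n : ℕ}
    (X : Fin (2 * n) → Matrix ι ι ℂ) (q : Matrix (Fin (2 * n)) (Fin (2 * n)) ℝ)
    (hq : q.IsHermitian) (h : ∀ i j, X i * X j + X j * X i = (2 * q i j) • (1 : Matrix ι ι ℂ))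
    (hX : ∀ i, (X i).IsHermitian) :
    (asym (2 * n) X)ᴴ = (-1 : ℂ) ^ n • asym (2 * n) X := by
  obtain ⟨P, c, hc, hP, hanti, hXY⟩ := exists_anticommuting X q hq h
  rw [hXY, conjTranspose_smul, star_trivial, prod_conjTranspose _ hanti fun i => ?_, smul_comm]
  · congr 1
    rw [mul_assoc, Nat.mul_div_cancel_left _ (by norm_num), pow_mul']
    rcases n with _ | n
    · simp
    · rw [Odd.neg_one_pow (n := 2 * (n + 1) - 1) ⟨n, by omega⟩]
  · rw [IsHermitian, conjTranspose_sum]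
    exact Finset.sum_congr rfl fun k _ => by rw [conjTranspose_smul, star_trivial, (hX k).eq]

end Antisymmetrizer

/-- The complex Euclidean space of dimension `n + 1`. -/
abbrev CSpace (n : ℕ) := EuclideanSpace ℂ (Fin (n + 1))

section RealFamily

variable {n : ℕ}

/-- The enumeration `(j, 0), (j, 1)` of the real coordinates of `ℂ ^ (n + 1)`. -/
def realIdx (n : ℕ) : Fin (2 * n + 2) ≃ Fin (n + 1) × Fin 2 :=
  (finCongr (by ring)).trans finProdFinEquiv.symm

theorem realIdx_zero : realIdx n 0 = (0, 0) := by
  simp [realIdx, Fin.divNat, Fin.modNat]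

theorem realIdx_one : realIdx n (0 : Fin (2 * n + 1)).succ = (0, 1) := by
  simp [realIdx, Fin.divNat, Fin.modNat]

theorem realIdx_succ_succ (i : Fin (2 * n)) :
    realIdx n i.succ.succ = (Fin.succ ⟨i / 2, by omega⟩, ⟨i % 2, by omega⟩) := by
  simp [realIdx, Fin.ext_iff, Fin.divNat, Fin.modNat]
  omega

/-- The family `b 0, i b 0, b 1, i b 1, …`. -/
noncomputable def realFam (b : Fin (n + 1) → CSpace n) (i : Fin (2 * n + 2)) : CSpace n :=
  Complex.basisOneI (realIdx n i).2 • b (realIdx n i).1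

/-- The family `b 1, i b 1, b 2, i b 2, …`. -/
noncomputable def tailFam (b : Fin (n + 1) → CSpace n) (i : Fin (2 * n)) : CSpace n :=
  realFam b i.succ.succ

theorem realFam_zero (b : Fin (n + 1) → CSpace n) : realFam b 0 = b 0 := by
  simp [realFam, realIdx_zero, Complex.coe_basisOneI]

theorem realFam_one (b : Fin (n + 1) → CSpace n) :
    realFam b (0 : Fin (2 * n + 1)).succ = Complex.I • b 0 := by
  rw [realFam, realIdx_one, Complex.coe_basisOneI]; simp

theorem realFam_one' (b : Fin (n + 1) → CSpace n) : realFam b 1 = Complex.I • b 0 := realFam_one b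

theorem tailFam_apply (b : Fin (n + 1) → CSpace n) (i : Fin (2 * n)) :
    tailFam b i = Complex.basisOneI ⟨i % 2, by omega⟩ • b (Fin.succ ⟨i / 2, by omega⟩) := by
  rw [tailFam, realFam, realIdx_succ_succ]

theorem inner_tailFam (b : OrthonormalBasis (Fin (n + 1)) ℂ (CSpace n)) (i : Fin (2 * n)) :
    inner ℂ (b 0) (tailFam b i) = 0 := by
  rw [tailFam_apply, inner_smul_right, b.orthonormal.2 (Fin.succ_ne_zero _).symm, mul_zero]

/-- The real basis underlying a complex orthonormal basis. -/
noncomputable def realBasis (b : OrthonormalBasis (Fin (n + 1)) ℂ (CSpace n)) :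
    Module.Basis (Fin (2 * n + 2)) ℝ (CSpace n) :=
  (Complex.basisOneI.smulTower' b.toBasis).reindex (realIdx n).symm

theorem coe_realBasis (b : OrthonormalBasis (Fin (n + 1)) ℂ (CSpace n)) : ⇑(realBasis b) = realFam b := by
  ext i : 1
  rw [realBasis, Module.Basis.reindex_apply, Module.Basis.smulTower'_apply]
  simp [realFam]

theorem realBasis_det (a b : OrthonormalBasis (Fin (n + 1)) ℂ (CSpace n)) :
    (realBasis a).det (realFam b) = 1 := by
  let L : CSpace n →ₗ[ℂ] CSpace n := (a.toBasis.equiv b.toBasis (Equiv.refl _)).toLinearMap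
  have hL : ∀ j, L (a j) = b j := fun j => by
    have := a.toBasis.equiv_apply j b.toBasis (Equiv.refl _)
    simpa [L] using this
  have h1 : realFam b = L.restrictScalars ℝ ∘ realBasis a := by
    ext i : 1
    rw [coe_realBasis, Function.comp_apply, LinearMap.restrictScalars_apply, realFam, realFam,
      map_smul, hL]
  have h2 : ‖LinearMap.det L‖ = 1 := by
    rw [← a.det_to_matrix_orthonormalBasis b]
    have h3 : ⇑b = L ∘ a.toBasis := by
      ext i : 1
      rw [Function.comp_apply, OrthonormalBasis.coe_toBasis, hL]
    rw [h3, Module.Basis.det_comp, Module.Basis.det_self, mul_one]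
  rw [h1, Module.Basis.det_comp, Module.Basis.det_self, mul_one, LinearMap.det_restrictScalars,
    Algebra.norm_complex_apply, Complex.normSq_eq_norm_sq, h2, one_pow]

theorem exists_eq_sum_tailFam (b : OrthonormalBasis (Fin (n + 1)) ℂ (CSpace n)) {u : CSpace n}
    (hu : inner ℂ (b 0) u = 0) : ∃ c : Fin (2 * n) → ℝ, u = ∑ k, c k • tailFam b k := by
  have h := (realBasis b).sum_repr u
  set r := (realBasis b).repr u
  rw [coe_realBasis, Fin.sum_univ_succ, Fin.sum_univ_succ, realFam_zero, realFam_one] at h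
  refine ⟨fun k => r k.succ.succ, ?_⟩
  have h0 : (r 0 : ℂ) + r (0 : Fin (2 * n + 1)).succ * Complex.I = 0 := by
    rw [← hu, ← h, inner_add_right, inner_add_right, inner_sum, Finset.sum_eq_zero]
    · simp only [← Complex.coe_smul, inner_smul_right, inner_self_eq_norm_sq_to_K,
        b.orthonormal.1]
      simp
    · intro k _
      rw [← Complex.coe_smul, inner_smul_right]
      exact mul_eq_zero_of_right _ (inner_tailFam b k)
  have hre := congrArg Complex.re h0
  have him := congrArg Complex.im h0
  simp at hre him
  rw [← h, hre, zero_smul, zero_add]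
  erw [him]
  rw [zero_smul, zero_add]
  rfl

theorem re_inner_tailFam (b : OrthonormalBasis (Fin (n + 1)) ℂ (CSpace n)) {i j : Fin (2 * n)}
    (hij : i ≠ j) : (inner ℂ (tailFam b i) (tailFam b j)).re = 0 := by
  rw [tailFam_apply, tailFam_apply, inner_smul_left, inner_smul_right]
  by_cases h : (i : ℕ) / 2 = j / 2
  · simp only [h, b.inner_eq_one, mul_one, Complex.coe_basisOneI]
    have : (i : ℕ) % 2 = 0 ∧ (j : ℕ) % 2 = 1 ∨ (i : ℕ) % 2 = 1 ∧ (j : ℕ) % 2 = 0 := by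
      have := Fin.val_ne_of_ne hij; omega
    rcases this with ⟨h0, h1⟩ | ⟨h0, h1⟩ <;> simp [h0, h1]
  · rw [b.orthonormal.2 (by simpa [Fin.ext_iff] using h)]
    simp

theorem linearIndependent_tailFam (b : OrthonormalBasis (Fin (n + 1)) ℂ (CSpace n)) :
    LinearIndependent ℝ (tailFam b) := by
  have h := (realBasis b).linearIndependent
  rw [coe_realBasis] at h
  exact h.comp (fun i : Fin (2 * n) => i.succ.succ)
    ((Fin.succ_injective _).comp (Fin.succ_injective _))

theorem exists_orthonormalBasis_zero {x : CSpace n} (hx : ‖x‖ = 1) :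
    ∃ b : OrthonormalBasis (Fin (n + 1)) ℂ (CSpace n), b 0 = x := by
  obtain ⟨b, hb⟩ := Orthonormal.exists_orthonormalBasis_extension_of_card_eq (𝕜 := ℂ)
    (ι := Fin (n + 1)) (by simp) (v := fun _ => x) (s := {0})
    ⟨fun _ => hx, fun i j hij => absurd (Subsingleton.elim i j) hij⟩
  exact ⟨b, hb 0 rfl⟩

end RealFamily

section WForm

variable {n : ℕ} {A : Type*} [Ring A] [Algebra ℝ A]

/-- The real-linear form `v ↦ Re ⟨x, v⟩ • 1`. -/
noncomputable def reForm (A : Type*) [Ring A] [Algebra ℝ A] (x : CSpace n) : CSpace n →ₗ[ℝ] A where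
  toFun v := (inner ℂ x v).re • (1 : A)
  map_add' u v := by rw [inner_add_right, Complex.add_re, add_smul]
  map_smul' c v := by
    rw [← Complex.coe_smul, inner_smul_right, Complex.re_ofReal_mul, mul_smul, RingHom.id_apply]

/-- The forms whose antisymmetrized product defines `wForm`. -/
noncomputable def wSlots (x : CSpace n) (K : CSpace n →ₗ[ℝ] A) : Fin (2 * n + 2) → (CSpace n →ₗ[ℝ] A) :=
  Fin.cons (reForm A x) (Fin.cons (reForm A (Complex.I • x)) fun _ : Fin (2 * n) => K)

theorem wSlots_zero (x : CSpace n) (K : CSpace n →ₗ[ℝ] A) : wSlots x K 0 = reForm A x := rfl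

theorem wSlots_one (x : CSpace n) (K : CSpace n →ₗ[ℝ] A) :
    wSlots x K (0 : Fin (2 * n + 1)).succ = reForm A (Complex.I • x) := rfl

theorem wSlots_succ_succ (x : CSpace n) (K : CSpace n →ₗ[ℝ] A) (i : Fin (2 * n)) :
    wSlots x K i.succ.succ = K := rfl

/-- The antisymmetrized product of `Re ⟨x, ·⟩`, `Re ⟨i x, ·⟩` and `2 n` copies of `K`. -/
noncomputable def wForm (x : CSpace n) (K : CSpace n →ₗ[ℝ] A) : CSpace n [⋀^Fin (2 * n + 2)]→ₗ[ℝ] A :=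
  MultilinearMap.alternatization
    ((MultilinearMap.mkPiAlgebraFin ℝ (2 * n + 2) A).compLinearMap (wSlots x K))

theorem wForm_apply (x : CSpace n) (K : CSpace n →ₗ[ℝ] A) (v : Fin (2 * n + 2) → CSpace n) :
    wForm x K v = altProd fun i j => wSlots x K i (v j) := by
  rw [wForm, MultilinearMap.alternatization_apply]
  rfl

/-- The coefficient of `wForm` in an orthonormal basis. -/
noncomputable def wVal (x : CSpace n) (K : CSpace n →ₗ[ℝ] A) : A :=
  wForm x K (realFam (EuclideanSpace.basisFun (Fin (n + 1)) ℂ))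

theorem wVal_eq_asym (b : OrthonormalBasis (Fin (n + 1)) ℂ (CSpace n)) (K : CSpace n →ₗ[ℝ] A) :
    wVal (b 0) K = asym (2 * n) fun i => K (tailFam b i) := by
  have h1 : wVal (b 0) K = wForm (b 0) K (realFam b) := by
    rw [(wForm (b 0) K).eq_basis_det_smul (realBasis (EuclideanSpace.basisFun (Fin (n + 1)) ℂ))
      (realFam b), realBasis_det, one_smul, coe_realBasis, wVal]
  rw [h1, wForm_apply, altProd_succ, altProd_succ, asym_eq_altProd]
  · rfl
  · simp [wSlots, reForm, realFam_one', b.orthonormal.1]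
  · intro i
    have : realFam b i.succ.succ = tailFam b i := rfl
    simp [wSlots, reForm, this, inner_tailFam]
  · simp [wSlots, reForm, realFam_zero, b.orthonormal.1]
  · intro i
    refine Fin.cases ?_ (fun i => ?_) i
    · simp [wSlots, reForm, realFam_one', b.orthonormal.1]
    · have : realFam b i.succ.succ = tailFam b i := rfl
      simp [wSlots, reForm, this, inner_tailFam]

theorem wVal_map {B : Type*} [Ring B] [Algebra ℝ B] {x : CSpace n} (hx : ‖x‖ = 1) (l μ : Circle)
    (φ : A →+* B) (K : CSpace n →ₗ[ℝ] A) (K' : CSpace n →ₗ[ℝ] B)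
    (h : ∀ u, inner ℂ x u = 0 → K' ((μ : ℂ) • u) = φ (K u)) :
    wVal ((l : ℂ) • x) K' = φ (wVal x K) := by
  obtain ⟨b, rfl⟩ := exists_orthonormalBasis_zero hx
  have hn : ∀ c : Circle, ‖(c : ℂ)‖ = 1 := Circle.norm_coe
  let c : Fin (n + 1) → Circle := Fin.cons l fun _ => μ
  obtain ⟨b', hb'⟩ := Orthonormal.exists_orthonormalBasis_extension_of_card_eq (𝕜 := ℂ)
    (ι := Fin (n + 1)) (by simp) (v := fun i => (c i : ℂ) • b i) (s := Set.univ) (by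
      constructor
      · intro i
        simp [norm_smul, b.orthonormal.1, hn (c i)]
      · intro i j hij
        simp [inner_smul_left, inner_smul_right, b.orthonormal.2 (Subtype.coe_injective.ne hij)])
  have h0 : b' 0 = (l : ℂ) • b 0 := hb' 0 trivial
  have hs : ∀ i : Fin n, b' i.succ = (μ : ℂ) • b i.succ := fun i => hb' _ trivial
  rw [← h0, wVal_eq_asym, wVal_eq_asym, ← map_asym]
  congr 1
  funext i
  rw [← h _ (inner_tailFam b i), tailFam_apply, tailFam_apply, hs, smul_comm]

section Quadratic

variable {x : CSpace n} (hx : ‖x‖ = 1) (K : CSpace n →ₗ[ℝ] A) (q : CSpace n → CSpace n → ℝ) (hq : ∀ u v, q u v = q v u)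
  (hK : ∀ u v, inner ℂ x u = 0 → inner ℂ x v = 0 →
    K u * K v + K v * K u = (2 * q u v) • (1 : A))

include hx hq hK

theorem wVal_mul {u : CSpace n} (hu : inner ℂ x u = 0) :
    wVal x K * K u = -(K u * wVal x K) := by
  obtain ⟨b, rfl⟩ := exists_orthonormalBasis_zero hx
  obtain ⟨c, rfl⟩ := exists_eq_sum_tailFam b hu
  rw [wVal_eq_asym, map_sum, Finset.mul_sum, Finset.sum_mul, ← Finset.sum_neg_distrib]
  refine Finset.sum_congr rfl fun i _ => ?_
  rw [map_smul, mul_smul_comm, smul_mul_assoc,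
    asym_mul (even_two_mul n) (fun i => K (tailFam b i))
      (Matrix.of fun i j => q (tailFam b i) (tailFam b j))
      (by ext i j; simp [hq]) (fun i j => by
        simpa using hK _ _ (inner_tailFam b i) (inner_tailFam b j)) i, smul_neg]

theorem wVal_isUnit (hpos : ∀ u, u ≠ 0 → inner ℂ x u = 0 → IsUnit (K u)) : IsUnit (wVal x K) := by
  obtain ⟨b, rfl⟩ := exists_orthonormalBasis_zero hx
  rw [wVal_eq_asym]
  refine asym_isUnit _ (Matrix.of fun i j => q (tailFam b i) (tailFam b j))
      (by ext i j; simp [hq]) (fun i j => by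
        simpa using hK _ _ (inner_tailFam b i) (inner_tailFam b j)) fun c hc => ?_
  have : ∑ k, c k • K (tailFam b k) = K (∑ k, c k • tailFam b k) := by
    rw [map_sum]; simp only [map_smul]
  rw [this]
  refine hpos _ (fun h0 => hc ?_) ?_
  · exact funext (Fintype.linearIndependent_iff.mp (linearIndependent_tailFam b) c h0)
  · rw [inner_sum]
    refine Finset.sum_eq_zero fun k _ => ?_
    rw [← Complex.coe_smul, inner_smul_right]
    exact mul_eq_zero_of_right _ (inner_tailFam b k)

end Quadratic

theorem wVal_conjTranspose {ι : Type*} [Fintype ι] [DecidableEq ι] {x : CSpace n} (hx : ‖x‖ = 1)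
    (K : CSpace n →ₗ[ℝ] Matrix ι ι ℂ) (q : CSpace n → CSpace n → ℝ) (hq : ∀ u v, q u v = q v u)
    (hK : ∀ u v, inner ℂ x u = 0 → inner ℂ x v = 0 →
      K u * K v + K v * K u = (2 * q u v) • (1 : Matrix ι ι ℂ))
    (hK' : ∀ u, (K u).IsHermitian) : (wVal x K)ᴴ = (-1 : ℂ) ^ n • wVal x K := by
  obtain ⟨b, rfl⟩ := exists_orthonormalBasis_zero hx
  rw [wVal_eq_asym]
  exact asym_conjTranspose _ (Matrix.of fun i j => q (tailFam b i) (tailFam b j))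
      (by ext i j; simp [hq]) (fun i j => by
        simpa using hK _ _ (inner_tailFam b i) (inner_tailFam b j)) fun i => hK' _

theorem wVal_neg {x : CSpace n} (hx : ‖x‖ = 1) (K : CSpace n →ₗ[ℝ] A) : wVal x (-K) = wVal x K := by
  obtain ⟨b, rfl⟩ := exists_orthonormalBasis_zero hx
  rw [wVal_eq_asym, wVal_eq_asym]
  have := (asym (A := A) (2 * n)).toMultilinearMap.map_smul_univ (fun _ => -1)
    fun i => K (tailFam b i)
  simpa using this

theorem continuous_wVal [TopologicalSpace A] [IsTopologicalRing A] [ContinuousSMul ℝ A]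
    {X : Type*} [TopologicalSpace X] (x : X → CSpace n) (K : X → CSpace n →ₗ[ℝ] A) (hx : Continuous x)
    (hK : ∀ u, Continuous fun p => K p u) : Continuous fun p => wVal (x p) (K p) := by
  have hlist : ∀ (m : ℕ) (g : Fin m → X → A), (∀ i, Continuous (g i)) →
      Continuous fun p => (List.ofFn fun i => g i p).prod := by
    intro m
    induction m with
    | zero => intro g _; simpa using continuous_const
    | succ m ih =>
      intro g hg
      simp only [List.ofFn_succ, List.prod_cons]
      exact (hg 0).mul (ih (fun i => g i.succ) fun i => hg _)
  have hre : ∀ (y : X → CSpace n) (_ : Continuous y) (u : CSpace n), Continuous fun p => reForm A (y p) u := by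
    intro y hy u
    exact (Complex.continuous_re.comp (hy.inner continuous_const)).smul continuous_const
  have hIx : Continuous fun p => Complex.I • x p :=
    (continuous_const_smul Complex.I).comp hx
  have hslots : ∀ (i : Fin (2 * n + 2)) (u : CSpace n),
      Continuous fun p => wSlots (x p) (K p) i u := by
    intro i u
    rcases Fin.eq_zero_or_eq_succ i with rfl | ⟨i, rfl⟩
    · simp only [wSlots_zero]
      exact hre x hx u
    · rcases Fin.eq_zero_or_eq_succ i with rfl | ⟨i, rfl⟩
      · simp only [wSlots_one]
        exact hre (fun p => Complex.I • x p) hIx u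
      · simp only [wSlots_succ_succ]
        exact hK u
  simp only [wVal, wForm_apply, altProd, Units.smul_def]
  exact continuous_finsetSum _ fun σ _ => (continuous_zsmul _).comp
    (hlist _ (fun i p => wSlots (x p) (K p) i _) fun i => hslots i _)

end WForm

theorem prod_ofFn_smul {A : Type*} [Ring A] [Algebra ℂ A] (c : ℂ) : ∀ {n : ℕ} (X : Fin n → A),
    (List.ofFn fun i => c • X i).prod = c ^ n • (List.ofFn X).prod
  | 0, X => by simp
  | n + 1, X => by
    rw [List.ofFn_succ, List.ofFn_succ, List.prod_cons, List.prod_cons, prod_ofFn_smul,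
      smul_mul_smul_comm, pow_succ']

theorem IsFock.wVal_cFock {n : ℕ} {Λ : Type*} [Fintype Λ] [DecidableEq Λ]
    {a : Fin (n + 1) → Matrix Λ Λ ℂ} {wt : Λ → ℕ} (ha : IsFock a wt)
    {x : EuclideanSpace ℂ (Fin (n + 1))} (hx : ‖x‖ = 1)
    (K : EuclideanSpace ℂ (Fin (n + 1)) →ₗ[ℝ] Matrix Λ Λ ℂ)
    (hK : ∀ u, inner ℂ x u = 0 → K u = cFock a u) :
    wVal x K = (((2 * n).factorial : ℂ) * Complex.I ^ n) • (refl1 a x * parity wt) := by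
  obtain ⟨b, rfl⟩ := exists_orthonormalBasis_zero hx
  have hanti : ∀ i j, i ≠ j → cFock a (tailFam b i) * cFock a (tailFam b j) =
      -(cFock a (tailFam b j) * cFock a (tailFam b i)) := fun i j hij => by
    rw [eq_neg_iff_add_eq_zero, ha.cFock_mul_add]
    rw [re_inner_tailFam b hij]; simp
  have hprod : (List.ofFn fun i => cFock a (tailFam b i)).prod =
      Complex.I ^ n • (List.ofFn fun i : Fin n => refl1 a (b i.succ)).prod := by
    rw [List.ofFn_mul', List.prod_flatten, List.map_ofFn]
    have : ∀ i : Fin n, (List.prod ∘ fun i : Fin n => List.ofFn fun j : Fin 2 =>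
        cFock a (tailFam b ⟨2 * i + j, by omega⟩)) i = Complex.I • refl1 a (b i.succ) := by
      intro i
      have h0 : tailFam b ⟨2 * i + 0, by omega⟩ = b i.succ := by
        rw [tailFam_apply]; simp
      have h1 : tailFam b ⟨2 * i + 1, by omega⟩ = Complex.I • b i.succ := by
        rw [tailFam_apply, Complex.coe_basisOneI]; simp [Nat.mul_add_div, Nat.add_mod]
      simp only [Function.comp_apply, List.ofFn_succ, List.ofFn_zero, List.prod_cons,
        List.prod_nil, mul_one]
      erw [h0, h1]
      rw [ha.cFock_cFock_I (b.orthonormal.1 _)]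
      rfl
    rw [funext this, prod_ofFn_smul]
  have hp := ha.prod_refl1 b
  rw [List.ofFn_succ, List.prod_cons] at hp
  rw [wVal_eq_asym]
  simp only [hK _ (inner_tailFam b _)]
  rw [asym_of_anticommute _ hanti, hprod, ← hp, ← mul_assoc, ha.refl1_sq hx, one_mul, mul_smul]
  norm_cast

section TopOpens

open Filter Topology

section Compactness

variable {X H : Type*} [TopologicalSpace X] [NormedAddCommGroup H] [InnerProductSpace ℂ H]
  [FiniteDimensional ℂ H]

/-- A large multiple of `C` added to `W` stays injective, if `W` is injective at the zeros of `C`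
and asymptotically orthogonal to `C` nearby. -/
theorem eventually_smul_add_ne_zero {S : Set X} (hS : IsCompact S) {C W : X → H → H} {ρ : X → ℝ}
    (hW : Continuous fun z : X × H => W z.1 z.2) (hρ : Continuous ρ) (hCn : ∀ p v, ‖v‖ = 1 → ‖C p v‖ = ρ p)
    (hinj : ∀ p ∈ S, ρ p = 0 → ∀ v, ‖v‖ = 1 → W p v ≠ 0)
    (hest : ∀ p ∈ S, ρ p = 0 → ∀ v, ‖v‖ = 1 → ∀ ε > 0, ∀ᶠ z : X × H in 𝓝 (p, v), ‖z.2‖ = 1 →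
      |(inner ℂ (C z.1 z.2) (W z.1 z.2)).re| ≤ ε * ρ z.1) :
    ∀ᶠ Λ : ℝ in atTop, ∀ p ∈ S, ∀ v, ‖v‖ = 1 → Λ • C p v + W p v ≠ 0 := by
  have hcomp : IsCompact (S ×ˢ Metric.sphere (0 : H) 1) :=
    hS.prod (@isCompact_sphere H _ (FiniteDimensional.proper ℂ H) 0 1)
  suffices h : ∀ᶠ Λ : ℝ in atTop, ∀ z ∈ S ×ˢ Metric.sphere (0 : H) 1,
      Λ • C z.1 z.2 + W z.1 z.2 ≠ 0 by
    filter_upwards [h] with Λ h p hp v hv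
    exact h (p, v) ⟨hp, by simpa using hv⟩
  refine hcomp.induction_on (p := fun s => ∀ᶠ Λ : ℝ in atTop, ∀ z ∈ s,
      Λ • C z.1 z.2 + W z.1 z.2 ≠ 0) ?_ ?_ ?_ ?_
  · simp
  · intro s t hst h
    filter_upwards [h] with Λ h z hz using h z (hst hz)
  · intro s t hs ht
    filter_upwards [hs, ht] with Λ hs ht z hz
    exact hz.elim (hs z) (ht z)
  · rintro ⟨p₀, v₀⟩ ⟨hp₀, hv₀⟩
    rw [mem_sphere_zero_iff_norm] at hv₀
    have hnorm : ∀ᶠ z in 𝓝[S ×ˢ Metric.sphere (0 : H) 1] (p₀, v₀), ‖z.2‖ = 1 := by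
      filter_upwards [self_mem_nhdsWithin] with z hz
      simpa using hz.2
    have key : ∀ {Λ : ℝ} {z : X × H}, 0 < Λ → ‖z.2‖ = 1 → Λ • C z.1 z.2 + W z.1 z.2 = 0 →
        ‖W z.1 z.2‖ = Λ * ρ z.1 ∧ (inner ℂ (C z.1 z.2) (W z.1 z.2)).re = -(Λ * ρ z.1 ^ 2) := by
      intro Λ z hΛ hz h
      have hWz : W z.1 z.2 = -(Λ • C z.1 z.2) := by rw [eq_neg_iff_add_eq_zero, add_comm, h]
      rw [hWz, norm_neg, norm_smul, hCn _ _ hz, Real.norm_of_nonneg hΛ.le]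
      refine ⟨rfl, ?_⟩
      rw [← Complex.coe_smul, inner_neg_right, inner_smul_right, inner_self_eq_norm_sq_to_K,
        hCn _ _ hz]
      simp [← Complex.ofReal_pow]
    by_cases h0 : ρ p₀ = 0
    · set b := ‖W p₀ v₀‖ with hb
      have hbpos : 0 < b := norm_pos_iff.mpr (hinj p₀ hp₀ h0 v₀ hv₀)
      have h1 : ∀ᶠ z : X × H in 𝓝 (p₀, v₀), b / 2 < ‖W z.1 z.2‖ :=
        hW.norm.continuousAt.eventually (lt_mem_nhds (by simpa [← hb] using hbpos))
      refine ⟨{z | ‖z.2‖ = 1 ∧ b / 2 < ‖W z.1 z.2‖ ∧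
        |(inner ℂ (C z.1 z.2) (W z.1 z.2)).re| ≤ b / 2 * ρ z.1}, ?_, ?_⟩
      · filter_upwards [hnorm, nhdsWithin_le_nhds h1,
          nhdsWithin_le_nhds (hest p₀ hp₀ h0 v₀ hv₀ (b / 2) (by positivity))] with z hz hz1 hz2
        exact ⟨hz, hz1, hz2 hz⟩
      · filter_upwards [eventually_gt_atTop 0] with Λ hΛ z ⟨hz, hz1, hz2⟩ h
        obtain ⟨hk1, hk2⟩ := key hΛ hz h
        rw [hk2, abs_neg] at hz2
        have hρ0 : 0 ≤ ρ z.1 := by rw [← hCn z.1 z.2 hz]; exact norm_nonneg _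
        rw [abs_of_nonneg (by positivity)] at hz2
        rw [hk1] at hz1
        rcases hρ0.eq_or_lt with hρz | hρz
        · rw [← hρz, mul_zero] at hz1
          linarith
        · nlinarith
    · have hpos : 0 < ρ p₀ := lt_of_le_of_ne (by
        rw [← hCn p₀ v₀ hv₀]; exact norm_nonneg _) (Ne.symm h0)
      have h1 : ∀ᶠ z : X × H in 𝓝 (p₀, v₀), ‖W z.1 z.2‖ < ‖W p₀ v₀‖ + 1 :=
        hW.norm.continuousAt.eventually (gt_mem_nhds (by simp))
      have h2 : ∀ᶠ z : X × H in 𝓝 (p₀, v₀), ρ p₀ / 2 < ρ z.1 :=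
        (hρ.comp continuous_fst).continuousAt.eventually (lt_mem_nhds (by simpa using hpos))
      refine ⟨{z | ‖z.2‖ = 1 ∧ ‖W z.1 z.2‖ < ‖W p₀ v₀‖ + 1 ∧ ρ p₀ / 2 < ρ z.1}, ?_, ?_⟩
      · filter_upwards [hnorm, nhdsWithin_le_nhds h1, nhdsWithin_le_nhds h2] with z hz hz1 hz2
        exact ⟨hz, hz1, hz2⟩
      · filter_upwards [eventually_gt_atTop 0,
          eventually_ge_atTop ((‖W p₀ v₀‖ + 1) / (ρ p₀ / 2))] with Λ hΛ hΛ' z ⟨hz, hz1, hz2⟩ h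
        obtain ⟨hk1, -⟩ := key hΛ hz h
        rw [div_le_iff₀ (by positivity)] at hΛ'
        nlinarith

end Compactness

section MatrixAction

variable {ι : Type*} [Fintype ι]

/-- The action of a matrix on Euclidean space. -/
noncomputable def mulE (M : Matrix ι ι ℂ) (v : EuclideanSpace ℂ ι) : EuclideanSpace ℂ ι :=
  WithLp.toLp 2 (M *ᵥ v.ofLp)

theorem mulE_mulE (M N : Matrix ι ι ℂ) (v : EuclideanSpace ℂ ι) :
    mulE M (mulE N v) = mulE (M * N) v := by
  simp [mulE]

theorem mulE_add (M N : Matrix ι ι ℂ) (v : EuclideanSpace ℂ ι) :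
    mulE (M + N) v = mulE M v + mulE N v := by
  simp [mulE, add_mulVec]

theorem mulE_smul (c : ℝ) (M : Matrix ι ι ℂ) (v : EuclideanSpace ℂ ι) :
    mulE (c • M) v = c • mulE M v := by
  simp [mulE, smul_mulVec]

theorem inner_mulE_left (M : Matrix ι ι ℂ) (u v : EuclideanSpace ℂ ι) :
    inner ℂ (mulE M u) v = inner ℂ u (mulE Mᴴ v) := by
  simp only [mulE, EuclideanSpace.inner_eq_star_dotProduct]
  rw [star_mulVec, dotProduct_comm, ← dotProduct_mulVec, dotProduct_comm]

theorem continuous_mulE {X : Type*} [TopologicalSpace X] {M : X → Matrix ι ι ℂ}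
    (hM : Continuous M) : Continuous fun z : X × EuclideanSpace ℂ ι => mulE (M z.1) z.2 :=
  (PiLp.continuous_toLp 2 _).comp ((hM.comp continuous_fst).matrix_mulVec
    ((PiLp.continuous_ofLp 2 _).comp continuous_snd))

end MatrixAction

section CliffordMaps

variable {ι : Type*} [Fintype ι] [DecidableEq ι] {Q : Type*} [NormedAddCommGroup Q]
  [NormedSpace ℝ Q]

/-- Real linear maps into the Hermitian matrices with `κ w ^ 2 = ‖w‖ ^ 2`. -/
structure IsCliffMap (κ : Q →ₗ[ℝ] Matrix ι ι ℂ) : Prop where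
  herm : ∀ w, (κ w).IsHermitian
  sq : ∀ w, κ w * κ w = (‖w‖ ^ 2) • (1 : Matrix ι ι ℂ)

namespace IsCliffMap

variable {κ : Q →ₗ[ℝ] Matrix ι ι ℂ} (hκ : IsCliffMap κ)

include hκ

theorem mul_add (w w' : Q) : κ w * κ w' + κ w' * κ w =
    (2 * ((‖w + w'‖ ^ 2 - ‖w‖ ^ 2 - ‖w'‖ ^ 2) / 2)) • (1 : Matrix ι ι ℂ) := by
  rw [mul_div_cancel₀ _ two_ne_zero, sub_smul, sub_smul, ← hκ.sq, ← hκ.sq, ← hκ.sq, map_add]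
  noncomm_ring

theorem norm_mulE (w : Q) (v : EuclideanSpace ℂ ι) : ‖mulE (κ w) v‖ = ‖w‖ * ‖v‖ := by
  have h : ((‖mulE (κ w) v‖ ^ 2 : ℝ) : ℂ) = ((‖w‖ * ‖v‖) ^ 2 : ℝ) := by
    have h1 := inner_self_eq_norm_sq_to_K (𝕜 := ℂ) (mulE (κ w) v)
    have h2 : mulE ((‖w‖ ^ 2) • (1 : Matrix ι ι ℂ)) v = (‖w‖ ^ 2) • v := by
      rw [mulE_smul]; simp [mulE]
    rw [inner_mulE_left, (hκ.herm w).eq, mulE_mulE, hκ.sq, h2, ← Complex.coe_smul,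
      inner_smul_right, inner_self_eq_norm_sq_to_K] at h1
    push_cast at h1 ⊢
    rw [mul_pow]
    exact h1.symm
  have := Complex.ofReal_injective h
  exact (pow_left_inj₀ (norm_nonneg _) (by positivity) two_ne_zero).mp this

theorem isUnit {w : Q} (hw : w ≠ 0) : IsUnit (κ w) := by
  have h : κ w * ((‖w‖ ^ 2)⁻¹ • κ w) = 1 := by
    rw [mul_smul_comm, hκ.sq, smul_smul, inv_mul_cancel₀ (by positivity), one_smul]
  exact IsUnit.of_mul_eq_one _ h

end IsCliffMap

end CliffordMaps

section Estimate

variable {n : ℕ} {ι : Type*} [Fintype ι] [DecidableEq ι] {Q : Type*} [NormedAddCommGroup Q]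
  [NormedSpace ℝ Q]

/-- The Hermitian normalization of `wVal`. -/
noncomputable def wHerm (x : CSpace n) (K : CSpace n →ₗ[ℝ] Matrix ι ι ℂ) : Matrix ι ι ℂ :=
  Complex.I ^ n • wVal x K

variable {κ : Q →ₗ[ℝ] Matrix ι ι ℂ} (hκ : IsCliffMap κ) {x : CSpace n} (hx : ‖x‖ = 1) (L : CSpace n →ₗ[ℝ] Q)

include hκ hx

theorem wHerm_isHermitian : (wHerm x (κ ∘ₗ L)).IsHermitian := by
  rw [IsHermitian, wHerm, conjTranspose_smul, wVal_conjTranspose hx (κ ∘ₗ L)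
    (fun u v => (‖L u + L v‖ ^ 2 - ‖L u‖ ^ 2 - ‖L v‖ ^ 2) / 2)
    (fun u v => by rw [add_comm (L u) (L v)]; ring) (fun u v _ _ => hκ.mul_add (L u) (L v))
    (fun u => hκ.herm (L u)), smul_smul]
  congr 1
  rw [star_pow, ← mul_pow]
  simp

theorem wHerm_mul {u : CSpace n} (hu : inner ℂ x u = 0) :
    wHerm x (κ ∘ₗ L) * κ (L u) = -(κ (L u) * wHerm x (κ ∘ₗ L)) := by
  have : wVal x (κ ∘ₗ L) * κ (L u) = -(κ (L u) * wVal x (κ ∘ₗ L)) := wVal_mul hx (κ ∘ₗ L)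
    (fun u v => (‖L u + L v‖ ^ 2 - ‖L u‖ ^ 2 - ‖L v‖ ^ 2) / 2)
    (fun u v => by rw [add_comm (L u) (L v)]; ring) (fun u v _ _ => hκ.mul_add (L u) (L v)) hu
  rw [wHerm, smul_mul_assoc, mul_smul_comm, this, smul_neg]

theorem wHerm_isUnit (hL : ∀ u, inner ℂ x u = 0 → L u = 0 → u = 0) :
    IsUnit (wHerm x (κ ∘ₗ L)) := by
  have := wVal_isUnit hx (κ ∘ₗ L)
    (fun u v => (‖L u + L v‖ ^ 2 - ‖L u‖ ^ 2 - ‖L v‖ ^ 2) / 2)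
    (fun u v => by rw [add_comm (L u) (L v)]; ring) (fun u v _ _ => hκ.mul_add (L u) (L v))
    (fun u hu hxu => hκ.isUnit (w := L u) fun h => hu (hL u hxu h))
  exact this.smul (Units.mk0 (Complex.I ^ n) (pow_ne_zero _ Complex.I_ne_zero))

theorem wHerm_mulE_ne_zero (hL : ∀ u, inner ℂ x u = 0 → L u = 0 → u = 0)
    {v : EuclideanSpace ℂ ι} (hv : v ≠ 0) : mulE (wHerm x (κ ∘ₗ L)) v ≠ 0 := by
  intro h
  obtain ⟨N, hN⟩ := (wHerm_isUnit hκ hx L hL).exists_left_inv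
  refine hv ?_
  have : mulE (N * wHerm x (κ ∘ₗ L)) v = v := by rw [hN]; simp [mulE]
  rw [← this, ← mulE_mulE, h]
  simp [mulE]

theorem re_inner_mulE_wHerm {u : CSpace n} (hu : inner ℂ x u = 0) (v : EuclideanSpace ℂ ι) :
    (inner ℂ (mulE (κ (L u)) v) (mulE (wHerm x (κ ∘ₗ L)) v)).re = 0 := by
  have h1 : inner ℂ (mulE (κ (L u)) v) (mulE (wHerm x (κ ∘ₗ L)) v) =
      inner ℂ v (mulE (κ (L u) * wHerm x (κ ∘ₗ L)) v) := by
    rw [inner_mulE_left, (hκ.herm _).eq, mulE_mulE]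
  have h2 : inner ℂ (mulE (wHerm x (κ ∘ₗ L)) v) (mulE (κ (L u)) v) =
      -inner ℂ v (mulE (κ (L u) * wHerm x (κ ∘ₗ L)) v) := by
    rw [inner_mulE_left, (wHerm_isHermitian hκ hx L).eq, mulE_mulE, wHerm_mul hκ hx L hu,
      ← inner_neg_right]
    congr 1
    simp [mulE, neg_mulVec]
  rw [← inner_conj_symm, h1] at h2
  have := congrArg Complex.re h2
  simp only [Complex.conj_re, Complex.neg_re] at this
  rw [h1]; linarith

theorem abs_re_inner_le {w : Q} {u : CSpace n} (hu : inner ℂ x u = 0) (v : EuclideanSpace ℂ ι) :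
    |(inner ℂ (mulE (κ w) v) (mulE (wHerm x (κ ∘ₗ L)) v)).re| ≤
      ‖w + L u‖ * ‖v‖ * ‖mulE (wHerm x (κ ∘ₗ L)) v‖ := by
  have h : (inner ℂ (mulE (κ w) v) (mulE (wHerm x (κ ∘ₗ L)) v)).re =
      (inner ℂ (mulE (κ (w + L u)) v) (mulE (wHerm x (κ ∘ₗ L)) v)).re := by
    rw [map_add, mulE_add, inner_add_left, Complex.add_re, re_inner_mulE_wHerm hκ hx L hu,
      add_zero]
  rw [h, ← hκ.norm_mulE]
  exact (Complex.abs_re_le_norm _).trans (norm_inner_le_norm _ _)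

end Estimate

section LocalEstimate

variable {n : ℕ} {ι : Type*} [Fintype ι] [DecidableEq ι] {Q : Type*} [NormedAddCommGroup Q]
  [NormedSpace ℝ Q] {X : Type*} [TopologicalSpace X] {x : X → CSpace n}
  {L : X → CSpace n →ₗ[ℝ] Q}

theorem continuous_cliffMap [FiniteDimensional ℝ Q] (κ : Q →ₗ[ℝ] Matrix ι ι ℂ) : Continuous κ :=
  LinearMap.continuous_of_finiteDimensional κ

theorem continuous_wHerm [FiniteDimensional ℝ Q] (κ : Q →ₗ[ℝ] Matrix ι ι ℂ) (hx : Continuous x)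
    (hL : Continuous fun z : X × CSpace n => L z.1 z.2) :
    Continuous fun p => wHerm (x p) (κ ∘ₗ L p) := by
  have h : Continuous fun p => wVal (x p) (κ ∘ₗ L p) := continuous_wVal x _ hx fun u =>
    (continuous_cliffMap κ).comp (hL.comp (continuous_id.prodMk continuous_const))
  exact h.const_smul (Complex.I ^ n)

theorem exists_eventually_mul_norm_le (hx : Continuous x)
    (hL : Continuous fun z : X × CSpace n => L z.1 z.2) {p₀ : X}
    (hL0 : ∀ u, inner ℂ (x p₀) u = 0 → L p₀ u = 0 → u = 0) :
    ∃ c > 0, ∀ᶠ p in 𝓝 p₀, ∀ u, inner ℂ (x p) u = 0 → c * ‖u‖ ≤ ‖L p u‖ := by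
  let g : X × CSpace n → ℝ := fun z => ‖L z.1 z.2‖ + ‖inner ℂ (x z.1) z.2‖
  have hg : Continuous g := hL.norm.add ((hx.comp continuous_fst).inner continuous_snd).norm
  have hS : IsCompact (Metric.sphere (0 : CSpace n) 1) := isCompact_sphere _ _
  obtain ⟨u₁, hu₁, hmin⟩ := hS.exists_isMinOn (NormedSpace.sphere_nonempty.mpr zero_le_one)
    (hg.comp (continuous_const (y := p₀) |>.prodMk continuous_id)).continuousOn
  have hpos : 0 < g (p₀, u₁) := by
    refine lt_of_le_of_ne (by positivity) fun h => ?_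
    have h1 := (add_eq_zero_iff_of_nonneg (norm_nonneg (L p₀ u₁))
      (norm_nonneg (inner ℂ (x p₀) u₁))).mp h.symm
    have := hL0 u₁ (norm_eq_zero.mp h1.2) (norm_eq_zero.mp h1.1)
    rw [this] at hu₁
    simp at hu₁
  refine ⟨g (p₀, u₁) / 2, by positivity, ?_⟩
  have hev : ∀ᶠ p in 𝓝 p₀, ∀ u ∈ Metric.sphere (0 : CSpace n) 1, g (p₀, u₁) / 2 < g (p, u) := by
    refine hS.eventually_forall_of_forall_eventually fun u hu => ?_
    refine hg.continuousAt.eventually (lt_mem_nhds ?_)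
    have : g (p₀, u₁) ≤ g (p₀, u) := hmin hu
    linarith
  filter_upwards [hev] with p hp u hu
  rcases eq_or_ne u 0 with rfl | hu0
  · simp
  · have h1 := (hp ((‖u‖⁻¹ : ℝ) • u) (by simp [norm_smul, hu0])).le
    simp only [g, ← Complex.coe_smul, inner_smul_right, hu, mul_zero, norm_zero, add_zero] at h1
    rw [Complex.coe_smul, map_smul, norm_smul, norm_inv, norm_norm, inv_mul_eq_div,
      le_div_iff₀ (norm_pos_iff.mpr hu0)] at h1
    exact h1

theorem eventually_abs_re_inner_le [FiniteDimensional ℝ Q] {κ : Q →ₗ[ℝ] Matrix ι ι ℂ}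
    (hκ : IsCliffMap κ) (hx : Continuous x) (hx1 : ∀ p, ‖x p‖ = 1)
    (hL : Continuous fun z : X × CSpace n => L z.1 z.2) {p₀ : X}
    (hL0 : ∀ u, inner ℂ (x p₀) u = 0 → L p₀ u = 0 → u = 0) {δ : X → Q} {η : X → CSpace n}
    (hη : ∀ p, inner ℂ (x p) (η p) = 0)
    (hδ : (fun p => δ p + L p (η p)) =o[𝓝 p₀] η) (v₀ : EuclideanSpace ℂ ι) {ε : ℝ} (hε : 0 < ε) :
    ∀ᶠ z : X × EuclideanSpace ℂ ι in 𝓝 (p₀, v₀), ‖z.2‖ = 1 →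
      |(inner ℂ (mulE (κ (δ z.1)) z.2) (mulE (wHerm (x z.1) (κ ∘ₗ L z.1)) z.2)).re| ≤
        ε * ‖δ z.1‖ := by
  obtain ⟨c, hc, hcL⟩ := exists_eventually_mul_norm_le hx hL hL0
  have hW := continuous_mulE (continuous_wHerm κ hx hL)
  set B := ‖mulE (wHerm (x p₀) (κ ∘ₗ L p₀)) v₀‖ + 1 with hB
  have hBpos : 0 < B := by positivity
  have h1 : ∀ᶠ z : X × EuclideanSpace ℂ ι in 𝓝 (p₀, v₀),
      ‖mulE (wHerm (x z.1) (κ ∘ₗ L z.1)) z.2‖ < B :=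
    hW.norm.continuousAt.eventually (gt_mem_nhds (by simp [hB]))
  set ε' := min (c / 2) (ε * (c / 2) / B)
  have hε' : 0 < ε' := by positivity
  have h2 := hδ.bound hε'
  have hfst : Tendsto Prod.fst (𝓝 (p₀, v₀)) (𝓝 p₀) := continuous_fst.continuousAt
  filter_upwards [h1, hfst.eventually h2, hfst.eventually hcL] with z hz1 hz2 hz3 hz
  refine (abs_re_inner_le hκ (hx1 _) (L z.1) (w := δ z.1) (hη z.1) z.2).trans ?_
  rw [hz, mul_one]
  have h3 := hz3 _ (hη z.1)
  have h4 : ‖L z.1 (η z.1)‖ ≤ ‖δ z.1 + L z.1 (η z.1)‖ + ‖δ z.1‖ := by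
    have := norm_sub_le (δ z.1 + L z.1 (η z.1)) (δ z.1)
    rwa [add_sub_cancel_left] at this
  have h5 : ε' ≤ c / 2 := min_le_left _ _
  have h6 : ε' * B ≤ ε * (c / 2) := by
    have : ε' ≤ ε * (c / 2) / B := min_le_right _ _
    rwa [le_div_iff₀ hBpos] at this
  have h7 : c / 2 * ‖η z.1‖ ≤ ‖δ z.1‖ := by
    nlinarith [norm_nonneg (η z.1)]
  calc ‖δ z.1 + L z.1 (η z.1)‖ * ‖mulE (wHerm (x z.1) (κ ∘ₗ L z.1)) z.2‖
      ≤ (ε' * ‖η z.1‖) * B := by gcongr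
    _ = (ε' * B) * ‖η z.1‖ := by ring
    _ ≤ ε * (c / 2) * ‖η z.1‖ := by gcongr
    _ = ε * (c / 2 * ‖η z.1‖) := by ring
    _ ≤ ε * ‖δ z.1‖ := by gcongr

end LocalEstimate

section PhaseMap

/-- Smooth maps defined away from the origin that induce an immersion and an injection of
complex projective space. -/
structure IsPhaseMap {n : ℕ} {P : Type*} [NormedAddCommGroup P] [InnerProductSpace ℝ P]
    (f : CSpace n → P) : Prop where
  smul : ∀ (c : ℂ) x, c ≠ 0 → f (c • x) = f x
  inj : ∀ x y, x ≠ 0 → y ≠ 0 → f x = f y → ∃ c : ℂ, y = c • x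
  contDiffAt : ∀ y, y ≠ 0 → ContDiffAt ℝ 1 f y
  ker : ∀ y, y ≠ 0 → ∀ u, fderiv ℝ f y u = 0 → ∃ c : ℂ, u = c • y

variable {F : Type*} [NormedAddCommGroup F] [InnerProductSpace ℝ F] [FiniteDimensional ℝ F]

/-- The denominator of stereographic projection from the ray through `p`. -/
noncomputable def rayGap (p m : F) : ℝ := ‖m‖ - inner ℝ p m

/-- Stereographic projection of rays, from the ray through `p`. -/
noncomputable def rayProj (p m : F) : (ℝ ∙ p)ᗮ :=
  (rayGap p m)⁻¹ • (ℝ ∙ p)ᗮ.orthogonalProjectionOnto m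

/-- A representative of the ray with given stereographic projection. -/
noncomputable def rayInv (p : F) (w : (ℝ ∙ p)ᗮ) : F := (w : F) + ((‖w‖ ^ 2 - 1) / 2) • p

theorem rayGap_smul_rayInv {p : F} (hp : ‖p‖ = 1) {m : F} (hm : rayGap p m ≠ 0) :
    m = rayGap p m • rayInv p (rayProj p m) := by
  have h2 := Submodule.starProjection_add_starProjection_orthogonal (K := ℝ ∙ p) m
  have h3 := Submodule.starProjection_unit_singleton ℝ hp m
  rw [h3, Submodule.starProjection_apply] at h2
  have h4 : ‖(ℝ ∙ p)ᗮ.orthogonalProjectionOnto m‖ ^ 2 = ‖m‖ ^ 2 - (inner ℝ p m) ^ 2 := by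
    have h5 := congrArg (fun z => inner ℝ z z) h2
    have h6 : inner ℝ p ((ℝ ∙ p)ᗮ.orthogonalProjectionOnto m : F) = 0 :=
      Submodule.mem_orthogonal_singleton_iff_inner_right.mp (Subtype.coe_prop _)
    simp only [inner_add_left, inner_add_right, inner_smul_left, inner_smul_right,
      real_inner_self_eq_norm_sq, hp, h6, real_inner_comm p] at h5
    simp only [one_pow, mul_one, mul_zero, add_zero, zero_add, conj_trivial] at h5
    have h7 : ‖((ℝ ∙ p)ᗮ.orthogonalProjectionOnto m : F)‖ =
      ‖(ℝ ∙ p)ᗮ.orthogonalProjectionOnto m‖ := rfl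
    rw [h7] at h5
    linarith
  set s := rayGap p m with hs
  have hs' : s = ‖m‖ - inner ℝ p m := rfl
  rw [rayInv, rayProj, smul_add, smul_smul, norm_smul, mul_pow, h4, ← hs, Submodule.coe_smul,
    smul_inv_smul₀ hm]
  have h7 : s * ((‖s⁻¹‖ ^ 2 * (‖m‖ ^ 2 - inner ℝ p m ^ 2) - 1) / 2) = inner ℝ p m := by
    rw [Real.norm_eq_abs, sq_abs]
    field_simp
    rw [hs']
    ring
  rw [h7, add_comm]
  exact h2.symm

theorem contDiffAt_rayGap (p : F) {m : F} (hm : m ≠ 0) : ContDiffAt ℝ 1 (rayGap p) m :=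
  (contDiffAt_norm ℝ hm).sub (contDiff_const.inner ℝ contDiff_id).contDiffAt

theorem contDiffAt_rayProj (p : F) {m : F} (hm : m ≠ 0) (h : rayGap p m ≠ 0) :
    ContDiffAt ℝ 1 (rayProj p) m :=
  ((contDiffAt_rayGap p hm).inv h).smul
    (ℝ ∙ p)ᗮ.orthogonalProjectionOnto.contDiff.contDiffAt

theorem rayProj_smul (p m : F) {r : ℝ} (hr : 0 < r) : rayProj p (r • m) = rayProj p m := by
  have : rayGap p (r • m) = r * rayGap p m := by
    rw [rayGap, rayGap, norm_smul, inner_smul_right, Real.norm_of_nonneg hr.le]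
    ring
  rw [rayProj, this, map_smul, smul_smul, mul_inv, mul_comm r⁻¹, mul_assoc,
    inv_mul_cancel₀ hr.ne', mul_one, rayProj]

theorem contDiff_rayInv (p : F) : ContDiff ℝ 1 (rayInv p) :=
  ((ℝ ∙ p)ᗮ.subtypeL.contDiff).add
    ((((contDiff_norm_sq ℝ).sub contDiff_const).div_const _).smul contDiff_const)

variable {n : ℕ}

theorem isPhaseMap_rayProj {p : F} (hp : ‖p‖ = 1) {M : CSpace n → F}
    (B : CSpace n →L[ℝ] CSpace n →L[ℝ] F)
    (hM : ∀ x, M x = B x x) (hB : ∀ x y, B x y = B y x)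
    (hsm : ∀ (c : ℂ) x, M (c • x) = (‖c‖ ^ 2 : ℝ) • M x)
    (hPR : ∀ x y, M x = M y → ∃ b : ℂ, ‖b‖ = 1 ∧ x = b • y)
    (hray : ∀ x, x ≠ 0 → rayGap p (M x) ≠ 0) :
    IsPhaseMap fun x => rayProj p (M x) := by
  have hM0 : M 0 = 0 := by simp [hM]
  have hne : ∀ x, x ≠ 0 → M x ≠ 0 := by
    intro x hx h
    obtain ⟨b, -, hb⟩ := hPR x 0 (by rw [h, hM0])
    exact hx (by simpa using hb)
  have hpos : ∀ x, x ≠ 0 → 0 < rayGap p (M x) := by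
    refine fun x hx => lt_of_le_of_ne ?_ (hray x hx).symm
    have := real_inner_le_norm p (M x)
    rw [hp, one_mul] at this
    rw [rayGap]
    linarith
  have hMB : M = fun y => B y y := funext hM
  have hMc : ContDiff ℝ 1 M := by
    rw [hMB]
    exact B.contDiff.clm_apply contDiff_id
  have hMd : ∀ y u, fderiv ℝ M y u = (2 : ℝ) • B y u := by
    intro y u
    have h := (B.hasFDerivAt (x := y)).clm_apply (hasFDerivAt_id y)
    have h' : HasFDerivAt (fun y => B y y) _ y := h
    rw [hMB, h'.fderiv]
    simp [hB u y, two_smul]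
  have hcd : ∀ y, y ≠ 0 → ContDiffAt ℝ 1 (fun x => rayProj p (M x)) y := fun y hy =>
    (contDiffAt_rayProj p (hne y hy) (hray y hy)).comp y hMc.contDiffAt
  refine ⟨?_, ?_, hcd, ?_⟩
  · intro c x hc
    simp only [hsm]
    exact rayProj_smul p _ (by positivity)
  · intro x y hx hy h
    have h1 := rayGap_smul_rayInv hp (hray x hx)
    have h2 := rayGap_smul_rayInv hp (hray y hy)
    rw [← h] at h2
    set w := rayInv p (rayProj p (M x))
    have hs := hpos x hx
    have hs' := hpos y hy
    obtain ⟨b, hb, hxy⟩ := hPR ((Real.sqrt (rayGap p (M y) / rayGap p (M x)) : ℂ) • x) y (by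
      rw [hsm, Complex.norm_real, Real.norm_eq_abs, sq_abs, Real.sq_sqrt (by positivity), h1,
        smul_smul, ← h1, div_mul_cancel₀ _ hs.ne', ← h2])
    have hb0 : b ≠ 0 := by
      rintro rfl
      simp at hb
    refine ⟨b⁻¹ * (Real.sqrt (rayGap p (M y) / rayGap p (M x)) : ℂ), ?_⟩
    rw [← smul_smul, hxy, inv_smul_smul₀ hb0]
  · intro y hy u hu
    have h1 : HasFDerivAt (fun x => rayGap p (M x)) _ y :=
      (((contDiffAt_rayGap p (hne y hy)).comp y hMc.contDiffAt).differentiableAt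
        one_ne_zero).hasFDerivAt
    have h2 := ((hcd y hy).differentiableAt one_ne_zero).hasFDerivAt
    have h3 := ((contDiff_rayInv p).differentiable one_ne_zero
      (rayProj p (M y))).hasFDerivAt
    have h4 := h1.smul (h3.comp y h2)
    have h5 : M =ᶠ[𝓝 y] fun x => rayGap p (M x) • rayInv p (rayProj p (M x)) := by
      filter_upwards [isOpen_ne.mem_nhds hy] with x hx
      exact rayGap_smul_rayInv hp (hray x hx)
    have h6 := congrArg (fun T => T u) (h4.congr_of_eventuallyEq h5).fderiv
    have h7 := rayGap_smul_rayInv hp (hray y hy)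
    simp only [hMd, ContinuousLinearMap.add_apply, ContinuousLinearMap.smul_apply,
      ContinuousLinearMap.comp_apply, hu, map_zero, smul_zero, zero_add,
      ContinuousLinearMap.smulRight_apply, Function.comp_apply] at h6
    generalize (fderiv ℝ (rayGap p ∘ M) y) u = τ at h6
    set s := rayGap p (M y)
    have hs : s ≠ 0 := hray y hy
    set w := rayInv p (rayProj p (M y))
    set v : CSpace n := u - (τ / (2 * s)) • y with hv
    have h8 : B y v = 0 := by
      have h9 : B y u = (τ / 2) • w := by
        rw [div_eq_inv_mul, ← smul_smul, ← h6, inv_smul_smul₀ two_ne_zero]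
      rw [hv, map_sub, map_smul, ← hM, h9, h7, smul_smul, ← sub_smul]
      field_simp
      simp
    obtain ⟨b, -, hb⟩ := hPR (y + v) (y - v) (by
      rw [hM, hM]
      simp [hB v y, h8])
    have hb1 : 1 + b ≠ 0 := by
      intro h
      have hb' : b = -1 := by linear_combination h
      rw [hb'] at hb
      have : (2 : ℂ) • y = 0 := by
        have := congrArg (· + (y - v)) hb
        simp only [neg_smul, one_smul, neg_add_cancel] at this
        rw [two_smul, ← this]
        abel
      exact hy ((smul_eq_zero_iff_right two_ne_zero).mp this)
    have hvy : v = ((1 + b)⁻¹ * (b - 1)) • y := by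
      rw [← smul_smul, eq_inv_smul_iff₀ hb1]
      rw [← sub_eq_zero] at hb ⊢
      rw [← hb]
      module
    refine ⟨(1 + b)⁻¹ * (b - 1) + (τ / (2 * s) : ℝ), ?_⟩
    rw [add_smul, ← hvy, Complex.coe_smul, hv, sub_add_cancel]

/-- The symmetric real bilinear map attached to a tuple of Hermitian matrices. -/
noncomputable def measForm {N d : ℕ} (A : Fin N → Matrix (Fin d) (Fin d) ℂ) :
    EuclideanSpace ℂ (Fin d) →ₗ[ℝ] EuclideanSpace ℂ (Fin d) →ₗ[ℝ] EuclideanSpace ℝ (Fin N) :=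
  LinearMap.mk₂ ℝ (fun x y => WithLp.toLp 2 fun j => (star x.ofLp ⬝ᵥ A j *ᵥ y.ofLp).re)
    (fun x x' y => by ext j; simp [add_dotProduct])
    (fun c x y => by ext j; simp [smul_dotProduct, star_smul])
    (fun x y y' => by ext j; simp [mulVec_add, dotProduct_add])
    (fun c x y => by ext j; simp [mulVec_smul, dotProduct_smul])

theorem measForm_comm {N d : ℕ} {A : Fin N → Matrix (Fin d) (Fin d) ℂ}
    (hA : ∀ j, (A j).IsHermitian) (x y) : measForm A x y = measForm A y x := by
  ext j
  have : star (star x.ofLp ⬝ᵥ A j *ᵥ y.ofLp) = star y.ofLp ⬝ᵥ A j *ᵥ x.ofLp := by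
    rw [← star_dotProduct, star_mulVec, (hA j).eq, dotProduct_mulVec]
  simp only [measForm, LinearMap.mk₂_apply]
  rw [← this]
  simp

theorem measForm_smul {N d : ℕ} (A : Fin N → Matrix (Fin d) (Fin d) ℂ) (c : ℂ) (x) :
    measForm A (c • x) (c • x) = (‖c‖ ^ 2 : ℝ) • measForm A x x := by
  ext j
  simp only [measForm, LinearMap.mk₂_apply, WithLp.ofLp_smul, star_smul, mulVec_smul,
    smul_dotProduct, dotProduct_smul, smul_smul, PiLp.smul_apply]
  have : c * star c = ((‖c‖ ^ 2 : ℝ) : ℂ) := by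
    rw [Complex.star_def, Complex.mul_conj']; simp
  rw [this, smul_eq_mul, smul_eq_mul, Complex.re_ofReal_mul]

theorem exists_isPhaseMap {n N : ℕ} {A : Fin N → Matrix (Fin (n + 1)) (Fin (n + 1)) ℂ}
    (hA : ∀ j, (A j).IsHermitian) (hPR : PhaseRetrievableC A) (hN : 2 * (n + 1) < N) :
    ∃ p : EuclideanSpace ℝ (Fin N), ‖p‖ = 1 ∧ ∃ f : CSpace n → (ℝ ∙ p)ᗮ, IsPhaseMap f := by
  let B : CSpace n →L[ℝ] CSpace n →L[ℝ] EuclideanSpace ℝ (Fin N) :=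
    LinearMap.toContinuousLinearMap
      ((LinearMap.toContinuousLinearMap (𝕜 := ℝ) (E := CSpace n)
        (F' := EuclideanSpace ℝ (Fin N))).toLinearMap ∘ₗ measForm A)
  have hB : ∀ x y, B x y = measForm A x y := fun _ _ => rfl
  set M : CSpace n → EuclideanSpace ℝ (Fin N) := fun x => B x x with hM
  have hsm : ∀ (c : ℂ) x, M (c • x) = (‖c‖ ^ 2 : ℝ) • M x := measForm_smul A
  have hMPR : ∀ x y, M x = M y → ∃ b : ℂ, ‖b‖ = 1 ∧ x = b • y := by
    intro x y h
    have him : ∀ z : CSpace n, ∀ j, (star z.ofLp ⬝ᵥ A j *ᵥ z.ofLp).im = 0 := fun z j =>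
      (hA j).im_star_dotProduct_mulVec_self z.ofLp
    obtain ⟨b, hb, hxy⟩ := hPR x.ofLp y.ofLp fun j =>
      Complex.ext (congrArg (fun w => w.ofLp j) h) (by rw [him, him])
    exact ⟨b, hb, PiLp.ext fun i => congrFun hxy i⟩
  have hMc : ContDiff ℝ 1 M := B.contDiff.clm_apply contDiff_id
  have hdim : Module.finrank ℝ (CSpace n) < Module.finrank ℝ (EuclideanSpace ℝ (Fin N)) := by
    rw [← Module.finrank_mul_finrank ℝ ℂ (CSpace n), Complex.finrank_real_complex,
      finrank_euclideanSpace_fin, finrank_euclideanSpace_fin]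
    exact hN
  obtain ⟨q, hq⟩ := (hMc.dense_compl_range_of_finrank_lt_finrank hdim).nonempty
  have hq0 : q ≠ 0 := by
    rintro rfl
    exact hq ⟨0, by simp [hM]⟩
  have hqn : 0 < ‖q‖ := norm_pos_iff.mpr hq0
  have hp : ‖(‖q‖⁻¹ : ℝ) • q‖ = 1 := by
    rw [norm_smul, norm_inv, norm_norm, inv_mul_cancel₀ hqn.ne']
  refine ⟨(‖q‖⁻¹ : ℝ) • q, hp, _, isPhaseMap_rayProj hp (M := M) B (fun _ => rfl)
    (fun x y => measForm_comm hA x y) hsm hMPR ?_⟩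
  intro x hx h
  have h1 : inner ℝ ((‖q‖⁻¹ : ℝ) • q) (M x) = ‖(‖q‖⁻¹ : ℝ) • q‖ * ‖M x‖ := by
    rw [hp, one_mul]
    rw [rayGap] at h
    linarith
  rw [inner_eq_norm_mul_iff_real, hp, one_smul] at h1
  have hMx : 0 < ‖M x‖ := by
    refine norm_pos_iff.mpr fun h0 => ?_
    obtain ⟨b, -, hb⟩ := hMPR x 0 (by rw [h0]; simp [hM])
    exact hx (by simpa using hb)
  refine hq ⟨(Real.sqrt (‖q‖ / ‖M x‖) : ℂ) • x, ?_⟩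
  rw [hsm, Complex.norm_real, Real.norm_eq_abs, sq_abs, Real.sq_sqrt (by positivity)]
  nth_rewrite 2 [← h1]
  rw [smul_smul, smul_smul]
  field_simp
  simp

end PhaseMap

section CliffordFamilies

open scoped Kronecker

variable {κ Λ : Type*} [Fintype κ] [DecidableEq κ] [Fintype Λ] [DecidableEq Λ]

/-- The real linear map attached to a Clifford system. -/
noncomputable def cliffMap {N : ℕ} (γ : Fin N → Matrix κ κ ℂ) :
    EuclideanSpace ℝ (Fin N) →ₗ[ℝ] Matrix κ κ ℂ where
  toFun w := ∑ i, w i • γ i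
  map_add' w w' := by simp [add_smul, Finset.sum_add_distrib]
  map_smul' c w := by simp [mul_smul, Finset.smul_sum]

theorem cliffMap_apply {N : ℕ} (γ : Fin N → Matrix κ κ ℂ) (w) :
    cliffMap γ w = ∑ i, w i • γ i := rfl

theorem IsCliff.cliffMap_mul_add {N : ℕ} {γ : Fin N → Matrix κ κ ℂ} (h : IsCliff γ) (w w') :
    cliffMap γ w * cliffMap γ w' + cliffMap γ w' * cliffMap γ w =
      (2 * inner ℝ w w') • (1 : Matrix κ κ ℂ) := by
  have h1 : ∀ i j, γ i * γ j + γ j * γ i = if i = j then (2 : ℝ) • (1 : Matrix κ κ ℂ) else 0 := by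
    intro i j
    split_ifs with hij
    · rw [hij, h.sq, two_smul]
    · rw [h.anti i j hij, neg_add_cancel]
  rw [cliffMap_apply, cliffMap_apply, Finset.sum_mul_sum, Finset.sum_mul_sum]
  rw [Finset.sum_comm (f := fun i j => w' i • γ i * w j • γ j), ← Finset.sum_add_distrib]
  simp_rw [← Finset.sum_add_distrib, smul_mul_smul_comm, mul_comm (w' _) (w _), ← smul_add, h1]
  simp only [smul_ite, smul_zero, Finset.sum_ite_eq, Finset.mem_univ, if_true]
  rw [PiLp.inner_apply, Finset.mul_sum, Finset.sum_smul]
  refine Finset.sum_congr rfl fun i _ => ?_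
  rw [smul_smul]
  congr 1
  simp
  ring

theorem IsCliff.isCliffMap {N : ℕ} {γ : Fin N → Matrix κ κ ℂ} (h : IsCliff γ) :
    IsCliffMap (cliffMap γ) where
  herm w := by
    rw [IsHermitian, cliffMap_apply, conjTranspose_sum]
    refine Finset.sum_congr rfl fun i _ => ?_
    rw [conjTranspose_smul, (h.herm i).eq, star_trivial]
  sq w := by
    have h1 := h.cliffMap_mul_add w w
    rw [real_inner_self_eq_norm_sq, mul_smul, two_smul, ← two_smul ℝ (cliffMap γ w * cliffMap γ w),
      ← two_smul ℝ ((‖w‖ ^ 2) • (1 : Matrix κ κ ℂ))] at h1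
    exact smul_right_injective _ two_ne_zero h1

theorem IsCliffMap.comp_subtype {Q : Type*} [NormedAddCommGroup Q] [NormedSpace ℝ Q]
    {c : Q →ₗ[ℝ] Matrix κ κ ℂ} (hc : IsCliffMap c) (P : Submodule ℝ Q) :
    IsCliffMap (c ∘ₗ P.subtype) :=
  ⟨fun _ => hc.herm _, fun _ => hc.sq _⟩

variable {n : ℕ} {a : Fin (n + 1) → Matrix Λ Λ ℂ} {wt : Λ → ℕ}

theorem cFock_add (z w) : cFock a (z + w) = cFock a z + cFock a w := by
  rw [cFock, crea_add, anni_add, cFock, cFock]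
  abel

theorem cFock_real_smul (r : ℝ) (z) : cFock a (r • z) = r • cFock a z := by
  rw [← Complex.coe_smul, cFock, crea_smul, anni_smul, cFock, Complex.star_def, Complex.conj_ofReal,
    smul_add, Complex.coe_smul, Complex.coe_smul]

variable {P : Type*} [NormedAddCommGroup P] [InnerProductSpace ℝ P]

/-- The sum of a Clifford map and Clifford multiplication on Fock space. -/
noncomputable def sumCliff (c : P →ₗ[ℝ] Matrix κ κ ℂ) (Γ : Matrix κ κ ℂ)
    (a : Fin (n + 1) → Matrix Λ Λ ℂ) : WithLp 2 (P × CSpace n) →ₗ[ℝ] Matrix (κ × Λ) (κ × Λ) ℂ where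
  toFun w := c w.fst ⊗ₖ 1 + Γ ⊗ₖ cFock a w.snd
  map_add' w w' := by
    simp only [WithLp.add_fst, WithLp.add_snd, map_add, cFock_add, add_kronecker, kronecker_add]
    abel
  map_smul' r w := by
    simp only [WithLp.smul_fst, WithLp.smul_snd, map_smul, cFock_real_smul, smul_kronecker,
      kronecker_smul, smul_add, RingHom.id_apply]

theorem sumCliff_apply (c : P →ₗ[ℝ] Matrix κ κ ℂ) (Γ : Matrix κ κ ℂ)
    (a : Fin (n + 1) → Matrix Λ Λ ℂ) (w : WithLp 2 (P × CSpace n)) :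
    sumCliff c Γ a w = c w.fst ⊗ₖ 1 + Γ ⊗ₖ cFock a w.snd := rfl

theorem IsFock.cFock_sq (ha : IsFock a wt) (z) :
    cFock a z * cFock a z = (‖z‖ ^ 2) • (1 : Matrix Λ Λ ℂ) := by
  have h1 := ha.cFock_mul_add z z
  have h2 : (inner ℂ z z).re = ‖z‖ ^ 2 := by
    rw [inner_self_eq_norm_sq_to_K]
    simp [← Complex.ofReal_pow]
  rw [h2, Complex.coe_smul, mul_smul, ← two_smul ℝ (cFock a z * cFock a z)] at h1
  exact smul_right_injective _ two_ne_zero h1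

omit [Fintype κ] [DecidableEq κ] [Fintype Λ] [DecidableEq Λ] in
theorem neg_kronecker_left (A : Matrix κ κ ℂ) (B : Matrix Λ Λ ℂ) : (-A) ⊗ₖ B = -(A ⊗ₖ B) := by
  ext i j
  simp [kroneckerMap_apply]

theorem isCliffMap_sumCliff {c : P →ₗ[ℝ] Matrix κ κ ℂ} (hc : IsCliffMap c) {Γ : Matrix κ κ ℂ}
    (hΓ : Γ.IsHermitian) (hΓ2 : Γ * Γ = 1) (hcΓ : ∀ w, c w * Γ = -(Γ * c w)) (ha : IsFock a wt) :
    IsCliffMap (sumCliff c Γ a) where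
  herm w := by
    rw [IsHermitian, sumCliff_apply, conjTranspose_add, conjTranspose_kronecker,
      conjTranspose_kronecker, (hc.herm _).eq, conjTranspose_one, hΓ.eq,
      (cFock_isHermitian _).eq]
  sq w := by
    rw [sumCliff_apply, mul_add, add_mul, add_mul, ← mul_kronecker_mul, ← mul_kronecker_mul,
      ← mul_kronecker_mul, ← mul_kronecker_mul, hc.sq, hΓ2, ha.cFock_sq, hcΓ, mul_one, one_mul,
      mul_one, WithLp.prod_norm_sq_eq_of_L2, smul_kronecker, kronecker_smul, one_kronecker_one,
      add_smul, neg_kronecker_left]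
    abel

end CliffordFamilies

section GappedFamilies

variable {n : ℕ} {ι : Type*} [Fintype ι] [DecidableEq ι] {Q : Type*} [NormedAddCommGroup Q]
  [NormedSpace ℝ Q] {X : Type*} [TopologicalSpace X] {x : X → CSpace n}
  {L : X → CSpace n →ₗ[ℝ] Q}

theorem mulVec_eq_zero_of_mulE_ne_zero {M : Matrix ι ι ℂ}
    (h : ∀ v : EuclideanSpace ℂ ι, ‖v‖ = 1 → mulE M v ≠ 0) (v : ι → ℂ) (hv : M *ᵥ v = 0) : v = 0 := by
  by_contra hne
  set w : EuclideanSpace ℂ ι := WithLp.toLp 2 v with hw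
  have hw0 : w ≠ 0 := fun h => hne (congrArg WithLp.ofLp h)
  refine h (((‖w‖⁻¹ : ℝ) : ℂ) • w) ?_ ?_
  · rw [Complex.coe_smul, norm_smul, norm_inv, norm_norm, inv_mul_cancel₀ (norm_ne_zero_iff.mpr hw0)]
  · rw [mulE, WithLp.ofLp_smul, mulVec_smul, hw, hv, smul_zero]
    rfl

theorem eventually_gapped [FiniteDimensional ℝ Q] {κ : Q →ₗ[ℝ] Matrix ι ι ℂ} (hκ : IsCliffMap κ)
    {S : Set X} (hS : IsCompact S) (hx : Continuous x) (hx1 : ∀ p, ‖x p‖ = 1)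
    (hL : Continuous fun z : X × CSpace n => L z.1 z.2) {δ : X → Q} {η : X → CSpace n}
    (hδ : Continuous δ) (hη : ∀ p, inner ℂ (x p) (η p) = 0)
    (h0 : ∀ p ∈ S, δ p = 0 → (∀ u, inner ℂ (x p) u = 0 → L p u = 0 → u = 0) ∧
      (fun q => δ q + L q (η q)) =o[𝓝 p] η) :
    ∀ᶠ Λ : ℝ in atTop, ∀ p ∈ S, ∀ v,
      (Λ • κ (δ p) + wHerm (x p) (κ ∘ₗ L p)) *ᵥ v = 0 → v = 0 := by
  have h := eventually_smul_add_ne_zero hS (C := fun p => mulE (κ (δ p)))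
    (W := fun p => mulE (wHerm (x p) (κ ∘ₗ L p))) (ρ := fun p => ‖δ p‖)
    (continuous_mulE (continuous_wHerm κ hx hL)) hδ.norm
    (fun p v hv => by rw [hκ.norm_mulE, hv, mul_one])
    (fun p hp hp0 v hv => wHerm_mulE_ne_zero hκ (hx1 p) (L p) (h0 p hp (norm_eq_zero.mp hp0)).1
      (norm_ne_zero_iff.mp (by rw [hv]; exact one_ne_zero)))
    (fun p hp hp0 v hv ε hε => eventually_abs_re_inner_le hκ hx hx1 hL
      (h0 p hp (norm_eq_zero.mp hp0)).1 hη (h0 p hp (norm_eq_zero.mp hp0)).2 v hε)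
  filter_upwards [h] with Λ h p hp v hv
  refine mulVec_eq_zero_of_mulE_ne_zero (fun w hw => ?_) v hv
  rw [mulE_add, mulE_smul]
  exact h p hp w hw

end GappedFamilies

section PhaseEstimate

variable {n : ℕ}

/-- The component of `u` orthogonal to `x`, for `x` a unit vector. -/
noncomputable def perpC (x : CSpace n) : CSpace n →ₗ[ℝ] CSpace n where
  toFun u := u - inner ℂ x u • x
  map_add' u v := by rw [inner_add_right]; module
  map_smul' c u := by
    rw [← Complex.coe_smul, inner_smul_right, RingHom.id_apply, ← Complex.coe_smul]; module

theorem perpC_apply (x u : CSpace n) : perpC x u = u - inner ℂ x u • x := rfl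

theorem inner_perpC {x : CSpace n} (hx : ‖x‖ = 1) (u) : inner ℂ x (perpC x u) = 0 := by
  rw [perpC_apply, inner_sub_right, inner_smul_right, inner_self_eq_norm_sq_to_K, hx]
  simp

theorem perpC_eq_zero {x y : CSpace n} (h : perpC x y = 0) : y = inner ℂ x y • x :=
  sub_eq_zero.mp h

theorem continuous_perpC : Continuous fun z : CSpace n × CSpace n => perpC z.1 z.2 := by
  simp only [perpC_apply]
  fun_prop

variable {P : Type*} [NormedAddCommGroup P] [InnerProductSpace ℝ P] {f : CSpace n → P}

namespace IsPhaseMap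

variable (hf : IsPhaseMap f)

include hf

theorem continuous_comp {X : Type*} [TopologicalSpace X] {y : X → CSpace n} (hy : Continuous y)
    (hy0 : ∀ p, y p ≠ 0) : Continuous fun p => f (y p) :=
  continuous_iff_continuousAt.mpr fun p =>
    ContinuousAt.comp (hf.contDiffAt _ (hy0 p)).continuousAt hy.continuousAt

theorem continuous_fderiv_comp {X : Type*} [TopologicalSpace X] {y : X → CSpace n}
    (hy : Continuous y) (hy0 : ∀ p, y p ≠ 0) : Continuous fun p => fderiv ℝ f (y p) :=
  continuous_iff_continuousAt.mpr fun p => ContinuousAt.comp (f := y) (g := fderiv ℝ f)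
    ((hf.contDiffAt _ (hy0 p)).fderiv_right (m := 0) (by simp)).continuousAt hy.continuousAt

theorem fderiv_smul (c : ℂ) (hc : c ≠ 0) {y : CSpace n} (hy : y ≠ 0) (u) :
    fderiv ℝ f (c • y) (c • u) = fderiv ℝ f y u := by
  have hcy : c • y ≠ 0 := smul_ne_zero hc hy
  have h1 : HasFDerivAt f _ (c • y) :=
    ((hf.contDiffAt _ hcy).differentiableAt one_ne_zero).hasFDerivAt
  let T : CSpace n →L[ℝ] CSpace n := (c • ContinuousLinearMap.id ℂ (CSpace n)).restrictScalars ℝ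
  have h2 : HasFDerivAt T T y := T.hasFDerivAt
  have h3 : f ∘ T = f := funext fun x => hf.smul c x hc
  have h4 : HasFDerivAt (f ∘ T) _ y := HasFDerivAt.comp y (f := T) h1 h2
  rw [h3] at h4
  rw [h4.fderiv]
  rfl

theorem parallel_iff {x y : CSpace n} (hx : ‖x‖ = 1) (hy : y ≠ 0) :
    f x = f y ↔ perpC x y = 0 := by
  have hx0 : x ≠ 0 := norm_ne_zero_iff.mp (by rw [hx]; exact one_ne_zero)
  constructor
  · intro h
    obtain ⟨c, rfl⟩ := hf.inj x y hx0 hy h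
    rw [perpC_apply, inner_smul_right, inner_self_eq_norm_sq_to_K, hx]
    simp
  · intro h
    have h1 := perpC_eq_zero h
    rw [h1, hf.smul]
    intro h2
    rw [h2, zero_smul] at h1
    exact hy h1

theorem eq_zero_of_fderiv {x y : CSpace n} (hx : ‖x‖ = 1) (hy : y ≠ 0) (h : perpC x y = 0) {u}
    (hu : inner ℂ x u = 0) (hfu : fderiv ℝ f y u = 0) : u = 0 := by
  obtain ⟨c, rfl⟩ := hf.ker y hy u hfu
  rw [perpC_eq_zero h, smul_smul, inner_smul_right, inner_self_eq_norm_sq_to_K, hx] at hu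
  rw [perpC_eq_zero h, smul_smul]
  simp at hu
  rcases hu with h | h <;> simp [h]

theorem isLittleO_fderiv {X : Type*} [TopologicalSpace X] {y : X → CSpace n}
    (hy : Continuous y) (hy0 : ∀ p, y p ≠ 0) (p₀ : X) (w : X → CSpace n) :
    (fun q => (fderiv ℝ f (y q) - fderiv ℝ f (y p₀)) (w q)) =o[𝓝 p₀] w := by
  rw [Asymptotics.isLittleO_iff]
  intro ε hε
  have hc : Tendsto (fun q => fderiv ℝ f (y q)) (𝓝 p₀) (𝓝 (fderiv ℝ f (y p₀))) :=
    (hf.continuous_fderiv_comp hy hy0).tendsto p₀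
  filter_upwards [hc (Metric.ball_mem_nhds _ hε)] with q hq
  rw [Set.mem_preimage, mem_ball_iff_norm] at hq
  exact (ContinuousLinearMap.le_opNorm _ _).trans
    (mul_le_mul_of_nonneg_right hq.le (norm_nonneg _))

theorem isLittleO_sub {X : Type*} [TopologicalSpace X] {y : X → CSpace n}
    (hy : Continuous y) {p₀ : X} (hy0 : y p₀ ≠ 0) {w : X → CSpace n} (hw : Continuous w)
    (hp : w p₀ = 0) :
    (fun q => f (y q - w q) - f (y q) + fderiv ℝ f (y p₀) (w q)) =o[𝓝 p₀] w := by
  have hs : HasStrictFDerivAt f (fderiv ℝ f (y p₀)) (y p₀) :=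
    (hf.contDiffAt _ hy0).hasStrictFDerivAt one_ne_zero
  have ht : Tendsto (fun q => (y q - w q, y q)) (𝓝 p₀) (𝓝 (y p₀, y p₀)) := by
    have := ((hy.sub hw).prodMk hy).tendsto p₀
    rwa [Pi.sub_apply, hp, sub_zero] at this
  have h := (hs.isLittleO.comp_tendsto ht).norm_right
  refine (h.congr (fun q => ?_) (fun q => ?_)).of_norm_right
  · simp only [Function.comp_apply, sub_sub_cancel_left, map_neg, sub_neg_eq_add]
  · simp only [Function.comp_apply, sub_sub_cancel_left, norm_neg]

theorem isLittleO {X : Type*} [TopologicalSpace X] {x y : X → CSpace n} (hx : Continuous x)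
    (hy : Continuous y) (hy0 : ∀ p, y p ≠ 0) {p₀ : X} (hp : perpC (x p₀) (y p₀) = 0) :
    (fun q => f (x q) - f (y q) + fderiv ℝ f (y q) (perpC (x q) (y q))) =o[𝓝 p₀]
      fun q => perpC (x q) (y q) := by
  refine ((hf.isLittleO_sub hy (hy0 p₀) (continuous_perpC.comp (hx.prodMk hy)) hp).add
    (hf.isLittleO_fderiv hy hy0 p₀ _)).congr' ?_ EventuallyEq.rfl
  have hne : ∀ᶠ q in 𝓝 p₀, inner ℂ (x q) (y q) ≠ 0 := by
    refine (Continuous.inner hx hy).continuousAt.eventually_ne fun h => hy0 p₀ ?_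
    rw [perpC_eq_zero hp, h, zero_smul]
  filter_upwards [hne] with q hq
  have h1 : f (y q - perpC (x q) (y q)) = f (x q) := by
    rw [perpC_apply, sub_sub_cancel, hf.smul _ _ hq]
  simp only [Function.comp_apply, h1, _root_.sub_apply]
  abel

end IsPhaseMap

end PhaseEstimate

section PhaseSymbol

open scoped Kronecker

variable {n : ℕ}

theorem norm_sph {d : ℕ} (x : Sph d) : ‖(x : EuclideanSpace ℂ (Fin d))‖ = 1 := by
  simp

theorem sph_ne_zero {d : ℕ} (x : Sph d) : (x : EuclideanSpace ℂ (Fin d)) ≠ 0 :=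
  norm_ne_zero_iff.mp (by rw [norm_sph]; exact one_ne_zero)

theorem circle_ne_zero (l : Circle) : (l : ℂ) ≠ 0 := Circle.coe_ne_zero l

theorem star_circle_mul (l : Circle) : star (l : ℂ) * l = 1 := by
  rw [Complex.star_def, ← Complex.normSq_eq_conj_mul_self, Circle.normSq_coe, Complex.ofReal_one]

variable {ι : Type*} [Fintype ι] [DecidableEq ι]

theorem wHerm_equiv (b : ι → ℕ) {x : CSpace n} (hx : ‖x‖ = 1) (l μ : Circle)
    {K K' : CSpace n →ₗ[ℝ] Matrix ι ι ℂ}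
    (h : ∀ u, inner ℂ x u = 0 → ∀ i j,
      (μ : ℂ) ^ b i * K' ((μ : ℂ) • u) i j = (μ : ℂ) ^ b j * K u i j) (i j : ι) :
    (μ : ℂ) ^ b i * wHerm ((l : ℂ) • x) K' i j = (μ : ℂ) ^ b j * wHerm x K i j := by
  have hμ : ∀ k, star (μ : ℂ) ^ k * (μ : ℂ) ^ k = 1 := fun k => by
    rw [← mul_pow, star_circle_mul, one_pow]
  let φ : Matrix ι ι ℂ →+* Matrix ι ι ℂ :=
    { toFun := fun X => diagonal (fun i => star (μ : ℂ) ^ b i) * X * diagonal fun i => (μ : ℂ) ^ b i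
      map_one' := by
        rw [mul_one, diagonal_mul_diagonal, ← diagonal_one]
        exact congrArg _ (funext fun i => hμ (b i))
      map_zero' := by simp
      map_add' := fun X Y => by rw [mul_add, add_mul]
      map_mul' := fun X Y => by
        have : diagonal (fun i => (μ : ℂ) ^ b i) * diagonal (fun i => star (μ : ℂ) ^ b i) = 1 := by
          rw [diagonal_mul_diagonal, ← diagonal_one]
          exact congrArg _ (funext fun i => by rw [mul_comm, hμ])
        calc _ = diagonal (fun i => star (μ : ℂ) ^ b i) * X * 1 * Y * diagonal fun i => (μ : ℂ) ^ b i := by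
              rw [mul_one]; noncomm_ring
          _ = _ := by rw [← this]; noncomm_ring }
  have hφ : ∀ X i j, φ X i j = star (μ : ℂ) ^ b i * X i j * (μ : ℂ) ^ b j := fun X i j => by
    change (diagonal (fun i => star (μ : ℂ) ^ b i) * X * diagonal fun i => (μ : ℂ) ^ b i) i j = _
    rw [mul_diagonal, diagonal_mul]
  have key := wVal_map hx l μ φ K K' fun u hu => by
    ext i j
    rw [hφ, mul_assoc, mul_comm (K u i j), ← h u hu, ← mul_assoc, hμ, one_mul]
  rw [wHerm, wHerm, key, Matrix.smul_apply, Matrix.smul_apply, hφ, smul_eq_mul, smul_eq_mul]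
  calc _ = star (μ : ℂ) ^ b i * (μ : ℂ) ^ b i * ((μ : ℂ) ^ b j * (Complex.I ^ n * wVal x K i j)) := by
        ring
    _ = _ := by rw [hμ, one_mul]

theorem perpC_smul {x : CSpace n} (l μ : Circle) (y) :
    perpC ((l : ℂ) • x) ((μ : ℂ) • y) = (μ : ℂ) • perpC x y := by
  rw [perpC_apply, perpC_apply, inner_smul_left, inner_smul_right, smul_sub, smul_smul, smul_smul]
  congr 2
  have h : (starRingEnd ℂ) (l : ℂ) * l = 1 := star_circle_mul l
  linear_combination (μ : ℂ) * inner ℂ x y * h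

section Base

variable {P : Type*} [NormedAddCommGroup P] [InnerProductSpace ℝ P]
  {κ : Type*} [Fintype κ] [DecidableEq κ]

/-- The symbol attached to a map on projective space and a Clifford map on its target. -/
noncomputable def baseSym (c : P →ₗ[ℝ] Matrix κ κ ℂ) (f : CSpace n → P) (Λ : ℝ) (x y : CSpace n) :
    Matrix κ κ ℂ :=
  Λ • c (f x - f y) + wHerm x (c ∘ₗ (fderiv ℝ f y : CSpace n →ₗ[ℝ] P))

variable [FiniteDimensional ℝ P] {c : P →ₗ[ℝ] Matrix κ κ ℂ} (hc : IsCliffMap c)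
  {f : CSpace n → P} (hf : IsPhaseMap f)

include hc hf

theorem baseSym_isHermitian (Λ : ℝ) {x : CSpace n} (hx : ‖x‖ = 1) (y) :
    (baseSym c f Λ x y).IsHermitian :=
  ((hc.herm _).smul (IsSelfAdjoint.all Λ)).add (wHerm_isHermitian hc hx _)

theorem continuous_baseSym (Λ : ℝ) :
    Continuous fun p : Sph (n + 1) × Sph (n + 1) => baseSym c f Λ p.1 p.2 := by
  have hx : Continuous fun p : Sph (n + 1) × Sph (n + 1) => (p.1 : CSpace n) := by fun_prop
  have hy : Continuous fun p : Sph (n + 1) × Sph (n + 1) => (p.2 : CSpace n) := by fun_prop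
  refine (((continuous_cliffMap c).comp ((hf.continuous_comp hx fun p => sph_ne_zero _).sub
    (hf.continuous_comp hy fun p => sph_ne_zero _))).const_smul Λ).add (continuous_wHerm c hx ?_)
  exact ((hf.continuous_fderiv_comp hy fun p => sph_ne_zero _).comp continuous_fst).clm_apply
    continuous_snd

theorem isSym2_baseSym (Λ : ℝ) :
    IsSym2 (fun _ => 0) (fun _ => 0) fun x y : Sph (n + 1) => baseSym c f Λ x y where
  cont := continuous_baseSym hc hf Λ
  herm x y := baseSym_isHermitian hc hf Λ (norm_sph x) y
  equiv l μ x y i j := by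
    have h := wHerm_equiv (fun _ => 0) (norm_sph x) l μ
      (K := c ∘ₗ (fderiv ℝ f y : CSpace n →ₗ[ℝ] P))
      (K' := c ∘ₗ (fderiv ℝ f ((μ : ℂ) • (y : CSpace n)) : CSpace n →ₗ[ℝ] P))
      (fun u _ i j => by
        rw [LinearMap.comp_apply, LinearMap.comp_apply, ContinuousLinearMap.coe_coe,
          ContinuousLinearMap.coe_coe, hf.fderiv_smul _ (circle_ne_zero μ) (sph_ne_zero y)]) i j
    simp only [pow_zero, one_mul] at h ⊢
    rw [rotS_coe, rotS_coe, baseSym, baseSym, hf.smul _ _ (circle_ne_zero l),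
      hf.smul _ _ (circle_ne_zero μ), Matrix.add_apply, Matrix.add_apply, h]

theorem eventually_gapped_baseSym :
    ∀ᶠ Λ in atTop, Gapped fun x y : Sph (n + 1) => baseSym c f Λ x y := by
  have hx : Continuous fun p : Sph (n + 1) × Sph (n + 1) => (p.1 : CSpace n) := by fun_prop
  have hy : Continuous fun p : Sph (n + 1) × Sph (n + 1) => (p.2 : CSpace n) := by fun_prop
  have h := eventually_gapped hc (isCompact_univ (X := Sph (n + 1) × Sph (n + 1))) hx
    (fun p => norm_sph _) (L := fun p => (fderiv ℝ f p.2 : CSpace n →ₗ[ℝ] P))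
    (Continuous.clm_apply ((hf.continuous_fderiv_comp hy fun p => sph_ne_zero _).comp
      continuous_fst) continuous_snd)
    (δ := fun p => f p.1 - f p.2) (η := fun p => perpC (p.1 : CSpace n) p.2)
    ((hf.continuous_comp hx fun p => sph_ne_zero _).sub
      (hf.continuous_comp hy fun p => sph_ne_zero _))
    (fun p => inner_perpC (norm_sph _) _) fun p _ hp => by
      have h0 := (hf.parallel_iff (norm_sph p.1) (sph_ne_zero p.2)).mp (sub_eq_zero.mp hp)
      exact ⟨fun u hu hfu => hf.eq_zero_of_fderiv (norm_sph _) (sph_ne_zero p.2) h0 hu hfu,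
        hf.isLittleO hx hy (fun p => sph_ne_zero _) h0⟩
  filter_upwards [h] with Λ h x y v hv
  exact h (x, y) trivial v hv

end Base

end PhaseSymbol

section FockWeights

variable {n : ℕ} {Λ : Type*} [Fintype Λ] [DecidableEq Λ] {a : Fin n → Matrix Λ Λ ℂ} {wt : Λ → ℕ}
  (ha : IsFock a wt)

include ha

theorem IsFock.wt_le (I : Λ) : wt I ≤ n := by
  by_contra! h
  have h1 := ha.card (wt I)
  rw [Nat.choose_eq_zero_of_lt h, Fintype.card_eq_zero_iff] at h1
  exact h1.false ⟨I, rfl⟩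

theorem IsFock.crea_circle (μ : Circle) (z) (I J) :
    (μ : ℂ) ^ (n - wt I) * crea a ((μ : ℂ) • z) I J = (μ : ℂ) ^ (n - wt J) * crea a z I J := by
  rw [crea_smul, Matrix.smul_apply, smul_eq_mul]
  by_cases hne : crea a z I J = 0
  · rw [hne, mul_zero, mul_zero, mul_zero]
  · have h1 := ha.crea_grade hne
    have h2 := ha.wt_le I
    rw [show n - wt J = n - wt I + 1 by omega]
    ring

theorem IsFock.anni_circle (μ : Circle) (z) (I J) :
    (μ : ℂ) ^ (n - wt I) * anni a ((μ : ℂ) • z) I J = (μ : ℂ) ^ (n - wt J) * anni a z I J := by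
  rw [anni_smul, Matrix.smul_apply, smul_eq_mul]
  by_cases hne : anni a z I J = 0
  · rw [hne, mul_zero, mul_zero, mul_zero]
  · have h1 := ha.anni_grade hne
    have h2 := ha.wt_le J
    rw [show n - wt I = n - wt J + 1 by omega]
    linear_combination (μ : ℂ) ^ (n - wt J) * anni a z I J * star_circle_mul μ

theorem IsFock.cFock_circle (μ : Circle) (z) (I J) :
    (μ : ℂ) ^ (n - wt I) * cFock a ((μ : ℂ) • z) I J = (μ : ℂ) ^ (n - wt J) * cFock a z I J := by
  rw [cFock, cFock, Matrix.add_apply, Matrix.add_apply, mul_add, mul_add, ha.crea_circle,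
    ha.anni_circle]

theorem IsFock.refl1_wt (x) {I J} (h : wt I ≠ wt J) : refl1 a x I J = 0 := by
  have h1 : (crea a x * anni a x) I J = 0 := by
    rw [mul_apply]
    refine Finset.sum_eq_zero fun K _ => ?_
    by_contra hne
    have h1 := ha.crea_grade (left_ne_zero_of_mul hne)
    have h2 := ha.anni_grade (right_ne_zero_of_mul hne)
    omega
  rw [refl1, Matrix.sub_apply, Matrix.smul_apply, h1, smul_zero, sub_zero, one_apply_ne]
  rintro rfl
  exact h rfl

end FockWeights

section Interpolation

open scoped Kronecker

/-- The parameter space of a path of symbols. -/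
abbrev SphPath (n : ℕ) : Type := ℝ × Sph (n + 1) × Sph (n + 1)

variable {n : ℕ} {P : Type*} [NormedAddCommGroup P] [InnerProductSpace ℝ P]
  {κ : Type*} [Fintype κ] [DecidableEq κ] {Λ : Type*} [Fintype Λ] [DecidableEq Λ]
  {Q : Type*} [NormedAddCommGroup Q] [NormedSpace ℝ Q]

/-- A Clifford map on a sum space built from one on `P` and the Fock representation. -/
structure IsSumCliff (c : P →ₗ[ℝ] Matrix κ κ ℂ) (Γ : Matrix κ κ ℂ)
    (a : Fin (n + 1) → Matrix Λ Λ ℂ) (i₁ : P →ₗ[ℝ] Q) (i₂ : CSpace n →ₗ[ℝ] Q)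
    (τ : Q →ₗ[ℝ] Matrix (κ × Λ) (κ × Λ) ℂ) : Prop where
  cliff : IsCliffMap τ
  left : ∀ p, τ (i₁ p) = c p ⊗ₖ 1
  right : ∀ u, τ (i₂ u) = Γ ⊗ₖ cFock a u
  disjoint : ∀ p u, i₁ p + i₂ u = 0 → p = 0 ∧ u = 0

/-- Interpolation between the displacement of `f` and that of the identity. -/
noncomputable def pathQ (i₁ : P →ₗ[ℝ] Q) (i₂ : CSpace n →ₗ[ℝ] Q) (f : CSpace n → P) (t : ℝ)
    (x y : CSpace n) : Q :=
  i₁ ((1 - t) • (f x - f y)) + i₂ (-(t • perpC x y))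

/-- Interpolation between the derivative of `f` and the identity. -/
noncomputable def pathL (i₁ : P →ₗ[ℝ] Q) (i₂ : CSpace n →ₗ[ℝ] Q) (f : CSpace n → P) (t : ℝ)
    (y : CSpace n) : CSpace n →ₗ[ℝ] Q :=
  i₁ ∘ₗ ((1 - t) • (fderiv ℝ f y : CSpace n →ₗ[ℝ] P)) + i₂ ∘ₗ (t • LinearMap.id)

theorem pathL_apply (i₁ : P →ₗ[ℝ] Q) (i₂ : CSpace n →ₗ[ℝ] Q) (f : CSpace n → P) (t : ℝ)
    (y u : CSpace n) : pathL i₁ i₂ f t y u = i₁ ((1 - t) • fderiv ℝ f y u) + i₂ (t • u) := rfl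

/-- The symbol interpolating between the one of `f` and the one of the identity. -/
noncomputable def pathSym (i₁ : P →ₗ[ℝ] Q) (i₂ : CSpace n →ₗ[ℝ] Q)
    (τ : Q →ₗ[ℝ] Matrix (κ × Λ) (κ × Λ) ℂ) (f : CSpace n → P) (r t : ℝ) (x y : CSpace n) :
    Matrix (κ × Λ) (κ × Λ) ℂ :=
  r • τ (pathQ i₁ i₂ f t x y) + wHerm x (τ ∘ₗ pathL i₁ i₂ f t y)

variable {a : Fin (n + 1) → Matrix Λ Λ ℂ} {wt : Λ → ℕ} {c : P →ₗ[ℝ] Matrix κ κ ℂ}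
  {Γ : Matrix κ κ ℂ} {i₁ : P →ₗ[ℝ] Q} {i₂ : CSpace n →ₗ[ℝ] Q}
  {τ : Q →ₗ[ℝ] Matrix (κ × Λ) (κ × Λ) ℂ} {f : CSpace n → P}

theorem IsSumCliff.circle (hτ : IsSumCliff c Γ a i₁ i₂ τ) (ha : IsFock a wt) (μ : Circle) (p : P)
    (u : CSpace n) (i j : κ × Λ) :
    (μ : ℂ) ^ (n + 1 - wt i.2) * τ (i₁ p + i₂ ((μ : ℂ) • u)) i j =
      (μ : ℂ) ^ (n + 1 - wt j.2) * τ (i₁ p + i₂ u) i j := by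
  have h := ha.cFock_circle μ u i.2 j.2
  rw [map_add, map_add, hτ.left, hτ.right, hτ.right, Matrix.add_apply, Matrix.add_apply,
    kroneckerMap_apply, kroneckerMap_apply, kroneckerMap_apply, mul_add, mul_add]
  congr 1
  · by_cases hij : i.2 = j.2
    · rw [hij]
    · rw [one_apply_ne hij, mul_zero, mul_zero, mul_zero]
  · linear_combination Γ i.1 j.1 * h

theorem continuous_slice {X M : Type*} [TopologicalSpace X] [TopologicalSpace M]
    {G : ℝ → X → X → M} (h : Continuous fun p : ℝ × X × X => G p.1 p.2.1 p.2.2) (t : ℝ) :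
    Continuous fun p : X × X => G t p.1 p.2 :=
  h.comp (Continuous.prodMk_right t)

theorem isSym2_pathSym (hτ : IsSumCliff c Γ a i₁ i₂ τ) (ha : IsFock a wt) (hf : IsPhaseMap f)
    {r t : ℝ} (hcont : Continuous fun p : Sph (n + 1) × Sph (n + 1) =>
      pathSym i₁ i₂ τ f r t p.1 p.2) :
    IsSym2 (fun _ => 0) (fun i : κ × Λ => n + 1 - wt i.2)
      fun x y : Sph (n + 1) => pathSym i₁ i₂ τ f r t x y where
  cont := hcont
  herm x y := by
    unfold pathSym
    have h1 := (hτ.cliff.herm (pathQ i₁ i₂ f t x y)).smul (IsSelfAdjoint.all r)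
    exact h1.add (wHerm_isHermitian hτ.cliff (norm_sph x) _)
  equiv l μ x y i j := by
    have h1 := wHerm_equiv (fun i : κ × Λ => n + 1 - wt i.2) (norm_sph x) l μ
      (K := τ ∘ₗ pathL i₁ i₂ f t y)
      (K' := τ ∘ₗ pathL i₁ i₂ f t ((μ : ℂ) • (y : CSpace n)))
      (fun u _ i j => by
        rw [LinearMap.comp_apply, LinearMap.comp_apply, pathL_apply, pathL_apply,
          hf.fderiv_smul _ (circle_ne_zero μ) (sph_ne_zero y), smul_comm t]
        exact hτ.circle ha μ _ _ i j) i j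
    have h2 := hτ.circle ha μ ((1 - t) • (f x - f y)) (-(t • perpC (x : CSpace n) y)) i j
    simp only [pow_zero, one_mul] at h1 ⊢
    rw [rotS_coe, rotS_coe, pathSym, pathSym, Matrix.add_apply, Matrix.add_apply, mul_add, mul_add,
      h1, Matrix.smul_apply, Matrix.smul_apply, mul_smul_comm, mul_smul_comm, pathQ, pathQ,
      hf.smul _ _ (circle_ne_zero l), hf.smul _ _ (circle_ne_zero μ), perpC_smul, smul_comm t,
      ← smul_neg, h2]

variable [FiniteDimensional ℝ P]

theorem continuous_pathQ (hf : IsPhaseMap f) (i₁ : P →ₗ[ℝ] Q) (i₂ : CSpace n →ₗ[ℝ] Q) :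
    Continuous fun p : SphPath n => pathQ i₁ i₂ f p.1 p.2.1 p.2.2 := by
  have hx : Continuous fun p : SphPath n => (p.2.1 : CSpace n) := by fun_prop
  have hy : Continuous fun p : SphPath n => (p.2.2 : CSpace n) := by fun_prop
  exact ((LinearMap.continuous_of_finiteDimensional i₁).comp
    ((continuous_const.sub continuous_fst).smul ((hf.continuous_comp hx fun p => sph_ne_zero _).sub
      (hf.continuous_comp hy fun p => sph_ne_zero _)))).add
    ((LinearMap.continuous_of_finiteDimensional i₂).comp
      (continuous_fst.smul (continuous_perpC.comp (hx.prodMk hy))).neg)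

theorem continuous_pathL (hf : IsPhaseMap f) (i₁ : P →ₗ[ℝ] Q) (i₂ : CSpace n →ₗ[ℝ] Q) :
    Continuous fun z : SphPath n × CSpace n =>
      pathL i₁ i₂ f z.1.1 z.1.2.2 z.2 := by
  have hy : Continuous fun p : SphPath n => (p.2.2 : CSpace n) := by fun_prop
  have h1 : Continuous fun z : SphPath n × CSpace n =>
      fderiv ℝ f z.1.2.2 z.2 := Continuous.clm_apply
    ((hf.continuous_fderiv_comp hy fun p => sph_ne_zero _).comp continuous_fst) continuous_snd
  exact ((LinearMap.continuous_of_finiteDimensional i₁).comp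
    ((continuous_const.sub (continuous_fst.comp continuous_fst)).smul h1)).add
    ((LinearMap.continuous_of_finiteDimensional i₂).comp
      ((continuous_fst.comp continuous_fst).smul continuous_snd))

variable [FiniteDimensional ℝ Q]

theorem continuous_pathSym (hf : IsPhaseMap f) (i₁ : P →ₗ[ℝ] Q) (i₂ : CSpace n →ₗ[ℝ] Q)
    (τ : Q →ₗ[ℝ] Matrix (κ × Λ) (κ × Λ) ℂ) (r : ℝ) :
    Continuous fun p : SphPath n =>
      pathSym i₁ i₂ τ f r p.1 p.2.1 p.2.2 := by
  have hx : Continuous fun p : SphPath n => (p.2.1 : CSpace n) := by fun_prop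
  have h1 := ((continuous_cliffMap τ).comp (continuous_pathQ hf i₁ i₂)).const_smul r
  have h2 := h1.add (continuous_wHerm τ hx (L := fun p => pathL i₁ i₂ f p.1 p.2.2)
    (continuous_pathL hf i₁ i₂))
  unfold pathSym
  exact h2

theorem IsSumCliff.eventually_gapped (hτ : IsSumCliff c Γ a i₁ i₂ τ) (hf : IsPhaseMap f) :
    ∀ᶠ r in atTop, ∀ t ∈ Set.Icc (0 : ℝ) 1,
      Gapped fun x y : Sph (n + 1) => pathSym i₁ i₂ τ f r t x y := by
  have hx : Continuous fun p : SphPath n => (p.2.1 : CSpace n) := by fun_prop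
  have hy : Continuous fun p : SphPath n => (p.2.2 : CSpace n) := by fun_prop
  have hpar : ∀ p : SphPath n,
      pathQ i₁ i₂ f p.1 p.2.1 p.2.2 = 0 → perpC (p.2.1 : CSpace n) p.2.2 = 0 := by
    rintro ⟨t, x, y⟩ hp
    obtain ⟨h1, h2⟩ := hτ.disjoint _ _ hp
    rcases eq_or_ne t 0 with rfl | ht
    · rw [sub_zero, one_smul, sub_eq_zero] at h1
      exact (hf.parallel_iff (norm_sph x) (sph_ne_zero y)).mp h1
    · exact (smul_eq_zero.mp (neg_eq_zero.mp h2)).resolve_left ht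
  have h := _root_.eventually_gapped hτ.cliff
    ((isCompact_Icc (a := (0 : ℝ)) (b := 1)).prod (isCompact_univ (X := Sph (n + 1) × Sph (n + 1)))) hx
    (fun p => norm_sph _) (L := fun p => pathL i₁ i₂ f p.1 p.2.2) (continuous_pathL hf i₁ i₂)
    (δ := fun p => pathQ i₁ i₂ f p.1 p.2.1 p.2.2) (η := fun p => perpC (p.2.1 : CSpace n) p.2.2)
    (continuous_pathQ hf i₁ i₂) (fun p => inner_perpC (norm_sph _) _) fun p hpS hp => by
      have h0 := hpar p hp
      refine ⟨fun u hu hLu => ?_, ?_⟩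
      · obtain ⟨h1, h2⟩ := hτ.disjoint _ _ hLu
        rcases smul_eq_zero.mp (show p.1 • u = 0 from h2) with ht | hu
        · rw [ht, sub_zero, one_smul] at h1
          exact hf.eq_zero_of_fderiv (norm_sph _) (sph_ne_zero p.2.2) h0 hu h1
        · exact hu
      · have h1 := hf.isLittleO hx hy (fun p => sph_ne_zero _) h0
        have hb : (fun q : SphPath n => 1 - q.1) =O[𝓝 p] fun _ => (1 : ℝ) :=
          (continuous_const.sub continuous_fst).continuousAt.isBigO_one ℝ
        have h2 := (LinearMap.toContinuousLinearMap i₁).isBigO_comp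
          (fun q : SphPath n => (1 - q.1) • (f q.2.1 - f q.2.2 +
            fderiv ℝ f q.2.2 (perpC (q.2.1 : CSpace n) q.2.2))) (𝓝 p)
        refine (h2.trans_isLittleO (hb.smul_isLittleO h1)).congr (fun q => ?_)
          fun q => by rw [one_smul]
        rw [LinearMap.coe_toContinuousLinearMap', pathQ, pathL_apply, map_neg, smul_add, map_add]
        abel
  filter_upwards [h] with r h t ht x y v hv
  exact h (t, x, y) ⟨ht, trivial⟩ v hv

end Interpolation

section SymbolAlgebra

variable {d : ℕ} {ι : Type*} [Fintype ι] [DecidableEq ι] {a b : ι → ℕ}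
  {F G C D B : Sph d → Sph d → Matrix ι ι ℂ}

theorem IsSym2.add (hF : IsSym2 a b F) (hG : IsSym2 a b G) :
    IsSym2 a b fun x y => F x y + G x y where
  cont := hF.cont.add hG.cont
  herm x y := (hF.herm x y).add (hG.herm x y)
  equiv l μ x y i j := by
    rw [Matrix.add_apply, Matrix.add_apply, mul_add, mul_add, hF.equiv, hG.equiv]

theorem IsSym2.smul (hF : IsSym2 a b F) (r : ℝ) : IsSym2 a b fun x y => r • F x y where
  cont := hF.cont.const_smul r
  herm x y := (hF.herm x y).smul (IsSelfAdjoint.all r)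
  equiv l μ x y i j := by
    rw [Matrix.smul_apply, Matrix.smul_apply, mul_smul_comm, mul_smul_comm, hF.equiv]

theorem IsSym2.zero : IsSym2 a b fun _ _ : Sph d => (0 : Matrix ι ι ℂ) where
  cont := continuous_const
  herm x y := isHermitian_zero
  equiv l μ x y i j := by simp

theorem star_mulVec_dotProduct_mulVec {X Y : Matrix ι ι ℂ} (hX : X.IsHermitian) (v : ι → ℂ) :
    star (X *ᵥ v) ⬝ᵥ Y *ᵥ v = star v ⬝ᵥ (X * Y) *ᵥ v := by
  rw [star_mulVec, hX.eq, ← dotProduct_mulVec, mulVec_mulVec]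

open scoped ComplexOrder in
/-- Anticommuting Hermitian matrices have no common cancellation. -/
theorem mulVec_eq_zero_of_anticomm {X Y Z : Matrix ι ι ℂ} (hX : X.IsHermitian)
    (hY : Y.IsHermitian) (hZ : Z.IsHermitian) (hXY : X * Y = -(Y * X)) (hXZ : X * Z = -(Z * X))
    (hYZ : Y * Z = -(Z * Y)) {v : ι → ℂ} (h : (X + Y + Z) *ᵥ v = 0) :
    X *ᵥ v = 0 ∧ Y *ᵥ v = 0 ∧ Z *ᵥ v = 0 := by
  have h1 : (X + Y + Z) * (X + Y + Z) = X * X + Y * Y + Z * Z := by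
    simp only [mul_add, add_mul, hXY, hXZ, hYZ]
    abel
  have h2 : star (X *ᵥ v) ⬝ᵥ X *ᵥ v + star (Y *ᵥ v) ⬝ᵥ Y *ᵥ v + star (Z *ᵥ v) ⬝ᵥ Z *ᵥ v = 0 := by
    rw [star_mulVec_dotProduct_mulVec hX, star_mulVec_dotProduct_mulVec hY,
      star_mulVec_dotProduct_mulVec hZ, ← dotProduct_add, ← dotProduct_add, ← add_mulVec,
      ← add_mulVec, ← h1, ← mulVec_mulVec, h, mulVec_zero, dotProduct_zero]
  have hp : ∀ w : ι → ℂ, 0 ≤ star w ⬝ᵥ w := fun w => dotProduct_star_self_nonneg w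
  have h3 := (add_eq_zero_iff_of_nonneg (add_nonneg (hp _) (hp _)) (hp _)).mp h2
  have h4 := (add_eq_zero_iff_of_nonneg (hp _) (hp _)).mp h3.1
  exact ⟨dotProduct_star_self_eq_zero.mp h4.1, dotProduct_star_self_eq_zero.mp h4.2,
    dotProduct_star_self_eq_zero.mp h3.2⟩

theorem sg_eq_of_anticomm (hd : 0 < d) (hC : IsSym2 a b C) (hD : IsSym2 a b D) (hB : IsSym2 a b B)
    (hCD : ∀ x y, C x y * D x y = -(D x y * C x y)) (hCB : ∀ x y, C x y * B x y = -(B x y * C x y))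
    (hDB : ∀ x y, D x y * B x y = -(B x y * D x y)) (h0 : Gapped fun x y => C x y + D x y)
    (h1 : Gapped fun x y => C x y + B x y) :
    ∀ᶠ M in atTop, ∀ m ≥ M, ∀ u ≥ M,
      sg a b (fun x y => C x y + D x y) m u = sg a b (fun x y => C x y + B x y) m u := by
  have key := sg_homotopy (a := a) (b := b) hd
    (fun t x y => C x y + (1 - t) • D x y + t • B x y) (by
      have e1 := hC.cont.comp (continuous_snd (X := ℝ) (Y := Sph d × Sph d))
      have e2 := hD.cont.comp (continuous_snd (X := ℝ) (Y := Sph d × Sph d))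
      have e3 := hB.cont.comp (continuous_snd (X := ℝ) (Y := Sph d × Sph d))
      exact (e1.add ((continuous_const.sub continuous_fst).smul e2)).add (continuous_fst.smul e3))
    (fun t => (hC.add (hD.smul (1 - t))).add (hB.smul t)) (by
      intro t _ x y v hv
      have hs : ∀ r : ℝ, IsSelfAdjoint r := fun r => IsSelfAdjoint.all r
      obtain ⟨e1, e2, e3⟩ := mulVec_eq_zero_of_anticomm (hC.herm x y)
        ((hD.herm x y).smul (hs (1 - t))) ((hB.herm x y).smul (hs t))
        (by rw [mul_smul_comm, smul_mul_assoc, hCD, smul_neg])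
        (by rw [mul_smul_comm, smul_mul_assoc, hCB, smul_neg])
        (by rw [mul_smul_comm, smul_mul_assoc, mul_smul_comm, smul_mul_assoc, hDB, smul_neg,
              smul_neg, smul_comm]) hv
      rcases eq_or_ne t 0 with rfl | ht
      · rw [sub_zero, one_smul] at e2
        exact h0 x y v (by rw [add_mulVec, e1, e2, add_zero])
      · rw [smul_mulVec, smul_eq_zero_iff_right ht] at e3
        exact h1 x y v (by rw [add_mulVec, e1, e3, add_zero]))
  simpa using key

/-- Anticommuting invertible symbols have the same signature. -/
theorem sg_eq_of_anticomm' (hd : 0 < d) (hD : IsSym2 a b D) (hB : IsSym2 a b B)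
    (hDB : ∀ x y, D x y * B x y = -(B x y * D x y)) (h0 : Gapped D) (h1 : Gapped B) :
    ∀ᶠ M in atTop, ∀ m ≥ M, ∀ u ≥ M, sg a b D m u = sg a b B m u := by
  have := sg_eq_of_anticomm hd IsSym2.zero hD hB (by simp) (by simp) hDB (by simpa using h0)
    (by simpa using h1)
  simpa using this

theorem sg_smul (hd : 0 < d) (hF : IsSym2 a b F) (hg : Gapped F) {r : ℝ} (hr : 0 < r) :
    ∀ᶠ M in atTop, ∀ m ≥ M, ∀ u ≥ M, sg a b (fun x y => r • F x y) m u = sg a b F m u := by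
  have key := sg_homotopy (a := a) (b := b) hd (fun t x y => ((1 - t) * r + t) • F x y) (by
      have e1 := hF.cont.comp (continuous_snd (X := ℝ) (Y := Sph d × Sph d))
      have e2 : Continuous fun p : ℝ × Sph d × Sph d => (1 - p.1) * r + p.1 := by fun_prop
      exact e2.smul e1) (fun t => hF.smul _) (by
      intro t ht x y v hv
      rw [smul_mulVec, smul_eq_zero_iff_right] at hv
      · exact hg x y v hv
      · rcases eq_or_lt_of_le ht.1 with rfl | h
        · simpa using hr.ne'
        · have : 0 ≤ (1 - t) * r := mul_nonneg (by linarith [ht.2]) hr.le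
          positivity)
  simpa using key

theorem gapped_of_sq (h : ∀ x y, F x y * F x y = 1) : Gapped F := fun x y v hv => by
  rw [← one_mulVec v, ← h x y, ← mulVec_mulVec, hv, mulVec_zero]

end SymbolAlgebra

section Endpoints

open scoped Kronecker

variable {n : ℕ} {P : Type*} [NormedAddCommGroup P] [InnerProductSpace ℝ P]
  {κ : Type*} [Fintype κ] [DecidableEq κ] {Λ : Type*} [Fintype Λ] [DecidableEq Λ]

theorem exists_isSumCliff {P : Type} [NormedAddCommGroup P] [InnerProductSpace ℝ P]
    [FiniteDimensional ℝ P] {c : P →ₗ[ℝ] Matrix κ κ ℂ} (hc : IsCliffMap c)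
    {Γ : Matrix κ κ ℂ} (hΓ : Γ.IsHermitian) (hΓ2 : Γ * Γ = 1) (hcΓ : ∀ w, c w * Γ = -(Γ * c w))
    {a : Fin (n + 1) → Matrix Λ Λ ℂ} {wt : Λ → ℕ} (ha : IsFock a wt) :
    ∃ (Q : Type) (_ : NormedAddCommGroup Q) (_ : NormedSpace ℝ Q) (_ : FiniteDimensional ℝ Q)
      (i₁ : P →ₗ[ℝ] Q) (i₂ : CSpace n →ₗ[ℝ] Q) (τ : Q →ₗ[ℝ] Matrix (κ × Λ) (κ × Λ) ℂ),
      IsSumCliff c Γ a i₁ i₂ τ := by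
  let e := (WithLp.linearEquiv 2 ℝ (P × CSpace n)).symm
  have : FiniteDimensional ℝ (WithLp 2 (P × CSpace n)) := Module.Finite.equiv e
  refine ⟨WithLp 2 (P × CSpace n), inferInstance, inferInstance, inferInstance,
    e.toLinearMap ∘ₗ LinearMap.inl ℝ P (CSpace n), e.toLinearMap ∘ₗ LinearMap.inr ℝ P (CSpace n),
    sumCliff c Γ a, isCliffMap_sumCliff hc hΓ hΓ2 hcΓ ha, fun p => ?_, fun u => ?_, fun p u h => ?_⟩
  · have h0 : cFock a 0 = 0 := by simpa using cFock_real_smul (a := a) 0 0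
    rw [sumCliff_apply]
    change c p ⊗ₖ 1 + Γ ⊗ₖ cFock a 0 = _
    rw [h0, kronecker_zero, add_zero]
  · rw [sumCliff_apply]
    change c 0 ⊗ₖ 1 + Γ ⊗ₖ cFock a u = _
    rw [map_zero, zero_kronecker, zero_add]
  · have h1 := congrArg WithLp.fst h
    have h2 := congrArg WithLp.snd h
    change p + 0 = 0 at h1
    change 0 + u = 0 at h2
    exact ⟨by simpa using h1, by simpa using h2⟩

variable {Q : Type*} [NormedAddCommGroup Q] [NormedSpace ℝ Q]
  {a : Fin (n + 1) → Matrix Λ Λ ℂ} {wt : Λ → ℕ} {c : P →ₗ[ℝ] Matrix κ κ ℂ}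
  {Γ : Matrix κ κ ℂ} {i₁ : P →ₗ[ℝ] Q} {i₂ : CSpace n →ₗ[ℝ] Q}
  {τ : Q →ₗ[ℝ] Matrix (κ × Λ) (κ × Λ) ℂ} {f : CSpace n → P}

theorem pathSym_zero (hτ : IsSumCliff c Γ a i₁ i₂ τ) (r : ℝ) {x : CSpace n} (hx : ‖x‖ = 1) (y) :
    pathSym i₁ i₂ τ f r 0 x y = baseSym c f r x y ⊗ₖ (1 : Matrix Λ Λ ℂ) := by
  let φ : Matrix κ κ ℂ →+* Matrix (κ × Λ) (κ × Λ) ℂ :=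
    { toFun := fun X => X ⊗ₖ 1
      map_one' := one_kronecker_one
      map_zero' := zero_kronecker _
      map_add' := fun X Y => add_kronecker _ _ _
      map_mul' := fun X Y => by rw [← mul_kronecker_mul, one_mul] }
  have h := wVal_map hx 1 1 φ (c ∘ₗ (fderiv ℝ f y : CSpace n →ₗ[ℝ] P)) (τ ∘ₗ pathL i₁ i₂ f 0 y)
    fun u _ => by
      rw [LinearMap.comp_apply, pathL_apply, sub_zero, one_smul, zero_smul, map_zero, add_zero,
        hτ.left, Circle.coe_one, one_smul]
      rfl
  rw [Circle.coe_one, one_smul] at h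
  rw [pathSym, baseSym, wHerm, wHerm, h, pathQ, sub_zero, one_smul, zero_smul, neg_zero, map_zero,
    add_zero, hτ.left, add_kronecker, smul_kronecker, smul_kronecker]
  rfl

theorem IsFock.parity_refl1 (ha : IsFock a wt) (x) :
    parity wt * refl1 a x = refl1 a x * parity wt := by
  rw [refl1, mul_sub, sub_mul, mul_smul_comm, smul_mul_assoc, ← mul_assoc, ha.parity_crea, neg_mul,
    mul_assoc, ha.parity_anni, mul_neg, neg_neg, mul_one, one_mul, mul_assoc]

theorem pathSym_one (hτ : IsSumCliff c Γ a i₁ i₂ τ) (hΓ2 : Γ * Γ = 1) (ha : IsFock a wt) (r : ℝ)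
    {x : CSpace n} (hx : ‖x‖ = 1) (y) :
    pathSym i₁ i₂ τ f r 1 x y = Γ ⊗ₖ cFock a (-(r • perpC x y)) +
      ((-1 : ℝ) ^ n * (2 * n).factorial) • (1 ⊗ₖ (refl1 a x * parity wt)) := by
  set p : Matrix κ κ ℂ := (1 / 2 : ℂ) • (1 + Γ) with hp
  set q : Matrix κ κ ℂ := (1 / 2 : ℂ) • (1 - Γ) with hq
  have hpq : p + q = 1 := by rw [hp, hq]; module
  have hpq' : p - q = Γ := by rw [hp, hq]; module
  have hpp : p * p = p := by
    rw [hp, smul_mul_smul_comm, mul_add, add_mul, add_mul, hΓ2, one_mul, mul_one, one_mul]; module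
  have hqq : q * q = q := by
    rw [hq, smul_mul_smul_comm, mul_sub, sub_mul, sub_mul, hΓ2, one_mul, mul_one, one_mul]; module
  have hpq0 : p * q = 0 := by
    rw [hp, hq, smul_mul_smul_comm, mul_sub, add_mul, add_mul, hΓ2, one_mul, mul_one, one_mul]
    module
  have hqp0 : q * p = 0 := by
    rw [hp, hq, smul_mul_smul_comm, mul_add, sub_mul, sub_mul, hΓ2, one_mul, mul_one, one_mul]
    module
  let φ : Matrix Λ Λ ℂ →+* Matrix (κ × Λ) (κ × Λ) ℂ :=
    { toFun := fun X => p ⊗ₖ X + q ⊗ₖ (parity wt * X * parity wt)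
      map_one' := by rw [mul_one, parity_sq, ← add_kronecker, hpq, one_kronecker_one]
      map_zero' := by simp
      map_add' := fun X Y => by
        simp only [kronecker_add, mul_add, add_mul]
        abel
      map_mul' := fun X Y => by
        simp only [mul_add, add_mul, ← mul_kronecker_mul, hpp, hqq, hpq0, hqp0, zero_kronecker,
          add_zero, zero_add]
        rw [show parity wt * X * parity wt * (parity wt * Y * parity wt) =
          parity wt * X * (parity wt * parity wt) * (Y * parity wt) by noncomm_ring, parity_sq,
          mul_one]
        noncomm_ring }
  let K : CSpace n →ₗ[ℝ] Matrix Λ Λ ℂ :=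
    { toFun := cFock a
      map_add' := cFock_add
      map_smul' := fun r z => cFock_real_smul r z }
  have hφF : ∀ u, φ (cFock a u) = Γ ⊗ₖ cFock a u := fun u => by
    change p ⊗ₖ cFock a u + q ⊗ₖ (parity wt * cFock a u * parity wt) = _
    rw [ha.parity_cFock, neg_mul, mul_assoc, parity_sq, mul_one, ← hpq', sub_eq_add_neg,
      add_kronecker, neg_kronecker_left]
    congr 1
    ext i j
    simp [kroneckerMap_apply]
  have h := wVal_map hx 1 1 φ K (τ ∘ₗ pathL i₁ i₂ f 1 y) fun u _ => by
      rw [LinearMap.comp_apply, pathL_apply, sub_self, zero_smul, map_zero, zero_add,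
        hτ.right, Circle.coe_one, one_smul, one_smul]
      exact (hφF u).symm
  rw [Circle.coe_one, one_smul, ha.wVal_cFock hx K fun u _ => rfl] at h
  have hω : ∀ z : ℂ, φ (z • (refl1 a x * parity wt)) = z • (1 ⊗ₖ (refl1 a x * parity wt)) := by
    intro z
    change p ⊗ₖ (z • (refl1 a x * parity wt)) +
      q ⊗ₖ (parity wt * (z • (refl1 a x * parity wt)) * parity wt) = _
    rw [mul_smul_comm, smul_mul_assoc, ← mul_assoc, ha.parity_refl1,
      mul_assoc (refl1 a x) _ (parity wt), parity_sq, mul_one, ← add_kronecker, hpq,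
      kronecker_smul]
  have hI : (Complex.I ^ n * ((2 * n).factorial * Complex.I ^ n) : ℂ) =
      ((((-1 : ℝ) ^ n * (2 * n).factorial : ℝ)) : ℂ) := by
    push_cast
    rw [mul_left_comm, ← mul_pow, Complex.I_mul_I, mul_comm]
  rw [pathSym, wHerm, h, hω, smul_smul, hI, pathQ, sub_self, zero_smul, map_zero, zero_add,
    hτ.right, one_smul, ← smul_neg, cFock_real_smul, kronecker_smul, Complex.coe_smul]

end Endpoints

section FockSymbols

open scoped Kronecker

variable {n : ℕ} {κ : Type*} [Fintype κ] [DecidableEq κ] {Λ : Type*} [Fintype Λ] [DecidableEq Λ]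
  {a : Fin (n + 1) → Matrix Λ Λ ℂ} {wt : Λ → ℕ}

theorem isUnit_of_mulVec {X : Matrix κ κ ℂ} (h : ∀ v, X *ᵥ v = 0 → v = 0) : IsUnit X :=
  mulVec_injective_iff_isUnit.mp fun v w hvw =>
    sub_eq_zero.mp (h _ (by rw [mulVec_sub, sub_eq_zero]; exact hvw))

theorem Gapped.kronecker {d : ℕ} {F : Sph d → Sph d → Matrix κ κ ℂ} (hF : Gapped F)
    {X : Matrix Λ Λ ℂ} (hX : X * X = 1) : Gapped fun x y => F x y ⊗ₖ X := fun x y v hv => by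
  obtain ⟨N, hN⟩ := (isUnit_of_mulVec (hF x y)).exists_left_inv
  rw [← one_mulVec v, ← one_kronecker_one, ← hN, ← hX, mul_kronecker_mul, ← mulVec_mulVec, hv,
    mulVec_zero]

theorem IsSym2.kronecker_left {d : ℕ} {a' b' : Λ → ℕ} {F : Sph d → Sph d → Matrix Λ Λ ℂ}
    (hF : IsSym2 a' b' F) {X : Matrix κ κ ℂ} (hX : X.IsHermitian) :
    IsSym2 (fun i : κ × Λ => a' i.2) (fun i => b' i.2) fun x y => X ⊗ₖ F x y where
  cont := continuous_matrix fun i j =>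
    continuous_const.mul (hF.cont.matrix_elem i.2 j.2)
  herm x y := by rw [IsHermitian, conjTranspose_kronecker, hX.eq, (hF.herm x y).eq]
  equiv l μ x y i j := by
    rw [kroneckerMap_apply, kroneckerMap_apply]
    linear_combination X i.1 j.1 * hF.equiv l μ x y i.2 j.2

theorem IsSym2.kronecker_diagonal {d : ℕ} {F : Sph d → Sph d → Matrix κ κ ℂ}
    (hF : IsSym2 (fun _ => 0) (fun _ => 0) F) (b' : Λ → ℕ) {ε : Λ → ℂ}
    (hε : (diagonal ε).IsHermitian) :
    IsSym2 (fun _ : κ × Λ => 0) (fun i => b' i.2) fun x y => F x y ⊗ₖ diagonal ε where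
  cont := continuous_matrix fun i j =>
    (hF.cont.matrix_elem i.1 j.1).mul continuous_const
  herm x y := by rw [IsHermitian, conjTranspose_kronecker, hε.eq, (hF.herm x y).eq]
  equiv l μ x y i j := by
    have h := hF.equiv l μ x y i.1 j.1
    simp only [pow_zero, one_mul] at h ⊢
    rw [kroneckerMap_apply, kroneckerMap_apply, h]
    by_cases hij : i.2 = j.2
    · rw [hij]
    · rw [diagonal_apply_ne _ hij, mul_zero, mul_zero, mul_zero]

/-- The zeroth order symbol of the model operator on Fock space. -/
noncomputable def omega (a : Fin (n + 1) → Matrix Λ Λ ℂ) (wt : Λ → ℕ) (x : CSpace n) :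
    Matrix Λ Λ ℂ :=
  refl1 a x * parity wt

/-- The signature of `omega`. -/
noncomputable def sgOmega (a : Fin (n + 1) → Matrix Λ Λ ℂ) (wt : Λ → ℕ) (m u : ℕ) : ℤ :=
  sg (d := n + 1) (fun _ => 0) (fun I => n + 1 - wt I) (fun x _ => omega a wt x) m u

theorem continuous_crea {X : Type*} [TopologicalSpace X] {g : X → CSpace n} (hg : Continuous g) :
    Continuous fun x => crea a (g x) := by
  unfold crea
  fun_prop

theorem continuous_anni {X : Type*} [TopologicalSpace X] {g : X → CSpace n} (hg : Continuous g) :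
    Continuous fun x => anni a (g x) := by
  unfold anni
  fun_prop

theorem crea_mul_anni_circle (l : Circle) (x : CSpace n) :
    crea a ((l : ℂ) • x) * anni a ((l : ℂ) • x) = crea a x * anni a x := by
  rw [crea_smul, anni_smul, smul_mul_smul_comm, mul_comm, star_circle_mul, one_smul]

variable (ha : IsFock a wt)

include ha

theorem IsFock.omega_sq {x : CSpace n} (hx : ‖x‖ = 1) : omega a wt x * omega a wt x = 1 := by
  rw [omega, mul_assoc, ← mul_assoc (parity wt), ha.parity_refl1, mul_assoc (refl1 a x), parity_sq,
    mul_one, ha.refl1_sq hx]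

theorem IsFock.omega_isHermitian (x : CSpace n) : (omega a wt x).IsHermitian := by
  rw [IsHermitian, omega, conjTranspose_mul, parity_isHermitian.eq, (refl1_isHermitian x).eq,
    ha.parity_refl1]

theorem IsFock.omega_mul_cFock {x z : CSpace n} (h : inner ℂ x z = 0) :
    omega a wt x * cFock a z = -(cFock a z * omega a wt x) := by
  have h2 : refl1 a x * anni a z = anni a z * refl1 a x := by
    have := congrArg conjTranspose (ha.refl1_crea h)
    rw [conjTranspose_mul, conjTranspose_mul, crea_conjTranspose, (refl1_isHermitian x).eq] at this
    exact this.symm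
  have h3 : refl1 a x * cFock a z = cFock a z * refl1 a x := by
    rw [cFock, mul_add, add_mul, ha.refl1_crea h, h2]
  rw [omega, mul_assoc, ha.parity_cFock, mul_neg, ← mul_assoc, h3, mul_assoc]

theorem IsFock.isSym2_omega : IsSym2 (fun _ => 0) (fun I => n + 1 - wt I)
    fun x _ : Sph (n + 1) => omega a wt x where
  cont := by
    have hx : Continuous fun p : Sph (n + 1) × Sph (n + 1) => (p.1 : CSpace n) := by fun_prop
    unfold omega refl1
    exact (continuous_const.sub (((continuous_crea hx).mul (continuous_anni hx)).const_smul
      2)).mul continuous_const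
  herm x y := ha.omega_isHermitian x
  equiv l μ x y I J := by
    have h1 : omega a wt (rotS l x : CSpace n) = omega a wt x := by
      rw [rotS_coe, omega, refl1, crea_mul_anni_circle]
      rfl
    simp only [h1, pow_zero, one_mul]
    by_cases h : wt I = wt J
    · rw [h]
    · rw [omega, parity, mul_diagonal, ha.refl1_wt _ h, zero_mul, mul_zero, mul_zero]

theorem IsFock.isSym2_cFock {g : CSpace n → CSpace n → CSpace n}
    (hg : Continuous fun p : Sph (n + 1) × Sph (n + 1) => g p.1 p.2)
    (hgs : ∀ (l μ : Circle) x y, g ((l : ℂ) • x) ((μ : ℂ) • y) = (μ : ℂ) • g x y) :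
    IsSym2 (fun _ => 0) (fun I => n + 1 - wt I)
      fun x y : Sph (n + 1) => cFock a (g x y) where
  cont := by
    unfold cFock
    exact (continuous_crea hg).add (continuous_anni hg)
  herm x y := cFock_isHermitian _
  equiv l μ x y I J := by
    simp only [pow_zero, one_mul, rotS_coe, hgs, ha.cFock_circle]

theorem IsFock.gapped_cFock : Gapped fun _ y : Sph (n + 1) => cFock a (y : CSpace n) :=
  gapped_of_sq fun _ y => by rw [ha.cFock_sq, norm_sph, one_pow, one_smul]

theorem IsFock.sg_cFock {g : CSpace n → CSpace n → CSpace n} (a' b' : Λ → ℕ) (m u : ℕ) :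
    sg (d := n + 1) a' b' (fun x y => cFock a (g x y)) m u = 0 :=
  sg_anticomm (fun _ _ => cFock_isHermitian _) (fun I => (-1) ^ wt I)
    (fun I => by rw [← mul_pow]; simp) (fun x y I J => by
      have := congrFun (congrFun (ha.parity_cFock (g x y)) I) J
      rwa [parity, diagonal_mul, Matrix.neg_apply, mul_diagonal] at this) m u

theorem IsFock.sum_wt {A : Type*} [CommRing A] (g : ℕ → A) :
    ∑ I, g (wt I) = ∑ i ∈ Finset.range (n + 2), ((n + 1).choose i : A) * g i := by
  rw [← Finset.sum_fiberwise_of_maps_to (t := Finset.range (n + 2)) (g := wt)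
    (fun I _ => Finset.mem_range.mpr (Nat.lt_succ_of_le (ha.wt_le I)))]
  refine Finset.sum_congr rfl fun i _ => ?_
  rw [← ha.card i, Fintype.card_subtype, Finset.sum_congr rfl fun I hI => by
    rw [(Finset.mem_filter.mp hI).2], Finset.sum_const, nsmul_eq_mul]

/-- The signature of a tensor product with a sign function on Fock space. -/
theorem IsFock.sg_kronecker_diagonal {d : ℕ} {F : Sph d → Sph d → Matrix κ κ ℂ}
    (hF : ∀ x y, (F x y).IsHermitian) {ε : ℤ} (hε : ε = 1 ∨ ε = -1) (m u : ℕ) :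
    sg (fun _ : κ × Λ => 0) (fun i => n + 1 - wt i.2)
      (fun x y => F x y ⊗ₖ diagonal fun I => (ε : ℂ) ^ wt I) m u =
    ∑ i ∈ Finset.range (n + 2), ((n + 1).choose i : ℤ) *
      (ε ^ i * sg (fun _ => 0) (fun _ => 0) F m (u + (n + 1 - i))) := by
  rw [← ha.sum_wt fun i => ε ^ i * sg (fun _ => 0) (fun _ => 0) F m (u + (n + 1 - i)),
    sg_blocks ((Equiv.sigmaEquivProd Λ κ).trans (Equiv.prodComm Λ κ))
    (τ := fun _ => κ) (a' := fun _ _ => 0) (b' := fun _ _ => 0) (m' := fun _ => m)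
    (u' := fun I => u + (n + 1 - wt I)) (G := fun I x y => (ε : ℂ) ^ wt I • F x y)
    (fun _ _ => rfl) (fun _ _ => rfl)]
  · refine Finset.sum_congr rfl fun I _ => ?_
    have h1 : ε ^ wt I = 1 ∨ ε ^ wt I = -1 := by
      rcases hε with rfl | rfl
      · exact Or.inl (one_pow _)
      · exact neg_one_pow_eq_or ℤ _
    rcases h1 with h1 | h1
    · have : (ε : ℂ) ^ wt I = 1 := by exact_mod_cast congrArg (Int.cast (R := ℂ)) h1
      simp only [this, one_smul, h1, one_mul]
    · have : (ε : ℂ) ^ wt I = -1 := by exact_mod_cast congrArg (Int.cast (R := ℂ)) h1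
      simp only [this, neg_smul, one_smul, h1, neg_one_mul]
      exact sg_neg hF _ _
  · intro x y I i j
    change F x y i j * diagonal (fun I => (ε : ℂ) ^ wt I) I I = _
    rw [diagonal_apply_eq, Matrix.smul_apply, smul_eq_mul, mul_comm]
  · intro x y I J i j h
    change F x y i j * diagonal (fun I => (ε : ℂ) ^ wt I) I J = _
    rw [diagonal_apply_ne _ h, mul_zero]

omit ha in
theorem sg_one_kronecker {d : ℕ} {a' b' : Λ → ℕ} {F : Sph d → Sph d → Matrix Λ Λ ℂ} (m u : ℕ) :
    sg (fun i : κ × Λ => a' i.2) (fun i => b' i.2) (fun x y => (1 : Matrix κ κ ℂ) ⊗ₖ F x y) m u =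
      Fintype.card κ * sg a' b' F m u := by
  rw [sg_blocks (Equiv.sigmaEquivProd κ Λ)
    (τ := fun _ => Λ) (a' := fun _ => a') (b' := fun _ => b') (m' := fun _ => m)
    (u' := fun _ => u) (G := fun _ => F) (fun _ _ => rfl) (fun _ _ => rfl)]
  · simp
  · intro x y I i j
    change (1 : Matrix κ κ ℂ) I I * F x y i j = _
    rw [one_apply_eq, one_mul]
  · intro x y I J i j h
    change (1 : Matrix κ κ ℂ) I J * F x y i j = _
    rw [one_apply_ne h, zero_mul]

end FockSymbols

section Recurrences

open scoped Kronecker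

variable {n : ℕ} {P : Type} [NormedAddCommGroup P] [InnerProductSpace ℝ P] [FiniteDimensional ℝ P]
  {κ : Type*} [Fintype κ] [DecidableEq κ] {Λ : Type*} [Fintype Λ] [DecidableEq Λ]
  {a : Fin (n + 1) → Matrix Λ Λ ℂ} {wt : Λ → ℕ} {c : P →ₗ[ℝ] Matrix κ κ ℂ} {f : CSpace n → P}

theorem IsFock.sum_neg_one_pow_sg (ha : IsFock a wt) {F : Sph (n + 1) → Sph (n + 1) → Matrix κ κ ℂ}
    (hF : IsSym2 (fun _ => 0) (fun _ => 0) F) (hg : Gapped F) :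
    ∀ᶠ M in atTop, ∀ m ≥ M, ∀ u ≥ M, ∑ i ∈ Finset.range (n + 2), ((n + 1).choose i : ℤ) *
      ((-1) ^ i * sg (fun _ => 0) (fun _ => 0) F m (u + (n + 1 - i))) = 0 := by
  have hpar : (diagonal fun I => ((-1 : ℤ) : ℂ) ^ wt I) = parity wt := by rw [parity]; simp
  have hherm : (diagonal fun I => ((-1 : ℤ) : ℂ) ^ wt I).IsHermitian := by
    rw [hpar]; exact parity_isHermitian
  have h := sg_eq_of_anticomm' n.succ_pos
    (hF.kronecker_diagonal (fun I => n + 1 - wt I) hherm)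
    ((ha.isSym2_cFock (g := fun _ y => y) (by fun_prop) fun _ _ _ _ => rfl).kronecker_left
      (isHermitian_one (n := κ)))
    (fun x y => by
      rw [hpar, ← mul_kronecker_mul, ← mul_kronecker_mul, ha.parity_cFock, mul_one, one_mul]
      ext i j
      simp [kroneckerMap_apply])
    (by rw [hpar]; exact hg.kronecker parity_sq)
    (gapped_of_sq fun x y => by
      rw [← mul_kronecker_mul, ha.cFock_sq, norm_sph, one_pow, one_smul, one_mul,
        one_kronecker_one])
  filter_upwards [h] with M hM m hm u hu
  rw [← ha.sg_kronecker_diagonal hF.herm (Or.inr rfl), hM m hm u hu]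
  exact (sg_one_kronecker (a' := fun _ => 0) (b' := fun I => n + 1 - wt I) m u).trans
    (by rw [ha.sg_cFock (g := fun _ y => y), mul_zero])

theorem IsFock.sum_sg_baseSym (ha : IsFock a wt) (hc : IsCliffMap c) {Γ : Matrix κ κ ℂ}
    (hΓ : Γ.IsHermitian) (hΓ2 : Γ * Γ = 1) (hcΓ : ∀ w, c w * Γ = -(Γ * c w)) (hf : IsPhaseMap f) :
    ∀ᶠ r in atTop, ∀ᶠ M in atTop, ∀ m ≥ M, ∀ u ≥ M,
      ∑ i ∈ Finset.range (n + 2), ((n + 1).choose i : ℤ) *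
        sg (d := n + 1) (fun _ => 0) (fun _ => 0) (fun x y => baseSym c f r x y) m (u + (n + 1 - i)) =
      (-1) ^ n * (Fintype.card κ * sgOmega a wt m u) := by
  obtain ⟨Q, _, _, _, i₁, i₂, τ, hτ⟩ := exists_isSumCliff hc hΓ hΓ2 hcΓ ha
  filter_upwards [hτ.eventually_gapped hf] with r hr
  have hpath := continuous_pathSym hf i₁ i₂ τ r
  have hsym : ∀ t, IsSym2 (fun _ => 0) (fun i : κ × Λ => n + 1 - wt i.2)
      fun x y : Sph (n + 1) => pathSym i₁ i₂ τ f r t x y := fun t =>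
    isSym2_pathSym hτ ha hf
      (continuous_slice (G := fun t (x y : Sph (n + 1)) => pathSym i₁ i₂ τ f r t x y) hpath t)
  have H1 := sg_homotopy n.succ_pos (fun t (x y : Sph (n + 1)) => pathSym i₁ i₂ τ f r t x y) hpath
    hsym hr
  have E0 : (fun x y : Sph (n + 1) => pathSym i₁ i₂ τ f r 0 x y) =
      fun x y : Sph (n + 1) =>
      baseSym c f r x y ⊗ₖ diagonal fun I => ((1 : ℤ) : ℂ) ^ wt I := by
    funext x y
    rw [pathSym_zero hτ r (norm_sph x)]
    simp
  set q : ℝ := (-1 : ℝ) ^ n * (2 * n).factorial with hq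
  have E1 : (fun x y : Sph (n + 1) => pathSym i₁ i₂ τ f r 1 x y) =
      fun x y : Sph (n + 1) =>
      q • (1 : Matrix κ κ ℂ) ⊗ₖ omega a wt x + Γ ⊗ₖ cFock a (-(r • perpC (x : CSpace n) y)) := by
    funext x y
    rw [pathSym_one hτ hΓ2 ha r (norm_sph x), add_comm]
    rfl
  have hW : IsSym2 (fun _ => 0) (fun i : κ × Λ => n + 1 - wt i.2)
      fun x _ : Sph (n + 1) => (1 : Matrix κ κ ℂ) ⊗ₖ omega a wt x :=
    ha.isSym2_omega.kronecker_left isHermitian_one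
  have hWg : Gapped fun x _ : Sph (n + 1) => (1 : Matrix κ κ ℂ) ⊗ₖ omega a wt x :=
    gapped_of_sq fun x _ => by
      rw [← mul_kronecker_mul, ha.omega_sq (norm_sph x), one_mul, one_kronecker_one]
  have hq0 : q ≠ 0 := mul_ne_zero (pow_ne_zero _ (by norm_num)) (by exact_mod_cast
    (Nat.factorial_ne_zero _))
  have hA : IsSym2 (fun _ => 0) (fun i : κ × Λ => n + 1 - wt i.2) fun x y : Sph (n + 1) =>
      Γ ⊗ₖ cFock a (-(r • perpC (x : CSpace n) y)) :=
    (ha.isSym2_cFock (g := fun x y => -(r • perpC x y)) (by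
      have := continuous_perpC (n := n)
      have h2 : Continuous fun p : Sph (n + 1) × Sph (n + 1) => ((p.1 : CSpace n), (p.2 : CSpace n)) := by
        fun_prop
      exact ((this.comp h2).const_smul r).neg)
      fun l μ x y => by rw [perpC_smul, smul_comm, smul_neg]).kronecker_left hΓ
  have H2 := sg_eq_of_anticomm n.succ_pos (hW.smul q) hA IsSym2.zero (fun x y => by
      rw [smul_mul_assoc, mul_smul_comm, ← mul_kronecker_mul, ← mul_kronecker_mul, one_mul, mul_one,
        ha.omega_mul_cFock (z := -(r • perpC (x : CSpace n) y)), ← smul_neg]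
      · ext i j
        simp [kroneckerMap_apply]
      · rw [inner_neg_right, inner_smul_right_eq_smul, inner_perpC (norm_sph x), smul_zero, neg_zero])
    (by simp) (by simp) (E1 ▸ hr 1 (by simp)) (fun x y v hv => by
      simp only [add_zero] at hv
      rw [smul_mulVec, smul_eq_zero_iff_right hq0] at hv
      exact hWg x y v hv)
  simp only [add_zero] at H2
  have H3 := sg_smul n.succ_pos hW hWg (r := ((2 * n).factorial : ℝ)) (by positivity)
  filter_upwards [H1, H2, H3] with M h1 h2 h3 m hm u hu
  have e0 := ha.sg_kronecker_diagonal (F := fun x y : Sph (n + 1) => baseSym c f r x y)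
    (fun x y => baseSym_isHermitian hc hf r (norm_sph x) y) (Or.inl rfl) m u
  simp only [one_pow, one_mul] at e0
  rw [← e0]
  have e1 := h1 m hm u hu
  rw [E0, E1, h2 m hm u hu] at e1
  have e2 := sg_one_kronecker (κ := κ) (a' := fun _ => 0) (b' := fun I => n + 1 - wt I)
    (F := fun x _ : Sph (n + 1) => omega a wt x) m u
  rw [e1, sgOmega, ← e2, ← h3 m hm u hu, hq]
  rcases Nat.even_or_odd n with hn | hn
  · rw [hn.neg_one_pow, hn.neg_one_pow, one_mul, one_mul]
  · rw [hn.neg_one_pow, hn.neg_one_pow, neg_one_mul, neg_one_mul, ← sg_neg (hW.smul _).herm]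
    simp only [neg_smul]

end Recurrences

section ShiftInvariance

variable {n : ℕ} {Λ : Type*} [Fintype Λ] [DecidableEq Λ]
  {a : Fin (n + 1) → Matrix Λ Λ ℂ} {wt : Λ → ℕ} (ha : IsFock a wt)

/-- Weights in the first variable on two copies of Fock space. -/
def dblA (Λ : Type*) : Λ ⊕ Λ → ℕ := Sum.elim (fun _ => 1) fun _ => 0

/-- Weights in the second variable on two copies of Fock space. -/
def dblB (n : ℕ) (wt : Λ → ℕ) : Λ ⊕ Λ → ℕ :=
  Sum.elim (fun I => 1 + (n + 1 - wt I)) fun I => n + 1 - wt I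

theorem sg_fromBlocks {d : ℕ} {F G : Sph d → Sph d → Matrix Λ Λ ℂ} (m u : ℕ) :
    sg (dblA Λ) (dblB n wt) (fun x y => fromBlocks (F x y) 0 0 (G x y)) m u =
      sg (fun _ => 0) (fun I => n + 1 - wt I) F (m + 1) (u + 1) +
      sg (fun _ => 0) (fun I => n + 1 - wt I) G m u := by
  rw [sg_blocks ((Equiv.sigmaEquivProd Bool Λ).trans (Equiv.boolProdEquivSum Λ))
    (τ := fun _ => Λ) (a' := fun _ _ => 0) (b' := fun _ I => n + 1 - wt I)
    (m' := fun k => bif k then m else m + 1)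
    (u' := fun k => bif k then u else u + 1) (G := fun k => bif k then G else F)]
  · rw [Fintype.sum_bool, add_comm]
    rfl
  · rintro (_ | _) I <;> rfl
  · rintro (_ | _) I
    · change u + 1 + (n + 1 - wt I) = u + (1 + (n + 1 - wt I))
      rw [add_assoc]
    · rfl
  · rintro x y (_ | _) I J <;> rfl
  · rintro x y (_ | _) (_ | _) I J h
    · exact absurd rfl h
    · rfl
    · rfl
    · exact absurd rfl h

theorem IsSym2.fromBlocks_diag {F G : Sph (n + 1) → Sph (n + 1) → Matrix Λ Λ ℂ}
    (hF : IsSym2 (fun _ => 0) (fun I => n + 1 - wt I) F)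
    (hG : IsSym2 (fun _ => 0) (fun I => n + 1 - wt I) G) :
    IsSym2 (dblA Λ) (dblB n wt) fun x y => fromBlocks (F x y) 0 0 (G x y) where
  cont := hF.cont.matrix_fromBlocks continuous_const continuous_const hG.cont
  herm x y := by
    rw [IsHermitian, fromBlocks_conjTranspose, (hF.herm x y).eq, (hG.herm x y).eq,
      conjTranspose_zero]
  equiv l μ x y i j := by
    have h1 := hF.equiv l μ x y
    have h2 := hG.equiv l μ x y
    simp only [pow_zero, one_mul] at h1 h2
    rcases i with I | I <;> rcases j with J | J
    · change (l : ℂ) ^ 1 * (μ : ℂ) ^ (1 + (n + 1 - wt I)) * F _ _ I J =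
        (l : ℂ) ^ 1 * (μ : ℂ) ^ (1 + (n + 1 - wt J)) * F _ _ I J
      rw [pow_add, pow_add]
      linear_combination (l : ℂ) * μ * h1 I J
    · rw [fromBlocks_apply₁₂, fromBlocks_apply₁₂, Matrix.zero_apply, mul_zero, mul_zero]
    · rw [fromBlocks_apply₂₁, fromBlocks_apply₂₁, Matrix.zero_apply, mul_zero, mul_zero]
    · change (l : ℂ) ^ 0 * (μ : ℂ) ^ (n + 1 - wt I) * G _ _ I J =
        (l : ℂ) ^ 0 * (μ : ℂ) ^ (n + 1 - wt J) * G _ _ I J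
      rw [pow_zero, one_mul, one_mul, h2]

/-- The number operator in the direction of a vector. -/
noncomputable def numOp (a : Fin (n + 1) → Matrix Λ Λ ℂ) (x : CSpace n) : Matrix Λ Λ ℂ :=
  crea a x * anni a x

theorem numOp_isHermitian (x : CSpace n) : (numOp a x).IsHermitian := by
  rw [IsHermitian, numOp, conjTranspose_mul, crea_conjTranspose, anni_conjTranspose]

/-- The common summand of the two symbols compared in the shift. -/
noncomputable def shiftC (a : Fin (n + 1) → Matrix Λ Λ ℂ) (wt : Λ → ℕ) (x : CSpace n) :
    Matrix (Λ ⊕ Λ) (Λ ⊕ Λ) ℂ :=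
  fromBlocks (parity wt * ((1 : ℝ) • 1 + (-1 : ℝ) • numOp a x)) 0 0
    (parity wt * ((0 : ℝ) • 1 + (1 : ℝ) • numOp a x))

/-- The diagonal summand removed in the shift. -/
noncomputable def shiftD (a : Fin (n + 1) → Matrix Λ Λ ℂ) (wt : Λ → ℕ) (x : CSpace n) :
    Matrix (Λ ⊕ Λ) (Λ ⊕ Λ) ℂ :=
  fromBlocks (parity wt * ((0 : ℝ) • 1 + (-1 : ℝ) • numOp a x)) 0 0
    (parity wt * ((-1 : ℝ) • 1 + (1 : ℝ) • numOp a x))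

/-- The off-diagonal summand added in the shift. -/
def shiftB (a : Fin (n + 1) → Matrix Λ Λ ℂ) (x : CSpace n) : Matrix (Λ ⊕ Λ) (Λ ⊕ Λ) ℂ :=
  fromBlocks 0 (crea a x) (anni a x) 0

theorem shiftC_eq (x : CSpace n) :
    shiftC a wt x = fromBlocks (parity wt * (1 - numOp a x)) 0 0 (parity wt * numOp a x) := by
  simp [shiftC, sub_eq_add_neg]

theorem shiftD_eq (x : CSpace n) :
    shiftD a wt x = fromBlocks (-(parity wt * numOp a x)) 0 0 (-(parity wt * (1 - numOp a x))) := by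
  simp only [shiftD, zero_smul, zero_add, neg_smul, one_smul, mul_neg, mul_add, mul_sub]
  congr 1
  abel

include ha

theorem IsFock.isSym2_crea :
    IsSym2 (dblA Λ) (dblB n wt) fun x _ : Sph (n + 1) =>
      fromBlocks 0 (crea a (x : CSpace n)) (anni a (x : CSpace n)) 0 where
  cont := by
    have hx : Continuous fun p : Sph (n + 1) × Sph (n + 1) => (p.1 : CSpace n) := by fun_prop
    exact continuous_const.matrix_fromBlocks (continuous_crea hx) (continuous_anni hx)
      continuous_const
  herm x y := by
    rw [IsHermitian, fromBlocks_conjTranspose, crea_conjTranspose, anni_conjTranspose,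
      conjTranspose_zero]
  equiv l μ x y i j := by
    rcases i with I | I <;> rcases j with J | J
    · rw [fromBlocks_apply₁₁, fromBlocks_apply₁₁, Matrix.zero_apply, mul_zero, mul_zero]
    · rw [fromBlocks_apply₁₂, fromBlocks_apply₁₂, rotS_coe, crea_smul, Matrix.smul_apply]
      change (l : ℂ) ^ 0 * (μ : ℂ) ^ (1 + (n + 1 - wt I)) * (l * crea a (x : CSpace n) I J) =
        (l : ℂ) ^ 1 * (μ : ℂ) ^ (n + 1 - wt J) * crea a (x : CSpace n) I J
      by_cases hne : crea a (x : CSpace n) I J = 0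
      · simp [hne]
      · have h1 := ha.crea_grade hne
        have h2 := ha.wt_le I
        rw [show n + 1 - wt J = 1 + (n + 1 - wt I) by omega]
        ring
    · rw [fromBlocks_apply₂₁, fromBlocks_apply₂₁, rotS_coe, anni_smul, Matrix.smul_apply]
      change (l : ℂ) ^ 1 * (μ : ℂ) ^ (n + 1 - wt I) * (star (l : ℂ) * anni a (x : CSpace n) I J) =
        (l : ℂ) ^ 0 * (μ : ℂ) ^ (1 + (n + 1 - wt J)) * anni a (x : CSpace n) I J
      by_cases hne : anni a (x : CSpace n) I J = 0
      · simp [hne]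
      · have h1 := ha.anni_grade hne
        have h2 := ha.wt_le J
        rw [show n + 1 - wt I = 1 + (n + 1 - wt J) by omega]
        linear_combination (μ : ℂ) ^ (1 + (n + 1 - wt J)) * anni a (x : CSpace n) I J *
          star_circle_mul l
    · rw [fromBlocks_apply₂₂, fromBlocks_apply₂₂, Matrix.zero_apply, mul_zero, mul_zero]

theorem IsFock.parity_numOp (x) : parity wt * numOp a x = numOp a x * parity wt := by
  rw [numOp, ← mul_assoc, ha.parity_crea, neg_mul, mul_assoc, ha.parity_anni, mul_neg, neg_neg,
    mul_assoc]

theorem IsFock.anni_mul_crea {x : CSpace n} (hx : ‖x‖ = 1) :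
    anni a x * crea a x = 1 - numOp a x := by
  rw [ha.anni_crea, inner_self_eq_norm_sq_to_K, hx]
  simp [numOp]

theorem IsFock.crea_mul_numOp (x : CSpace n) : crea a x * numOp a x = 0 := by
  rw [numOp, ← mul_assoc, ha.crea_sq, zero_mul]

theorem IsFock.numOp_mul_anni (x : CSpace n) : numOp a x * anni a x = 0 := by
  rw [numOp, mul_assoc, ha.anni_sq, mul_zero]

theorem IsFock.numOp_mul_crea {x : CSpace n} (hx : ‖x‖ = 1) :
    numOp a x * crea a x = crea a x := by
  rw [numOp, mul_assoc, ha.anni_mul_crea hx, mul_sub, ha.crea_mul_numOp, mul_one, sub_zero]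

theorem IsFock.anni_mul_numOp {x : CSpace n} (hx : ‖x‖ = 1) :
    anni a x * numOp a x = anni a x := by
  rw [numOp, ← mul_assoc, ha.anni_mul_crea hx, sub_mul, ha.numOp_mul_anni, one_mul, sub_zero]

theorem IsFock.numOp_sq {x : CSpace n} (hx : ‖x‖ = 1) : numOp a x * numOp a x = numOp a x := by
  nth_rw 2 [numOp]
  rw [← mul_assoc, ha.numOp_mul_crea hx, numOp]

theorem IsFock.isSym2_parity_numOp (r q : ℝ) : IsSym2 (fun _ => 0) (fun I => n + 1 - wt I)
    fun x _ : Sph (n + 1) => parity wt * (r • 1 + q • numOp a x) where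
  cont := by
    have hx : Continuous fun p : Sph (n + 1) × Sph (n + 1) => (p.1 : CSpace n) := by fun_prop
    exact continuous_const.mul (continuous_const.add
      (((continuous_crea hx).mul (continuous_anni hx)).const_smul q))
  herm x y := by
    have h1 : (r • 1 + q • numOp a (x : CSpace n)).IsHermitian :=
      (isHermitian_one.smul (IsSelfAdjoint.all r)).add
        ((numOp_isHermitian _).smul (IsSelfAdjoint.all q))
    rw [IsHermitian, conjTranspose_mul, h1.eq, parity_isHermitian.eq, add_mul, mul_add,
      smul_mul_assoc, smul_mul_assoc, mul_smul_comm, mul_smul_comm, ha.parity_numOp, one_mul,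
      mul_one]
  equiv l μ x y I J := by
    have h1 : numOp a (rotS l x : CSpace n) = numOp a x := by
      rw [rotS_coe, numOp, crea_mul_anni_circle, numOp]
    simp only [h1, pow_zero, one_mul]
    by_cases h : wt I = wt J
    · rw [h]
    · have h2 : numOp a (x : CSpace n) I J = 0 := by
        have := ha.refl1_wt (x : CSpace n) h
        rw [refl1, Matrix.sub_apply, one_apply_ne (fun e => h (congrArg wt e)), zero_sub,
          neg_eq_zero, Matrix.smul_apply] at this
        exact (smul_eq_zero_iff_right two_ne_zero).mp this
      rw [parity, diagonal_mul, Matrix.add_apply, Matrix.smul_apply, Matrix.smul_apply, h2,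
        one_apply_ne (fun e => h (congrArg wt e))]
      simp

theorem IsFock.parity_numOp_mul (x : CSpace n) (X : Matrix Λ Λ ℂ) :
    parity wt * numOp a x * (parity wt * X) = numOp a x * X := by
  rw [ha.parity_numOp, mul_assoc, ← mul_assoc (parity wt), parity_sq, one_mul]

theorem IsFock.parity_one_sub_numOp_mul (x : CSpace n) (X : Matrix Λ Λ ℂ) :
    parity wt * (1 - numOp a x) * (parity wt * X) = (1 - numOp a x) * X := by
  rw [mul_sub, mul_one, sub_mul, ha.parity_numOp_mul, ← mul_assoc, parity_sq, one_mul, sub_mul,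
    one_mul]

theorem IsFock.crea_parity (x : CSpace n) : crea a x * parity wt = -(parity wt * crea a x) := by
  rw [ha.parity_crea, neg_neg]

theorem IsFock.anni_parity (x : CSpace n) : anni a x * parity wt = -(parity wt * anni a x) := by
  rw [ha.parity_anni, neg_neg]

section Unit

variable {x : CSpace n} (hx : ‖x‖ = 1)

include hx

theorem IsFock.shiftC_mul_shiftD : shiftC a wt x * shiftD a wt x = 0 := by
  rw [shiftC_eq, shiftD_eq, fromBlocks_multiply]
  simp only [mul_neg, ha.parity_numOp_mul, ha.parity_one_sub_numOp_mul, mul_zero, zero_mul,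
    add_zero, zero_add, neg_zero]
  simp only [sub_mul, mul_sub, ha.numOp_sq hx, one_mul, mul_one, sub_self, neg_zero,
    fromBlocks_zero]

theorem IsFock.shiftD_mul_shiftC : shiftD a wt x * shiftC a wt x = 0 := by
  rw [shiftC_eq, shiftD_eq, fromBlocks_multiply]
  simp only [neg_mul, ha.parity_numOp_mul, ha.parity_one_sub_numOp_mul, mul_zero, zero_mul,
    add_zero, zero_add, neg_zero]
  simp only [sub_mul, mul_sub, ha.numOp_sq hx, one_mul, mul_one, sub_self, neg_zero,
    fromBlocks_zero]

theorem IsFock.shiftC_mul_shiftB : shiftC a wt x * shiftB a x = 0 := by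
  rw [shiftC_eq, shiftB, fromBlocks_multiply]
  simp only [mul_assoc, mul_zero, zero_mul, add_zero, zero_add, sub_mul, ha.numOp_mul_crea hx,
    ha.numOp_mul_anni, one_mul, sub_self, fromBlocks_zero]

theorem IsFock.shiftB_mul_shiftC : shiftB a x * shiftC a wt x = 0 := by
  rw [shiftC_eq, shiftB, fromBlocks_multiply]
  simp only [← mul_assoc, ha.crea_parity, ha.anni_parity, neg_mul]
  simp only [mul_assoc, mul_zero, zero_mul, add_zero, zero_add, mul_sub, ha.crea_mul_numOp,
    ha.anni_mul_numOp hx, mul_one, sub_self, neg_zero, fromBlocks_zero]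

theorem IsFock.shiftD_mul_shiftB : shiftD a wt x * shiftB a x = -(shiftB a x * shiftD a wt x) := by
  rw [shiftD_eq, shiftB, fromBlocks_multiply, fromBlocks_multiply, fromBlocks_neg]
  simp only [mul_neg, ← mul_assoc, ha.crea_parity, ha.anni_parity, neg_mul]
  simp only [mul_assoc, mul_zero, zero_mul, add_zero, zero_add, mul_sub, sub_mul,
    ha.crea_mul_numOp, ha.anni_mul_numOp hx, ha.numOp_mul_crea hx, ha.numOp_mul_anni, mul_one,
    one_mul, sub_zero, neg_zero, neg_neg]

theorem IsFock.shiftC_add_shiftD_sq :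
    (shiftC a wt x + shiftD a wt x) * (shiftC a wt x + shiftD a wt x) = 1 := by
  rw [mul_add, add_mul, add_mul, ha.shiftC_mul_shiftD hx, ha.shiftD_mul_shiftC hx, shiftC_eq,
    shiftD_eq, fromBlocks_multiply, fromBlocks_multiply]
  simp only [neg_mul_neg, ha.parity_numOp_mul, ha.parity_one_sub_numOp_mul, mul_zero, zero_mul,
    add_zero, zero_add, fromBlocks_add]
  simp only [ha.numOp_sq hx, sub_mul, mul_sub, one_mul, mul_one, sub_self, sub_zero]
  rw [← fromBlocks_one]
  congr 1 <;> abel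

theorem IsFock.shiftC_sub_shiftD_sq :
    (shiftC a wt x + -shiftD a wt x) * (shiftC a wt x + -shiftD a wt x) = 1 := by
  rw [← ha.shiftC_add_shiftD_sq hx, mul_add, add_mul, add_mul, mul_add, add_mul, add_mul, mul_neg,
    neg_mul, neg_mul_neg, ha.shiftC_mul_shiftD hx, ha.shiftD_mul_shiftC hx, neg_zero]

theorem IsFock.shiftC_add_shiftB_sq :
    (shiftC a wt x + shiftB a x) * (shiftC a wt x + shiftB a x) = 1 := by
  rw [mul_add, add_mul, add_mul, ha.shiftC_mul_shiftB hx, ha.shiftB_mul_shiftC hx, shiftC_eq,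
    shiftB, fromBlocks_multiply, fromBlocks_multiply, ha.anni_mul_crea hx, ← numOp]
  simp only [ha.parity_numOp_mul, ha.parity_one_sub_numOp_mul, mul_zero, zero_mul, add_zero,
    zero_add, fromBlocks_add]
  simp only [ha.numOp_sq hx, sub_mul, mul_sub, one_mul, mul_one, sub_self, sub_zero]
  rw [← fromBlocks_one]
  congr 1 <;> abel

end Unit

theorem IsFock.shiftC_add_shiftD (x : CSpace n) :
    shiftC a wt x + shiftD a wt x = fromBlocks (omega a wt x) 0 0 (-(omega a wt x)) := by
  rw [shiftC_eq, shiftD_eq, fromBlocks_add, add_zero, omega, ← ha.parity_refl1, refl1, ← numOp]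
  congr 1
  · noncomm_ring
  · noncomm_ring

theorem IsFock.eventually_sgOmega_add : ∀ᶠ M in atTop, ∀ m ≥ M, ∀ u ≥ M,
    sg (dblA Λ) (dblB n wt)
      (fun x _ : Sph (n + 1) => fromBlocks (omega a wt x) 0 0 (-(omega a wt x))) m u =
    sg (dblA Λ) (dblB n wt) (fun x _ : Sph (n + 1) =>
      fromBlocks (parity wt * ((1 : ℝ) • 1 + (0 : ℝ) • numOp a x)) 0 0
        (parity wt * ((1 : ℝ) • 1 + (0 : ℝ) • numOp a x))) m u := by
  have sC : IsSym2 (dblA Λ) (dblB n wt) fun x _ : Sph (n + 1) => shiftC a wt x :=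
    (ha.isSym2_parity_numOp _ _).fromBlocks_diag (ha.isSym2_parity_numOp _ _)
  have sD : IsSym2 (dblA Λ) (dblB n wt) fun x _ : Sph (n + 1) => shiftD a wt x :=
    (ha.isSym2_parity_numOp _ _).fromBlocks_diag (ha.isSym2_parity_numOp _ _)
  have sB : IsSym2 (dblA Λ) (dblB n wt) fun x _ : Sph (n + 1) => shiftB a (x : CSpace n) :=
    ha.isSym2_crea
  have sD' : IsSym2 (dblA Λ) (dblB n wt) fun x _ : Sph (n + 1) => -shiftD a wt x := by
    simpa using sD.smul (-1)
  have F1 : (fun (x : Sph (n + 1)) (_ : Sph (n + 1)) => shiftC a wt x + shiftD a wt x) = fun x _ : Sph (n + 1) =>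
      fromBlocks (omega a wt x) 0 0 (-(omega a wt x)) := by
    funext x y
    exact ha.shiftC_add_shiftD x
  have F2 : (fun (x : Sph (n + 1)) (_ : Sph (n + 1)) => shiftC a wt x + -shiftD a wt x) = fun x _ : Sph (n + 1) =>
      fromBlocks (parity wt * ((1 : ℝ) • 1 + (0 : ℝ) • numOp a x)) 0 0
        (parity wt * ((1 : ℝ) • 1 + (0 : ℝ) • numOp a x)) := by
    funext x y
    rw [shiftC_eq, shiftD_eq, fromBlocks_neg, fromBlocks_add, neg_zero, add_zero]
    simp only [one_smul, zero_smul, add_zero]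
    congr 1
    · noncomm_ring
    · noncomm_ring
  have CD : ∀ x : Sph (n + 1), shiftC a wt x * shiftD a wt x = -(shiftD a wt x * shiftC a wt x) :=
    fun x => by
      rw [ha.shiftC_mul_shiftD (norm_sph x), ha.shiftD_mul_shiftC (norm_sph x), neg_zero]
  have CB : ∀ x : Sph (n + 1), shiftC a wt x * shiftB a x = -(shiftB a x * shiftC a wt x) :=
    fun x => by
      rw [ha.shiftC_mul_shiftB (norm_sph x), ha.shiftB_mul_shiftC (norm_sph x), neg_zero]
  have DB : ∀ x : Sph (n + 1), shiftD a wt x * shiftB a x = -(shiftB a x * shiftD a wt x) :=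
    fun x => ha.shiftD_mul_shiftB (norm_sph x)
  have g2 : Gapped fun x _ : Sph (n + 1) => shiftC a wt x + shiftB a (x : CSpace n) :=
    gapped_of_sq fun x _ => ha.shiftC_add_shiftB_sq (norm_sph x)
  have H1 := sg_eq_of_anticomm n.succ_pos sC sD sB (fun x _ => CD x) (fun x _ => CB x)
    (fun x _ => DB x) (gapped_of_sq fun x _ => ha.shiftC_add_shiftD_sq (norm_sph x)) g2
  have H2 := sg_eq_of_anticomm n.succ_pos sC sD' sB
    (fun x _ => by rw [mul_neg, neg_mul, CD x])
    (fun x _ => CB x) (fun x _ => by rw [neg_mul, mul_neg, DB x])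
    (gapped_of_sq fun x _ => ha.shiftC_sub_shiftD_sq (norm_sph x)) g2
  rw [F1] at H1
  rw [F2] at H2
  filter_upwards [H1, H2] with M h1 h2 m hm u hu
  rw [h1 m hm u hu, h2 m hm u hu]

theorem IsFock.sgOmega_succ :
    ∀ᶠ M in atTop, ∀ m ≥ M, ∀ u ≥ M, sgOmega a wt (m + 1) (u + 1) = sgOmega a wt m u := by
  have hF := ha.isSym2_cFock (g := fun _ y => y) (by fun_prop) fun _ _ _ _ => rfl
  have hP := ha.isSym2_parity_numOp 1 0
  have H3 := sg_eq_of_anticomm' n.succ_pos hP hF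
    (fun x y => by
      simp only [one_smul, zero_smul, add_zero, mul_one]
      exact ha.parity_cFock _)
    (gapped_of_sq fun x y => by
      simp only [one_smul, zero_smul, add_zero, mul_one]
      exact parity_sq) ha.gapped_cFock
  filter_upwards [ha.eventually_sgOmega_add, H3] with M h1 h3 m hm u hu
  have e2 : sg (fun _ => 0) (fun I => n + 1 - wt I) (fun x _ : Sph (n + 1) => -omega a wt x) m u =
      -sgOmega a wt m u :=
    sg_neg (F := fun x _ : Sph (n + 1) => omega a wt x) (fun x _ => ha.omega_isHermitian x) m u
  have e3 := h3 (m + 1) (hm.trans m.le_succ) (u + 1) (hu.trans u.le_succ)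
  have e4 := h3 m hm u hu
  rw [ha.sg_cFock (g := fun _ y => y)] at e3 e4
  have e1 := h1 m hm u hu
  rw [sg_fromBlocks, sg_fromBlocks, e2, e3, e4, add_zero, ← sub_eq_add_neg] at e1
  exact sub_eq_zero.mp e1

/-- Homogeneous component of `omega`. -/
noncomputable def omegaBlock (a : Fin (n + 1) → Matrix Λ Λ ℂ) (wt : Λ → ℕ)
    (e : Λ → Fin (n + 2)) (k : Fin (n + 2)) (x : CSpace n) :
    Matrix {I // e I = k} {I // e I = k} ℂ :=
  (omega a wt x).submatrix Subtype.val Subtype.val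

theorem IsFock.exists_sgOmega_eq : ∃ r : ℕ → ℕ → ℤ, ∀ m u, sgOmega a wt m u =
    (m + n).choose n * (u + (n + 1) + n).choose n +
    ∑ k ∈ Finset.Ico 1 (n + 1), r k m * (u + (n + 1 - k) + n).choose n -
    (-1) ^ (n + 1) * (m + n).choose n * (u + n).choose n := by
  let e : Λ → Fin (n + 2) := fun I => ⟨wt I, by have := ha.wt_le I; omega⟩
  have he : ∀ k (I : {I // e I = k}), wt I = k := fun k I => congrArg Fin.val I.2
  have hcard : ∀ k : Fin (n + 2), Fintype.card {I // e I = k} = (n + 1).choose k := fun k => by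
    rw [← ha.card]
    exact Fintype.card_congr (Equiv.subtypeEquivRight fun I => Fin.ext_iff)
  have hsum : ∀ m u, sgOmega a wt m u = ∑ k : Fin (n + 2), sg (d := n + 1) (fun _ => 0)
      (fun _ => n + 1 - (k : ℕ)) (fun x _ => omegaBlock a wt e k x) m u := fun m u =>
    sg_blocks (Equiv.sigmaFiberEquiv e) (m' := fun _ => m) (u' := fun _ => u) (fun _ _ => rfl)
      (fun k I => by
        change u + (n + 1 - k) = u + (n + 1 - wt I)
        rw [he]) (fun _ _ _ _ _ => rfl)
      fun x y k l I J hkl => by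
        change omega a wt x I J = 0
        rw [omega, parity, mul_diagonal, ha.refl1_wt _ (fun h => hkl (Fin.ext ?_)), zero_mul]
        rw [← he k I, h, he l J]
  choose ρ hρ using fun (k : Fin (n + 2)) (m : ℕ) => sg_tensor n.succ_pos (a := fun _ => 0)
    (b := fun _ : {I // e I = k} => n + 1 - (k : ℕ)) (fun _ => rfl)
    (fun x : Sph (n + 1) => omegaBlock a wt e k x) m
  have h0 : ∀ x : Sph (n + 1), omegaBlock a wt e 0 x = diagonal fun _ => ((1 : ℤ) : ℂ) := fun x => by
    ext I J
    have h1 : (crea a (x : CSpace n) * anni a x) I J = 0 := by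
      rw [mul_apply]
      refine Finset.sum_eq_zero fun K _ => ?_
      by_contra hne
      have := ha.crea_grade (left_ne_zero_of_mul hne)
      have := he 0 I
      simp at this
      omega
    rw [omegaBlock, submatrix_apply, omega, parity, mul_diagonal, he, refl1, Matrix.sub_apply,
      Matrix.smul_apply, h1, smul_zero, sub_zero, one_apply, diagonal_apply]
    simp [Subtype.ext_iff]
  have hl : ∀ x : Sph (n + 1), omegaBlock a wt e (Fin.last (n + 1)) x =
      diagonal fun _ => ((-(-1) ^ (n + 1) : ℤ) : ℂ) := fun x => by
    ext I J
    have h1 : (anni a (x : CSpace n) * crea a x) I J = 0 := by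
      rw [mul_apply]
      refine Finset.sum_eq_zero fun K _ => ?_
      by_contra hne
      have := ha.crea_grade (right_ne_zero_of_mul hne)
      have := he _ J
      have := ha.wt_le K
      simp at *
      omega
    rw [omegaBlock, submatrix_apply, omega, parity, mul_diagonal, he, refl1, ← numOp,
      show numOp a (x : CSpace n) = 1 - anni a x * crea a x by
        rw [ha.anni_mul_crea (norm_sph x), sub_sub_cancel], Matrix.sub_apply,
      Matrix.smul_apply, Matrix.sub_apply, h1, sub_zero, one_apply, diagonal_apply]
    by_cases h : I = J
    · simp [h]
      ring
    · simp [h, Subtype.ext_iff.not.1 h]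
  have hε : (-(-1) ^ (n + 1) : ℤ) = 1 ∨ (-(-1) ^ (n + 1) : ℤ) = -1 := by
    rcases neg_one_pow_eq_or ℤ (n + 1) with h | h <;> simp [h]
  have hlast : ∀ m u, sg (d := n + 1) (fun _ => 0) (fun _ => n + 1 - (Fin.last (n + 1) : ℕ))
      (fun x _ : Sph (n + 1) => omegaBlock a wt e (Fin.last (n + 1)) x) m u =
      -((-1) ^ (n + 1) * (m + n).choose n * (u + n).choose n) := fun m u => by
    simp only [hl]
    rw [sg_smul_one n.succ_pos _ hε]
    simp [hcard, card_degIdx]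
    ring
  refine ⟨fun k m => ρ (Fin.ofNat (n + 2) k) m, fun m u => ?_⟩
  rw [hsum, Fin.sum_univ_succ, Fin.sum_univ_castSucc, Finset.sum_Ico_eq_sum_range,
    Nat.add_sub_cancel, Finset.sum_range, sub_eq_add_neg]
  refine (add_assoc _ _ _).symm.trans ?_
  congr 2
  · simp only [h0]
    rw [sg_smul_one n.succ_pos 1 (Or.inl rfl)]
    simp [hcard, card_degIdx]
  · refine Finset.sum_congr rfl fun k _ => ?_
    change _ = ρ (Fin.ofNat (n + 2) (1 + k)) m * _
    have hk : Fin.ofNat (n + 2) (1 + k) = k.castSucc.succ := Fin.ext (by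
      simp [Fin.ofNat, add_comm]
      omega)
    rw [hρ, card_degIdx, hk, Fin.val_succ, Fin.val_castSucc, add_comm 1]
  · exact hlast m u

end ShiftInvariance

section Symmetrization

variable {n : ℕ} {κ : Type*} [Fintype κ] [DecidableEq κ]

theorem IsSym2.swap {d : ℕ} {F : Sph d → Sph d → Matrix κ κ ℂ}
    (hF : IsSym2 (fun _ => 0) (fun _ => 0) F) :
    IsSym2 (fun _ => 0) (fun _ => 0) fun x y => F y x where
  cont := hF.cont.comp continuous_swap
  herm x y := hF.herm y x
  equiv l μ x y i j := by simpa using hF.equiv μ l y x i j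

variable {P : Type*} [NormedAddCommGroup P] [InnerProductSpace ℝ P] [FiniteDimensional ℝ P]
  {c : P →ₗ[ℝ] Matrix κ κ ℂ} (hc : IsCliffMap c) {f : CSpace n → P} (hf : IsPhaseMap f)

/-- The homotopy from `baseSym` to a symbol that is symmetric under exchange of the variables. -/
noncomputable def swapSym (c : P →ₗ[ℝ] Matrix κ κ ℂ) (f : CSpace n → P) (r t : ℝ)
    (x y : CSpace n) : Matrix κ κ ℂ :=
  (1 - t / 2) • baseSym c f r x y + (t / 2) • baseSym c f (-r) y x

theorem swapSym_eq (r t : ℝ) (x y : CSpace n) : swapSym c f r t x y = r • c (f x - f y) +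
    ((1 - t / 2) • wHerm x (c ∘ₗ (fderiv ℝ f y : CSpace n →ₗ[ℝ] P)) +
      (t / 2) • wHerm y (c ∘ₗ (fderiv ℝ f x : CSpace n →ₗ[ℝ] P))) := by
  rw [swapSym, baseSym, baseSym, ← neg_sub (f x) (f y), map_neg]
  module

include hf in
theorem IsPhaseMap.wHerm_swap {x y : CSpace n} (hx : ‖x‖ = 1) (hy : ‖y‖ = 1)
    (h : perpC x y = 0) : wHerm y (c ∘ₗ (fderiv ℝ f x : CSpace n →ₗ[ℝ] P)) =
      wHerm x (c ∘ₗ (fderiv ℝ f y : CSpace n →ₗ[ℝ] P)) := by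
  have hy1 := perpC_eq_zero h
  have hl : ‖(inner ℂ x y : ℂ)‖ = 1 := by
    have := congrArg norm hy1
    rw [norm_smul, hx, hy, mul_one] at this
    exact this.symm
  let l : Circle := ⟨inner ℂ x y, mem_sphere_zero_iff_norm.mpr hl⟩
  have hy2 : y = (l : ℂ) • x := hy1
  clear_value l
  subst hy2
  rw [wHerm, wHerm, wVal_map hx l l⁻¹ (RingHom.id _) _ _ fun u _ => ?_]
  · rfl
  · have hx0 : x ≠ 0 := norm_ne_zero_iff.mp (by rw [hx]; exact one_ne_zero)
    have h1 := hf.fderiv_smul (l : ℂ) (circle_ne_zero l) hx0 ((l⁻¹ : Circle) • u)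
    rw [Circle.smul_def, smul_smul, ← Circle.coe_mul, mul_inv_cancel, Circle.coe_one, one_smul] at h1
    rw [LinearMap.comp_apply, LinearMap.comp_apply, ContinuousLinearMap.coe_coe,
      ContinuousLinearMap.coe_coe, h1]
    rfl

include hc hf

theorem isSym2_swapSym (r t : ℝ) :
    IsSym2 (fun _ => 0) (fun _ => 0) fun x y : Sph (n + 1) => swapSym c f r t x y :=
  ((isSym2_baseSym hc hf r).smul _).add ((isSym2_baseSym hc hf (-r)).swap.smul _)

theorem continuous_swapSym (r : ℝ) : Continuous fun p : SphPath n =>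
    swapSym c f r p.1 p.2.1 p.2.2 := by
  have h1 := (continuous_baseSym hc hf r).comp (continuous_snd (X := ℝ))
  have h2 := ((continuous_baseSym hc hf (-r)).comp continuous_swap).comp (continuous_snd (X := ℝ))
  exact ((by fun_prop : Continuous fun p : SphPath n => 1 - p.1 / 2).smul h1).add
    ((by fun_prop : Continuous fun p : SphPath n => p.1 / 2).smul h2)

theorem eventually_gapped_swapSym : ∀ᶠ r in atTop, ∀ t ∈ Set.Icc (0 : ℝ) 1,
    Gapped fun x y : Sph (n + 1) => swapSym c f r t x y := by
  have hx : Continuous fun p : SphPath n => (p.2.1 : CSpace n) := by fun_prop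
  have hy : Continuous fun p : SphPath n => (p.2.2 : CSpace n) := by fun_prop
  have hx0 : ∀ p : SphPath n, (p.2.1 : CSpace n) ≠ 0 := fun p => sph_ne_zero _
  have hy0 : ∀ p : SphPath n, (p.2.2 : CSpace n) ≠ 0 := fun p => sph_ne_zero _
  have hfx := hf.continuous_comp hx hx0
  have hfy := hf.continuous_comp hy hy0
  have hLx : Continuous fun z : SphPath n × CSpace n => (fderiv ℝ f z.1.2.1 : CSpace n →ₗ[ℝ] P) z.2 :=
    ((hf.continuous_fderiv_comp hx hx0).comp continuous_fst).clm_apply continuous_snd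
  have hLy : Continuous fun z : SphPath n × CSpace n => (fderiv ℝ f z.1.2.2 : CSpace n →ₗ[ℝ] P) z.2 :=
    ((hf.continuous_fderiv_comp hy hy0).comp continuous_fst).clm_apply continuous_snd
  have hWxy := continuous_mulE (continuous_wHerm c hx
    (L := fun p : SphPath n => (fderiv ℝ f p.2.2 : CSpace n →ₗ[ℝ] P)) hLy)
  have hWyx := continuous_mulE (continuous_wHerm c hy
    (L := fun p : SphPath n => (fderiv ℝ f p.2.1 : CSpace n →ₗ[ℝ] P)) hLx)
  have h := eventually_smul_add_ne_zero
    ((isCompact_Icc (a := (0 : ℝ)) (b := 1)).prod (isCompact_univ (X := Sph (n + 1) × Sph (n + 1))))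
    (C := fun p : SphPath n => mulE (c (f p.2.1 - f p.2.2)))
    (W := fun (p : SphPath n) v =>
      (1 - p.1 / 2) • mulE (wHerm (p.2.1 : CSpace n) (c ∘ₗ (fderiv ℝ f p.2.2 : CSpace n →ₗ[ℝ] P))) v +
      (p.1 / 2) • mulE (wHerm (p.2.2 : CSpace n) (c ∘ₗ (fderiv ℝ f p.2.1 : CSpace n →ₗ[ℝ] P))) v)
    (ρ := fun p => ‖f p.2.1 - f p.2.2‖)
    (((by fun_prop : Continuous fun z : SphPath n × EuclideanSpace ℂ κ => 1 - z.1.1 / 2).smul hWxy).add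
      ((by fun_prop : Continuous fun z : SphPath n × EuclideanSpace ℂ κ => z.1.1 / 2).smul hWyx))
    (hfx.sub hfy).norm
    (fun p v hv => by rw [hc.norm_mulE, hv, mul_one]) ?_ ?_
  · filter_upwards [h] with r h t ht x y
    refine mulVec_eq_zero_of_mulE_ne_zero fun v hv => ?_
    change mulE (swapSym c f r t x y) v ≠ 0
    rw [swapSym_eq, mulE_add, mulE_smul, mulE_add, mulE_smul, mulE_smul]
    exact h (t, x, y) ⟨ht, trivial⟩ v hv
  · rintro ⟨t, x, y⟩ - hp v hv
    have h0 := (hf.parallel_iff (norm_sph x) (sph_ne_zero y)).mp (sub_eq_zero.mp (norm_eq_zero.mp hp))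
    simp only [hf.wHerm_swap (c := c) (norm_sph x) (norm_sph y) h0]
    rw [← add_smul, sub_add_cancel, one_smul]
    exact wHerm_mulE_ne_zero hc (norm_sph x) _
      (fun u hu hfu => hf.eq_zero_of_fderiv (norm_sph _) (sph_ne_zero y) h0 hu hfu)
      (norm_ne_zero_iff.mp (by rw [hv]; exact one_ne_zero))
  · rintro ⟨t, x, y⟩ ⟨ht, -⟩ hp v hv ε hε
    have hp := sub_eq_zero.mp (norm_eq_zero.mp hp)
    have h0 := (hf.parallel_iff (norm_sph x) (sph_ne_zero y)).mp hp
    have h0' := (hf.parallel_iff (norm_sph y) (sph_ne_zero x)).mp hp.symm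
    have e1 := eventually_abs_re_inner_le hc hx (fun p => norm_sph _)
      (L := fun p : SphPath n => (fderiv ℝ f p.2.2 : CSpace n →ₗ[ℝ] P)) hLy (p₀ := (t, x, y))
      (fun u hu hfu => hf.eq_zero_of_fderiv (norm_sph x) (sph_ne_zero y) h0 hu hfu)
      (δ := fun p => f p.2.1 - f p.2.2) (η := fun p => perpC (p.2.1 : CSpace n) p.2.2)
      (fun p => inner_perpC (norm_sph _) _) (hf.isLittleO hx hy hy0 h0) v (ε := ε / 3) (by positivity)
    have e2 := eventually_abs_re_inner_le hc hy (fun p => norm_sph _)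
      (L := fun p : SphPath n => (fderiv ℝ f p.2.1 : CSpace n →ₗ[ℝ] P)) hLx (p₀ := (t, x, y))
      (fun u hu hfu => hf.eq_zero_of_fderiv (norm_sph y) (sph_ne_zero x) h0' hu hfu)
      (δ := fun p => f p.2.2 - f p.2.1) (η := fun p => perpC (p.2.2 : CSpace n) p.2.1)
      (fun p => inner_perpC (norm_sph _) _) (hf.isLittleO hy hx hx0 h0') v (ε := ε / 3) (by positivity)
    have e3 : ∀ᶠ z : SphPath n × EuclideanSpace ℂ κ in 𝓝 ((t, x, y), v), z.1.1 ∈ Set.Ioo (-1 : ℝ) 2 :=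
      (by fun_prop : Continuous fun z : SphPath n × EuclideanSpace ℂ κ => z.1.1).continuousAt.eventually
        (Ioo_mem_nhds (neg_one_lt_zero.trans_le ht.1) (ht.2.trans_lt one_lt_two))
    filter_upwards [e1, e2, e3] with z h1 h2 h3 hz
    have h1 := abs_le.mp (h1 hz)
    have h2 := abs_le.mp (h2 hz)
    have e4 : ∀ (M : Matrix κ κ ℂ), mulE (-M) z.2 = -mulE M z.2 := fun M => by
      rw [← neg_one_smul ℝ, mulE_smul, neg_one_smul]
    rw [norm_sub_rev, ← neg_sub (f z.1.2.1) (f z.1.2.2), map_neg, e4, inner_neg_left, Complex.neg_re] at h2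
    have h4 : 0 ≤ ε / 3 * ‖f z.1.2.1 - f z.1.2.2‖ := by positivity
    rw [inner_add_right, ← Complex.coe_smul (1 - z.1.1 / 2), ← Complex.coe_smul (z.1.1 / 2),
      inner_smul_right, inner_smul_right, Complex.add_re, Complex.re_ofReal_mul,
      Complex.re_ofReal_mul, show ε * ‖f z.1.2.1 - f z.1.2.2‖ =
        3 * (ε / 3 * ‖f z.1.2.1 - f z.1.2.2‖) by ring]
    generalize (inner ℂ (mulE (c (f z.1.2.1 - f z.1.2.2)) z.2) (mulE (wHerm (z.1.2.1 : CSpace n)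
      (c ∘ₗ (fderiv ℝ f z.1.2.2 : CSpace n →ₗ[ℝ] P))) z.2)).re = A at h1 ⊢
    generalize (inner ℂ (mulE (c (f z.1.2.1 - f z.1.2.2)) z.2) (mulE (wHerm (z.1.2.2 : CSpace n)
      (c ∘ₗ (fderiv ℝ f z.1.2.1 : CSpace n →ₗ[ℝ] P))) z.2)).re = B at h2 ⊢
    generalize ε / 3 * ‖f z.1.2.1 - f z.1.2.2‖ = E at *
    refine (abs_add_le _ _).trans ?_
    rw [abs_mul, abs_mul]
    have a1 : |A| ≤ E := abs_le.mpr h1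
    have a2 : |B| ≤ E := abs_le.mpr ⟨by linarith, by linarith⟩
    have a3 : |1 - z.1.1 / 2| ≤ 3 / 2 := abs_le.mpr ⟨by linarith [h3.2], by linarith [h3.1]⟩
    have a4 : |z.1.1 / 2| ≤ 1 := abs_le.mpr ⟨by linarith [h3.1], by linarith [h3.2]⟩
    nlinarith [mul_le_mul a3 a1 (abs_nonneg A) (by norm_num), mul_le_mul a4 a2 (abs_nonneg B) (by norm_num)]

omit [FiniteDimensional ℝ P] hc hf in
theorem conj_baseSym (hn : Even n) {V : Matrix κ κ ℂ} (hVV : V * V.map star = -1)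
    (hV : ∀ w, V * (c w).map star = -(c w * V)) (r : ℝ) {x : CSpace n} (hx : ‖x‖ = 1) (y) :
    V * (baseSym c f r x y).map star = baseSym c f (-r) x y * V := by
  have hVV' : -V.map star * V = 1 := mul_eq_one_comm.mp (by rw [mul_neg, hVV, neg_neg])
  let φ : Matrix κ κ ℂ →+* Matrix κ κ ℂ :=
    { toFun := fun X => V * X.map star * -V.map star
      map_one' := by rw [map_star_one, mul_one, mul_neg, hVV, neg_neg]
      map_zero' := by ext i j; simp
      map_add' := fun X Y => by
        rw [Matrix.map_add _ (fun a b => star_add a b), mul_add, add_mul]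
      map_mul' := fun X Y => by
        calc V * (X * Y).map star * -V.map star
            = V * X.map star * (-V.map star * V) * Y.map star * -V.map star := by
              have h : (X * Y).map star = X.map star * Y.map star :=
                Matrix.map_mul (L := X) (M := Y) (f := starRingEnd ℂ)
              rw [hVV', mul_one, h, ← mul_assoc V]
          _ = _ := by noncomm_ring }
  have hφ : ∀ X, φ X * V = V * X.map star := fun X => by
    change V * X.map star * -V.map star * V = _
    rw [mul_assoc, hVV', mul_one]
  have key := wVal_map hx 1 1 φ (c ∘ₗ (fderiv ℝ f y : CSpace n →ₗ[ℝ] P))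
    (-(c ∘ₗ (fderiv ℝ f y : CSpace n →ₗ[ℝ] P))) fun u _ => by
      rw [Circle.coe_one, one_smul, LinearMap.neg_apply]
      change -c (fderiv ℝ f y u) = V * (c (fderiv ℝ f y u)).map star * -V.map star
      rw [hV, neg_mul_neg, mul_assoc, hVV, mul_neg, mul_one]
  rw [Circle.coe_one, one_smul, wVal_neg hx] at key
  have h1 : ∀ X Y : Matrix κ κ ℂ, (X + Y).map star = X.map star + Y.map star := fun X Y => by
    ext; simp
  have h2 : ∀ (s : ℝ) (X : Matrix κ κ ℂ), (s • X).map star = s • X.map star := fun s X => by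
    ext; simp
  have h3 : ∀ X : Matrix κ κ ℂ, (Complex.I ^ n • X).map star = Complex.I ^ n • X.map star := fun X => by
    ext i j
    simp [hn.neg_pow]
  rw [baseSym, baseSym, wHerm, h1, h2, h3, mul_add, mul_smul_comm, mul_smul_comm, hV, add_mul,
    ← hφ, ← key, smul_mul_assoc, smul_mul_assoc, neg_smul, smul_neg]

theorem eventually_four_dvd_sg_baseSym (hn : Even n) (hκ : 4 ∣ Fintype.card κ) {V : Matrix κ κ ℂ}
    (hVV : V * V.map star = -1) (hV : ∀ w, V * (c w).map star = -(c w * V)) :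
    ∀ᶠ r in atTop, ∀ᶠ M in atTop, ∀ m ≥ M, (4 : ℤ) ∣ sg (d := n + 1) (fun _ => 0) (fun _ => 0)
      (fun x y => baseSym c f r x y) m m := by
  filter_upwards [eventually_gapped_swapSym hc hf] with r hr
  have h1 := sg_homotopy n.succ_pos (fun t x y => swapSym c f r t x y) (continuous_swapSym hc hf r)
    (isSym2_swapSym hc hf r) hr
  have h2 := four_dvd_sg n.succ_pos (isSym2_swapSym hc hf r 1) (hr 1 (by simp)) hκ V hVV fun x y => by
    have h2 : ∀ (X Y : Matrix κ κ ℂ), ((1 - 1 / 2 : ℝ) • X + (1 / 2 : ℝ) • Y).map star =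
        (1 / 2 : ℝ) • X.map star + (1 / 2 : ℝ) • Y.map star := fun X Y => by
      ext
      simp [map_ofNat]
      ring_nf
      simp
    rw [swapSym, h2, mul_add, mul_smul_comm, mul_smul_comm, conj_baseSym hn hVV hV _ (norm_sph y),
      conj_baseSym hn hVV hV _ (norm_sph x), neg_neg, swapSym, add_mul, smul_mul_assoc, smul_mul_assoc,
      add_comm]
    norm_num
  filter_upwards [h1, h2] with M h1 h2 m hm
  have e : (fun x y : Sph (n + 1) => baseSym c f r x y) = fun x y : Sph (n + 1) => swapSym c f r 0 x y := by
    funext x y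
    simp [swapSym]
  rw [e, h1 m hm m hm]
  exact h2 m hm

end Symmetrization

section LowerBound

theorem PhaseRetrievableC.false_of_isCliff {n N k : ℕ} {A : Fin N → Matrix (Fin (n + 1)) (Fin (n + 1)) ℂ}
    (hA : ∀ j, (A j).IsHermitian) (hPR : PhaseRetrievableC A) (hN : 2 * (n + 1) < N) (hk : 2 ≤ k)
    {κ : Type} [Fintype κ] [DecidableEq κ] {γ : Fin N → Matrix κ κ ℂ} (hγ : IsCliff γ)
    (hκ : Fintype.card κ = 2 ^ k) (h : k + (Nat.digits 2 n).sum = 2 * n ∨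
      k + (Nat.digits 2 n).sum = 2 * n + 1 ∧ Even n ∧ ∃ U, IsCliffJ γ U (-1)) : False := by
  obtain ⟨p, hp, f, hf⟩ := exists_isPhaseMap hA hPR hN
  obtain ⟨Λ, _, _, a, wt, ha⟩ := exists_isFock (n + 1)
  have hc := hγ.isCliffMap.comp_subtype (ℝ ∙ p)ᗮ
  set c := cliffMap γ ∘ₗ (ℝ ∙ p)ᗮ.subtype with hc_def
  have hΓ2 : cliffMap γ p * cliffMap γ p = 1 := by
    rw [hγ.isCliffMap.sq, hp, one_pow, one_smul]
  have hcΓ : ∀ w, c w * cliffMap γ p = -(cliffMap γ p * c w) := fun w => by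
    have h1 := hγ.cliffMap_mul_add w p
    rw [real_inner_comm, Submodule.mem_orthogonal_singleton_iff_inner_right.mp w.2, mul_zero,
      zero_smul] at h1
    exact eq_neg_of_add_eq_zero_left h1
  obtain ⟨t, ht⟩ := ha.exists_sgOmega_eq
  have hσ : |(-1 : ℤ) ^ n| = 1 := by simp
  have e1 := ha.sum_sg_baseSym hc (hγ.isCliffMap.herm p) hΓ2 hcΓ hf
  have e2 := eventually_gapped_baseSym hc hf
  rcases h with h | ⟨h, hn, U, hU⟩
  · obtain ⟨r, h1, h2⟩ := (e1.and e2).exists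
    have hS := isSym2_baseSym hc hf r
    obtain ⟨M, h1, h3, h4, h5⟩ := (h1.and ((ha.sum_neg_one_pow_sg hS h2).and
      (ha.sgOmega_succ.and (sg_even n.succ_pos hS h2 (hκ ▸ dvd_pow_self 2 (by omega))
        (fun _ => rfl) fun _ => rfl)))).exists
    refine false_of_even h4 ht (S := sg (fun _ => 0) (fun _ => 0)
      fun x y : Sph (n + 1) => baseSym c f r x y) (fun m hm u hu => ?_) (fun m hm u hu => ?_)
      hσ h h5
    · rw [h1 m hm u hu, hκ, mul_assoc]
      push_cast
      rfl
    · rw [← h3 m hm u hu]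
      exact Finset.sum_congr rfl fun i _ => by ring
  · have hUc : ∀ w, U * (cliffMap γ w).map star = cliffMap γ w * U := fun w => by
      have : (cliffMap γ w).map star = ∑ i, w i • (γ i).map star := by
        ext i j
        simp [cliffMap_apply, Matrix.sum_apply]
      rw [this, cliffMap_apply, Finset.mul_sum, Finset.sum_mul]
      exact Finset.sum_congr rfl fun i _ => by rw [mul_smul_comm, hU.conj, smul_mul_assoc]
    have e3 := eventually_four_dvd_sg_baseSym hc hf hn
      (hκ ▸ pow_dvd_pow 2 hk : 2 ^ 2 ∣ Fintype.card κ) (V := cliffMap γ p * U) (by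
        have h1 : (cliffMap γ p * U).map star = (cliffMap γ p).map star * U.map star :=
          Matrix.map_mul (f := starRingEnd ℂ)
        rw [h1, mul_assoc, ← mul_assoc U, hUc, mul_assoc, hU.conj_sq, neg_one_smul, mul_neg, mul_neg,
          mul_one, hΓ2]) fun w => by
        rw [mul_assoc, show (c w).map star = (cliffMap γ w).map star from rfl, hUc, ← mul_assoc,
          ← mul_assoc, hcΓ, neg_mul, neg_neg]
        rfl
    obtain ⟨r, h1, h2, h5⟩ := (e1.and (e2.and e3)).exists
    have hS := isSym2_baseSym hc hf r
    obtain ⟨M, h1, h3, h4, h5⟩ := (h1.and ((ha.sum_neg_one_pow_sg hS h2).and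
      (ha.sgOmega_succ.and h5))).exists
    refine false_of_four_dvd h4 ht (S := sg (fun _ => 0) (fun _ => 0)
      fun x y : Sph (n + 1) => baseSym c f r x y) (fun m hm u hu => ?_) (fun m hm u hu => ?_)
      hσ hn h h5
    · rw [h1 m hm u hu, hκ, mul_assoc]
      push_cast
      rfl
    · rw [← h3 m hm u hu]
      exact Finset.sum_congr rfl fun i _ => by ring

theorem PhaseRetrievableC.exists_pad {d N N' : ℕ} (h : N ≤ N') {A : Fin N → Matrix (Fin d) (Fin d) ℂ}
    (hA : ∀ j, (A j).IsHermitian) (hPR : PhaseRetrievableC A) :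
    ∃ B : Fin N' → Matrix (Fin d) (Fin d) ℂ, (∀ j, (B j).IsHermitian) ∧ PhaseRetrievableC B := by
  refine ⟨fun j => if h : (j : ℕ) < N then A ⟨j, h⟩ else 0, fun j => ?_, fun x y hxy => hPR x y
    fun j => ?_⟩
  · dsimp only
    split_ifs
    · exact hA _
    · exact isHermitian_zero
  · simpa using hxy (Fin.castLE h j)

theorem digits_two_sum_lt {n : ℕ} (hn : 2 ≤ n) : (Nat.digits 2 n).sum < n := by
  rw [Nat.digits_def' one_lt_two (by omega), List.sum_cons]
  have := Nat.digit_sum_le 2 (n / 2)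
  omega

theorem PhaseRetrievableC.lt_card {n N : ℕ} (hn : 4 ≤ n)
    {A : Fin N → Matrix (Fin (n + 1)) (Fin (n + 1)) ℂ} (hA : ∀ j, (A j).IsHermitian)
    (hPR : PhaseRetrievableC A) {α : ℕ} (hα : α = (Nat.digits 2 n).sum) :
    4 * n + 1 + (if Even n ∧ α % 4 = 3 then 2 else if Even n ∧ α % 4 = 2 then 1 else 0) <
      N + 2 * α := by
  have hlt : α < n := hα ▸ digits_two_sum_lt (by omega)
  by_contra! hle
  split_ifs at hle with h3 h2
  · obtain ⟨B, hB, hBPR⟩ := exists_pad (N' := 1 + 4 * (n - (α - 1) / 2)) (by omega) hA hPR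
    obtain ⟨κ, _, _, γ, U, hκ, hU⟩ := exists_isCliffJ_add exists_isCliffJ_one (n - (α - 1) / 2)
    rw [Odd.neg_one_pow (Nat.odd_iff.mpr (by have := Nat.even_iff.mp h3.1; omega))] at hU
    exact hBPR.false_of_isCliff hB (by omega) (by omega) hU.toIsCliff hκ
      (Or.inr ⟨by omega, h3.1, U, hU⟩)
  · obtain ⟨B, hB, hBPR⟩ := exists_pad (N' := 2 + 4 * (n - α / 2)) (by omega) hA hPR
    obtain ⟨κ, _, _, γ, U, hκ, hU⟩ := exists_isCliffJ_add exists_isCliffJ_two (n - α / 2)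
    rw [Odd.neg_one_pow (Nat.odd_iff.mpr (by have := Nat.even_iff.mp h2.1; omega))] at hU
    exact hBPR.false_of_isCliff hB (by omega) (by omega) hU.toIsCliff hκ
      (Or.inr ⟨by omega, h2.1, U, hU⟩)
  · obtain ⟨B, hB, hBPR⟩ := exists_pad (N' := 2 * (2 * n - α) + 1) (by omega) hA hPR
    obtain ⟨κ, _, _, γ, hκ, hγ⟩ := exists_isCliff (2 * n - α)
    exact hBPR.false_of_isCliff hB (by omega) (by omega) hγ hκ (Or.inl (by omega))

end LowerBound

end TopOpens

theorem stmt_18 (d : ℕ) (hd : 4 < d) (α ε δ : ℕ)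
    (hα : α = (Nat.digits 2 (d - 1)).sum)
    (hε : ε = if Odd d ∧ α % 4 = 3 then 2
      else if Odd d ∧ α % 4 = 2 then 1 else 0)
    (hδ : δ = if Odd d then 0 else 1) :
    (∀ (N : ℕ) (A : Fin N → Matrix (Fin d) (Fin d) ℂ),
      (∀ j, (A j).IsHermitian) → PhaseRetrievableC A →
        (4 * d : ℤ) - 2 - 2 * α + ε ≤ (N : ℤ)) ∧
    (∃ A : Fin (4 * d - 3 - α - δ) → Matrix (Fin d) (Fin d) ℂ,
      (∀ j, (A j).IsHermitian) ∧ PhaseRetrievableC A) := by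
  refine ⟨fun N A hA hPR => ?_, by subst hα hδ; exact exists_phaseRetrievableC d (by omega)⟩
  obtain ⟨n, rfl⟩ : ∃ n, d = n + 1 := ⟨d - 1, by omega⟩
  have h := hPR.lt_card (by omega) hA hα
  simp only [Nat.odd_add_one, Nat.not_odd_iff_even] at hε
  rw [← hε] at h
  push_cast
  omega
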